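/- Let m ∈ ℕ, p_1,…,p_{m+1} ∈ [1,∞) and p ∈ (1/(m+1),∞) with 1/p = 1/p_1 + ⋯ + 1/p_{m+1}. Then ‖C_{m+1}(a_1,…,a_m; f)‖_{L^{p,∞}(ℝ)} ≤ C ∏_{j=1}^m ‖a_j‖_{L^{p_j}(ℝ)} ‖f‖_{L^{p_{m+1}}(ℝ)}. Moreover, if min_{1≤j≤m+1} p_j > 1, then ‖C_{m+1}(a_1,…,a_m; f)‖_{L^p(ℝ)} ≤ C ∏_{j=1}^m ‖a_j‖_{L^{p_j}(ℝ)} ‖f‖_{L^{p_{m+1}}(ℝ)}, with constants C depending only on m and the exponents. -/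

import Mathlib

open MeasureTheory Filter Set
open scoped ENNReal BigOperators

noncomputable section

/-- `Adiff g x y = ∫_y^x g`, i.e. `G x - G y` for an antiderivative `G` of `g`. -/
def Adiff (g : ℝ → ℝ) (x y : ℝ) : ℝ := ∫ t in y..x, g t

/-- `P₂(A; x, y) = A x - A y - A' y * (x - y)`. -/
def P2 (A A' : ℝ → ℝ) (x y : ℝ) : ℝ := A x - A y - A' y * (x - y)

/-- The generalized Calderón commutator `𝒞_{m+1,A}(a₁,…,a_m; f)`, defined as a
principal value. -/
def CcommA (m : ℕ) (A A' : ℝ → ℝ) (a : Fin m → ℝ → ℝ) (f : ℝ → ℝ) (x : ℝ) : ℝ :=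
  limUnder (nhdsWithin 0 (Ioi 0)) fun ε : ℝ =>
    ∫ y in {y : ℝ | ε < |x - y|},
      (P2 A A' x y * ∏ j, Adiff (a j) x y) / (x - y) ^ (m + 2) * f y

/-- The `(m+1)`-th order Calderón commutator `𝒞_{m+1}(a₁,…,a_m; f)`. -/
def Ccomm (m : ℕ) (a : Fin m → ℝ → ℝ) (f : ℝ → ℝ) (x : ℝ) : ℝ :=
  limUnder (nhdsWithin 0 (Ioi 0)) fun ε : ℝ =>
    ∫ y in {y : ℝ | ε < |x - y|},
      (∏ j, Adiff (a j) x y) / (x - y) ^ (m + 1) * f y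

/-- The BMO norm of `g` over intervals in `ℝ`. -/
def bmoNorm (g : ℝ → ℝ) : ℝ :=
  sSup {c : ℝ | ∃ u v : ℝ, u < v ∧
    c = (v - u)⁻¹ * ∫ y in Ioc u v, |g y - (v - u)⁻¹ * ∫ z in Ioc u v, g z|}

/-- Average (in `ℝ≥0∞`) of a nonnegative function over an interval. -/
def avgE (g : ℝ → ℝ) (u v : ℝ) : ℝ≥0∞ :=
  (ENNReal.ofReal (v - u))⁻¹ * ∫⁻ y in Ioc u v, ENNReal.ofReal (g y)

/-- Weighted `L^p` norm `(∫ |g|^p w)^{1/p}`. -/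
def wLpNorm (p : ℝ) (w g : ℝ → ℝ) : ℝ≥0∞ :=
  (∫⁻ x, ENNReal.ofReal (|g x| ^ p * w x)) ^ (1 / p)

/-- `L^p` norm. -/
def LpNorm (p : ℝ) (g : ℝ → ℝ) : ℝ≥0∞ :=
  (∫⁻ x, ENNReal.ofReal (|g x| ^ p)) ^ (1 / p)

/-- Weak `L^p` quasinorm. -/
def wkNorm (p : ℝ) (g : ℝ → ℝ) : ℝ≥0∞ :=
  ⨆ (t : ℝ) (_ : 0 < t), ENNReal.ofReal t * (volume {x : ℝ | t < |g x|}) ^ (1 / p)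

/-- The multiple weight `ν_{→w} = ∏ w_i^{p/p_i}`. -/
def nuW (k : ℕ) (ptot : ℝ) (p : Fin k → ℝ) (w : Fin k → ℝ → ℝ) : ℝ → ℝ :=
  fun x => ∏ i, w i x ^ (ptot / p i)

/-- The multilinear Muckenhoupt `A_{→P}` constant (for exponents `p i > 1`). -/
def APconst (k : ℕ) (ptot : ℝ) (p : Fin k → ℝ) (w : Fin k → ℝ → ℝ) : ℝ≥0∞ :=
  ⨆ (u : ℝ) (v : ℝ) (_ : u < v),
    avgE (nuW k ptot p w) u v *
      ∏ i, (avgE (fun y => w i y ^ (-(1 / (p i - 1)))) u v) ^ (ptot * (1 - 1 / p i))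

/-- Hardy–Littlewood maximal operator on `ℝ` (over intervals). -/
def Mop1 (g : ℝ → ℝ) (x : ℝ) : ℝ≥0∞ :=
  ⨆ (u : ℝ) (v : ℝ) (_ : u < v) (_ : x ∈ Ioc u v), avgE (fun y => |g y|) u v

/-- The Fujii–Wilson `A_∞` constant of a weight `u` on `ℝ`. -/
def AinfConst (u : ℝ → ℝ) : ℝ≥0∞ :=
  ⨆ (c : ℝ) (d : ℝ) (_ : c < d),
    (∫⁻ y in Ioc c d, ENNReal.ofReal (u y))⁻¹ *
      ∫⁻ x in Ioc c d, Mop1 (Set.indicator (Ioc c d) u) x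

/-- The `A_{(1,…,1)}` constant of a vector weight. -/
def A11const (k : ℕ) (w : Fin k → ℝ → ℝ) : ℝ≥0∞ :=
  ⨆ (u : ℝ) (v : ℝ) (_ : u < v),
    avgE (fun x => ∏ i, w i x ^ ((1 : ℝ) / k)) u v *
      ∏ i, ((ENNReal.ofReal (essInf (w i) (volume.restrict (Ioc u v))))⁻¹) ^ ((1 : ℝ) / k)

/-- Luxemburg norm `‖f‖_{L(log L)^γ, (u,v)}` over the interval `(u, v]`. -/
def luxNormI (γ : ℝ) (u v : ℝ) (f : ℝ → ℝ) : ℝ :=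
  sInf {t : ℝ | 0 < t ∧
    ∫⁻ y in Ioc u v, ENNReal.ofReal (|f y| / t * Real.log (Real.exp 1 + |f y| / t) ^ γ)
      ≤ ENNReal.ofReal (v - u)}

/-- The interval with the same center as `(u,v]` and `lam` times its length. -/
def scaleI (lam u v : ℝ) : ℝ × ℝ :=
  ((u + v) / 2 - lam * (v - u) / 2, (u + v) / 2 + lam * (v - u) / 2)

/-- Maximal operator `M_{L log L}` on `ℝ`. -/
def MLlogL (f : ℝ → ℝ) (x : ℝ) : ℝ≥0∞ :=
  ⨆ (u : ℝ) (v : ℝ) (_ : u < v) (_ : x ∈ Ioc u v), ENNReal.ofReal (luxNormI 1 u v f)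

/-- John–Strömberg sharp maximal operator `M^♯_{0,s}` on `ℝ`. -/
def Msharp1 (s : ℝ) (g : ℝ → ℝ) (x : ℝ) : ℝ≥0∞ :=
  ⨆ (u : ℝ) (v : ℝ) (_ : u < v) (_ : x ∈ Ioc u v),
    ⨅ (b : ℝ), ⨅ (t : ℝ) (_ : 0 < t)
      (_ : volume {y ∈ Ioc u v | t < |g y - b|} < ENNReal.ofReal s * volume (Ioc u v)),
      ENNReal.ofReal t

/-- Membership in BMO(ℝ). -/
def MemBMO (g : ℝ → ℝ) : Prop :=
  ∃ M : ℝ, ∀ u v : ℝ, u < v →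
    (v - u)⁻¹ * (∫ y in Ioc u v, |g y - (v - u)⁻¹ * ∫ z in Ioc u v, g z|) ≤ M

end

namespace CC
noncomputable section
open MeasureTheory Filter Set Metric Topology
open scoped ENNReal BigOperators

/-- centered maximal function -/
def Mc (g : ℝ → ℝ≥0∞) (x : ℝ) : ℝ≥0∞ :=
  ⨆ (r : ℝ) (_ : 0 < r), (∫⁻ y in ball x r, g y) / ENNReal.ofReal (2 * r)

lemma le_Mc (g : ℝ → ℝ≥0∞) (x : ℝ) {r : ℝ} (hr : 0 < r) :
    (∫⁻ y in ball x r, g y) ≤ ENNReal.ofReal (2 * r) * Mc g x := by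
  have h : (∫⁻ y in ball x r, g y) / ENNReal.ofReal (2 * r) ≤ Mc g x :=
    le_iSup₂_of_le r hr le_rfl
  have h2 : 0 < 2 * r := by linarith
  rw [ENNReal.div_le_iff (by simp [hr]) ENNReal.ofReal_ne_top] at h
  rwa [mul_comm]

lemma Mc_mono {g h : ℝ → ℝ≥0∞} (hgh : ∀ x, g x ≤ h x) (x : ℝ) : Mc g x ≤ Mc h x := by
  unfold Mc
  gcongr
  exact hgh _

lemma Mc_mono_ae {g h : ℝ → ℝ≥0∞} (hgh : g ≤ᵐ[volume] h) (x : ℝ) : Mc g x ≤ Mc h x := by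
  unfold Mc
  refine iSup₂_mono fun r hr => ?_
  refine ENNReal.div_le_div_right ?_ _
  exact lintegral_mono_ae (ae_restrict_of_ae hgh)

lemma lt_Mc_iff {g : ℝ → ℝ≥0∞} {x : ℝ} {t : ℝ≥0∞} :
    t < Mc g x ↔ ∃ r : ℝ, 0 < r ∧ t < (∫⁻ y in ball x r, g y) / ENNReal.ofReal (2 * r) := by
  simp [Mc, lt_iSup_iff]

lemma isOpen_lt_Mc (g : ℝ → ℝ≥0∞) (t : ℝ≥0∞) : IsOpen {x | t < Mc g x} := by
  rw [Metric.isOpen_iff]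
  intro x hx
  obtain ⟨r, hr, h⟩ := lt_Mc_iff.1 hx
  rw [ENNReal.lt_div_iff_mul_lt (by simp [hr]) (Or.inl ENNReal.ofReal_ne_top)] at h
  -- continuity from below
  have hU : ball x r = ⋃ n : ℕ, ball x (r - 1 / ((n : ℝ) + 1)) := by
    ext y
    simp only [mem_ball, mem_iUnion]
    constructor
    · intro hy
      obtain ⟨n, hn⟩ := exists_nat_one_div_lt (sub_pos.2 hy)
      exact ⟨n, by linarith⟩
    · rintro ⟨n, hn⟩
      have : 0 < 1 / ((n : ℝ) + 1) := by positivity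
      linarith
  have hmono : Monotone fun n : ℕ => ball x (r - 1 / ((n : ℝ) + 1)) := by
    intro a b hab
    refine ball_subset_ball ?_
    have : (1 : ℝ) / ((b : ℝ) + 1) ≤ 1 / ((a : ℝ) + 1) := by
      gcongr
    linarith
  have h3 : (∫⁻ y in ball x r, g y) = ⨆ n : ℕ, ∫⁻ y in ball x (r - 1 / ((n : ℝ) + 1)), g y := by
    rw [← withDensity_apply _ measurableSet_ball]
    conv_lhs => rw [hU]
    rw [hmono.measure_iUnion]
    congr 1
    ext n
    rw [withDensity_apply _ measurableSet_ball]
  rw [h3, lt_iSup_iff] at h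
  obtain ⟨n, hn⟩ := h
  refine ⟨1 / ((n : ℝ) + 1), by positivity, ?_⟩
  intro x' hx'
  refine lt_Mc_iff.2 ⟨r, hr, ?_⟩
  rw [ENNReal.lt_div_iff_mul_lt (by simp [hr]) (Or.inl ENNReal.ofReal_ne_top)]
  refine hn.trans_le (lintegral_mono_set ?_)
  refine ball_subset_ball' ?_
  rw [mem_ball, dist_comm] at hx'
  linarith

lemma measurable_Mc (g : ℝ → ℝ≥0∞) : Measurable (Mc g) :=
  measurable_of_Ioi fun t => (isOpen_lt_Mc g t).measurableSet

lemma Mc_weak (g : ℝ → ℝ≥0∞) (t : ℝ≥0∞) (ht : t ≠ ∞) :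
    t * volume {x | t < Mc g x} ≤ 5 * ∫⁻ y, g y := by
  by_cases ht0 : t = 0
  · simp [ht0]
  by_cases hI : (∫⁻ y, g y) = ∞
  · simp [hI, ENNReal.mul_top]
  have H : ∀ x : {x | t < Mc g x}, ∃ r : ℝ, 0 < r ∧
      t * ENNReal.ofReal (2 * r) < (∫⁻ y in ball x.1 r, g y) := by
    rintro ⟨x, hx⟩
    obtain ⟨r, hr, h⟩ := lt_Mc_iff.1 hx
    rw [ENNReal.lt_div_iff_mul_lt (by simp [hr]) (Or.inl ENNReal.ofReal_ne_top)] at h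
    exact ⟨r, hr, h⟩
  choose r hr0 hr using H
  have hbd : ∀ x, r x ≤ ((∫⁻ y, g y) / t).toReal := by
    intro x
    have h1 : t * ENNReal.ofReal (2 * r x) ≤ ∫⁻ y, g y :=
      (hr x).le.trans (setLIntegral_le_lintegral _ _)
    have h2 : ENNReal.ofReal (2 * r x) ≤ (∫⁻ y, g y) / t := by
      rw [ENNReal.le_div_iff_mul_le (Or.inl ht0) (Or.inl ht), mul_comm]; exact h1
    have h3 := (ENNReal.ofReal_le_iff_le_toReal (ENNReal.div_ne_top hI ht0)).1 h2
    have := hr0 x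
    linarith
  obtain ⟨u, -, hdis, hcov⟩ := Vitali.exists_disjoint_subfamily_covering_enlargement_ball
    (Set.univ : Set {x | t < Mc g x}) (fun x => x.1) r _ (fun a _ => hbd a) 5 (by norm_num)
  have hcount : u.Countable := by
    refine hdis.countable_of_isOpen (fun i _ => isOpen_ball) (fun i _ => ?_)
    exact ⟨i.1, mem_ball_self (hr0 i)⟩
  have hsub : {x | t < Mc g x} ⊆ ⋃ b ∈ u, ball b.1 (5 * r b) := by
    intro x hx
    obtain ⟨b, hb, h⟩ := hcov ⟨x, hx⟩ (mem_univ _)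
    exact mem_biUnion hb (h (mem_ball_self (hr0 _)))
  calc t * volume {x | t < Mc g x} ≤ t * ∑' b : u, volume (ball b.1.1 (5 * r b.1)) := by
        gcongr
        exact (measure_mono hsub).trans (measure_biUnion_le _ hcount _)
    _ = ∑' b : u, 5 * (t * ENNReal.ofReal (2 * r b.1)) := by
        rw [← ENNReal.tsum_mul_left]
        congr 1
        ext b
        rw [Real.volume_ball, show (2 * (5 * r b.1)) = 5 * (2 * r b.1) by ring,
          ENNReal.ofReal_mul (by norm_num)]
        simp only [ENNReal.ofReal_ofNat]
        ring
    _ ≤ ∑' b : u, 5 * (∫⁻ y in ball b.1.1 (r b.1), g y) := by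
        gcongr with b
        exact (hr b.1).le
    _ = 5 * ∑' b : u, (∫⁻ y in ball b.1.1 (r b.1), g y) := ENNReal.tsum_mul_left
    _ = 5 * ∫⁻ y in ⋃ b ∈ u, ball b.1 (r b), g y := by
        rw [lintegral_biUnion hcount (fun _ _ => measurableSet_ball) hdis]
    _ ≤ 5 * ∫⁻ y, g y := by
        gcongr
        exact Measure.restrict_le_self

/-- truncated weak type estimate -/
lemma Mc_weak_trunc (g : ℝ → ℝ≥0∞) (hg : Measurable g) (t : ℝ) (ht : 0 < t) :
    volume {x | ENNReal.ofReal t < Mc g x} ≤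
      ENNReal.ofReal (10 / t) * ∫⁻ y, {y | ENNReal.ofReal t < 2 * g y}.indicator g y := by
  set g1 := {y | ENNReal.ofReal t < 2 * g y}.indicator g
  have hms : MeasurableSet {y | ENNReal.ofReal t < 2 * g y} :=
    measurableSet_lt measurable_const (hg.const_mul 2)
  have hsplit : ∀ y, g y ≤ ENNReal.ofReal (t / 2) + g1 y := by
    intro y
    by_cases hy : ENNReal.ofReal t < 2 * g y
    · simp [g1, hy]
    · simp only [g1, mem_ofPred_eq, hy, not_false_eq_true, indicator_of_notMem, add_zero]
      rw [not_lt] at hy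
      rw [ENNReal.ofReal_div_of_pos (by norm_num), ENNReal.le_div_iff_mul_le (by simp) (by simp)]
      simpa [mul_comm] using hy
  have hsub : {x | ENNReal.ofReal t < Mc g x} ⊆ {x | ENNReal.ofReal (t / 2) < Mc g1 x} := by
    intro x hx
    obtain ⟨r, hr, h⟩ := lt_Mc_iff.1 hx
    refine lt_Mc_iff.2 ⟨r, hr, ?_⟩
    rw [ENNReal.lt_div_iff_mul_lt (by simp [hr]) (Or.inl ENNReal.ofReal_ne_top)] at h ⊢
    by_contra hcon
    rw [not_lt] at hcon
    have : (∫⁻ y in ball x r, g y) ≤ ENNReal.ofReal t * ENNReal.ofReal (2 * r) := by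
      calc (∫⁻ y in ball x r, g y) ≤ ∫⁻ y in ball x r, (ENNReal.ofReal (t / 2) + g1 y) :=
            lintegral_mono fun y => hsplit y
        _ = ENNReal.ofReal (t / 2) * ENNReal.ofReal (2 * r) + ∫⁻ y in ball x r, g1 y := by
            rw [lintegral_add_left measurable_const]
            simp
        _ ≤ ENNReal.ofReal (t / 2) * ENNReal.ofReal (2 * r) +
            ENNReal.ofReal (t / 2) * ENNReal.ofReal (2 * r) := by gcongr
        _ = ENNReal.ofReal t * ENNReal.ofReal (2 * r) := by
            rw [← add_mul, ← ENNReal.ofReal_add (by positivity) (by positivity)]; congr 2; ring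
    exact absurd h (not_lt.2 this)
  have hw := Mc_weak g1 (ENNReal.ofReal (t / 2)) (by simp)
  have ht2 : ENNReal.ofReal (t / 2) ≠ 0 := by simp [ht]
  calc volume {x | ENNReal.ofReal t < Mc g x} ≤ volume {x | ENNReal.ofReal (t / 2) < Mc g1 x} :=
        measure_mono hsub
    _ ≤ (5 * ∫⁻ y, g1 y) / ENNReal.ofReal (t / 2) := by
        rw [ENNReal.le_div_iff_mul_le (Or.inl ht2) (Or.inl (by simp)), mul_comm]; exact hw
    _ = _ := by
        have e : ENNReal.ofReal (10 / t) = 5 * (ENNReal.ofReal (t / 2))⁻¹ := by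
          rw [show (10 / t) = 5 / (t / 2) by field_simp; norm_num,
            ENNReal.ofReal_div_of_pos (by positivity : 0 < t / 2), ENNReal.ofReal_ofNat,
            div_eq_mul_inv]
        rw [e, div_eq_mul_inv]
        generalize (ENNReal.ofReal (t / 2))⁻¹ = c
        ring

/-- layer cake at a point -/
lemma layer_pt {p : ℝ} (hp : 0 < p) (u : ℝ≥0∞) :
    ∫⁻ t in Ioi (0 : ℝ), ENNReal.ofReal (p * t ^ (p - 1)) * (if ENNReal.ofReal t < u then 1 else 0)
      = u ^ p := by
  have key : ∀ v : ℝ, 0 ≤ v → ∫⁻ t in Ioc (0 : ℝ) v, ENNReal.ofReal (p * t ^ (p - 1))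
      = ENNReal.ofReal (v ^ p) := by
    intro v hv
    rw [← ofReal_integral_eq_lintegral_ofReal]
    · congr 1
      rw [← intervalIntegral.integral_of_le hv]
      rw [intervalIntegral.integral_const_mul, integral_rpow (Or.inl (by linarith))]
      simp only [sub_add_cancel]
      rw [Real.zero_rpow hp.ne']
      field_simp
      ring
    · have := (intervalIntegral.intervalIntegrable_rpow' (a := 0) (b := v) (r := p - 1) (by linarith)).const_mul p
      exact (intervalIntegrable_iff_integrableOn_Ioc_of_le hv).1 this
    · filter_upwards [ae_restrict_mem measurableSet_Ioc] with t ht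
      have := ht.1
      positivity
  induction u using ENNReal.recTopCoe with
  | top =>
    simp only [ENNReal.ofReal_lt_top, if_true, mul_one]
    rw [ENNReal.top_rpow_of_pos hp]
    rw [eq_top_iff]
    refine ENNReal.le_of_forall_nnreal_lt fun r _ => ?_
    calc (r : ℝ≥0∞) = ENNReal.ofReal (((r : ℝ) ^ (1 / p)) ^ p) := by
          rw [← Real.rpow_mul (NNReal.coe_nonneg r), one_div_mul_cancel hp.ne']; simp
      _ = ∫⁻ t in Ioc (0 : ℝ) ((r : ℝ) ^ (1 / p)), ENNReal.ofReal (p * t ^ (p - 1)) :=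
          (key _ (by positivity)).symm
      _ ≤ _ := lintegral_mono_set Ioc_subset_Ioi_self
  | coe v =>
    have : ∀ t ∈ Ioi (0 : ℝ), ENNReal.ofReal (p * t ^ (p - 1)) *
        (if ENNReal.ofReal t < v then 1 else 0) =
        (Iio (v : ℝ)).indicator (fun t => ENNReal.ofReal (p * t ^ (p - 1))) t := by
      intro t ht
      have : ENNReal.ofReal t < v ↔ t < v := by
        rw [ENNReal.ofReal_lt_iff_lt_toReal (le_of_lt ht) (by simp)]; simp
      by_cases h : t < v <;> simp [this, h]
    rw [setLIntegral_congr_fun measurableSet_Ioi this, lintegral_indicator measurableSet_Iio,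
      Measure.restrict_restrict measurableSet_Iio, Iio_inter_Ioi, Measure.restrict_congr_set Ioo_ae_eq_Ioc]
    refine (key v (NNReal.coe_nonneg v)).trans ?_
    rw [← ENNReal.coe_rpow_of_nonneg _ hp.le, ← ENNReal.ofReal_coe_nnreal, NNReal.coe_rpow]

lemma layer_cake {α : Type*} [MeasurableSpace α] {μ : Measure α} [SFinite μ] {p : ℝ} (hp : 0 < p)
    {g : α → ℝ≥0∞} (hg : Measurable g) :
    ∫⁻ x, g x ^ p ∂μ = ∫⁻ t in Ioi (0 : ℝ), ENNReal.ofReal (p * t ^ (p - 1)) *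
      μ {x | ENNReal.ofReal t < g x} := by
  simp_rw [← layer_pt hp]
  rw [lintegral_lintegral_swap]
  · refine lintegral_congr fun t => ?_
    rw [lintegral_const_mul]
    · congr 1
      have : (fun x => if ENNReal.ofReal t < g x then (1 : ℝ≥0∞) else 0) =
        {x | ENNReal.ofReal t < g x}.indicator 1 := by
        ext x; simp [indicator_apply]
      rw [this, lintegral_indicator_one (measurableSet_lt measurable_const hg)]
    · exact Measurable.ite (measurableSet_lt measurable_const hg) measurable_const measurable_const
  · refine Measurable.aemeasurable ?_
    refine Measurable.mul (by fun_prop) ?_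
    refine Measurable.ite (measurableSet_lt (by fun_prop) (by fun_prop)) measurable_const measurable_const

lemma Mc_strong {p : ℝ} (hp : 1 < p) (g : ℝ → ℝ≥0∞) (hg : Measurable g) :
    ∫⁻ x, Mc g x ^ p ≤ ENNReal.ofReal (10 * p / (p - 1) * 2 ^ (p - 1)) * ∫⁻ x, g x ^ p := by
  have hp1 : 0 < p - 1 := by linarith
  rw [layer_cake (by linarith) (measurable_Mc g)]
  calc _ ≤ ∫⁻ t in Ioi (0 : ℝ), ∫⁻ y, ENNReal.ofReal (10 * p / (p - 1)) *
          (g y * (ENNReal.ofReal ((p - 1) * t ^ (p - 1 - 1)) *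
            (if ENNReal.ofReal t < 2 * g y then 1 else 0))) := by
        refine setLIntegral_mono' measurableSet_Ioi fun t ht => ?_
        have ht : 0 < t := ht
        calc _ ≤ ENNReal.ofReal (p * t ^ (p - 1)) * (ENNReal.ofReal (10 / t) *
              ∫⁻ y, {y | ENNReal.ofReal t < 2 * g y}.indicator g y) := by
              gcongr; exact Mc_weak_trunc g hg t ht
          _ = ENNReal.ofReal (10 * p / (p - 1)) * (ENNReal.ofReal ((p - 1) * t ^ (p - 1 - 1)) *
              ∫⁻ y, {y | ENNReal.ofReal t < 2 * g y}.indicator g y) := by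
              rw [← mul_assoc, ← mul_assoc, ← ENNReal.ofReal_mul (by positivity),
                ← ENNReal.ofReal_mul (by positivity)]
              congr 2
              rw [Real.rpow_sub_one ht.ne' (p - 1)]
              field_simp
          _ = _ := by
              rw [← lintegral_const_mul' _ _ (by simp), ← lintegral_const_mul' _ _ (by simp)]
              refine lintegral_congr fun y => ?_
              congr 1
              by_cases h : ENNReal.ofReal t < 2 * g y
              · simp only [mem_ofPred_eq, h, indicator_of_mem, if_true, mul_one]
                rw [mul_comm]
              · simp [h]
    _ = ∫⁻ y, ENNReal.ofReal (10 * p / (p - 1)) * (g y * (2 * g y) ^ (p - 1)) := by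
        rw [lintegral_lintegral_swap]
        · refine lintegral_congr fun y => ?_
          rw [lintegral_const_mul' _ _ (by simp), lintegral_const_mul, layer_pt hp1]
          refine Measurable.mul (by fun_prop) ?_
          refine Measurable.ite (measurableSet_lt (by fun_prop) (by fun_prop)) measurable_const measurable_const
        · refine Measurable.aemeasurable ?_
          refine Measurable.mul (by fun_prop) ?_
          refine Measurable.mul (by fun_prop) ?_
          refine Measurable.mul (by fun_prop) ?_
          refine Measurable.ite (measurableSet_lt (by fun_prop) (by fun_prop)) measurable_const measurable_const
    _ = _ := by
        rw [← lintegral_const_mul' _ _ (by simp)]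
        refine lintegral_congr fun y => ?_
        rw [ENNReal.ofReal_mul (by positivity), ENNReal.mul_rpow_of_nonneg _ _ hp1.le,
          ← ENNReal.ofReal_rpow_of_pos (by norm_num)]
        simp only [ENNReal.ofReal_ofNat]
        have : g y ^ p = g y * g y ^ (p - 1) := by
          conv_lhs => rw [show p = 1 + (p - 1) by ring]
          rw [ENNReal.rpow_add_of_nonneg _ _ (by norm_num) hp1.le, ENNReal.rpow_one]
        rw [this]; ring

/-- weak (p,p) -/
lemma Mc_weak_p {p : ℝ} (hp : 1 ≤ p) (g : ℝ → ℝ≥0∞) (hg : Measurable g) (t : ℝ) (ht : 0 < t) :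
    volume {x | ENNReal.ofReal t < Mc g x} ≤
      ENNReal.ofReal (5 * 2 ^ p / t ^ p) * ∫⁻ y, g y ^ p := by
  refine (Mc_weak_trunc g hg t ht).trans ?_
  rw [← lintegral_const_mul' _ _ (by simp), ← lintegral_const_mul' _ _ (by simp)]
  refine lintegral_mono fun y => ?_
  by_cases h : ENNReal.ofReal t < 2 * g y
  · simp only [mem_ofPred_eq, h, indicator_of_mem]
    have h1 : ENNReal.ofReal t ^ (p - 1) ≤ (2 * g y) ^ (p - 1) :=
      ENNReal.rpow_le_rpow h.le (by linarith)
    have e1 : ENNReal.ofReal (10 / t) = ENNReal.ofReal (10 / t ^ p) * ENNReal.ofReal t ^ (p - 1) := by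
      rw [ENNReal.ofReal_rpow_of_pos ht, ← ENNReal.ofReal_mul (by positivity)]
      congr 1
      rw [Real.rpow_sub_one ht.ne']
      have := Real.rpow_pos_of_pos ht p
      field_simp
    have : g y ^ p = g y * g y ^ (p - 1) := by
      conv_lhs => rw [show p = 1 + (p - 1) by ring]
      rw [ENNReal.rpow_add_of_nonneg _ _ (by norm_num) (by linarith), ENNReal.rpow_one]
    rw [e1, this]
    calc _ ≤ ENNReal.ofReal (10 / t ^ p) * (2 * g y) ^ (p - 1) * g y := by gcongr
      _ = _ := by
        rw [ENNReal.mul_rpow_of_nonneg _ _ (by linarith)]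
        have : ENNReal.ofReal (5 * 2 ^ p / t ^ p) = ENNReal.ofReal (10 / t ^ p) * 2 ^ (p - 1) := by
          rw [← ENNReal.ofReal_ofNat 2, ENNReal.ofReal_rpow_of_pos (by norm_num), ← ENNReal.ofReal_mul (by positivity)]
          congr 1
          rw [Real.rpow_sub_one (by norm_num)]
          ring
        rw [this]; ring
  · simp [h]

end
end CC

namespace CC
noncomputable section
open MeasureTheory Filter Set Metric Topology
open scoped ENNReal BigOperators

lemma int_cube {s a : ℝ} (hs : 0 < s) (ha : 0 ≤ a) :
    ∫⁻ r in Ioi a, ENNReal.ofReal (2 * s / (r + s) ^ 3) = ENNReal.ofReal (s / (a + s) ^ 2) := by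
  have hd : ∀ x ∈ Ici a, HasDerivAt (fun r => - (s / (r + s) ^ 2)) (2 * s / (x + s) ^ 3) x := by
    intro x hx
    have hx : a ≤ x := hx
    have h0 : x + s ≠ 0 := by linarith
    have h1 : HasDerivAt (fun r : ℝ => (r + s) ^ 2) (2 * (x + s)) x := by
      have := ((hasDerivAt_id x).add_const s).fun_pow 2
      simpa using this
    have := ((hasDerivAt_const x s).fun_div h1 (pow_ne_zero 2 h0)).fun_neg
    refine this.congr_deriv ?_
    field_simp
    ring
  have hpos : ∀ x ∈ Ioi a, 0 ≤ 2 * s / (x + s) ^ 3 := by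
    intro x hx
    have hx : a < x := hx
    have : 0 < x + s := by linarith
    positivity
  have hlim : Tendsto (fun r => - (s / (r + s) ^ 2)) atTop (𝓝 0) := by
    rw [← neg_zero]
    refine Tendsto.neg ?_
    refine Tendsto.div_atTop tendsto_const_nhds ?_
    exact (tendsto_pow_atTop (by norm_num)).comp (tendsto_atTop_add_const_right _ _ tendsto_id)
  rw [← ofReal_integral_eq_lintegral_ofReal (integrableOn_Ioi_deriv_of_nonneg' hd hpos hlim)
    ((ae_restrict_mem measurableSet_Ioi).mono hpos),
    integral_Ioi_of_hasDerivAt_of_nonneg' hd hpos hlim]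
  congr 1
  ring

lemma int_sq {s a : ℝ} (hs : 0 < s) (ha : 0 ≤ a) :
    ∫⁻ r in Ioi a, ENNReal.ofReal (s / (r + s) ^ 2) = ENNReal.ofReal (s / (a + s)) := by
  have hd : ∀ x ∈ Ici a, HasDerivAt (fun r => - (s / (r + s))) (s / (x + s) ^ 2) x := by
    intro x hx
    have hx : a ≤ x := hx
    have h0 : x + s ≠ 0 := by linarith
    have h1 : HasDerivAt (fun r : ℝ => (r + s)) 1 x := by
      simpa using ((hasDerivAt_id x).add_const s)
    have := ((hasDerivAt_const x s).fun_div h1 h0).fun_neg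
    refine this.congr_deriv ?_
    field_simp
    ring
  have hpos : ∀ x ∈ Ioi a, 0 ≤ s / (x + s) ^ 2 := by
    intro x hx
    have hx : a < x := hx
    have : 0 < x + s := by linarith
    positivity
  have hlim : Tendsto (fun r => - (s / (r + s))) atTop (𝓝 0) := by
    rw [← neg_zero]
    refine Tendsto.neg ?_
    refine Tendsto.div_atTop tendsto_const_nhds ?_
    exact (tendsto_atTop_add_const_right _ _ tendsto_id)
  rw [← ofReal_integral_eq_lintegral_ofReal (integrableOn_Ioi_deriv_of_nonneg' hd hpos hlim)
    ((ae_restrict_mem measurableSet_Ioi).mono hpos),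
    integral_Ioi_of_hasDerivAt_of_nonneg' hd hpos hlim]
  congr 1
  ring

lemma poisson_le {g : ℝ → ℝ≥0∞} (hg : Measurable g) (x : ℝ) {s : ℝ} (hs : 0 < s) :
    ∫⁻ y, g y * ENNReal.ofReal (s / (|x - y| + s) ^ 2) ≤ 4 * Mc g x := by
  have h1 : ∀ y, g y * ENNReal.ofReal (s / (|x - y| + s) ^ 2) =
      ∫⁻ r in Ioi (0 : ℝ), ENNReal.ofReal (2 * s / (r + s) ^ 3) * (if |x - y| < r then g y else 0) := by
    intro y
    rw [← int_cube hs (abs_nonneg _), mul_comm, ← lintegral_mul_const _ (by fun_prop)]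
    have : ∀ r, ENNReal.ofReal (2 * s / (r + s) ^ 3) * (if |x - y| < r then g y else 0) =
        (Ioi |x - y|).indicator (fun r => ENNReal.ofReal (2 * s / (r + s) ^ 3) * g y) r := by
      intro r
      by_cases h : |x - y| < r <;> simp [h]
    simp_rw [this]
    rw [lintegral_indicator measurableSet_Ioi, Measure.restrict_restrict measurableSet_Ioi,
      inter_eq_left.2 (Ioi_subset_Ioi (abs_nonneg _))]
  simp_rw [h1]
  rw [lintegral_lintegral_swap]
  · calc _ ≤ ∫⁻ r in Ioi (0 : ℝ), ENNReal.ofReal (s / (r + s) ^ 2) * (4 * Mc g x) := by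
          refine setLIntegral_mono' measurableSet_Ioi fun r hr => ?_
          have hr : 0 < r := hr
          rw [lintegral_const_mul' _ _ ENNReal.ofReal_ne_top]
          have : (fun y => if |x - y| < r then g y else 0) = (ball x r).indicator g := by
            funext y
            have : |x - y| < r ↔ y ∈ ball x r := by
              rw [mem_ball, Real.dist_eq, abs_sub_comm]
            by_cases h : y ∈ ball x r
            · rw [if_pos (this.2 h), indicator_of_mem h]
            · rw [if_neg (fun h' => h (this.1 h')), indicator_of_notMem h]
          rw [this, lintegral_indicator measurableSet_ball]
          calc _ ≤ ENNReal.ofReal (2 * s / (r + s) ^ 3) * (ENNReal.ofReal (2 * r) * Mc g x) := by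
                gcongr; exact le_Mc g x hr
            _ = ENNReal.ofReal (2 * s / (r + s) ^ 3 * (2 * r)) * Mc g x := by
                rw [ENNReal.ofReal_mul (by positivity : 0 ≤ 2 * s / (r + s) ^ 3), mul_assoc]
            _ ≤ ENNReal.ofReal (s / (r + s) ^ 2 * 4) * Mc g x := by
                refine mul_le_mul_left (ENNReal.ofReal_le_ofReal ?_) _
                have : 0 < r + s := by linarith
                rw [div_mul_eq_mul_div, div_mul_eq_mul_div, div_le_div_iff₀ (by positivity) (by positivity)]
                have : 0 < s * (r+s)^2 := by positivity
                nlinarith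
            _ = _ := by
                rw [ENNReal.ofReal_mul (by positivity)]
                simp only [ENNReal.ofReal_ofNat]; ring
      _ = 4 * Mc g x := by
          rw [lintegral_mul_const _ (by fun_prop), int_sq hs le_rfl]
          simp [hs.ne']
  · refine Measurable.aemeasurable ?_
    refine Measurable.mul (by fun_prop) ?_
    refine Measurable.ite (measurableSet_lt (by fun_prop) (by fun_prop)) (by fun_prop) measurable_const

lemma le_Mc_ae {g : ℝ → ℝ≥0∞} (hg : Measurable g) (hfin : ∀ x, g x ≠ ∞) :
    ∀ᵐ x, g x ≤ Mc g x := by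
  let gn : ℕ → ℝ → ℝ≥0∞ := fun n => (ball (0 : ℝ) n).indicator fun x => min (g x) n
  have hgn : ∀ n, Measurable (gn n) := fun n =>
    (hg.min measurable_const).indicator measurableSet_ball
  have hle : ∀ n x, gn n x ≤ g x := by
    intro n x
    by_cases h : x ∈ ball (0 : ℝ) n <;> simp [gn, h]
  have hintg : ∀ n, (∫⁻ x, gn n x) ≠ ∞ := by
    intro n
    rw [lintegral_indicator measurableSet_ball]
    refine ne_of_lt ((lintegral_mono (fun x => min_le_right _ _)).trans_lt ?_)
    simp only [lintegral_const, MeasurableSet.univ, Measure.restrict_apply, univ_inter]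
    exact ENNReal.mul_lt_top (by simp) (by rw [Real.volume_ball]; exact ENNReal.ofReal_lt_top)
  have key : ∀ n, ∀ᵐ x, gn n x ≤ Mc g x := by
    intro n
    filter_upwards [(Besicovitch.vitaliFamily (volume : Measure ℝ)).ae_tendsto_lintegral_div
      (hgn n).aemeasurable (hintg n)] with x hx
    have h2 := hx.comp (Besicovitch.tendsto_filterAt volume x)
    refine le_of_tendsto h2 ?_
    filter_upwards [self_mem_nhdsWithin] with r hr
    have hr : 0 < r := hr
    simp only [Function.comp]
    rw [Real.volume_closedBall]
    calc _ = (∫⁻ y in ball x r, gn n y) / ENNReal.ofReal (2 * r) := by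
          congr 1
          refine setLIntegral_congr ?_
          refine (ae_eq_of_subset_of_measure_ge ball_subset_closedBall ?_
            measurableSet_ball.nullMeasurableSet ?_).symm
          · simp [Real.volume_closedBall, Real.volume_ball]
          · rw [Real.volume_closedBall]; exact ENNReal.ofReal_ne_top
      _ ≤ (∫⁻ y in ball x r, g y) / ENNReal.ofReal (2 * r) := by
          gcongr; exact hle _ _
      _ ≤ _ := le_iSup₂_of_le r hr le_rfl
  filter_upwards [ae_all_iff.2 key] with x hx
  obtain ⟨n, hn⟩ := exists_nat_gt (max |x| (g x).toReal)
  refine le_trans (le_of_eq ?_) (hx n)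
  have h1 : x ∈ ball (0 : ℝ) n := by
    simp only [mem_ball, dist_zero_right, Real.norm_eq_abs]
    exact (le_max_left _ _).trans_lt hn
  simp only [gn, indicator_of_mem h1]
  rw [min_eq_left]
  rw [← ENNReal.ofReal_toReal (hfin x), ← ENNReal.ofReal_natCast]
  exact ENNReal.ofReal_le_ofReal ((le_max_right _ _).trans hn.le)

end
end CC

namespace CC
noncomputable section
open MeasureTheory Filter Set Metric Topology
open scoped ENNReal BigOperators

structure Crv (z b : ℝ → ℂ) : Prop where
  deriv : ∀ x, HasDerivAt z (b x) x
  cont : Continuous b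
  close : ∀ x, ‖b x - 1‖ ≤ 1 / 4

/-- regularized denominator -/
def DD (z : ℝ → ℂ) (s : ℝ) (x y : ℝ) : ℂ := z x - z y + s * Complex.I

/-- logarithmic potential -/
def UU (z : ℝ → ℂ) (s : ℝ) (p x : ℝ) : ℂ := Complex.log (-Complex.I * DD z s x p)

variable {z b : ℝ → ℂ}

namespace Crv

lemma norm_le (h : Crv z b) (x : ℝ) : ‖b x‖ ≤ 5 / 4 := by
  have := h.close x
  have h2 : ‖b x‖ ≤ ‖b x - 1‖ + ‖(1 : ℂ)‖ := by simpa using norm_add_le (b x - 1) 1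
  simp at h2
  linarith

lemma le_norm (h : Crv z b) (x : ℝ) : 3 / 4 ≤ ‖b x‖ := by
  have := h.close x
  have h2 : ‖(1 : ℂ)‖ ≤ ‖b x - 1‖ + ‖b x‖ := by
    have := norm_sub_le (b x) (b x - 1)
    simp at this
    simp; linarith
  simp at h2
  linarith

lemma contz (h : Crv z b) : Continuous z :=
  continuous_iff_continuousAt.2 fun x => (h.deriv x).continuousAt

lemma sub_le (h : Crv z b) (x y : ℝ) : ‖z x - z y - ((x - y : ℝ) : ℂ)‖ ≤ 1 / 4 * |x - y| := by
  have hd : ∀ t ∈ (univ : Set ℝ), HasDerivWithinAt (fun t : ℝ => z t - (t : ℂ)) (b t - 1) univ t := by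
    intro t _
    exact ((h.deriv t).sub (Complex.ofRealCLM.hasDerivAt (x := t))).hasDerivWithinAt
  have := convex_univ.norm_image_sub_le_of_norm_hasDerivWithin_le hd (fun t _ => h.close t)
    (mem_univ y) (mem_univ x)
  rw [Real.norm_eq_abs] at this
  have e : z x - z y - ((x - y : ℝ) : ℂ) = z x - (x : ℂ) - (z y - (y : ℂ)) := by push_cast; ring
  rw [e]
  exact this

lemma sub_norm_le (h : Crv z b) (x y : ℝ) : ‖z x - z y‖ ≤ 5 / 4 * |x - y| := by
  have h1 := h.sub_le x y
  have h2 := norm_add_le (z x - z y - ((x - y : ℝ) : ℂ)) ((x - y : ℝ) : ℂ)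
  rw [sub_add_cancel, Complex.norm_real, Real.norm_eq_abs] at h2
  linarith

lemma re_abs (h : Crv z b) (x y : ℝ) : |(z x - z y).re - (x - y)| ≤ 1 / 4 * |x - y| := by
  have h1 := (Complex.abs_re_le_norm _).trans (h.sub_le x y)
  simpa using h1

lemma im_abs (h : Crv z b) (x y : ℝ) : |(z x - z y).im| ≤ 1 / 4 * |x - y| := by
  have h1 := (Complex.abs_im_le_norm _).trans (h.sub_le x y)
  simpa using h1

lemma D_re (s x y : ℝ) : (DD z s x y).re = (z x - z y).re := by
  simp [DD]
lemma D_im (s x y : ℝ) : (DD z s x y).im = (z x - z y).im + s := by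
  simp [DD]

lemma re_lower (h : Crv z b) (s x y : ℝ) : 3 / 4 * |x - y| ≤ |(DD z s x y).re| := by
  rw [D_re]
  have h1 := h.re_abs x y
  have h2 : |x - y| ≤ |(z x - z y).re| + |(z x - z y).re - (x - y)| := by
    have := abs_sub (z x - z y).re ((z x - z y).re - (x - y))
    simpa using this
  linarith

lemma D_lower (h : Crv z b) {s : ℝ} (_hs : 0 ≤ s) (x y : ℝ) :
    (|x - y| + s) / 4 ≤ ‖DD z s x y‖ := by
  have h1 := (h.re_lower s x y).trans (Complex.abs_re_le_norm _)
  have h2 : s - 1 / 4 * |x - y| ≤ ‖DD z s x y‖ := by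
    refine le_trans ?_ (Complex.abs_im_le_norm _)
    rw [D_im]
    have := h.im_abs x y
    have h3 := neg_abs_le (z x - z y).im
    have h4 := le_abs_self ((z x - z y).im + s)
    linarith
  linarith

lemma D_lower' (h : Crv z b) (s x y : ℝ) : 3 / 4 * |x - y| ≤ ‖DD z s x y‖ :=
  (h.re_lower s x y).trans (Complex.abs_re_le_norm _)

lemma D_upper (h : Crv z b) {s : ℝ} (hs : 0 ≤ s) (x y : ℝ) :
    ‖DD z s x y‖ ≤ 2 * (|x - y| + s) := by
  have h1 := h.sub_norm_le x y
  have h2 := norm_add_le (z x - z y) (s * Complex.I)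
  rw [norm_mul, Complex.norm_real, Complex.norm_I, Real.norm_eq_abs, abs_of_nonneg hs] at h2
  have h3 := abs_nonneg (x - y)
  unfold DD
  linarith

lemma D_pos (h : Crv z b) {s : ℝ} (hs : 0 < s) (x y : ℝ) : 0 < ‖DD z s x y‖ := by
  have := h.D_lower hs.le x y
  have h3 := abs_nonneg (x - y)
  linarith

lemma D_ne (h : Crv z b) {s : ℝ} (hs : 0 < s) (x y : ℝ) : DD z s x y ≠ 0 :=
  norm_pos_iff.1 (h.D_pos hs x y)

lemma slit (h : Crv z b) {s : ℝ} (hs : 0 < s) (x y : ℝ) :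
    -Complex.I * DD z s x y ∈ Complex.slitPlane := by
  rw [Complex.mem_slitPlane_iff]
  by_cases hxy : x = y
  · left; subst hxy; simp [DD, hs]
  · right
    have h1 := h.re_lower s x y
    have h2 : 0 < |x - y| := abs_pos.2 (sub_ne_zero.2 hxy)
    have h3 : (DD z s x y).re ≠ 0 := by
      intro h0; rw [h0] at h1; simp at h1; linarith
    simpa using h3

lemma contD (h : Crv z b) (s : ℝ) : Continuous fun q : ℝ × ℝ => DD z s q.1 q.2 := by
  have := h.contz
  unfold DD
  fun_prop

lemma hasDerivAt_U_x (h : Crv z b) {s : ℝ} (hs : 0 < s) (p x : ℝ) :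
    HasDerivAt (UU z s p) (b x / DD z s x p) x := by
  have h1 : HasDerivAt (fun x => -Complex.I * DD z s x p) (-Complex.I * b x) x := by
    unfold DD
    exact (((h.deriv x).sub_const _).add_const _).const_mul _
  refine (h1.clog_real (h.slit hs x p)).congr_deriv ?_
  have := h.D_ne hs x p
  field_simp

lemma hasDerivAt_U_p (h : Crv z b) {s : ℝ} (hs : 0 < s) (p x : ℝ) :
    HasDerivAt (fun p => UU z s p x) (-(b p / DD z s x p)) p := by
  have h1 : HasDerivAt (fun p => -Complex.I * DD z s x p) (-Complex.I * (-b p)) p := by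
    unfold DD
    exact (((h.deriv p).const_sub _).add_const _).const_mul _
  refine (h1.clog_real (h.slit hs x p)).congr_deriv ?_
  have := h.D_ne hs x p
  field_simp

lemma contU (h : Crv z b) {s : ℝ} (hs : 0 < s) (p : ℝ) : Continuous (UU z s p) :=
  continuous_iff_continuousAt.2 fun x => (h.hasDerivAt_U_x hs p x).continuousAt

lemma contK (h : Crv z b) {s : ℝ} (hs : 0 < s) : Continuous fun q : ℝ × ℝ => b q.1 * b q.2 / DD z s q.1 q.2 := by
  have := h.cont
  exact Continuous.div (by fun_prop) (h.contD s) (fun q => h.D_ne hs _ _)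

lemma int_U (h : Crv z b) {s : ℝ} (hs : 0 < s) (p q x : ℝ) :
    ∫ y in p..q, b y / DD z s x y = UU z s p x - UU z s q x := by
  have h1 : ∀ y, HasDerivAt (fun p => -UU z s p x) (b y / DD z s x y) y := by
    intro y
    have := (h.hasDerivAt_U_p hs y x).fun_neg
    rwa [neg_neg] at this
  rw [intervalIntegral.integral_eq_sub_of_hasDerivAt (f := fun p => -UU z s p x) (fun y _ => h1 y)]
  · ring
  · refine Continuous.intervalIntegrable ?_ _ _
    exact h.cont.div ((h.contD s).comp (by fun_prop : Continuous fun y : ℝ => (x, y))) (fun y => h.D_ne hs x y)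

/-- difference of potentials: logarithmic bound -/
lemma U_sub_log (h : Crv z b) {s : ℝ} (hs : 0 < s) {p q x R : ℝ} (hp : x ≠ p) (hq : x ≠ q)
    (hpR : |x - p| ≤ R) (hqR : |x - q| ≤ R) :
    ‖UU z s p x - UU z s q x‖ ≤ 11 + 4 * ((R / |x - p|) ^ (1 / 4 : ℝ) + (R / |x - q|) ^ (1 / 4 : ℝ)) := by
  have hp0 : 0 < |x - p| := abs_pos.2 (sub_ne_zero.2 hp)
  have hq0 : 0 < |x - q| := abs_pos.2 (sub_ne_zero.2 hq)
  have hR : 0 < R := hp0.trans_le hpR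
  have him : ∀ p, |(UU z s p x).im| ≤ Real.pi := fun p => by
    rw [UU, Complex.log_im]; exact Complex.abs_arg_le_pi _
  have hre : ∀ p, (UU z s p x).re = Real.log ‖DD z s x p‖ := fun p => by
    rw [UU, Complex.log_re, norm_mul]; simp
  have hlog : ∀ p q, 0 < |x - p| → 0 < |x - q| → |x - p| ≤ R → |x - q| ≤ R →
      Real.log ‖DD z s x p‖ - Real.log ‖DD z s x q‖ ≤ 3 + 4 * (R / |x - q|) ^ (1 / 4 : ℝ) := by
    intro p q hp0 hq0 hpR hqR
    have a1 := h.D_upper hs.le x p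
    have a2 := h.D_lower hs.le x q
    have a3 : ‖DD z s x p‖ ≤ 8 * (R / |x - q|) * ‖DD z s x q‖ := by
      have : |x - p| + s ≤ (R / |x - q|) * (|x - q| + s) := by
        have h1 : (R / |x - q|) * |x - q| = R := by field_simp
        have h2 : 1 ≤ R / |x - q| := by rw [le_div_iff₀ hq0]; linarith
        nlinarith
      have h3 : 0 < R / |x - q| := by positivity
      nlinarith
    have a4 := Real.log_le_log (h.D_pos hs x p) a3
    rw [Real.log_mul (by positivity) (h.D_pos hs x q).ne', Real.log_mul (by norm_num) (by positivity)] at a4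
    have a5 : Real.log 8 ≤ 3 := by
      have : Real.log 8 = 3 * Real.log 2 := by
        rw [show (8 : ℝ) = 2 ^ 3 by norm_num, Real.log_pow]; norm_num
      have := Real.log_two_lt_d9
      linarith
    have a6 : Real.log (R / |x - q|) ≤ 4 * (R / |x - q|) ^ (1 / 4 : ℝ) := by
      have := Real.log_le_rpow_div (x := R / |x - q|) (by positivity) (ε := 1 / 4) (by norm_num)
      linarith
    linarith
  have e1 := hlog p q hp0 hq0 hpR hqR
  have e2 := hlog q p hq0 hp0 hqR hpR
  have hn := Complex.norm_le_abs_re_add_abs_im (UU z s p x - UU z s q x)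
  have i1 : |(UU z s p x - UU z s q x).im| ≤ 8 := by
    rw [Complex.sub_im]
    have := abs_sub (UU z s p x).im (UU z s q x).im
    have := him p
    have := him q
    have := Real.pi_lt_d2
    linarith
  have i2 : |(UU z s p x - UU z s q x).re| ≤ 3 + 4 * ((R / |x - p|) ^ (1 / 4 : ℝ) + (R / |x - q|) ^ (1 / 4 : ℝ)) := by
    rw [Complex.sub_re, hre, hre, abs_le]
    have : 0 ≤ (R / |x - p|) ^ (1 / 4 : ℝ) := by positivity
    have : 0 ≤ (R / |x - q|) ^ (1 / 4 : ℝ) := by positivity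
    constructor <;> linarith
  linarith

end Crv
end
end CC

namespace CC
noncomputable section
open MeasureTheory Filter Set Metric Topology
open scoped ENNReal BigOperators

def ww (n : ℤ) : ℝ := (1 + |(n : ℝ)|) ^ (-(5 / 4) : ℝ)

lemma ww_pos (n : ℤ) : 0 < ww n := by unfold ww; positivity

lemma K_le_aux {a c K : ℝ} (ha : 0 < a) (hac : a ≤ c) (hK : 0 < K) (h : K ≤ a + c) :
    K / (a * c) ≤ 2 * K ^ (1 / 4 : ℝ) * a ^ (-(5 / 4) : ℝ) := by
  have hc : 0 < c := ha.trans_le hac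
  have h1 : K = K ^ (1 / 4 : ℝ) * K ^ (3 / 4 : ℝ) := by
    rw [← Real.rpow_add hK]; norm_num
  have h2 : K ^ (3 / 4 : ℝ) ≤ 2 * c ^ (3 / 4 : ℝ) := by
    calc K ^ (3 / 4 : ℝ) ≤ (2 * c) ^ (3 / 4 : ℝ) := by
          apply Real.rpow_le_rpow hK.le (by linarith) (by norm_num)
      _ = 2 ^ (3 / 4 : ℝ) * c ^ (3 / 4 : ℝ) := Real.mul_rpow (by norm_num) hc.le
      _ ≤ 2 * c ^ (3 / 4 : ℝ) := by
          gcongr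
          calc (2 : ℝ) ^ (3 / 4 : ℝ) ≤ 2 ^ (1 : ℝ) := Real.rpow_le_rpow_of_exponent_le (by norm_num) (by norm_num)
            _ = 2 := by norm_num
  have h3 : c ^ (3 / 4 : ℝ) / c = c ^ (-(1 / 4) : ℝ) := by
    rw [← Real.rpow_sub_one hc.ne']; norm_num
  have h4 : c ^ (-(1 / 4) : ℝ) ≤ a ^ (-(1 / 4) : ℝ) :=
    Real.rpow_le_rpow_of_nonpos ha hac (by norm_num)
  have h5 : a ^ (-(1 / 4) : ℝ) / a = a ^ (-(5 / 4) : ℝ) := by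
    rw [← Real.rpow_sub_one ha.ne']; norm_num
  calc K / (a * c) = K ^ (1 / 4 : ℝ) * K ^ (3 / 4 : ℝ) / (a * c) := by rw [← h1]
    _ ≤ K ^ (1 / 4 : ℝ) * (2 * c ^ (3 / 4 : ℝ)) / (a * c) := by gcongr
    _ = 2 * K ^ (1 / 4 : ℝ) * ((c ^ (3 / 4 : ℝ) / c) / a) := by field_simp
    _ ≤ 2 * K ^ (1 / 4 : ℝ) * (a ^ (-(1 / 4) : ℝ) / a) := by rw [h3]; gcongr
    _ = _ := by rw [h5]

lemma K_le {a c K : ℝ} (ha : 0 < a) (hc : 0 < c) (hK : 0 < K) (h : K ≤ a + c) :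
    K / (a * c) ≤ 2 * K ^ (1 / 4 : ℝ) * (a ^ (-(5 / 4) : ℝ) + c ^ (-(5 / 4) : ℝ)) := by
  have hK' : 0 < K ^ (1 / 4 : ℝ) := by positivity
  have ha' : 0 < a ^ (-(5 / 4) : ℝ) := by positivity
  have hc' : 0 < c ^ (-(5 / 4) : ℝ) := by positivity
  rcases le_total a c with hac | hac
  · have := K_le_aux ha hac hK h
    nlinarith [mul_pos hK' hc']
  · have := K_le_aux hc hac hK (by linarith)
    rw [mul_comm a c]
    nlinarith [mul_pos hK' ha']

lemma ww_ge (n : ℤ) (hn : 4 ≤ |n|) : |(n : ℝ)| ^ (-(5 / 4) : ℝ) ≤ 2 * ww n := by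
  have hn' : (4 : ℝ) ≤ |(n : ℝ)| := by exact_mod_cast hn
  set a := |(n : ℝ)|
  have h1 : (5 / 4 * a) ^ (-(5 / 4) : ℝ) ≤ ww n := by
    unfold ww
    exact Real.rpow_le_rpow_of_nonpos (by positivity) (by linarith) (by norm_num)
  rw [Real.mul_rpow (by norm_num) (by positivity)] at h1
  have h2 : (1 / 2 : ℝ) ≤ (5 / 4 : ℝ) ^ (-(5 / 4) : ℝ) := by
    calc (1 / 2 : ℝ) ≤ (5 / 4 : ℝ) ^ (-2 : ℝ) := by
          rw [Real.rpow_neg (by norm_num)]; norm_num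
      _ ≤ _ := Real.rpow_le_rpow_of_exponent_le (by norm_num) (by norm_num)
  have h3 : 0 < a ^ (-(5 / 4) : ℝ) := by positivity
  nlinarith

lemma ww_ge' (n : ℤ) (hn : |n| < 4) : 1 / 8 ≤ ww n := by
  have hn' : |(n : ℝ)| ≤ 3 := by
    have : |n| ≤ 3 := by omega
    exact_mod_cast this
  unfold ww
  calc (1 / 8 : ℝ) ≤ (4 : ℝ) ^ (-(5 / 4) : ℝ) := by
        have : (4 : ℝ) ^ (-(3 / 2) : ℝ) ≤ (4 : ℝ) ^ (-(5 / 4) : ℝ) :=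
          Real.rpow_le_rpow_of_exponent_le (by norm_num) (by norm_num)
        refine le_trans (le_of_eq ?_) this
        rw [show (4 : ℝ) = 2 ^ (2 : ℝ) by norm_num, ← Real.rpow_mul (by norm_num)]
        norm_num
    _ ≤ _ := Real.rpow_le_rpow_of_nonpos (by positivity) (by linarith) (by norm_num)

lemma qint (a : ℝ) {h R : ℝ} (hh : 0 < h) (hR : 0 < R) :
    IntervalIntegrable (fun x => (R / (x - a)) ^ (1 / 4 : ℝ)) volume a (a + h) ∧
    ∫ x in a..(a + h), (R / (x - a)) ^ (1 / 4 : ℝ) = 4 / 3 * R ^ (1 / 4 : ℝ) * h ^ (3 / 4 : ℝ) := by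
  have e : ∀ y ∈ uIoc (0 : ℝ) h, R ^ (1 / 4 : ℝ) * y ^ (-(1 / 4) : ℝ) = (R / y) ^ (1 / 4 : ℝ) := by
    intro y hy
    rw [uIoc_of_le hh.le] at hy
    rw [Real.div_rpow hR.le hy.1.le, Real.rpow_neg hy.1.le]; rfl
  have i0 : IntervalIntegrable (fun y : ℝ => R ^ (1 / 4 : ℝ) * y ^ (-(1 / 4) : ℝ)) volume 0 h :=
    (intervalIntegral.intervalIntegrable_rpow' (by norm_num)).const_mul _
  have i1 : IntervalIntegrable (fun y : ℝ => (R / y) ^ (1 / 4 : ℝ)) volume 0 h :=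
    i0.congr e
  constructor
  · have := i1.comp_sub_right a
    simpa [add_comm] using this
  · rw [intervalIntegral.integral_comp_sub_right (fun y => (R / y) ^ (1 / 4 : ℝ)) a]
    simp only [sub_self, add_sub_cancel_left]
    rw [← intervalIntegral.integral_congr_ae (Eventually.of_forall e), intervalIntegral.integral_const_mul,
      integral_rpow (Or.inl (by norm_num))]
    norm_num
    ring

lemma qint' (a : ℝ) {h R : ℝ} (hh : 0 < h) (hR : 0 < R) :
    IntervalIntegrable (fun x => (R / (a + h - x)) ^ (1 / 4 : ℝ)) volume a (a + h) ∧
    ∫ x in a..(a + h), (R / (a + h - x)) ^ (1 / 4 : ℝ) = 4 / 3 * R ^ (1 / 4 : ℝ) * h ^ (3 / 4 : ℝ) := by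
  obtain ⟨h1, h2⟩ := qint 0 hh hR
  simp only [sub_zero, zero_add] at h1 h2
  constructor
  · have := (h1.comp_sub_left (a + h)).symm
    simpa using this
  · rw [intervalIntegral.integral_comp_sub_left (fun y => (R / y) ^ (1 / 4 : ℝ)) (a + h)]
    simpa using h2

open Classical in
def kap (z : ℝ → ℂ) (s u h : ℝ) (P M : ℤ) (K : ℕ) : ℂ :=
  if 4 ≤ |P - M| ∧ 4 ≤ |P + K - M| then
    UU z s (u + P * h) (u + M * h) - UU z s (u + (P + K) * h) (u + M * h) else 0

variable {z b : ℝ → ℂ}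

lemma grid_dist {u h x : ℝ} (hh : 0 < h) {J P : ℤ} (hx : x ∈ Ioo (u + J * h) (u + J * h + h)) :
    x - (u + J * h) ≤ |x - (u + P * h)| ∨ (u + J * h + h) - x ≤ |x - (u + P * h)| := by
  rcases le_or_gt P J with hP | hP
  · left
    refine le_trans ?_ (le_abs_self _)
    have : (P : ℝ) ≤ J := by exact_mod_cast hP
    nlinarith
  · right
    refine le_trans ?_ (neg_le_abs _)
    have : (J : ℝ) + 1 ≤ P := by exact_mod_cast hP
    nlinarith

lemma Qbound_near (hc : Crv z b) {s : ℝ} (hs : 0 < s) {h : ℝ} (hh : 0 < h) (u : ℝ) (P M J : ℤ) (K : ℕ)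
    (hK : 1 ≤ K) (hJ : J = M - 1 ∨ J = M) (hn : |P - M| < 4 ∨ |P + K - M| < 4) :
    ‖∫ x in (u + J * h)..(u + J * h + h),
      (UU z s (u + P * h) x - UU z s (u + (P + K) * h) x) * b x‖ ≤
      60 * h * (K : ℝ) ^ (1 / 4 : ℝ) := by
  have hK1 : (1 : ℝ) ≤ K := by exact_mod_cast hK
  set R := 5 * K * h with hRdef
  have hR : 0 < R := by positivity
  obtain ⟨i1, e1⟩ := qint (u + J * h) hh hR
  obtain ⟨i2, e2⟩ := qint' (u + J * h) hh hR
  set a := u + J * h with ha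
  have hM : (M : ℝ) - 1 ≤ J ∧ (J : ℝ) ≤ M := by
    rcases hJ with rfl | rfl
    · push_cast; constructor <;> linarith
    · constructor <;> linarith
  -- distances
  have hnP : |(P : ℝ) - M| ≤ K + 3 ∧ |(P : ℝ) + K - M| ≤ K + 3 := by
    have h1 : |P - M| ≤ K + 3 ∧ |P + K - M| ≤ K + 3 := by
      rcases hn with hn | hn
      · rw [abs_lt] at hn; constructor <;> rw [abs_le] <;> constructor <;> omega
      · rw [abs_lt] at hn; constructor <;> rw [abs_le] <;> constructor <;> omega
    exact_mod_cast h1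
  have hdist : ∀ x ∈ Ioo a (a + h), ∀ y : ℝ, |y - M| ≤ K + 3 → |x - (u + y * h)| ≤ R := by
    intro x hx y hy
    rw [abs_le] at hy ⊢
    have := hx.1
    have := hx.2
    have e1 : h ≤ K * h := by nlinarith
    constructor <;> nlinarith [mul_le_mul_of_nonneg_right hy.1 hh.le, mul_le_mul_of_nonneg_right hy.2 hh.le,
      mul_le_mul_of_nonneg_right hM.1 hh.le, mul_le_mul_of_nonneg_right hM.2 hh.le]
  have hle : a ≤ a + h := by linarith
  have hbound : ∀ᵐ x, x ∈ Ioc a (a + h) →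
      ‖(UU z s (u + P * h) x - UU z s (u + (P + K) * h) x) * b x‖ ≤
      5 / 4 * (11 + 8 * ((R / (x - a)) ^ (1 / 4 : ℝ) + (R / (a + h - x)) ^ (1 / 4 : ℝ))) := by
    have : ∀ᵐ x : ℝ, x ≠ a + h := by
      simp [ae_iff]
    filter_upwards [this] with x hx1 hx2
    have hx : x ∈ Ioo a (a + h) := ⟨hx2.1, lt_of_le_of_ne hx2.2 hx1⟩
    have q1 : 0 < x - a := by linarith [hx.1]
    have q2 : 0 < a + h - x := by linarith [hx.2]
    have hq : ∀ P : ℤ, 0 < |x - (u + P * h)| ∧ (R / |x - (u + P * h)|) ^ (1 / 4 : ℝ) ≤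
        (R / (x - a)) ^ (1 / 4 : ℝ) + (R / (a + h - x)) ^ (1 / 4 : ℝ) := by
      intro P
      have g1 : 0 ≤ (R / (x - a)) ^ (1 / 4 : ℝ) := by positivity
      have g2 : 0 ≤ (R / (a + h - x)) ^ (1 / 4 : ℝ) := by positivity
      rcases grid_dist (P := P) hh hx with hd | hd
      · have hd' : x - a ≤ |x - (u + P * h)| := hd
        refine ⟨by linarith, ?_⟩
        have : (R / |x - (u + P * h)|) ^ (1 / 4 : ℝ) ≤ (R / (x - a)) ^ (1 / 4 : ℝ) := by gcongr
        linarith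
      · have hd' : a + h - x ≤ |x - (u + P * h)| := hd
        refine ⟨by linarith, ?_⟩
        have : (R / |x - (u + P * h)|) ^ (1 / 4 : ℝ) ≤ (R / (a + h - x)) ^ (1 / 4 : ℝ) := by gcongr
        linarith
    have hqP := hq P
    have hqQ := hq (P + K)
    push_cast at hqQ
    have := hc.U_sub_log hs (p := u + P * h) (q := u + (P + K) * h) (x := x) (R := R)
      (sub_ne_zero.1 (abs_pos.1 hqP.1)) (sub_ne_zero.1 (abs_pos.1 hqQ.1))
      (hdist x hx P hnP.1) (hdist x hx _ hnP.2)
    rw [norm_mul, mul_comm]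
    refine mul_le_mul (hc.norm_le x) ?_ (norm_nonneg _) (by norm_num)
    linarith [hqP.2, hqQ.2]
  have hib : IntervalIntegrable (fun x => 5 / 4 * (11 + 8 * ((R / (x - a)) ^ (1 / 4 : ℝ) + (R / (a + h - x)) ^ (1 / 4 : ℝ))))
      volume a (a + h) :=
    (intervalIntegrable_const.add ((i1.add i2).const_mul 8)).const_mul _
  refine (intervalIntegral.norm_integral_le_of_norm_le hle hbound hib).trans ?_
  rw [intervalIntegral.integral_const_mul, intervalIntegral.integral_add intervalIntegrable_const
    ((i1.add i2).const_mul 8), intervalIntegral.integral_const_mul, intervalIntegral.integral_add i1 i2, e1, e2]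
  simp only [intervalIntegral.integral_const, add_sub_cancel_left, smul_eq_mul]
  have r1 : R ^ (1 / 4 : ℝ) * h ^ (3 / 4 : ℝ) ≤ 3 / 2 * (K : ℝ) ^ (1 / 4 : ℝ) * h := by
    rw [hRdef, Real.mul_rpow (by positivity) hh.le, Real.mul_rpow (by norm_num) (by positivity)]
    rw [mul_assoc (_ * _), ← Real.rpow_add hh]
    norm_num
    have : (5 : ℝ) ^ (1 / 4 : ℝ) ≤ 3 / 2 := by
      have e : ((3 / 2 : ℝ) ^ (4 : ℝ)) ^ (1 / 4 : ℝ) = 3 / 2 := by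
        rw [← Real.rpow_mul (by norm_num)]; norm_num
      rw [← e]
      exact Real.rpow_le_rpow (by norm_num) (by norm_num) (by norm_num)
    gcongr
  have r2 : (1 : ℝ) ≤ (K : ℝ) ^ (1 / 4 : ℝ) := Real.one_le_rpow hK1 (by norm_num)
  nlinarith

lemma Qbound_far (hc : Crv z b) {s : ℝ} (hs : 0 < s) {h : ℝ} (hh : 0 < h) (u : ℝ) (P M J : ℤ) (K : ℕ)
    (hK : 1 ≤ K) (hJ : J = M - 1 ∨ J = M) (hn1 : 4 ≤ |P - M|) (hn2 : 4 ≤ |P + K - M|) :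
    ‖∫ x in (u + J * h)..(u + J * h + h),
      (UU z s (u + P * h) x - UU z s (u + (P + K) * h) x -
        (UU z s (u + P * h) (u + M * h) - UU z s (u + (P + K) * h) (u + M * h))) * b x‖ ≤
      7 * h * (K / (|(P : ℝ) - M| * |(P : ℝ) + K - M|)) := by
  have hK1 : (1 : ℝ) ≤ K := by exact_mod_cast hK
  have hn1' : (4 : ℝ) ≤ |(P : ℝ) - M| := by exact_mod_cast hn1
  have hn2' : (4 : ℝ) ≤ |(P : ℝ) + K - M| := by exact_mod_cast hn2
  set G := fun x => UU z s (u + P * h) x - UU z s (u + (P + K) * h) x with hG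
  set np := |(P : ℝ) - M|
  set nq := |(P : ℝ) + K - M|
  have hM : (M : ℝ) - 1 ≤ J ∧ (J : ℝ) ≤ M := by
    rcases hJ with rfl | rfl
    · push_cast; constructor <;> linarith
    · constructor <;> linarith
  set S := Icc (u + M * h - h) (u + M * h + h) with hS
  have hder : ∀ x ∈ S, HasDerivWithinAt G (b x / DD z s x (u + P * h) - b x / DD z s x (u + (P + K) * h)) S x :=
    fun x _ => ((hc.hasDerivAt_U_x hs _ x).sub (hc.hasDerivAt_U_x hs _ x)).hasDerivWithinAt
  have hdist : ∀ x ∈ S, ∀ y : ℝ, 4 ≤ |y - M| → 3 / 4 * |y - M| * h ≤ |x - (u + y * h)| := by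
    intro x hx y hy
    have h1 : |u + M * h - (u + y * h)| = |y - M| * h := by
      rw [show u + M * h - (u + y * h) = -((y - M) * h) by ring, abs_neg, abs_mul, abs_of_pos hh]
    have h2 : |x - (u + M * h)| ≤ h := by
      rw [abs_le]; constructor <;> linarith [hx.1, hx.2]
    have h3 : |u + M * h - (u + y * h)| ≤ |x - (u + M * h)| + |x - (u + y * h)| := by
      have := abs_sub (x - (u + y * h)) (x - (u + M * h))
      rw [show x - (u + y * h) - (x - (u + M * h)) = u + M * h - (u + y * h) by ring] at this
      linarith
    nlinarith
  have hbd : ∀ x ∈ S, ‖b x / DD z s x (u + P * h) - b x / DD z s x (u + (P + K) * h)‖ ≤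
      5 * (K / (np * nq)) / h := by
    intro x hx
    have d1 := (hc.D_lower' s x (u + P * h))
    have d2 := (hc.D_lower' s x (u + (P + K) * h))
    have f1 := hdist x hx P hn1'
    have f2 := hdist x hx (P + K) hn2'
    have n1 := hc.D_ne hs x (u + P * h)
    have n2 := hc.D_ne hs x (u + (P + K) * h)
    have e : b x / DD z s x (u + P * h) - b x / DD z s x (u + (P + K) * h) =
        b x * (z (u + P * h) - z (u + (P + K) * h)) / (DD z s x (u + P * h) * DD z s x (u + (P + K) * h)) := by
      rw [div_sub_div _ _ n1 n2]
      congr 1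
      unfold DD
      generalize u + P * h = p1
      generalize u + (P + K) * h = p2
      ring
    rw [e, norm_div, norm_mul, norm_mul]
    have g1 : ‖z (u + P * h) - z (u + (P + K) * h)‖ ≤ 5 / 4 * (K * h) := by
      refine (hc.sub_norm_le _ _).trans (le_of_eq ?_)
      rw [show u + P * h - (u + (P + K) * h) = -(K * h) by ring, abs_neg, abs_of_pos (by positivity)]
    have d1' : 9 / 16 * np * h ≤ ‖DD z s x (u + P * h)‖ := by
      have : 3 / 4 * (3 / 4 * np * h) ≤ ‖DD z s x (u + P * h)‖ := by
        refine le_trans ?_ d1; gcongr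
      linarith
    have d2' : 9 / 16 * nq * h ≤ ‖DD z s x (u + (P + K) * h)‖ := by
      have : 3 / 4 * (3 / 4 * nq * h) ≤ ‖DD z s x (u + (P + K) * h)‖ := by
        refine le_trans ?_ d2; gcongr
      linarith
    calc _ ≤ (5 / 4) * (5 / 4 * (K * h)) / ((9 / 16 * np * h) * (9 / 16 * nq * h)) := by
          gcongr
          exact hc.norm_le x
      _ = (400 / 81) * (K / (np * nq)) / h := by field_simp; norm_num
      _ ≤ _ := by gcongr; norm_num
  have hmv : ∀ x ∈ uIoc (u + J * h) (u + J * h + h), ‖(G x - G (u + M * h)) * b x‖ ≤ 7 * (K / (np * nq)) := by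
    intro x hx
    rw [uIoc_of_le (by linarith)] at hx
    have hxS : x ∈ S := by
      constructor
      · nlinarith [hx.1]
      · nlinarith [hx.2]
    have hmS : u + M * h ∈ S := by constructor <;> linarith
    have m1 := (convex_Icc _ _).norm_image_sub_le_of_norm_hasDerivWithin_le hder hbd hmS hxS
    have m2 : ‖x - (u + M * h)‖ ≤ h := by
      rw [Real.norm_eq_abs, abs_le]; constructor <;> linarith [hxS.1, hxS.2]
    have m3 : ‖G x - G (u + M * h)‖ ≤ 5 * (K / (np * nq)) := by
      refine m1.trans ?_
      calc _ ≤ 5 * (K / (np * nq)) / h * h := by gcongr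
        _ = _ := by field_simp
    rw [norm_mul]
    calc _ ≤ 5 * (K / (np * nq)) * (5 / 4) := by
          gcongr
          exact hc.norm_le x
      _ ≤ _ := by
          have : 0 ≤ K / (np * nq) := by positivity
          linarith
  have := intervalIntegral.norm_integral_le_of_norm_le_const hmv
  refine this.trans (le_of_eq ?_)
  rw [show u + J * h + h - (u + J * h) = h by ring, abs_of_pos hh]
  ring

lemma Qbound (hc : Crv z b) {s : ℝ} (hs : 0 < s) {h : ℝ} (hh : 0 < h) (u : ℝ) (P M J : ℤ) (K : ℕ)
    (hK : 1 ≤ K) (hJ : J = M - 1 ∨ J = M) :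
    ‖∫ x in (u + J * h)..(u + J * h + h),
      (UU z s (u + P * h) x - UU z s (u + (P + K) * h) x - kap z s u h P M K) * b x‖ ≤
      480 * h * (K : ℝ) ^ (1 / 4 : ℝ) * (ww (P - M) + ww (P + K - M)) := by
  have hK1 : (1 : ℝ) ≤ K := by exact_mod_cast hK
  have hK4 : (0 : ℝ) < (K : ℝ) ^ (1 / 4 : ℝ) := by positivity
  have w1 := ww_pos (P - M)
  have w2 := ww_pos (P + K - M)
  by_cases hf : 4 ≤ |P - M| ∧ 4 ≤ |P + K - M|
  · rw [kap, if_pos hf]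
    refine (Qbound_far hc hs hh u P M J K hK hJ hf.1 hf.2).trans ?_
    have hn1' : (4 : ℝ) ≤ |(P : ℝ) - M| := by exact_mod_cast hf.1
    have hn2' : (4 : ℝ) ≤ |(P : ℝ) + K - M| := by exact_mod_cast hf.2
    have g1 := ww_ge _ hf.1
    have g2 := ww_ge _ hf.2
    push_cast at g1 g2
    have := K_le (a := |(P : ℝ) - M|) (c := |(P : ℝ) + K - M|) (K := K) (by linarith) (by linarith)
      (by linarith) (by
        have := abs_sub ((P : ℝ) + K - M) ((P : ℝ) - M)
        rw [show (P : ℝ) + K - M - ((P : ℝ) - M) = K by ring, abs_of_pos (by linarith)] at this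
        linarith)
    calc _ ≤ 7 * h * (2 * (K : ℝ) ^ (1 / 4 : ℝ) * (2 * ww (P - M) + 2 * ww (P + K - M))) := by
          gcongr
          refine this.trans ?_
          gcongr
      _ = 28 * h * (K : ℝ) ^ (1 / 4 : ℝ) * (ww (P - M) + ww (P + K - M)) := by ring
      _ ≤ _ := by gcongr; norm_num
  · rw [kap, if_neg hf]
    simp only [sub_zero]
    have hn : |P - M| < 4 ∨ |P + K - M| < 4 := by
      by_contra hcon
      push Not at hcon
      exact hf hcon
    refine (Qbound_near hc hs hh u P M J K hK hJ hn).trans ?_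
    have : 1 / 8 ≤ ww (P - M) + ww (P + K - M) := by
      rcases hn with hn | hn
      · have := ww_ge' _ hn; linarith
      · have := ww_ge' _ hn; linarith
    have h3 : 0 < h * (K : ℝ) ^ (1 / 4 : ℝ) := by positivity
    nlinarith

end
end CC

namespace CC
noncomputable section
open MeasureTheory Filter Set Metric Topology
open scoped ENNReal BigOperators

lemma sum_pairs {M : Type*} [AddCommMonoid M] (g : ℕ → M) (n : ℕ) :
    ∑ i ∈ Finset.range (2 * n), g i = ∑ i ∈ Finset.range n, (g (2 * i) + g (2 * i + 1)) := by
  induction n with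
  | zero => simp
  | succ n ih => rw [show 2 * (n + 1) = 2 * n + 1 + 1 by ring, Finset.sum_range_succ, Finset.sum_range_succ,
      Finset.sum_range_succ, ih, add_assoc]

def cc (m : ℕ → ℕ → ℂ) : ℕ → ℕ → ℂ
  | 0, i => m 0 i
  | k + 1, i => m (k + 1) i - m k (i / 2)

lemma tele (φ : ℕ → ℕ → ℂ) (hφ : ∀ k i, φ k i = φ (k + 1) (2 * i) + φ (k + 1) (2 * i + 1))
    (m : ℕ → ℕ → ℂ) (N : ℕ) :
    ∑ i ∈ Finset.range (2 ^ N), m N i * φ N i =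
      ∑ k ∈ Finset.range (N + 1), ∑ i ∈ Finset.range (2 ^ k), cc m k i * φ k i := by
  induction N with
  | zero => simp [cc]
  | succ N ih =>
    rw [Finset.sum_range_succ, ← ih, show 2 ^ (N + 1) = 2 * 2 ^ N by ring, sum_pairs, sum_pairs,
      ← Finset.sum_add_distrib]
    refine Finset.sum_congr rfl fun i _ => ?_
    rw [hφ N i]
    simp only [cc]
    rw [show 2 * i / 2 = i by omega, show (2 * i + 1) / 2 = i by omega]
    ring

lemma summable_ww : Summable ww := by
  have h := Real.summable_abs_int_rpow (b := 5 / 4) (by norm_num)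
  have h' : Summable fun n : ℤ => |(n : ℝ)| ^ (-(5 / 4) : ℝ) + if n = 0 then (1 : ℝ) else 0 :=
    h.add (summable_of_hasFiniteSupport (by
      refine (Set.finite_singleton (0 : ℤ)).subset ?_
      intro n hn
      by_contra h0
      have : n ≠ 0 := h0
      simp [this] at hn))
  refine Summable.of_nonneg_of_le (fun n => (ww_pos n).le) (fun n => ?_) h'
  by_cases hn : n = 0
  · subst hn
    have : (0 : ℝ) ≤ |((0 : ℤ) : ℝ)| ^ (-(5 / 4) : ℝ) := by positivity
    have h2 : ww 0 = 1 := by simp [ww]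
    rw [h2]; simp only [if_true]; linarith
  · simp only [hn, if_false, add_zero]
    unfold ww
    have : 0 < |(n : ℝ)| := abs_pos.2 (by exact_mod_cast hn)
    exact Real.rpow_le_rpow_of_nonpos this (by linarith) (by norm_num)

def SW : ℝ := ∑' n, ww n

lemma SW_nonneg : 0 ≤ SW := tsum_nonneg fun n => (ww_pos n).le

lemma sum_ww_le {ι : Type*} (S : Finset ι) (f : ι → ℤ) (hf : Function.Injective f) :
    ∑ j ∈ S, ww (f j) ≤ SW := by
  have h1 := summable_ww.comp_injective hf
  calc ∑ j ∈ S, ww (f j) ≤ ∑' j, (ww ∘ f) j := h1.sum_le_tsum S fun j _ => (ww_pos _).le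
    _ ≤ SW := Summable.tsum_le_tsum_of_inj f hf (fun n _ => (ww_pos n).le) (fun j => le_rfl) h1 summable_ww

lemma ww_shift {n k : ℤ} (h : |n - k| ≤ 1) : ww n ≤ 4 * ww k := by
  have h' : |(n : ℝ) - k| ≤ 1 := by exact_mod_cast h
  have h1 : |(k : ℝ)| ≤ |(n : ℝ)| + 1 := by
    have := abs_sub (n : ℝ) ((n : ℝ) - k)
    rw [show (n : ℝ) - (n - k) = k by ring] at this
    linarith
  unfold ww
  have h2 : (1 + |(n : ℝ)|) ^ (-(5 / 4) : ℝ) ≤ (1 / 2 * (1 + |(k : ℝ)|)) ^ (-(5 / 4) : ℝ) :=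
    Real.rpow_le_rpow_of_nonpos (by positivity) (by linarith [abs_nonneg (n : ℝ)]) (by norm_num)
  rw [Real.mul_rpow (by norm_num) (by positivity)] at h2
  have h3 : (1 / 2 : ℝ) ^ (-(5 / 4) : ℝ) ≤ 4 := by
    calc (1 / 2 : ℝ) ^ (-(5 / 4) : ℝ) ≤ (1 / 2 : ℝ) ^ (-2 : ℝ) :=
          Real.rpow_le_rpow_of_exponent_ge (by norm_num) (by norm_num) (by norm_num)
      _ = 4 := by rw [Real.rpow_neg (by norm_num)]; norm_num
  refine h2.trans ?_
  gcongr

/-- grid point -/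
def gp (u L : ℝ) (k j : ℕ) : ℝ := u + j * (L / 2 ^ k)

/-- dyadic interval integral -/
def DIn (u L : ℝ) (φ : ℝ → ℂ) (k j : ℕ) : ℂ := ∫ x in (gp u L k j)..(gp u L k j + L / 2 ^ k), φ x

lemma gp_add (u L : ℝ) (k j : ℕ) : gp u L k j + L / 2 ^ k = gp u L k (j + 1) := by
  unfold gp; push_cast; ring

lemma gp_two (u L : ℝ) (k j : ℕ) : gp u L (k + 1) (2 * j) = gp u L k j := by
  unfold gp; push_cast; rw [pow_succ]; field_simp

lemma DIn_split (u L : ℝ) {φ : ℝ → ℂ} (hφ : Continuous φ) (k j : ℕ) :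
    DIn u L φ k j = DIn u L φ (k + 1) (2 * j) + DIn u L φ (k + 1) (2 * j + 1) := by
  unfold DIn
  simp only [gp_add]
  rw [intervalIntegral.integral_add_adjacent_intervals (hφ.intervalIntegrable _ _) (hφ.intervalIntegrable _ _),
    gp_two, show 2 * j + 1 + 1 = 2 * (j + 1) by ring, gp_two]

lemma DIn_sum (u L : ℝ) {φ : ℝ → ℂ} (hφ : Continuous φ) (k : ℕ) :
    ∑ j ∈ Finset.range (2 ^ k), DIn u L φ k j = ∫ x in u..(u + L), φ x := by
  unfold DIn
  simp only [gp_add]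
  rw [intervalIntegral.sum_integral_adjacent_intervals (fun j _ => hφ.intervalIntegrable _ _)]
  congr 1
  · simp [gp]
  · simp [gp]; field_simp

variable {z b : ℝ → ℂ}

/-- double integral -/
def QQ (z b : ℝ → ℂ) (s u L : ℝ) (k i l j : ℕ) : ℂ :=
  DIn u L (fun x => DIn u L (fun y => b x * b y / DD z s x y) k i) l j

lemma contDIn (u L : ℝ) {H : ℝ × ℝ → ℂ} (hH : Continuous H) (k i : ℕ) :
    Continuous fun x => DIn u L (fun y => H (x, y)) k i := by
  unfold DIn
  exact intervalIntegral.continuous_parametric_intervalIntegral_of_continuous' (f := fun x y => H (x, y)) hH _ _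

lemma QQ_split_left (hc : Crv z b) {s : ℝ} (hs : 0 < s) (u L : ℝ) (k i l j : ℕ) :
    QQ z b s u L k i l j = QQ z b s u L (k + 1) (2 * i) l j + QQ z b s u L (k + 1) (2 * i + 1) l j := by
  unfold QQ
  have hK := hc.contK hs
  have h1 : ∀ x, DIn u L (fun y => b x * b y / DD z s x y) k i = DIn u L (fun y => b x * b y / DD z s x y) (k+1) (2 * i)
      + DIn u L (fun y => b x * b y / DD z s x y) (k+1) (2 * i+1) := fun x =>
    DIn_split u L (hK.comp (by fun_prop : Continuous fun y : ℝ => (x, y))) k i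
  simp_rw [h1]
  conv_lhs => unfold DIn
  rw [intervalIntegral.integral_add]
  · rfl
  · exact (contDIn u L hK _ _).intervalIntegrable _ _
  · exact (contDIn u L hK _ _).intervalIntegrable _ _

lemma QQ_split_right (hc : Crv z b) {s : ℝ} (hs : 0 < s) (u L : ℝ) (k i l j : ℕ) :
    QQ z b s u L k i l j = QQ z b s u L k i (l + 1) (2 * j) + QQ z b s u L k i (l + 1) (2 * j + 1) :=
  DIn_split u L (contDIn u L (hc.contK hs) _ _) _ _

def BB (z b : ℝ → ℂ) (s u L : ℝ) (k l : ℕ) (c d : ℕ → ℂ) : ℂ :=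
  ∑ j ∈ Finset.range (2 ^ l), d j * ∑ i ∈ Finset.range (2 ^ k), c i * QQ z b s u L k i l j

lemma BB_tele (hc : Crv z b) {s : ℝ} (hs : 0 < s) (u L : ℝ) (m n : ℕ → ℕ → ℂ) (N : ℕ) :
    BB z b s u L N N (m N) (n N) = ∑ k ∈ Finset.range (N + 1), ∑ l ∈ Finset.range (N + 1),
      BB z b s u L k l (cc m k) (cc n l) := by
  have h1 : BB z b s u L N N (m N) (n N) = ∑ i ∈ Finset.range (2 ^ N), m N i *
      ∑ j ∈ Finset.range (2 ^ N), n N j * QQ z b s u L N i N j := by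
    unfold BB
    simp_rw [Finset.mul_sum]
    rw [Finset.sum_comm]
    refine Finset.sum_congr rfl fun i _ => Finset.sum_congr rfl fun j _ => by ring
  rw [h1, tele (fun k i => ∑ j ∈ Finset.range (2 ^ N), n N j * QQ z b s u L k i N j)]
  · refine Finset.sum_congr rfl fun k _ => ?_
    unfold BB
    have h2 : ∑ i ∈ Finset.range (2 ^ k), cc m k i * ∑ j ∈ Finset.range (2 ^ N), n N j * QQ z b s u L k i N j
      = ∑ j ∈ Finset.range (2 ^ N), n N j * ∑ i ∈ Finset.range (2 ^ k), cc m k i * QQ z b s u L k i N j := by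
      simp_rw [Finset.mul_sum]
      rw [Finset.sum_comm]
      refine Finset.sum_congr rfl fun i _ => Finset.sum_congr rfl fun j _ => by ring
    rw [h2, tele (fun l j => ∑ i ∈ Finset.range (2 ^ k), cc m k i * QQ z b s u L k i l j)]
    intro l j
    rw [← Finset.sum_add_distrib]
    refine Finset.sum_congr rfl fun i _ => ?_
    rw [QQ_split_right hc hs]; ring
  · intro k i
    rw [← Finset.sum_add_distrib]
    refine Finset.sum_congr rfl fun j _ => ?_
    rw [QQ_split_left hc hs]; ring

/-- cancellation property -/
def Can (b : ℝ → ℂ) (u L : ℝ) (l : ℕ) (d : ℕ → ℂ) : Prop :=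
  l = 0 ∨ ∀ j, d (2 * j) * DIn u L b l (2 * j) + d (2 * j + 1) * DIn u L b l (2 * j + 1) = 0

/-- square function of level k -/
def XX (L : ℝ) (k : ℕ) (c : ℕ → ℂ) : ℝ := L / 2 ^ k * ∑ i ∈ Finset.range (2 ^ k), ‖c i‖ ^ 2

lemma QQ_bound (hc : Crv z b) {s : ℝ} (hs : 0 < s) (u : ℝ) {L : ℝ} (hL : 0 < L) {k l : ℕ} (hkl : k ≤ l) (i j : ℕ) :
    ‖QQ z b s u L k i l j - kap z s u (L / 2 ^ l) (i * 2 ^ (l - k)) (2 * (j / 2 : ℕ) + 1) (2 ^ (l - k)) * DIn u L b l j‖ ≤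
      1920 * (L / 2 ^ l) * (((2 : ℝ) ^ (l - k)) ^ (1 / 4 : ℝ)) *
       (ww (i * 2 ^ (l - k) - j) + ww (i * 2 ^ (l - k) + 2 ^ (l - k) - j)) := by
  set K : ℕ := 2 ^ (l - k) with hKdef
  have hK1 : 1 ≤ K := Nat.one_le_two_pow
  set M : ℤ := 2 * (j / 2 : ℕ) + 1 with hM
  have hh : 0 < L / 2 ^ l := by positivity
  have hJ : (j : ℤ) = M - 1 ∨ (j : ℤ) = M := by omega
  have hpow : (2 : ℝ) ^ l = K * 2 ^ k := by
    rw [hKdef]; push_cast; rw [← pow_add]; congr 1; omega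
  have hK0 : (0 : ℝ) < K := by positivity
  have hkK : L / 2 ^ k = K * (L / 2 ^ l) := by rw [hpow]; field_simp
  have key := Qbound hc hs hh u (i * K) M j K hK1 hJ
  have e1 : QQ z b s u L k i l j - kap z s u (L / 2 ^ l) (i * K) M K * DIn u L b l j =
      ∫ x in (u + ((j : ℤ) : ℝ) * (L / 2 ^ l))..(u + ((j : ℤ) : ℝ) * (L / 2 ^ l) + (L / 2 ^ l)),
      (UU z s (u + ((i * K : ℤ) : ℝ) * (L / 2 ^ l)) x - UU z s (u + (((i * K : ℤ) : ℝ) + K) * (L / 2 ^ l)) x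
        - kap z s u (L / 2 ^ l) (i * K) M K) * b x := by
    have e2 : ∀ x, DIn u L (fun y => b x * b y / DD z s x y) k i =
      (UU z s (u + ((i * K : ℤ) : ℝ) * (L / 2 ^ l)) x - UU z s (u + (((i * K : ℤ) : ℝ) + K) * (L / 2 ^ l)) x) * b x := by
      intro x
      unfold DIn
      simp_rw [mul_div_assoc]
      rw [intervalIntegral.integral_const_mul, hc.int_U hs, mul_comm]
      unfold gp
      rw [hkK]
      push_cast
      congr 3 <;> ring
    unfold QQ
    simp_rw [e2, sub_mul]
    have hb := hc.cont
    have hu := fun p => hc.contU hs p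
    rw [intervalIntegral.integral_sub (Continuous.intervalIntegrable (by fun_prop) _ _)
      (Continuous.intervalIntegrable (by fun_prop) _ _), intervalIntegral.integral_const_mul]
    simp only [Int.cast_natCast]
    rfl
  have e3 : ((2 : ℤ) ^ (l - k)) = (K : ℤ) := by rw [hKdef]; push_cast; rfl
  have e4 : ((2 : ℝ) ^ (l - k)) = (K : ℝ) := by rw [hKdef]; push_cast; rfl
  rw [e3, e4, e1]
  refine key.trans ?_
  have w1 : ww (i * K - M) ≤ 4 * ww (i * K - j) := ww_shift (by rw [abs_le]; constructor <;> omega)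
  have w2 : ww (i * K + K - M) ≤ 4 * ww (i * K + K - j) := ww_shift (by rw [abs_le]; constructor <;> omega)
  calc _ ≤ 480 * (L / 2 ^ l) * (K : ℝ) ^ (1 / 4 : ℝ) * (4 * ww (i * K - j) + 4 * ww (i * K + K - j)) := by gcongr
    _ = _ := by ring

lemma BB_bound (hc : Crv z b) {s : ℝ} (hs : 0 < s) (u : ℝ) {L : ℝ} (hL : 0 < L) {k l : ℕ} (hkl : k ≤ l)
    (c d : ℕ → ℂ) (hd : Can b u L l d) :
    ‖BB z b s u L k l c d‖ ≤ 1920 * SW * ((2 : ℝ) ^ (l - k)) ^ (-(1 / 4) : ℝ) * (XX L k c + XX L l d) := by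
  set K : ℕ := 2 ^ (l - k) with hKdef
  have hK1 : 1 ≤ K := Nat.one_le_two_pow
  have hK0 : (0 : ℝ) < K := by positivity
  have hpow : (2 : ℝ) ^ l = K * 2 ^ k := by
    rw [hKdef]; push_cast; rw [← pow_add]; congr 1; omega
  have hkK : L / 2 ^ k = K * (L / 2 ^ l) := by rw [hpow]; field_simp
  have e3 : ((2 : ℤ) ^ (l - k)) = (K : ℤ) := by rw [hKdef]; push_cast; rfl
  have e4 : ((2 : ℝ) ^ (l - k)) = (K : ℝ) := by rw [hKdef]; push_cast; rfl
  set κ : ℕ → ℕ → ℂ := fun i j => kap z s u (L / 2 ^ l) (i * K) (2 * (j / 2 : ℕ) + 1) K with hκ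
  have hcan : ∀ i ∈ Finset.range (2 ^ k), ∑ j ∈ Finset.range (2 ^ l), d j * (κ i j * DIn u L b l j) = 0 := by
    intro i hi
    rcases Nat.eq_zero_or_pos l with h0 | h0
    · subst h0
      have hk0 : k = 0 := by omega
      subst hk0
      have hi0 : i = 0 := by simpa using hi
      subst hi0
      simp only [pow_zero, Finset.range_one, Finset.sum_singleton, hκ]
      rw [kap, if_neg]
      · simp
      · rintro ⟨h, -⟩
        norm_num at h
    · obtain ⟨l, rfl⟩ : ∃ l', l = l' + 1 := ⟨l - 1, by omega⟩
      rcases hd with hd | hd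
      · omega
      rw [show 2 ^ (l + 1) = 2 * 2 ^ l by ring, sum_pairs]
      refine Finset.sum_eq_zero fun j _ => ?_
      have e : κ i (2 * j + 1) = κ i (2 * j) := by
        simp only [hκ]
        rw [show (2 * j + 1) / 2 = (2 * j) / 2 by omega]
      rw [e]
      linear_combination κ i (2 * j) * hd j
  have hB : BB z b s u L k l c d = ∑ j ∈ Finset.range (2 ^ l), ∑ i ∈ Finset.range (2 ^ k),
      d j * c i * (QQ z b s u L k i l j - κ i j * DIn u L b l j) := by
    have e1 : ∑ j ∈ Finset.range (2 ^ l), ∑ i ∈ Finset.range (2 ^ k), d j * c i * (κ i j * DIn u L b l j) = 0 := by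
      rw [Finset.sum_comm]
      refine Finset.sum_eq_zero fun i hi => ?_
      have := hcan i hi
      calc _ = c i * ∑ j ∈ Finset.range (2 ^ l), d j * (κ i j * DIn u L b l j) := by
            rw [Finset.mul_sum]; exact Finset.sum_congr rfl fun j _ => by ring
        _ = 0 := by rw [this, mul_zero]
    unfold BB
    simp_rw [mul_sub, Finset.sum_sub_distrib]
    rw [e1, sub_zero]
    refine Finset.sum_congr rfl fun j _ => ?_
    rw [Finset.mul_sum]
    exact Finset.sum_congr rfl fun i _ => by ring
  set W : ℕ → ℕ → ℝ := fun i j => ww (i * K - j) + ww (i * K + K - j) with hW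
  have hW0 : ∀ i j, 0 ≤ W i j := fun i j => add_nonneg (ww_pos _).le (ww_pos _).le
  have hWj : ∀ i, ∑ j ∈ Finset.range (2 ^ l), W i j ≤ 2 * SW := by
    intro i
    simp only [hW]
    rw [Finset.sum_add_distrib, two_mul]
    refine add_le_add (sum_ww_le _ (fun j : ℕ => (i * K - j : ℤ)) ?_) (sum_ww_le _ (fun j : ℕ => (i * K + K - j : ℤ)) ?_)
    · intro a b hab; simp only at hab; omega
    · intro a b hab; simp only at hab; omega
  have hWi : ∀ j, ∑ i ∈ Finset.range (2 ^ k), W i j ≤ 2 * SW := by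
    intro j
    simp only [hW]
    rw [Finset.sum_add_distrib, two_mul]
    have hK0' : (K : ℤ) ≠ 0 := by positivity
    refine add_le_add (sum_ww_le _ (fun i : ℕ => (i * K - j : ℤ)) ?_) (sum_ww_le _ (fun i : ℕ => (i * K + K - j : ℤ)) ?_)
    · intro a b hab
      have : (a : ℤ) * K = b * K := by simp only at hab; omega
      exact_mod_cast mul_right_cancel₀ hK0' this
    · intro a b hab
      have : (a : ℤ) * K = b * K := by simp only at hab; omega
      exact_mod_cast mul_right_cancel₀ hK0' this
  set h := L / 2 ^ l with hh
  have hh0 : 0 < h := by positivity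
  set q := (K : ℝ) ^ (1 / 4 : ℝ) with hq
  have hq0 : 0 < q := by positivity
  have hq4 : (K : ℝ) = q ^ 4 := by
    rw [hq, ← Real.rpow_natCast, ← Real.rpow_mul hK0.le]; norm_num
  have hqi : (K : ℝ) ^ (-(1 / 4) : ℝ) = q⁻¹ := by rw [Real.rpow_neg hK0.le]
  have hterm : ∀ i j, ‖d j * c i * (QQ z b s u L k i l j - κ i j * DIn u L b l j)‖ ≤
      960 * h * (q ^ 3 * (‖c i‖ ^ 2 * W i j) + q⁻¹ * (‖d j‖ ^ 2 * W i j)) := by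
    intro i j
    have h1 := QQ_bound hc hs u hL hkl i j
    rw [e3, e4] at h1
    rw [norm_mul, norm_mul]
    have h2 : ‖d j‖ * ‖c i‖ ≤ 1 / 2 * (q ^ 2 * ‖c i‖ ^ 2 + (q ^ 2)⁻¹ * ‖d j‖ ^ 2) := by
      have : 0 ≤ (q * ‖c i‖ - q⁻¹ * ‖d j‖) ^ 2 := sq_nonneg _
      have e : (q * ‖c i‖ - q⁻¹ * ‖d j‖) ^ 2 = q ^ 2 * ‖c i‖ ^ 2 + (q ^ 2)⁻¹ * ‖d j‖ ^ 2 - 2 * (‖d j‖ * ‖c i‖) := by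
        field_simp; ring
      linarith
    calc _ ≤ (1 / 2 * (q ^ 2 * ‖c i‖ ^ 2 + (q ^ 2)⁻¹ * ‖d j‖ ^ 2)) * (1920 * h * q * W i j) := by
          have := hW0 i j
          gcongr
      _ = _ := by field_simp; ring
  rw [hB, e4, hqi]
  calc _ ≤ ∑ j ∈ Finset.range (2 ^ l), ∑ i ∈ Finset.range (2 ^ k),
        960 * h * (q ^ 3 * (‖c i‖ ^ 2 * W i j) + q⁻¹ * (‖d j‖ ^ 2 * W i j)) := by
        refine (norm_sum_le _ _).trans (Finset.sum_le_sum fun j _ => (norm_sum_le _ _).trans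
          (Finset.sum_le_sum fun i _ => hterm i j))
    _ = 960 * h * (q ^ 3 * ∑ i ∈ Finset.range (2 ^ k), ‖c i‖ ^ 2 * ∑ j ∈ Finset.range (2 ^ l), W i j) +
        960 * h * (q⁻¹ * ∑ j ∈ Finset.range (2 ^ l), ‖d j‖ ^ 2 * ∑ i ∈ Finset.range (2 ^ k), W i j) := by
        simp_rw [mul_add, Finset.sum_add_distrib, Finset.mul_sum]
        congr 1
        rw [Finset.sum_comm]
    _ ≤ 960 * h * (q ^ 3 * ∑ i ∈ Finset.range (2 ^ k), ‖c i‖ ^ 2 * (2 * SW)) +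
        960 * h * (q⁻¹ * ∑ j ∈ Finset.range (2 ^ l), ‖d j‖ ^ 2 * (2 * SW)) := by
        gcongr with i _ j _
        · exact hWj i
        · exact hWi j
    _ = _ := by
        unfold XX
        rw [hkK, ← hh, ← Finset.sum_mul, ← Finset.sum_mul, hq4]
        field_simp
        ring
end
end CC

namespace CC
noncomputable section
open MeasureTheory Filter Set Metric Topology
open scoped ENNReal BigOperators ComplexConjugate

variable {z b : ℝ → ℂ}

lemma Crv.conj (hc : Crv z b) : Crv (fun x => conj (z x)) (fun x => conj (b x)) where
  deriv x := (Complex.conjCLE.hasFDerivAt.comp_hasDerivAt x (hc.deriv x))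
  cont := Complex.continuous_conj.comp hc.cont
  close x := by
    have := hc.close x
    rw [← Complex.norm_conj] at this
    simpa using this

lemma DIn_conj (u L : ℝ) (φ : ℝ → ℂ) (k j : ℕ) : DIn u L (fun x => conj (φ x)) k j = conj (DIn u L φ k j) := by
  unfold DIn
  simp only [intervalIntegral.intervalIntegral_eq_integral_uIoc, integral_conj]
  split_ifs <;> simp

lemma DIn_swap (u L : ℝ) {H : ℝ × ℝ → ℂ} (hH : Continuous H) (k i l j : ℕ) :
    DIn u L (fun x => DIn u L (fun y => H (x, y)) k i) l j = DIn u L (fun y => DIn u L (fun x => H (x, y)) l j) k i := by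
  unfold DIn
  refine intervalIntegral_intervalIntegral_swap (F := fun x y => H (x, y)) ?_
  have : Function.uncurry (fun x y => H (x, y)) = H := by ext ⟨x, y⟩; rfl
  rw [this]
  exact (hH.continuousOn.integrableOn_compact (isCompact_uIcc.prod isCompact_uIcc)).mono_set
    (Set.prod_mono uIoc_subset_uIcc uIoc_subset_uIcc)

lemma QQ_conj (hc : Crv z b) {s : ℝ} (hs : 0 < s) (u L : ℝ) (k i l j : ℕ) :
    QQ z b s u L k i l j = -conj (QQ (fun x => conj (z x)) (fun x => conj (b x)) s u L l j k i) := by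
  unfold QQ
  rw [← DIn_conj]
  simp_rw [← DIn_conj]
  rw [DIn_swap u L (H := fun q => b q.1 * b q.2 / DD z s q.1 q.2) (hc.contK hs)]
  unfold DIn
  simp_rw [← intervalIntegral.integral_neg]
  refine intervalIntegral.integral_congr fun y _ => ?_
  refine intervalIntegral.integral_congr fun x _ => ?_
  unfold DD
  simp only [map_div₀, map_mul, map_add, map_sub, Complex.conj_conj, Complex.conj_I, Complex.conj_ofReal]
  rw [show z x - z y + s * Complex.I = -(z y - z x + s * -Complex.I) by ring, div_neg, mul_comm (b x)]

lemma BB_conj (hc : Crv z b) {s : ℝ} (hs : 0 < s) (u L : ℝ) (k l : ℕ) (c d : ℕ → ℂ) :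
    BB z b s u L k l c d = -conj (BB (fun x => conj (z x)) (fun x => conj (b x)) s u L l k
      (fun j => conj (d j)) (fun i => conj (c i))) := by
  unfold BB
  simp_rw [QQ_conj hc hs u L k _ l, map_sum, map_mul, map_sum, Complex.conj_conj, map_mul, Complex.conj_conj,
    Finset.mul_sum]
  rw [Finset.sum_comm, ← Finset.sum_neg_distrib]
  refine Finset.sum_congr rfl fun i _ => ?_
  rw [← Finset.sum_neg_distrib]
  refine Finset.sum_congr rfl fun j _ => ?_
  ring

def rr (n : ℤ) : ℝ := ((2 : ℝ) ^ n.natAbs) ^ (-(1 / 4) : ℝ)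

lemma rr_pos (n : ℤ) : 0 < rr n := by unfold rr; positivity

lemma summable_rr : Summable rr := by
  have h : ∀ n : ℕ, ((2 : ℝ) ^ n) ^ (-(1 / 4) : ℝ) = ((2 : ℝ) ^ (-(1 / 4) : ℝ)) ^ n := by
    intro n
    rw [← Real.rpow_natCast, ← Real.rpow_natCast, ← Real.rpow_mul (by norm_num), ← Real.rpow_mul (by norm_num), mul_comm]
  have hg : Summable fun n : ℕ => ((2 : ℝ) ^ (-(1 / 4) : ℝ)) ^ n :=
    summable_geometric_of_lt_one (by positivity) (Real.rpow_lt_one_of_one_lt_of_neg (by norm_num) (by norm_num))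
  apply Summable.of_nat_of_neg
  · refine hg.congr fun n => ?_
    rw [← h]; simp [rr]
  · refine hg.congr fun n => ?_
    rw [← h]; simp [rr]

def SR : ℝ := ∑' n, rr n

lemma sum_rr_le {ι : Type*} (S : Finset ι) (f : ι → ℤ) (hf : Function.Injective f) :
    ∑ j ∈ S, rr (f j) ≤ SR := by
  have h1 := summable_rr.comp_injective hf
  calc ∑ j ∈ S, rr (f j) ≤ ∑' j, (rr ∘ f) j := h1.sum_le_tsum S fun j _ => (rr_pos _).le
    _ ≤ SR := Summable.tsum_le_tsum_of_inj f hf (fun n _ => (rr_pos n).le) (fun j => le_rfl) h1 summable_rr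

lemma SR_nonneg : 0 ≤ SR := tsum_nonneg fun n => (rr_pos n).le

lemma XX_nonneg {L : ℝ} (hL : 0 < L) (k : ℕ) (c : ℕ → ℂ) : 0 ≤ XX L k c := by unfold XX; positivity

lemma BB_bound2 (hc : Crv z b) {s : ℝ} (hs : 0 < s) (u : ℝ) {L : ℝ} (hL : 0 < L) (k l : ℕ)
    (c d : ℕ → ℂ) (hcc : Can b u L k c) (hd : Can b u L l d) :
    ‖BB z b s u L k l c d‖ ≤ 1920 * SW * rr (k - l) * (XX L k c + XX L l d) := by
  rcases le_total k l with hkl | hkl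
  · have e : rr (k - l) = ((2 : ℝ) ^ (l - k)) ^ (-(1 / 4) : ℝ) := by
      unfold rr; congr 2; omega
    rw [e]
    exact BB_bound hc hs u hL hkl c d hd
  · have e : rr (k - l) = ((2 : ℝ) ^ (k - l)) ^ (-(1 / 4) : ℝ) := by
      unfold rr; congr 2; omega
    rw [e, BB_conj hc hs, norm_neg, Complex.norm_conj]
    have hX : ∀ (k : ℕ) (c : ℕ → ℂ), XX L k (fun i => conj (c i)) = XX L k c := by
      intro k c; simp [XX]
    have := BB_bound hc.conj hs u hL hkl (fun j => conj (d j)) (fun i => conj (c i)) (by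
      rcases hcc with h | h
      · exact Or.inl h
      · right
        intro j
        rw [DIn_conj, DIn_conj, ← map_mul, ← map_mul, ← map_add, h j, map_zero])
    rw [hX, hX, add_comm (XX L l d)] at this
    exact this

lemma BB_total (hc : Crv z b) {s : ℝ} (hs : 0 < s) (u : ℝ) {L : ℝ} (hL : 0 < L) (m n : ℕ → ℕ → ℂ)
    (hm : ∀ k, Can b u L k (cc m k)) (hn : ∀ k, Can b u L k (cc n k)) (N : ℕ) :
    ‖BB z b s u L N N (m N) (n N)‖ ≤ 1920 * SW * SR * (∑ k ∈ Finset.range (N + 1), XX L k (cc m k) +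
      ∑ k ∈ Finset.range (N + 1), XX L k (cc n k)) := by
  rw [BB_tele hc hs]
  have hSW := SW_nonneg
  calc _ ≤ ∑ k ∈ Finset.range (N + 1), ∑ l ∈ Finset.range (N + 1), 1920 * SW * rr (k - l) *
        (XX L k (cc m k) + XX L l (cc n l)) :=
        (norm_sum_le _ _).trans (Finset.sum_le_sum fun k _ => (norm_sum_le _ _).trans
          (Finset.sum_le_sum fun l _ => BB_bound2 hc hs u hL k l _ _ (hm k) (hn l)))
    _ = 1920 * SW * (∑ k ∈ Finset.range (N + 1), XX L k (cc m k) * ∑ l ∈ Finset.range (N + 1), rr (k - l)) +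
        1920 * SW * (∑ l ∈ Finset.range (N + 1), XX L l (cc n l) * ∑ k ∈ Finset.range (N + 1), rr (k - l)) := by
        simp_rw [mul_add, Finset.sum_add_distrib, Finset.mul_sum]
        congr 1
        · refine Finset.sum_congr rfl fun k _ => Finset.sum_congr rfl fun l _ => by ring
        · rw [Finset.sum_comm]
          refine Finset.sum_congr rfl fun k _ => Finset.sum_congr rfl fun l _ => by ring
    _ ≤ 1920 * SW * (∑ k ∈ Finset.range (N + 1), XX L k (cc m k) * SR) +
        1920 * SW * (∑ l ∈ Finset.range (N + 1), XX L l (cc n l) * SR) := by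
        gcongr with k _ l _
        · exact XX_nonneg hL _ _
        · exact sum_rr_le _ (fun l : ℕ => (k - l : ℤ)) (fun a b hab => by simp only at hab; omega)
        · exact XX_nonneg hL _ _
        · exact sum_rr_le _ (fun k : ℕ => (k - l : ℤ)) (fun a b hab => by simp only at hab; omega)
    _ = _ := by rw [← Finset.sum_mul, ← Finset.sum_mul]; ring

/-- adapted averages -/
def mm (b : ℝ → ℂ) (u L : ℝ) (f : ℝ → ℂ) (k j : ℕ) : ℂ := DIn u L (fun x => f x * b x) k j / DIn u L b k j

lemma DIn_b (hc : Crv z b) (u : ℝ) {L : ℝ} (hL : 0 < L) (k j : ℕ) :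
    ‖DIn u L b k j - (L / 2 ^ k : ℝ)‖ ≤ 1 / 4 * (L / 2 ^ k) := by
  have hh : 0 < L / 2 ^ k := by positivity
  have e : DIn u L b k j - (L / 2 ^ k : ℝ) = ∫ x in (gp u L k j)..(gp u L k j + L / 2 ^ k), (b x - 1) := by
    rw [intervalIntegral.integral_sub (hc.cont.intervalIntegrable _ _) intervalIntegrable_const]
    simp [DIn]
  rw [e]
  have := intervalIntegral.norm_integral_le_of_norm_le_const (a := gp u L k j) (b := gp u L k j + L / 2 ^ k)
    (f := fun x => b x - 1) (C := 1 / 4) (fun x _ => hc.close x)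
  rwa [add_sub_cancel_left, abs_of_pos hh] at this

lemma DIn_b_ne (hc : Crv z b) (u : ℝ) {L : ℝ} (hL : 0 < L) (k j : ℕ) : DIn u L b k j ≠ 0 := by
  intro h
  have := DIn_b hc u hL k j
  have hh : 0 < L / 2 ^ k := by positivity
  rw [h, zero_sub, norm_neg, Complex.norm_real, Real.norm_of_nonneg hh.le] at this
  linarith

lemma Can_mm (hc : Crv z b) (u : ℝ) {L : ℝ} (hL : 0 < L) {f : ℝ → ℂ} (hf : Continuous f) (k : ℕ) :
    Can b u L k (cc (mm b u L f) k) := by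
  cases k with
  | zero => exact Or.inl rfl
  | succ k =>
    right
    intro j
    simp only [cc, mm]
    rw [show 2 * j / 2 = j by omega, show (2 * j + 1) / 2 = j by omega]
    have n1 := DIn_b_ne hc u hL (k + 1) (2 * j)
    have n2 := DIn_b_ne hc u hL (k + 1) (2 * j + 1)
    have n0 := DIn_b_ne hc u hL k j
    rw [sub_mul, sub_mul, div_mul_cancel₀ _ n1, div_mul_cancel₀ _ n2]
    have e1 := DIn_split u L hc.cont k j
    have e2 := DIn_split u L (hf.mul hc.cont) k j
    have : DIn u L (fun x => f x * b x) k j / DIn u L b k j * DIn u L b k j = DIn u L (fun x => f x * b x) k j :=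
      div_mul_cancel₀ _ n0
    have e2' : DIn u L (fun x => f x * b x) k j = DIn u L (fun x => f x * b x) (k + 1) (2 * j) +
      DIn u L (fun x => f x * b x) (k + 1) (2 * j + 1) := e2
    linear_combination e2' * (-1) - this + (DIn u L (fun x => f x * b x) k j / DIn u L b k j) * e1

/-- Bellman function -/
def Bel (F β : ℂ) : ℝ := ‖F‖ ^ 2 * (1 + 4 / (2 - ‖β - 1‖ ^ 2))

lemma sq_div_conv {A a c w1 w2 : ℝ} (hA : 0 ≤ A) (hac : A ≤ (a + c) / 2) (h1 : 0 < w1) (h2 : 0 < w2) :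
    A ^ 2 / ((w1 + w2) / 2) ≤ (a ^ 2 / w1 + c ^ 2 / w2) / 2 := by
  set v := (w1 + w2) / 2 with hv
  have hv0 : 0 < v := by positivity
  have key : ∀ {a w : ℝ}, 0 < w → ∀ t : ℝ, 2 * a * t - t ^ 2 * w ≤ a ^ 2 / w := by
    intro a w hw t
    rw [le_div_iff₀ hw]
    nlinarith [sq_nonneg (a - t * w)]
  have k1 := key (a := a) h1 (A / v)
  have k2 := key (a := c) h2 (A / v)
  have hAv : 0 ≤ A / v := by positivity
  have e : A ^ 2 / v = 2 * A * (A / v) - (A / v) ^ 2 * v := by field_simp; ring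
  rw [e]
  have : (A / v) ^ 2 * v = ((A / v) ^ 2 * w1 + (A / v) ^ 2 * w2) / 2 := by rw [hv]; ring
  nlinarith [mul_le_mul_of_nonneg_right hac hAv]

lemma quot_bd {F G β γ β1 : ℂ} (h0 : 3 / 4 ≤ ‖β‖) (h1 : 3 / 4 ≤ ‖β1‖) (h : β1 = β + γ) :
    ‖(F + G) / β1 - F / β‖ ^ 2 ≤ 7 * (‖G‖ ^ 2 + ‖F‖ ^ 2 * ‖γ‖ ^ 2) := by
  have n0 : β ≠ 0 := by rintro rfl; norm_num at h0
  have n1 : β1 ≠ 0 := by intro h2; rw [h2] at h1; norm_num at h1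
  have e : (F + G) / β1 - F / β = G / β1 - F * γ / (β1 * β) := by
    field_simp
    rw [h]; ring
  rw [e]
  have t : ‖G / β1 - F * γ / (β1 * β)‖ ≤ 4 / 3 * ‖G‖ + 16 / 9 * (‖F‖ * ‖γ‖) := by
    refine (norm_sub_le _ _).trans ?_
    rw [norm_div, norm_div, norm_mul, norm_mul]
    refine add_le_add ?_ ?_
    · rw [div_le_iff₀ (by linarith)]
      nlinarith [norm_nonneg G]
    · rw [div_le_iff₀ (by nlinarith)]
      have : 9 / 16 ≤ ‖β1‖ * ‖β‖ := by nlinarith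
      nlinarith [mul_nonneg (norm_nonneg F) (norm_nonneg γ)]
  have t0 := norm_nonneg (G / β1 - F * γ / (β1 * β))
  have hg := norm_nonneg G
  have hp := mul_nonneg (norm_nonneg F) (norm_nonneg γ)
  rw [← mul_pow]
  set p := ‖F‖ * ‖γ‖
  have : ‖G / β1 - F * γ / (β1 * β)‖ ^ 2 ≤ (4 / 3 * ‖G‖ + 16 / 9 * p) ^ 2 := by gcongr
  nlinarith [sq_nonneg (4 / 3 * ‖G‖ - 16 / 9 * p)]

lemma Bel_local {F1 F2 β1 β2 F β : ℂ} (h1 : ‖β1 - 1‖ ≤ 1 / 4) (h2 : ‖β2 - 1‖ ≤ 1 / 4)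
    (hF : F = (F1 + F2) / 2) (hβ : β = (β1 + β2) / 2) :
    Bel F β + 1 / 20 * (‖F1 / β1 - F / β‖ ^ 2 + ‖F2 / β2 - F / β‖ ^ 2) ≤ (Bel F1 β1 + Bel F2 β2) / 2 := by
  set G := (F1 - F2) / 2 with hG
  set γ := (β1 - β2) / 2 with hγ
  have eF1 : F1 = F + G := by rw [hF, hG]; ring
  have eF2 : F2 = F + -G := by rw [hF, hG]; ring
  have eb1 : β1 = β + γ := by rw [hβ, hγ]; ring
  have eb2 : β2 = β + -γ := by rw [hβ, hγ]; ring
  have nF : ‖F1‖ ^ 2 + ‖F2‖ ^ 2 = 2 * ‖F‖ ^ 2 + 2 * ‖G‖ ^ 2 := by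
    have := parallelogram_law_with_norm ℝ F G
    rw [eF1, eF2, ← sub_eq_add_neg]; nlinarith
  have nb : ‖β1 - 1‖ ^ 2 + ‖β2 - 1‖ ^ 2 = 2 * ‖β - 1‖ ^ 2 + 2 * ‖γ‖ ^ 2 := by
    have := parallelogram_law_with_norm ℝ (β - 1) γ
    rw [eb1, eb2, show β + γ - 1 = β - 1 + γ by ring, show β + -γ - 1 = β - 1 - γ by ring]; nlinarith
  have hb : ‖β - 1‖ ≤ 1 / 4 := by
    rw [show β - 1 = ((β1 - 1) + (β2 - 1)) / 2 by rw [hβ]; ring, norm_div]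
    have := norm_add_le (β1 - 1) (β2 - 1)
    have e2 : ‖(2 : ℂ)‖ = 2 := by norm_num
    rw [e2]; linarith
  have low : ∀ β : ℂ, ‖β - 1‖ ≤ 1 / 4 → 3 / 4 ≤ ‖β‖ := by
    intro β h
    have := norm_sub_norm_le (1 : ℂ) (1 - β)
    rw [show (1 : ℂ) - (1 - β) = β by ring, norm_sub_rev 1 β, norm_one] at this
    linarith
  have tri : ‖F‖ ≤ (‖F1‖ + ‖F2‖) / 2 := by
    rw [hF, norm_div]
    have := norm_add_le F1 F2
    have e2 : ‖(2 : ℂ)‖ = 2 := by norm_num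
    rw [e2]; linarith
  have q1 := quot_bd (F := F) (G := G) (low _ hb) (low _ h1) eb1
  have q2 := quot_bd (F := F) (G := -G) (low _ hb) (low _ h2) eb2
  rw [← eF1] at q1
  rw [← eF2, norm_neg, norm_neg] at q2
  unfold Bel
  have sq1 : ‖β1 - 1‖ ^ 2 ≤ 1 / 16 := by nlinarith [norm_nonneg (β1 - 1)]
  have sq2 : ‖β2 - 1‖ ^ 2 ≤ 1 / 16 := by nlinarith [norm_nonneg (β2 - 1)]
  have conv := sq_div_conv (norm_nonneg F) tri (w1 := 2 - ‖β1 - 1‖ ^ 2) (w2 := 2 - ‖β2 - 1‖ ^ 2) (by linarith) (by linarith)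
  set w := 2 - ‖β - 1‖ ^ 2 with hw
  have hw2 : w ≤ 2 := by rw [hw]; nlinarith [norm_nonneg (β - 1)]
  have ev : ((2 - ‖β1 - 1‖ ^ 2) + (2 - ‖β2 - 1‖ ^ 2)) / 2 = w - ‖γ‖ ^ 2 := by rw [hw]; linarith
  rw [ev] at conv
  have hv0 : 0 < w - ‖γ‖ ^ 2 := by rw [← ev]; linarith
  have hγ0 : 0 ≤ ‖γ‖ ^ 2 := by positivity
  have hw0 : 0 < w := by linarith
  have inv : 1 / w + ‖γ‖ ^ 2 / 4 ≤ 1 / (w - ‖γ‖ ^ 2) := by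
    have : 1 / (w - ‖γ‖ ^ 2) - 1 / w = ‖γ‖ ^ 2 / (w * (w - ‖γ‖ ^ 2)) := by field_simp; ring
    have h4 : ‖γ‖ ^ 2 / 4 ≤ ‖γ‖ ^ 2 / (w * (w - ‖γ‖ ^ 2)) := by
      apply div_le_div_of_nonneg_left hγ0 (by positivity)
      nlinarith
    linarith
  have inv2 : ‖F‖ ^ 2 / w + ‖F‖ ^ 2 * ‖γ‖ ^ 2 / 4 ≤ ‖F‖ ^ 2 / (w - ‖γ‖ ^ 2) := by
    have := mul_le_mul_of_nonneg_left inv (sq_nonneg ‖F‖)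
    calc _ = ‖F‖ ^ 2 * (1 / w + ‖γ‖ ^ 2 / 4) := by ring
      _ ≤ _ := this
      _ = _ := by ring
  have r0 : ‖F‖ ^ 2 * (1 + 4 / w) = ‖F‖ ^ 2 + 4 * (‖F‖ ^ 2 / w) := by ring
  have r1 : ‖F1‖ ^ 2 * (1 + 4 / (2 - ‖β1 - 1‖ ^ 2)) = ‖F1‖ ^ 2 + 4 * (‖F1‖ ^ 2 / (2 - ‖β1 - 1‖ ^ 2)) := by ring
  have r2 : ‖F2‖ ^ 2 * (1 + 4 / (2 - ‖β2 - 1‖ ^ 2)) = ‖F2‖ ^ 2 + 4 * (‖F2‖ ^ 2 / (2 - ‖β2 - 1‖ ^ 2)) := by ring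
  rw [r0, r1, r2]
  have : 0 ≤ ‖F‖ ^ 2 * ‖γ‖ ^ 2 := by positivity
  have : 0 ≤ ‖G‖ ^ 2 := by positivity
  linarith

lemma Bel_nonneg_le {F β : ℂ} (h1 : ‖β - 1‖ ≤ 1 / 4) : ‖F‖ ^ 2 ≤ Bel F β ∧ Bel F β ≤ 5 * ‖F‖ ^ 2 := by
  unfold Bel
  have sq1 : ‖β - 1‖ ^ 2 ≤ 1 / 16 := by nlinarith [norm_nonneg (β - 1)]
  have h2 : 0 ≤ 4 / (2 - ‖β - 1‖ ^ 2) := div_nonneg (by norm_num) (by linarith)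
  have h3 : 4 / (2 - ‖β - 1‖ ^ 2) ≤ 4 := by
    rw [div_le_iff₀ (by linarith)]; linarith
  constructor <;> nlinarith [sq_nonneg ‖F‖]

lemma cs_int {a h : ℝ} (hh : 0 < h) {g : ℝ → ℂ} (hg : Continuous g) :
    ‖∫ x in a..(a + h), g x‖ ^ 2 ≤ h * ∫ x in a..(a + h), ‖g x‖ ^ 2 := by
  have hle : a ≤ a + h := by linarith
  set A := ∫ x in a..(a + h), ‖g x‖ with hA
  have h1 : ‖∫ x in a..(a + h), g x‖ ≤ A := intervalIntegral.norm_integral_le_integral_norm hle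
  have hgn := hg.norm
  have h2 : ∫ x in a..(a + h), (2 * (A / h) * ‖g x‖ - (A / h) ^ 2) ≤ ∫ x in a..(a + h), ‖g x‖ ^ 2 := by
    refine intervalIntegral.integral_mono_on hle (Continuous.intervalIntegrable (by fun_prop) _ _)
      (Continuous.intervalIntegrable (by fun_prop) _ _) fun x _ => ?_
    nlinarith [sq_nonneg (‖g x‖ - A / h)]
  rw [intervalIntegral.integral_sub (Continuous.intervalIntegrable (by fun_prop) _ _) intervalIntegrable_const,
    intervalIntegral.integral_const_mul, ← hA] at h2
  simp only [intervalIntegral.integral_const, add_sub_cancel_left, smul_eq_mul] at h2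
  have e : 2 * (A / h) * A - h * (A / h) ^ 2 = A ^ 2 / h := by field_simp; ring
  rw [e, div_le_iff₀ hh] at h2
  calc _ ≤ A ^ 2 := by gcongr
    _ ≤ _ := by linarith

lemma Bessel (hc : Crv z b) (u : ℝ) {L : ℝ} (hL : 0 < L) {f : ℝ → ℂ} (hf : Continuous f) (N : ℕ) :
    ∑ k ∈ Finset.range (N + 1), XX L k (cc (mm b u L f) k) ≤ 80 * ∫ x in u..(u + L), ‖f x‖ ^ 2 := by
  set F : ℕ → ℕ → ℂ := fun k j => DIn u L (fun x => f x * b x) k j / (L / 2 ^ k : ℝ) with hF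
  set β : ℕ → ℕ → ℂ := fun k j => DIn u L b k j / (L / 2 ^ k : ℝ) with hβ
  have hfb : Continuous fun x => f x * b x := hf.mul hc.cont
  have hh : ∀ k : ℕ, (0 : ℝ) < L / 2 ^ k := fun k => by positivity
  have hhC : ∀ k : ℕ, ((L / 2 ^ k : ℝ) : ℂ) ≠ 0 := fun k => by exact_mod_cast (hh k).ne'
  have hb1 : ∀ k j, ‖β k j - 1‖ ≤ 1 / 4 := by
    intro k j
    have := DIn_b hc u hL k j
    have e : β k j - 1 = (DIn u L b k j - (L / 2 ^ k : ℝ)) / (L / 2 ^ k : ℝ) := by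
      simp only [hβ]; rw [sub_div, div_self (hhC k)]
    rw [e, norm_div, Complex.norm_real, Real.norm_of_nonneg (hh k).le, div_le_iff₀ (hh k)]
    exact this
  have hm : ∀ k j, mm b u L f k j = F k j / β k j := by
    intro k j
    simp only [mm, hF, hβ]
    rw [div_div_div_cancel_right₀ (hhC k)]
  have half : ∀ (φ : ℝ → ℂ) (_ : Continuous φ) (k j : ℕ), DIn u L φ k j / (L / 2 ^ k : ℝ) =
      (DIn u L φ (k + 1) (2 * j) / (L / 2 ^ (k + 1) : ℝ) + DIn u L φ (k + 1) (2 * j + 1) / (L / 2 ^ (k + 1) : ℝ)) / 2 := by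
    intro φ hφ k j
    rw [DIn_split u L hφ]
    have := hhC k
    have e : ((L / 2 ^ (k + 1) : ℝ) : ℂ) = ((L / 2 ^ k : ℝ) : ℂ) / 2 := by push_cast; rw [pow_succ]; field_simp
    rw [e]; field_simp
  set Ψ : ℕ → ℝ := fun k => L / 2 ^ k * ∑ j ∈ Finset.range (2 ^ k), Bel (F k j) (β k j) with hΨ
  have main : ∀ N, ∑ k ∈ Finset.range (N + 1), XX L k (cc (mm b u L f) k) ≤ 10 * Ψ N := by
    intro N
    induction N with
    | zero =>
      simp only [hΨ, XX, zero_add, Finset.range_one, Finset.sum_singleton, pow_zero, cc]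
      rw [hm]
      have h1 := (Bel_nonneg_le (F := F 0 0) (hb1 0 0)).1
      have h2 := quot_bd (F := 0) (G := F 0 0) (β := β 0 0) (γ := 0) (β1 := β 0 0)
        (by
          have := norm_sub_norm_le (1 : ℂ) (1 - β 0 0)
          rw [show (1 : ℂ) - (1 - β 0 0) = β 0 0 by ring, norm_sub_rev 1 (β 0 0), norm_one] at this
          linarith [hb1 0 0]) (by
          have := norm_sub_norm_le (1 : ℂ) (1 - β 0 0)
          rw [show (1 : ℂ) - (1 - β 0 0) = β 0 0 by ring, norm_sub_rev 1 (β 0 0), norm_one] at this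
          linarith [hb1 0 0]) (by ring)
      simp at h2
      rw [div_one, norm_div]
      have h3 : (‖F 0 0‖ / ‖β 0 0‖) ^ 2 ≤ 10 * Bel (F 0 0) (β 0 0) := by linarith [sq_nonneg ‖F 0 0‖]
      have := mul_le_mul_of_nonneg_left h3 hL.le
      linarith
    | succ N ih =>
      rw [Finset.sum_range_succ]
      have step : XX L (N + 1) (cc (mm b u L f) (N + 1)) ≤ 10 * (Ψ (N + 1) - Ψ N) := by
        simp only [hΨ, XX]
        rw [show 2 ^ (N + 1) = 2 * 2 ^ N by ring, sum_pairs, sum_pairs]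
        have e : (L / 2 ^ N : ℝ) = 2 * (L / 2 ^ (N + 1)) := by rw [pow_succ]; field_simp
        have e' : L / (2 * 2 ^ N) = L / 2 ^ (N + 1) := by rw [pow_succ]; ring
        rw [e, mul_assoc 2, Finset.mul_sum, Finset.mul_sum, Finset.mul_sum, Finset.mul_sum, ← Finset.sum_sub_distrib,
          Finset.mul_sum]
        refine Finset.sum_le_sum fun j _ => ?_
        have := Bel_local (hb1 (N + 1) (2 * j)) (hb1 (N + 1) (2 * j + 1)) (half _ hfb N j) (half _ hc.cont N j)
        simp only [cc]
        rw [show 2 * j / 2 = j by omega, show (2 * j + 1) / 2 = j by omega]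
        simp only [hm]
        change Bel (F N j) (β N j) + 1 / 20 * (‖F (N + 1) (2 * j) / β (N + 1) (2 * j) - F N j / β N j‖ ^ 2 +
          ‖F (N + 1) (2 * j + 1) / β (N + 1) (2 * j + 1) - F N j / β N j‖ ^ 2) ≤ _ at this
        have h0 := hh (N + 1)
        set h := L / 2 ^ (N + 1)
        have h5 : (‖F (N + 1) (2 * j) / β (N + 1) (2 * j) - F N j / β N j‖ ^ 2 +
          ‖F (N + 1) (2 * j + 1) / β (N + 1) (2 * j + 1) - F N j / β N j‖ ^ 2) ≤
          10 * ((Bel (F (N + 1) (2 * j)) (β (N + 1) (2 * j)) + Bel (F (N + 1) (2 * j + 1)) (β (N + 1) (2 * j + 1)))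
            - 2 * Bel (F N j) (β N j)) := by linarith
        have := mul_le_mul_of_nonneg_left h5 h0.le
        linarith
      linarith
  refine (main N).trans ?_
  have hΨN : Ψ N ≤ 5 * (25 / 16) * ∫ x in u..(u + L), ‖f x‖ ^ 2 := by
    have hsum : ∑ j ∈ Finset.range (2 ^ N), ∫ x in (gp u L N j)..(gp u L N j + L / 2 ^ N), ‖f x‖ ^ 2 =
        ∫ x in u..(u + L), ‖f x‖ ^ 2 := by
      have hc2 : Continuous fun x => ‖f x‖ ^ 2 := by fun_prop
      simp only [gp_add]
      rw [intervalIntegral.sum_integral_adjacent_intervals (fun j _ => hc2.intervalIntegrable _ _)]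
      congr 1
      · simp [gp]
      · simp [gp]; field_simp
    rw [← hsum, Finset.mul_sum]
    simp only [hΨ]
    rw [Finset.mul_sum]
    refine Finset.sum_le_sum fun j _ => ?_
    have h1 := (Bel_nonneg_le (F := F N j) (hb1 N j)).2
    have h2 := cs_int (a := gp u L N j) (hh N) hfb
    have h3 : ∫ x in (gp u L N j)..(gp u L N j + L / 2 ^ N), ‖f x * b x‖ ^ 2 ≤
        25 / 16 * ∫ x in (gp u L N j)..(gp u L N j + L / 2 ^ N), ‖f x‖ ^ 2 := by
      rw [← intervalIntegral.integral_const_mul]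
      refine intervalIntegral.integral_mono_on (by linarith [hh N]) (Continuous.intervalIntegrable (by fun_prop) _ _)
        (Continuous.intervalIntegrable (by fun_prop) _ _) fun x _ => ?_
      rw [norm_mul, mul_pow]
      have := hc.norm_le x
      have : ‖b x‖ ^ 2 ≤ 25 / 16 := by nlinarith [norm_nonneg (b x)]
      nlinarith [sq_nonneg ‖f x‖]
    have h4 : ‖F N j‖ ^ 2 = ‖DIn u L (fun x => f x * b x) N j‖ ^ 2 / (L / 2 ^ N) ^ 2 := by
      simp only [hF]
      rw [norm_div, Complex.norm_real, Real.norm_of_nonneg (hh N).le, div_pow]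
    have h0 := hh N
    set h := L / 2 ^ N
    calc h * Bel (F N j) (β N j) ≤ h * (5 * ‖F N j‖ ^ 2) := by gcongr
      _ = 5 * (‖DIn u L (fun x => f x * b x) N j‖ ^ 2 / h) := by rw [h4]; field_simp
      _ ≤ 5 * ∫ x in (gp u L N j)..(gp u L N j + h), ‖f x * b x‖ ^ 2 := by
          gcongr
          rw [div_le_iff₀ h0, mul_comm]
          exact h2
      _ ≤ _ := by linarith
  have : 0 ≤ ∫ x in u..(u + L), ‖f x‖ ^ 2 :=
    intervalIntegral.integral_nonneg (by linarith) fun x _ => by positivity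
  linarith

end
end CC

namespace CC
noncomputable section
open MeasureTheory Filter Set Metric Topology
open scoped ENNReal BigOperators ComplexConjugate

variable {z b : ℝ → ℂ}

lemma mm_close (hc : Crv z b) (u : ℝ) {L : ℝ} (hL : 0 < L) {f : ℝ → ℂ} (hf : Continuous f) (k j : ℕ) {δ : ℝ}
    (hδ : ∀ x ∈ Icc (gp u L k j) (gp u L k j + L / 2 ^ k), ∀ y ∈ Icc (gp u L k j) (gp u L k j + L / 2 ^ k), ‖f x - f y‖ ≤ δ)
    (x : ℝ) (hx : x ∈ Icc (gp u L k j) (gp u L k j + L / 2 ^ k)) : ‖f x - mm b u L f k j‖ ≤ 2 * δ := by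
  have hh : 0 < L / 2 ^ k := by positivity
  have hδ0 : 0 ≤ δ := (norm_nonneg _).trans (hδ x hx x hx)
  have n0 := DIn_b_ne hc u hL k j
  have hb := hc.cont
  have e : f x - mm b u L f k j = (∫ y in (gp u L k j)..(gp u L k j + L / 2 ^ k), (f x - f y) * b y) / DIn u L b k j := by
    simp_rw [sub_mul]
    rw [intervalIntegral.integral_sub (Continuous.intervalIntegrable (by fun_prop) _ _)
      (Continuous.intervalIntegrable (by fun_prop) _ _), intervalIntegral.integral_const_mul, sub_div]
    change _ = f x * DIn u L b k j / _ - _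
    rw [mul_div_cancel_right₀ _ n0]
    rfl
  have lo : 3 / 4 * (L / 2 ^ k) ≤ ‖DIn u L b k j‖ := by
    have h1 := DIn_b hc u hL k j
    have := norm_sub_norm_le ((L / 2 ^ k : ℝ) : ℂ) ((L / 2 ^ k : ℝ) - DIn u L b k j)
    rw [sub_sub_cancel, norm_sub_rev _ (DIn u L b k j), Complex.norm_real, Real.norm_of_nonneg hh.le] at this
    linarith
  have up : ‖∫ y in (gp u L k j)..(gp u L k j + L / 2 ^ k), (f x - f y) * b y‖ ≤ δ * (5 / 4) * (L / 2 ^ k) := by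
    have := intervalIntegral.norm_integral_le_of_norm_le_const (a := gp u L k j) (b := gp u L k j + L / 2 ^ k)
      (f := fun y => (f x - f y) * b y) (C := δ * (5 / 4)) (fun y hy => by
        rw [uIoc_of_le (by linarith)] at hy
        rw [norm_mul]
        exact mul_le_mul (hδ x hx y ⟨hy.1.le, hy.2⟩) (hc.norm_le y) (norm_nonneg _) hδ0)
    rwa [add_sub_cancel_left, abs_of_pos hh] at this
  rw [e, norm_div, div_le_iff₀ (by linarith)]
  nlinarith

lemma gp_mem {u L : ℝ} (hL : 0 < L) {k j : ℕ} (hj : j < 2 ^ k) :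
    Icc (gp u L k j) (gp u L k j + L / 2 ^ k) ⊆ Icc u (u + L) := by
  have hh : 0 < L / 2 ^ k := by positivity
  intro x hx
  have h1 : ((j : ℝ) + 1) ≤ 2 ^ k := by exact_mod_cast hj
  have h2 : ((j : ℝ) + 1) * (L / 2 ^ k) ≤ L := by
    calc _ ≤ 2 ^ k * (L / 2 ^ k) := by gcongr
      _ = L := by field_simp
  have h3 : 0 ≤ (j : ℝ) * (L / 2 ^ k) := by positivity
  unfold gp at hx
  constructor
  · linarith [hx.1]
  · nlinarith [hx.2]

lemma DIn_norm_le {u L : ℝ} (hL : 0 < L) {k j : ℕ} {φ : ℝ → ℂ} {C : ℝ}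
    (h : ∀ x ∈ Icc (gp u L k j) (gp u L k j + L / 2 ^ k), ‖φ x‖ ≤ C) : ‖DIn u L φ k j‖ ≤ C * (L / 2 ^ k) := by
  have hh : 0 < L / 2 ^ k := by positivity
  have := intervalIntegral.norm_integral_le_of_norm_le_const (a := gp u L k j) (b := gp u L k j + L / 2 ^ k)
      (f := φ) (C := C) (fun y hy => by
        rw [uIoc_of_le (by linarith)] at hy
        exact h y ⟨hy.1.le, hy.2⟩)
  rwa [add_sub_cancel_left, abs_of_pos hh] at this

lemma small_osc {u L : ℝ} (hL : 0 < L) {f : ℝ → ℂ} (hf : Continuous f) {δ : ℝ} (hδ : 0 < δ) :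
    ∃ N0, ∀ N ≥ N0, ∀ j < 2 ^ N, ∀ x ∈ Icc (gp u L N j) (gp u L N j + L / 2 ^ N),
      ∀ y ∈ Icc (gp u L N j) (gp u L N j + L / 2 ^ N), ‖f x - f y‖ ≤ δ := by
  have huc := isCompact_Icc.uniformContinuousOn_of_continuous (s := Icc u (u + L)) hf.continuousOn
  rw [Metric.uniformContinuousOn_iff] at huc
  obtain ⟨ε, hε, h⟩ := huc δ hδ
  obtain ⟨N0, hN0⟩ := exists_pow_lt_of_lt_one (show 0 < ε / L by positivity) (show (1 / 2 : ℝ) < 1 by norm_num)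
  refine ⟨N0, fun N hN j hj x hx y hy => ?_⟩
  rw [← dist_eq_norm]
  refine (h x (gp_mem hL hj hx) y (gp_mem hL hj hy) ?_).le
  have h1 : L / 2 ^ N < ε := by
    have : (1 / 2 : ℝ) ^ N ≤ (1 / 2 : ℝ) ^ N0 := pow_le_pow_of_le_one (by norm_num) (by norm_num) hN
    calc L / 2 ^ N = (1 / 2) ^ N * L := by rw [div_pow, one_pow]; ring
      _ < ε / L * L := by nlinarith
      _ = ε := by field_simp
  refine lt_of_le_of_lt ?_ h1
  rw [Real.dist_eq, abs_le]
  constructor <;> linarith [hx.1, hx.2, hy.1, hy.2]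

def Lam (z b : ℝ → ℂ) (s u L : ℝ) (f g : ℝ → ℂ) : ℂ :=
  ∫ x in u..(u + L), g x * ∫ y in u..(u + L), f y * (b x * b y / DD z s x y)

lemma Lam_approx (hc : Crv z b) {s : ℝ} (hs : 0 < s) (u : ℝ) {L : ℝ} (hL : 0 < L) {f g : ℝ → ℂ}
    (hf : Continuous f) (hg : Continuous g) {η : ℝ} (hη : 0 < η) :
    ∃ N, ‖Lam z b s u L f g - BB z b s u L N N (mm b u L f N) (mm b u L g N)‖ ≤ η := by
  have hK := hc.contK hs
  have hb := hc.cont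
  obtain ⟨Bf, hBf⟩ := isCompact_Icc.exists_bound_of_continuousOn (s := Icc u (u + L)) hf.continuousOn
  obtain ⟨Bg, hBg⟩ := isCompact_Icc.exists_bound_of_continuousOn (s := Icc u (u + L)) hg.continuousOn
  set B := max 0 (max Bf Bg) with hB
  have hB0 : 0 ≤ B := le_max_left _ _
  have hBf' : ∀ x ∈ Icc u (u + L), ‖f x‖ ≤ B := fun x hx => (hBf x hx).trans ((le_max_left _ _).trans (le_max_right _ _))
  have hBg' : ∀ x ∈ Icc u (u + L), ‖g x‖ ≤ B := fun x hx => (hBg x hx).trans ((le_max_right _ _).trans (le_max_right _ _))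
  set C0 := 25 / 4 / s with hC0
  have hC0' : 0 < C0 := by positivity
  have hKb : ∀ x y, ‖b x * b y / DD z s x y‖ ≤ C0 := by
    intro x y
    have h1 := hc.D_lower hs.le x y
    have h2 := hc.norm_le x
    have h3 := hc.norm_le y
    rw [norm_div, norm_mul]
    calc _ ≤ (5 / 4) * (5 / 4) / (s / 4) := by
          have : s / 4 ≤ ‖DD z s x y‖ := le_trans (by linarith [abs_nonneg (x - y)]) h1
          gcongr
      _ = C0 := by rw [hC0]; field_simp; norm_num
  set δ := min 1 (η / ((4 * B + 4) * C0 * L ^ 2)) with hδ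
  have hδ0 : 0 < δ := by rw [hδ]; positivity
  obtain ⟨N1, h1⟩ := small_osc (u := u) hL hf hδ0
  obtain ⟨N2, h2⟩ := small_osc (u := u) hL hg hδ0
  set N := max N1 N2
  refine ⟨N, ?_⟩
  have hh : 0 < L / 2 ^ N := by positivity
  have e1 : ∀ x, ∫ y in u..(u + L), f y * (b x * b y / DD z s x y) =
      ∑ i ∈ Finset.range (2 ^ N), DIn u L (fun y => f y * (b x * b y / DD z s x y)) N i := by
    intro x
    rw [DIn_sum]
    exact hf.mul (hK.comp (by fun_prop : Continuous fun y : ℝ => (x, y)))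
  have hKf : Continuous fun q : ℝ × ℝ => f q.2 * (b q.1 * b q.2 / DD z s q.1 q.2) :=
    (hf.comp continuous_snd).mul hK
  have cD : ∀ i, Continuous fun x => DIn u L (fun y => f y * (b x * b y / DD z s x y)) N i := fun i =>
    contDIn u L hKf N i
  have e2 : Lam z b s u L f g = ∑ j ∈ Finset.range (2 ^ N), ∑ i ∈ Finset.range (2 ^ N),
      DIn u L (fun x => g x * DIn u L (fun y => f y * (b x * b y / DD z s x y)) N i) N j := by
    unfold Lam
    simp_rw [e1, Finset.mul_sum]
    have hi : ∀ i ∈ Finset.range (2 ^ N), IntervalIntegrable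
        (fun x => g x * DIn u L (fun y => f y * (b x * b y / DD z s x y)) N i) volume u (u + L) := fun i _ =>
      (hg.mul (cD i)).intervalIntegrable _ _
    rw [intervalIntegral.integral_finsetSum hi, Finset.sum_comm]
    refine Finset.sum_congr rfl fun i _ => ?_
    exact (DIn_sum u L (hg.mul (cD i)) N).symm
  rw [e2]
  unfold BB
  simp_rw [Finset.mul_sum]
  rw [← Finset.sum_sub_distrib]
  simp_rw [← Finset.sum_sub_distrib]
  have term : ∀ j ∈ Finset.range (2 ^ N), ∀ i ∈ Finset.range (2 ^ N),
      ‖DIn u L (fun x => g x * DIn u L (fun y => f y * (b x * b y / DD z s x y)) N i) N j -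
        mm b u L g N j * (mm b u L f N i * QQ z b s u L N i N j)‖ ≤ δ * (4 * B + 4) * C0 * (L / 2 ^ N) * (L / 2 ^ N) := by
    intro j hj i hi
    rw [Finset.mem_range] at hj hi
    set mi := mm b u L f N i
    set nj := mm b u L g N j
    have e3 : DIn u L (fun x => g x * DIn u L (fun y => f y * (b x * b y / DD z s x y)) N i) N j -
        nj * (mi * QQ z b s u L N i N j) =
        DIn u L (fun x => DIn u L (fun y => (g x * f y - nj * mi) * (b x * b y / DD z s x y)) N i) N j := by
      have cy : ∀ x, Continuous fun y => b x * b y / DD z s x y := fun x =>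
        hK.comp (by fun_prop : Continuous fun y : ℝ => (x, y))
      have e4 : ∀ x, DIn u L (fun y => (g x * f y - nj * mi) * (b x * b y / DD z s x y)) N i =
          g x * DIn u L (fun y => f y * (b x * b y / DD z s x y)) N i -
          nj * mi * DIn u L (fun y => b x * b y / DD z s x y) N i := by
        intro x
        unfold DIn
        rw [← intervalIntegral.integral_const_mul, ← intervalIntegral.integral_const_mul, ← intervalIntegral.integral_sub]
        · exact intervalIntegral.integral_congr fun y _ => by ring
        · exact (continuous_const.mul (hf.mul (cy x))).intervalIntegrable _ _
        · exact (continuous_const.mul (cy x)).intervalIntegrable _ _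
      simp_rw [e4]
      conv_rhs => unfold DIn
      rw [intervalIntegral.integral_sub, intervalIntegral.integral_const_mul, ← mul_assoc]
      · rfl
      · exact (hg.mul (cD i)).intervalIntegrable _ _
      · exact (continuous_const.mul (contDIn u L hK N i)).intervalIntegrable _ _
    rw [e3]
    refine DIn_norm_le hL fun x hx => DIn_norm_le hL fun y hy => ?_
    rw [norm_mul]
    refine mul_le_mul ?_ (hKb x y) (norm_nonneg _) (by positivity)
    have c1 := mm_close hc u hL hf N i (h1 N (le_max_left _ _) i hi) y hy
    have c2 := mm_close hc u hL hg N j (h2 N (le_max_right _ _) j hj) x hx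
    have b1 := hBf' y (gp_mem hL hi hy)
    have b2 := hBg' x (gp_mem hL hj hx)
    have b3 : ‖mi‖ ≤ B + 2 := by
      have := norm_sub_norm_le mi (f y)
      rw [norm_sub_rev] at this
      have : δ ≤ 1 := min_le_left _ _
      linarith
    rw [show g x * f y - nj * mi = g x * (f y - mi) + (g x - nj) * mi by ring]
    refine (norm_add_le _ _).trans ?_
    rw [norm_mul, norm_mul]
    calc _ ≤ B * (2 * δ) + (2 * δ) * (B + 2) := by gcongr
      _ = _ := by ring
  refine (norm_sum_le _ _).trans ((Finset.sum_le_sum fun j hj => (norm_sum_le _ _).trans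
    (Finset.sum_le_sum fun i hi => term j hj i hi)).trans ?_)
  simp only [Finset.sum_const, Finset.card_range, nsmul_eq_mul]
  have hδ2 : δ ≤ η / ((4 * B + 4) * C0 * L ^ 2) := min_le_right _ _
  push_cast
  calc _ = δ * ((4 * B + 4) * C0 * L ^ 2) := by field_simp
    _ ≤ η / ((4 * B + 4) * C0 * L ^ 2) * ((4 * B + 4) * C0 * L ^ 2) := by gcongr
    _ = η := by field_simp

def C1 : ℝ := 1920 * SW * SR * 80 + 1

lemma C1_ge : 1 ≤ C1 := by
  have h1 := SW_nonneg; have h2 := SR_nonneg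
  have : 0 ≤ 1920 * SW * SR * 80 := by positivity
  unfold C1; linarith

lemma Lam_bound (hc : Crv z b) {s : ℝ} (hs : 0 < s) (u : ℝ) {L : ℝ} (hL : 0 < L) {f g : ℝ → ℂ}
    (hf : Continuous f) (hg : Continuous g) :
    ‖Lam z b s u L f g‖ ≤ C1 * ((∫ x in u..(u + L), ‖f x‖ ^ 2) + ∫ x in u..(u + L), ‖g x‖ ^ 2) := by
  refine le_of_forall_pos_le_add fun η hη => ?_
  obtain ⟨N, hN⟩ := Lam_approx hc hs u hL hf hg hη
  have h1 := BB_total hc hs u hL (mm b u L f) (mm b u L g) (Can_mm hc u hL hf) (Can_mm hc u hL hg) N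
  have h2 := Bessel hc u hL hf N
  have h3 := Bessel hc u hL hg N
  have h4 := norm_sub_norm_le (Lam z b s u L f g) (BB z b s u L N N (mm b u L f N) (mm b u L g N))
  have hp : 0 ≤ 1920 * SW * SR := by have h1 := SW_nonneg; have h2 := SR_nonneg; positivity
  have i1 : 0 ≤ ∫ x in u..(u + L), ‖f x‖ ^ 2 := intervalIntegral.integral_nonneg (by linarith) fun x _ => by positivity
  have i2 : 0 ≤ ∫ x in u..(u + L), ‖g x‖ ^ 2 := intervalIntegral.integral_nonneg (by linarith) fun x _ => by positivity
  have := mul_le_mul_of_nonneg_left (add_le_add h2 h3) hp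
  unfold C1
  linarith

lemma L2_interval (hc : Crv z b) {s : ℝ} (hs : 0 < s) (u : ℝ) {L : ℝ} (hL : 0 < L) {f : ℝ → ℂ} (hf : Continuous f) :
    ∫ x in u..(u + L), ‖∫ y in u..(u + L), f y * b y / DD z s x y‖ ^ 2 ≤ 8 * C1 ^ 2 * ∫ x in u..(u + L), ‖f x‖ ^ 2 := by
  have hb := hc.cont
  have hb0 : ∀ x, b x ≠ 0 := fun x h => by
    have := hc.le_norm x
    rw [h] at this; norm_num at this
  set T : ℝ → ℂ := fun x => ∫ y in u..(u + L), f y * b y / DD z s x y with hT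
  have cT : Continuous T := by
    refine intervalIntegral.continuous_parametric_intervalIntegral_of_continuous' (f := fun x y => f y * b y / DD z s x y) ?_ _ _
    exact Continuous.div (f := fun q : ℝ × ℝ => f q.2 * b q.2) (by fun_prop) (hc.contD s) (fun q => hc.D_ne hs _ _)
  have h1 := C1_ge
  set θ := 1 / (4 * C1) with hθ
  have hθ0 : 0 < θ := by positivity
  set g : ℝ → ℂ := fun x => θ * (conj (T x) / b x) with hg
  have cg : Continuous g := continuous_const.mul ((Complex.continuous_conj.comp cT).div hb hb0)
  have key := Lam_bound hc hs u hL hf cg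
  have e : Lam z b s u L f g = ((θ * ∫ x in u..(u + L), ‖T x‖ ^ 2 : ℝ) : ℂ) := by
    unfold Lam
    rw [Complex.ofReal_mul, ← intervalIntegral.integral_ofReal, ← intervalIntegral.integral_const_mul]
    refine intervalIntegral.integral_congr fun x _ => ?_
    have e1 : ∫ y in u..(u + L), f y * (b x * b y / DD z s x y) = b x * T x := by
      simp only [hT]
      rw [← intervalIntegral.integral_const_mul]
      exact intervalIntegral.integral_congr fun y _ => by ring
    simp only [e1, hg]
    have := hb0 x
    rw [show (θ : ℂ) * (conj (T x) / b x) * (b x * T x) = θ * (T x * conj (T x)) by field_simp, Complex.mul_conj,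
      Complex.normSq_eq_norm_sq]
  have i1 : 0 ≤ ∫ x in u..(u + L), ‖f x‖ ^ 2 := intervalIntegral.integral_nonneg (by linarith) fun x _ => by positivity
  have i2 : 0 ≤ ∫ x in u..(u + L), ‖T x‖ ^ 2 := intervalIntegral.integral_nonneg (by linarith) fun x _ => by positivity
  have i3 : ∫ x in u..(u + L), ‖g x‖ ^ 2 ≤ θ ^ 2 * (16 / 9) * ∫ x in u..(u + L), ‖T x‖ ^ 2 := by
    rw [← intervalIntegral.integral_const_mul]
    refine intervalIntegral.integral_mono_on (by linarith) (Continuous.intervalIntegrable (by fun_prop) _ _)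
        (Continuous.intervalIntegrable (by fun_prop) _ _) fun x _ => ?_
    simp only [hg]
    rw [norm_mul, norm_div, Complex.norm_conj, Complex.norm_real, Real.norm_of_nonneg hθ0.le, mul_pow, mul_assoc]
    gcongr
    have := hc.le_norm x
    have hbp : 0 < ‖b x‖ := by linarith
    rw [div_pow, div_le_iff₀ (by positivity)]
    have : 9 / 16 ≤ ‖b x‖ ^ 2 := by nlinarith
    nlinarith [sq_nonneg ‖T x‖]
  rw [e, Complex.norm_real, Real.norm_of_nonneg (by positivity)] at key
  set I := ∫ x in u..(u + L), ‖T x‖ ^ 2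
  set J := ∫ x in u..(u + L), ‖f x‖ ^ 2
  have k2 : θ * I ≤ C1 * (J + θ ^ 2 * (16 / 9) * I) := key.trans (by gcongr)
  have k3 : C1 * θ ^ 2 = θ / 4 := by rw [hθ]; field_simp
  have k4 : θ * (5 / 9) * I ≤ C1 * J := by nlinarith
  have k5 : θ * C1 = 1 / 4 := by rw [hθ]; field_simp
  have k6 := mul_le_mul_of_nonneg_left k4 (show 0 ≤ C1 by linarith)
  nlinarith [mul_nonneg (mul_nonneg (show 0 ≤ C1 by linarith) (show 0 ≤ C1 by linarith)) i1]

/-- regularized Cauchy integral -/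
def TT (z b : ℝ → ℂ) (s : ℝ) (f : ℝ → ℂ) (x : ℝ) : ℂ := ∫ y, f y * b y / DD z s x y

lemma ofReal_pow_norm (w : ℂ) (n : ℕ) : ENNReal.ofReal (‖w‖ ^ n) = ‖w‖ₑ ^ n := by
  rw [ENNReal.ofReal_pow (norm_nonneg _), ofReal_norm]

lemma supp_bd {f : ℝ → ℂ} (hfs : HasCompactSupport f) : ∃ M : ℝ, 0 < M ∧ ∀ x, M ≤ |x| → f x = 0 := by
  obtain ⟨M, hM⟩ := hfs.isCompact.isBounded.subset_closedBall 0
  refine ⟨|M| + 1, by positivity, fun x hx => ?_⟩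
  by_contra h
  have := hM (subset_tsupport f h)
  rw [mem_closedBall, Real.dist_eq, sub_zero] at this
  linarith [le_abs_self M]

lemma TT_eq {s : ℝ} {f : ℝ → ℂ} {R : ℝ} (hM : ∀ x, R ≤ |x| → f x = 0) (hR : 0 < R) (x : ℝ) :
    ∫ y in (-R)..R, f y * b y / DD z s x y = TT z b s f x := by
  rw [intervalIntegral.integral_of_le (by linarith)]
  refine setIntegral_eq_integral_of_forall_compl_eq_zero fun y hy => ?_
  rw [hM y, zero_mul, zero_div]
  by_contra hcon
  push Not at hcon
  have h3 := abs_lt.1 hcon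
  exact hy ⟨by linarith, by linarith⟩

lemma contTT (hc : Crv z b) {s : ℝ} (hs : 0 < s) {f : ℝ → ℂ} (hf : Continuous f) (hfs : HasCompactSupport f) :
    Continuous fun x => TT z b s f x := by
  have hb := hc.cont
  obtain ⟨R, hR, hM⟩ := supp_bd hfs
  simp_rw [← TT_eq hM hR]
  refine intervalIntegral.continuous_parametric_intervalIntegral_of_continuous' (f := fun x y => f y * b y / DD z s x y) ?_ _ _
  exact Continuous.div (f := fun q : ℝ × ℝ => f q.2 * b q.2) (by fun_prop) (hc.contD s) (fun q => hc.D_ne hs _ _)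

theorem TT_L2 (hc : Crv z b) {s : ℝ} (hs : 0 < s) {f : ℝ → ℂ} (hf : Continuous f) (hfs : HasCompactSupport f) :
    ∫⁻ x, ‖TT z b s f x‖ₑ ^ 2 ≤ ENNReal.ofReal (8 * C1 ^ 2) * ∫⁻ x, ‖f x‖ₑ ^ 2 := by
  have hb := hc.cont
  obtain ⟨M, hM0, hM⟩ := supp_bd hfs
  have cT := contTT hc hs hf hfs
  have key : ∀ R : ℝ, M < R → ∫⁻ x in Ioc (-R) R, ‖TT z b s f x‖ₑ ^ 2 ≤
      ENNReal.ofReal (8 * C1 ^ 2) * ∫⁻ x, ‖f x‖ₑ ^ 2 := by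
    intro R hR
    have hR0 : 0 < R := by linarith
    have := L2_interval hc hs (-R) (L := 2 * R) (by linarith) hf
    rw [show -R + 2 * R = R by ring] at this
    simp_rw [TT_eq (fun x hx => hM x (hR.le.trans hx)) hR0] at this
    have conv : ∀ φ : ℝ → ℂ, Continuous φ → ENNReal.ofReal (∫ x in (-R)..R, ‖φ x‖ ^ 2) = ∫⁻ x in Ioc (-R) R, ‖φ x‖ₑ ^ 2 := by
      intro φ hφ
      rw [intervalIntegral.integral_of_le (by linarith), ofReal_integral_eq_lintegral_ofReal]
      · simp_rw [ofReal_pow_norm]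
      · exact (Continuous.intervalIntegrable (by fun_prop : Continuous fun x => ‖φ x‖ ^ 2) (-R) R).1
      · exact Eventually.of_forall fun x => by positivity
    rw [← conv _ cT]
    calc _ ≤ ENNReal.ofReal (8 * C1 ^ 2 * ∫ x in (-R)..R, ‖f x‖ ^ 2) := ENNReal.ofReal_le_ofReal this
      _ = ENNReal.ofReal (8 * C1 ^ 2) * ∫⁻ x in Ioc (-R) R, ‖f x‖ₑ ^ 2 := by
          rw [ENNReal.ofReal_mul (by positivity), conv _ hf]
      _ ≤ _ := by gcongr; exact Measure.restrict_le_self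
  have hcov : AECover volume atTop (fun n : ℕ => Ioc (-(n : ℝ)) n) :=
    aecover_Ioc (tendsto_neg_atTop_atBot.comp tendsto_natCast_atTop_atTop) tendsto_natCast_atTop_atTop
  have cT : AEMeasurable (fun x => ‖TT z b s f x‖ₑ ^ 2) := (cT.measurable.enorm.pow_const 2).aemeasurable
  refine le_of_tendsto (hcov.lintegral_tendsto_of_countably_generated cT) ?_
  filter_upwards [(tendsto_natCast_atTop_atTop (R := ℝ)).eventually_gt_atTop M] with n hn
  exact key n hn

end
end CC

namespace CC
noncomputable section
open MeasureTheory Filter Set Metric Topology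
open scoped ENNReal BigOperators ComplexConjugate

variable {z b : ℝ → ℂ}

def VV (z : ℝ → ℂ) (s : ℝ) (y w : ℝ) : ℂ := (z y - z w) ^ 2 + (s : ℂ) ^ 2

lemma VV_eq (s : ℝ) (y w : ℝ) : VV z s y w = -(DD z s y w * DD z s w y) := by
  unfold VV DD
  linear_combination ((s : ℂ) ^ 2) * Complex.I_sq

lemma VV_symm (s : ℝ) (y w : ℝ) : VV z s y w = VV z s w y := by
  unfold VV; ring

lemma VV_lower (hc : Crv z b) {s : ℝ} (hs : 0 ≤ s) (y w : ℝ) : (|y - w| + s) ^ 2 / 16 ≤ ‖VV z s y w‖ := by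
  rw [VV_eq, norm_neg, norm_mul]
  have h1 := hc.D_lower hs y w
  have h2 := hc.D_lower hs w y
  rw [abs_sub_comm] at h2
  have := mul_le_mul h1 h2 (by positivity) (by positivity)
  linarith

lemma VV_ne (hc : Crv z b) {s : ℝ} (hs : 0 < s) (y w : ℝ) : VV z s y w ≠ 0 := by
  rw [VV_eq, neg_ne_zero]
  exact mul_ne_zero (hc.D_ne hs _ _) (hc.D_ne hs _ _)

def HH (z b : ℝ → ℂ) (s : ℝ) (f : ℝ → ℂ) (y : ℝ) : ℂ := ∫ w, f w * b w * ((z y - z w) / VV z s y w)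

def EE (z b : ℝ → ℂ) (s : ℝ) (f : ℝ → ℂ) (x : ℝ) : ℂ :=
  ∫ y, ∫ w, s ^ 2 * (f y * b y) * (f w * b w) / (DD z s x y * DD z s x w * VV z s y w)

lemma int_supp {f g : ℝ → ℂ} {R : ℝ} (hR : 0 < R) (hM : ∀ x, R ≤ |x| → f x = 0) (hg : ∀ x, f x = 0 → g x = 0) :
    ∫ y, g y = ∫ y in (-R)..R, g y := by
  rw [intervalIntegral.integral_of_le (by linarith)]
  symm
  refine setIntegral_eq_integral_of_forall_compl_eq_zero fun y hy => hg y (hM y ?_)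
  by_contra hcon
  push Not at hcon
  have h3 := abs_lt.1 hcon
  exact hy ⟨by linarith, by linarith⟩

lemma contHH (hc : Crv z b) {s : ℝ} (hs : 0 < s) {f : ℝ → ℂ} (hf : Continuous f) (hfs : HasCompactSupport f) :
    Continuous fun x => HH z b s f x := by
  have hb := hc.cont
  have hz := hc.contz
  obtain ⟨R, hR, hM⟩ := supp_bd hfs
  have : ∀ x, HH z b s f x = ∫ w in (-R)..R, f w * b w * ((z x - z w) / VV z s x w) := fun x =>
    int_supp hR hM fun w hw => by rw [hw]; ring
  simp_rw [this]
  refine intervalIntegral.continuous_parametric_intervalIntegral_of_continuous'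
    (f := fun x w => f w * b w * ((z x - z w) / VV z s x w)) ?_ _ _
  have : Continuous fun q : ℝ × ℝ => VV z s q.1 q.2 := by unfold VV; fun_prop
  exact Continuous.mul (f := fun q : ℝ × ℝ => f q.2 * b q.2) (by fun_prop)
    (Continuous.div (f := fun q : ℝ × ℝ => z q.1 - z q.2) (by fun_prop) this fun q => VV_ne hc hs _ _)

lemma cotlar_id (hc : Crv z b) {s : ℝ} (hs : 0 < s) {f : ℝ → ℂ} (hf : Continuous f) (hfs : HasCompactSupport f) (x : ℝ) :
    TT z b s f x ^ 2 = 2 * TT z b s (fun y => f y * HH z b s f y) x + EE z b s f x := by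
  have hb := hc.cont
  have hz := hc.contz
  have cV : Continuous fun q : ℝ × ℝ => VV z s q.1 q.2 := by unfold VV; fun_prop
  have cD := hc.contD s
  obtain ⟨R, hR, hM⟩ := supp_bd hfs
  set F : ℝ → ℂ := fun y => f y * b y with hF
  have hM' : ∀ x, R ≤ |x| → F x = 0 := fun x hx => by simp [hF, hM x hx]
  have cF : Continuous F := hf.mul hb
  set k : ℝ → ℝ → ℂ := fun y w => F y / DD z s x y * (F w * ((z y - z w) / VV z s y w)) with hk
  set e : ℝ → ℝ → ℂ := fun y w => s ^ 2 * F y * F w / (DD z s x y * DD z s x w * VV z s y w) with he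
  have cDx : Continuous fun y => DD z s x y := cD.comp (by fun_prop : Continuous fun y : ℝ => (x, y))
  have cFD : Continuous fun y => F y / DD z s x y := cF.div cDx fun y => hc.D_ne hs _ _
  have cH : Continuous fun q : ℝ × ℝ => F q.2 * ((z q.1 - z q.2) / VV z s q.1 q.2) :=
    (cF.comp continuous_snd).mul (Continuous.div (f := fun q : ℝ × ℝ => z q.1 - z q.2) (by fun_prop) cV fun q => VV_ne hc hs _ _)
  have ck : Continuous fun q : ℝ × ℝ => k q.1 q.2 := (cFD.comp continuous_fst).mul cH
  have ce : Continuous fun q : ℝ × ℝ => e q.1 q.2 := by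
    refine Continuous.div (by fun_prop) ?_ fun q => mul_ne_zero (mul_ne_zero (hc.D_ne hs _ _) (hc.D_ne hs _ _)) (VV_ne hc hs _ _)
    exact ((cDx.comp continuous_fst).mul (cDx.comp continuous_snd)).mul cV
  have e1 : TT z b s f x = ∫ y in (-R)..R, F y / DD z s x y := (TT_eq hM hR x).symm
  have e2 : TT z b s (fun y => f y * HH z b s f y) x = ∫ y in (-R)..R, ∫ w in (-R)..R, k y w := by
    rw [← TT_eq (fun y hy => by rw [hM y hy, zero_mul]) hR]
    refine intervalIntegral.integral_congr fun y _ => ?_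
    simp only [hk]
    rw [intervalIntegral.integral_const_mul]
    unfold HH
    rw [int_supp hR hM fun w hw => by rw [hw]; ring]
    simp only [hF]
    ring
  have e3 : EE z b s f x = ∫ y in (-R)..R, ∫ w in (-R)..R, e y w := by
    unfold EE
    rw [int_supp hR hM fun y hy => by simp [hy]]
    refine intervalIntegral.integral_congr fun y _ => ?_
    exact int_supp hR hM fun w hw => by simp [hw]
  have e4 : ∫ y in (-R)..R, ∫ w in (-R)..R, k w y = ∫ y in (-R)..R, ∫ w in (-R)..R, k y w := by
    symm
    refine intervalIntegral_intervalIntegral_swap (F := k) ?_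
    have : Function.uncurry k = fun q : ℝ × ℝ => k q.1 q.2 := by ext ⟨x, y⟩; rfl
    rw [this]
    exact (ck.continuousOn.integrableOn_compact (isCompact_uIcc.prod isCompact_uIcc)).mono_set
      (Set.prod_mono uIoc_subset_uIcc uIoc_subset_uIcc)
  have i1 : ∀ {g : ℝ → ℝ → ℂ}, (Continuous fun q : ℝ × ℝ => g q.1 q.2) → ∀ y, IntervalIntegrable (fun w => g y w) volume (-R) R :=
    fun hg y => (hg.comp (by fun_prop : Continuous fun w : ℝ => (y, w))).intervalIntegrable _ _
  have i2 : ∀ {g : ℝ → ℝ → ℂ}, (Continuous fun q : ℝ × ℝ => g q.1 q.2) → IntervalIntegrable (fun y => ∫ w in (-R)..R, g y w) volume (-R) R :=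
    fun {g} hg => (intervalIntegral.continuous_parametric_intervalIntegral_of_continuous' (f := g) hg _ _).intervalIntegrable _ _
  have ck' : Continuous fun q : ℝ × ℝ => k q.2 q.1 := ck.comp continuous_swap
  rw [e2, e3, two_mul]
  nth_rewrite 2 [← e4]
  rw [e1, sq, ← intervalIntegral.integral_mul_const, ← intervalIntegral.integral_add (i2 ck) (i2 (g := fun y w => k w y) ck'),
    ← intervalIntegral.integral_add ((i2 ck).add (i2 (g := fun y w => k w y) ck')) (i2 ce)]
  refine intervalIntegral.integral_congr fun y _ => ?_
  rw [← intervalIntegral.integral_const_mul, ← intervalIntegral.integral_add (i1 ck y) (i1 (g := fun y w => k w y) ck' y),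
    ← intervalIntegral.integral_add ((i1 ck y).add (i1 (g := fun y w => k w y) ck' y)) (i1 ce y)]
  refine intervalIntegral.integral_congr fun w _ => ?_
  simp only [hk, he]
  rw [VV_symm s w y]
  have n1 := hc.D_ne hs x y
  have n2 := hc.D_ne hs x w
  have n3 := VV_ne hc hs y w
  have key : VV z s y w = (z y - z w) * (DD z s x w - DD z s x y) + s ^ 2 := by unfold VV DD; ring
  field_simp
  rw [key]
  ring

end
end CC

namespace CC
noncomputable section
open MeasureTheory Filter Set Metric Topology
open scoped ENNReal BigOperators ComplexConjugate NNReal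

variable {z b : ℝ → ℂ}

lemma HH_le (hc : Crv z b) {s : ℝ} (hs : 0 < s) {f : ℝ → ℂ} (hf : Continuous f) (hfs : HasCompactSupport f) (y : ℝ) :
    ‖HH z b s f y‖ₑ ≤ ‖TT z b s f y‖ₑ + 80 * Mc (fun w => ‖f w‖ₑ) y := by
  have hb := hc.cont
  have hz := hc.contz
  have cV : Continuous fun w => VV z s y w := by unfold VV; fun_prop
  have cD : Continuous fun w => DD z s y w := (hc.contD s).comp (by fun_prop : Continuous fun w : ℝ => (y, w))
  have key : HH z b s f y = TT z b s f y + ∫ w, f w * b w * (s * Complex.I / VV z s y w) := by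
    unfold HH TT
    rw [← integral_add]
    · congr 1; ext w
      have n1 := hc.D_ne hs y w
      have n2 := hc.D_ne hs w y
      have n3 := VV_ne hc hs y w
      have : VV z s y w = DD z s y w * (z y - z w - s * Complex.I) := by
        unfold VV DD; linear_combination ((s : ℂ) ^ 2) * Complex.I_sq
      have n4 : (z y - z w - s * Complex.I) ≠ 0 := fun h => n3 (by rw [this, h, mul_zero])
      rw [this]
      field_simp
      ring
    · refine Continuous.integrable_of_hasCompactSupport ((hf.mul hb).div cD fun w => hc.D_ne hs _ _) ?_
      exact hfs.mono fun w hw h => hw (by simp [h])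
    · refine Continuous.integrable_of_hasCompactSupport ((hf.mul hb).mul (continuous_const.div cV fun w => VV_ne hc hs _ _)) ?_
      exact hfs.mono fun w hw h => hw (by simp [h])
  rw [key]
  refine (enorm_add_le _ _).trans (add_le_add le_rfl ?_)
  refine (enorm_integral_le_lintegral_enorm _).trans ?_
  calc ∫⁻ w, ‖f w * b w * (s * Complex.I / VV z s y w)‖ₑ ≤ ∫⁻ w, 20 * (‖f w‖ₑ * ENNReal.ofReal (s / (|y - w| + s) ^ 2)) := by
        refine lintegral_mono fun w => ?_
        have e20 : (20 : ℝ≥0∞) = ENNReal.ofReal 20 := by norm_num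
        rw [← ofReal_norm, ← ofReal_norm, e20, ← ENNReal.ofReal_mul (norm_nonneg _), ← ENNReal.ofReal_mul (by norm_num)]
        refine ENNReal.ofReal_le_ofReal ?_
        have h1 := VV_lower hc hs.le y w
        have h2 := hc.norm_le w
        have h3 : 0 < |y - w| + s := by positivity
        rw [norm_mul, norm_mul, norm_div, norm_mul, Complex.norm_I, Complex.norm_real, Real.norm_of_nonneg hs.le, mul_one]
        calc _ ≤ ‖f w‖ * (5 / 4) * (s / ((|y - w| + s) ^ 2 / 16)) := by gcongr
          _ = _ := by field_simp; ring
    _ = 20 * ∫⁻ w, ‖f w‖ₑ * ENNReal.ofReal (s / (|y - w| + s) ^ 2) := by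
        rw [lintegral_const_mul]
        have := hf.measurable
        fun_prop
    _ ≤ 20 * (4 * Mc (fun w => ‖f w‖ₑ) y) := by
        gcongr
        exact poisson_le hf.measurable.enorm y hs
    _ = _ := by rw [← mul_assoc]; norm_num

lemma EE_le (hc : Crv z b) {s : ℝ} (hs : 0 < s) {f : ℝ → ℂ} (hf : Continuous f) (x : ℝ) :
    ‖EE z b s f x‖ₑ ≤ 12800 * Mc (fun y => ‖f y‖ₑ * Mc (fun w => ‖f w‖ₑ) y) x + 6400 * Mc (fun w => ‖f w‖ₑ) x ^ 2 := by
  set g : ℝ → ℝ≥0∞ := fun w => ‖f w‖ₑ with hg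
  have mg : Measurable g := hf.measurable.enorm
  have mM := measurable_Mc g
  set p : ℝ → ℝ → ℝ≥0∞ := fun x y => ENNReal.ofReal (s / (|x - y| + s) ^ 2) with hp
  have mp : ∀ x, Measurable (p x) := fun x => by simp only [hp]; fun_prop
  have pt : ∀ y w, ‖(s : ℂ) ^ 2 * (f y * b y) * (f w * b w) / (DD z s x y * DD z s x w * VV z s y w)‖ₑ ≤
      800 * (g y * p x y) * (g w * p y w) + 400 * (g y * p x y) * (g w * p x w) := by
    intro y w
    set A := |x - y| + s
    set B := |x - w| + s
    set G := |y - w| + s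
    have hA : 0 < A := by positivity
    have hB : 0 < B := by positivity
    have hG : 0 < G := by positivity
    have hABG : A ≤ B + G := by
      have := abs_sub_le x w y
      rw [abs_sub_comm w y] at this
      simp only [A, B, G]; linarith
    have r1 : ‖(s : ℂ) ^ 2 * (f y * b y) * (f w * b w) / (DD z s x y * DD z s x w * VV z s y w)‖ ≤
        800 * (‖f y‖ * (s / A ^ 2)) * (‖f w‖ * (s / G ^ 2)) + 400 * (‖f y‖ * (s / A ^ 2)) * (‖f w‖ * (s / B ^ 2)) := by
      have h1 : A / 4 ≤ _ := hc.D_lower hs.le x y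
      have h2 : B / 4 ≤ _ := hc.D_lower hs.le x w
      have h3 : G ^ 2 / 16 ≤ _ := VV_lower hc hs.le y w
      have h4 := hc.norm_le y
      have h5 := hc.norm_le w
      simp only [norm_div, norm_mul, norm_pow, Complex.norm_real, Real.norm_of_nonneg hs.le]
      calc _ ≤ s ^ 2 * (‖f y‖ * (5 / 4)) * (‖f w‖ * (5 / 4)) / (A / 4 * (B / 4) * (G ^ 2 / 16)) := by gcongr
        _ = 400 * s ^ 2 * ‖f y‖ * ‖f w‖ * (A * B) / (A ^ 2 * B ^ 2 * G ^ 2) := by field_simp; ring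
        _ ≤ 400 * s ^ 2 * ‖f y‖ * ‖f w‖ * (2 * B ^ 2 + G ^ 2) / (A ^ 2 * B ^ 2 * G ^ 2) := by
            gcongr; nlinarith [sq_nonneg (B - G)]
        _ = _ := by field_simp; ring
    rw [← ofReal_norm]
    refine (ENNReal.ofReal_le_ofReal r1).trans (le_of_eq ?_)
    rw [ENNReal.ofReal_add (by positivity) (by positivity), ENNReal.ofReal_mul (by positivity), ENNReal.ofReal_mul (by positivity),
      ENNReal.ofReal_mul (by positivity), ENNReal.ofReal_mul (by positivity), ENNReal.ofReal_mul (by positivity),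
      ENNReal.ofReal_mul (by positivity), ENNReal.ofReal_mul (by positivity), ofReal_norm, ofReal_norm]
    norm_num [hg, hp]
    rfl
  unfold EE
  refine (enorm_integral_le_lintegral_enorm _).trans ?_
  have inner : ∀ y, ‖∫ w, (s : ℂ) ^ 2 * (f y * b y) * (f w * b w) / (DD z s x y * DD z s x w * VV z s y w)‖ₑ ≤
      3200 * ((g y * Mc g y) * p x y) + 1600 * Mc g x * (g y * p x y) := by
    intro y
    refine (enorm_integral_le_lintegral_enorm _).trans ((lintegral_mono (pt y)).trans ?_)
    have m1 := mp y
    have m2 := mp x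
    rw [lintegral_add_left (by fun_prop), lintegral_const_mul _ (by fun_prop), lintegral_const_mul _ (by fun_prop)]
    refine (add_le_add (mul_le_mul_right (poisson_le mg y hs) _) (mul_le_mul_right (poisson_le mg x hs) _)).trans (le_of_eq ?_)
    ring
  refine (lintegral_mono inner).trans ?_
  have m2 := mp x
  rw [lintegral_add_left (by fun_prop), lintegral_const_mul _ (by fun_prop), lintegral_const_mul _ (by fun_prop)]
  refine (add_le_add (mul_le_mul_right (poisson_le (mg.mul mM) x hs) _) (mul_le_mul_right (poisson_le mg x hs) _)).trans (le_of_eq ?_)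
  simp only [Pi.mul_def]
  ring

lemma add_pow_le' (u v : ℝ≥0∞) (r : ℕ) : (u + v) ^ r ≤ 2 ^ r * (u ^ r + v ^ r) := by
  rw [mul_add, ← mul_pow, ← mul_pow]
  rcases le_total u v with h | h
  · refine le_add_left ?_
    gcongr
    rw [two_mul]; gcongr
  · refine le_add_right ?_
    gcongr
    rw [two_mul]; gcongr

lemma young_eps {ε : ℝ≥0} (hε : 0 < ε) (u v : ℝ≥0∞) : u * v ≤ ε * v ^ 2 + (ε⁻¹ : ℝ≥0) * u ^ 2 := by
  rcases le_total u (ε * v) with h | h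
  · refine le_add_right ?_
    calc u * v ≤ ε * v * v := by gcongr
      _ = _ := by ring
  · refine le_add_left ?_
    have : v ≤ (ε⁻¹ : ℝ≥0) * u := by
      calc v = (ε⁻¹ : ℝ≥0) * (ε * v) := by
            rw [← mul_assoc, ← ENNReal.coe_mul, inv_mul_cancel₀ hε.ne', ENNReal.coe_one, one_mul]
        _ ≤ _ := by gcongr
    calc u * v ≤ u * ((ε⁻¹ : ℝ≥0) * u) := by gcongr
      _ = _ := by ring

lemma Mc_nat {n : ℕ} (hn : 2 ≤ n) : ∃ c : ℝ≥0, ∀ g : ℝ → ℝ≥0∞, Measurable g → ∫⁻ x, Mc g x ^ n ≤ c * ∫⁻ x, g x ^ n := by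
  refine ⟨Real.toNNReal (10 * (n : ℝ) / ((n : ℝ) - 1) * 2 ^ ((n : ℝ) - 1)), fun g hg => ?_⟩
  have := Mc_strong (p := n) (by exact_mod_cast hn) g hg
  simp only [ENNReal.rpow_natCast] at this
  exact this

lemma TT_fin (hc : Crv z b) {s : ℝ} (hs : 0 < s) {f : ℝ → ℂ} (hf : Continuous f) (hfs : HasCompactSupport f) {n : ℕ} (hn : 2 ≤ n) :
    ∫⁻ x, ‖TT z b s f x‖ₑ ^ n < ∞ := by
  have hb := hc.cont
  have h2 : ∫⁻ x, ‖TT z b s f x‖ₑ ^ 2 < ∞ := by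
    refine (TT_L2 hc hs hf hfs).trans_lt (ENNReal.mul_lt_top ENNReal.ofReal_lt_top ?_)
    have : Integrable fun x => f x ^ 2 := Continuous.integrable_of_hasCompactSupport (by fun_prop)
      (hfs.mono fun w hw h => hw (by simp [h]))
    have := this.2
    simpa [HasFiniteIntegral] using this
  have hi : ∫⁻ y, ‖f y‖ₑ < ∞ := (hf.integrable_of_hasCompactSupport hfs).2
  have hbd : ∀ x, ‖TT z b s f x‖ₑ ≤ ENNReal.ofReal (5 / s) * ∫⁻ y, ‖f y‖ₑ := by
    intro x
    refine (enorm_integral_le_lintegral_enorm _).trans ?_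
    rw [← lintegral_const_mul _ hf.measurable.enorm]
    refine lintegral_mono fun y => ?_
    rw [← ofReal_norm, ← ofReal_norm, ← ENNReal.ofReal_mul (by positivity)]
    refine ENNReal.ofReal_le_ofReal ?_
    rw [norm_div, norm_mul]
    have h1 := hc.D_lower hs.le x y
    have h2 := hc.norm_le y
    calc _ ≤ ‖f y‖ * (5 / 4) / (s / 4) := by
          have : s / 4 ≤ ‖DD z s x y‖ := le_trans (by linarith [abs_nonneg (x - y)]) h1
          gcongr
      _ = _ := by field_simp
  set K := ENNReal.ofReal (5 / s) * ∫⁻ y, ‖f y‖ₑ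
  have hK : K < ∞ := ENNReal.mul_lt_top ENNReal.ofReal_lt_top hi
  obtain ⟨k, rfl⟩ := Nat.exists_eq_add_of_le hn
  calc _ ≤ ∫⁻ x, K ^ k * ‖TT z b s f x‖ₑ ^ 2 := by
        refine lintegral_mono fun x => ?_
        rw [pow_add, mul_comm]
        gcongr
        exact hbd x
    _ = K ^ k * ∫⁻ x, ‖TT z b s f x‖ₑ ^ 2 := by
        rw [lintegral_const_mul]
        exact ((contTT hc hs hf hfs).measurable.enorm).pow_const 2
    _ < ∞ := ENNReal.mul_lt_top (ENNReal.pow_lt_top hK) h2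

/-- uniform `L^n` boundedness of the Cauchy integrals. -/
def BT (n : ℕ) : Prop := ∃ K : ℝ≥0, ∀ (z b : ℝ → ℂ), Crv z b → ∀ s : ℝ, 0 < s → ∀ f : ℝ → ℂ, Continuous f →
  HasCompactSupport f → ∫⁻ x, ‖TT z b s f x‖ₑ ^ n ≤ K * ∫⁻ x, ‖f x‖ₑ ^ n

lemma BT_two : BT 2 := ⟨_, fun _ _ hc _ hs _ hf hfs => TT_L2 hc hs hf hfs⟩

lemma BT_step {r : ℕ} (hr : 2 ≤ r) (h : BT r) : BT (2 * r) := by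
  obtain ⟨K, hK⟩ := h
  obtain ⟨c1, hc1⟩ := Mc_nat hr
  obtain ⟨c2, hc2⟩ := Mc_nat (n := 2 * r) (by omega)
  set ε : ℝ≥0 := (2 * 16 ^ r * (K + 1))⁻¹ with hε
  have hε0 : 0 < ε := by positivity
  set c3 : ℝ≥0 := 4 ^ r * K * (ε * 4 ^ r * 80 ^ (2 * r) * c2 + ε⁻¹) + 4 ^ r * (12800 ^ r * c1 * (1 + c2) + 6400 ^ r * c2) with hc3
  refine ⟨2 * c3, fun z b hc s hs f hf hfs => ?_⟩
  set g : ℝ → ℝ≥0∞ := fun w => ‖f w‖ₑ with hg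
  have mg : Measurable g := hf.measurable.enorm
  have mM := measurable_Mc g
  have cT := contTT hc hs hf hfs
  have cH := contHH hc hs hf hfs
  have mT := cT.measurable.enorm
  have mH := cH.measurable.enorm
  set A := ∫⁻ x, ‖TT z b s f x‖ₑ ^ (2 * r) with hA
  have hAf : A < ∞ := TT_fin hc hs hf hfs (by omega)
  set G := ∫⁻ x, g x ^ (2 * r) with hG
  have hMG : ∫⁻ x, Mc g x ^ (2 * r) ≤ c2 * G := hc2 g mg
  -- the bound for H
  have hH : ∫⁻ x, ‖HH z b s f x‖ₑ ^ (2 * r) ≤ 4 ^ r * (A + 80 ^ (2 * r) * (c2 * G)) := by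
    calc _ ≤ ∫⁻ x, 4 ^ r * (‖TT z b s f x‖ₑ ^ (2 * r) + 80 ^ (2 * r) * Mc g x ^ (2 * r)) := by
          refine lintegral_mono fun x => ?_
          refine (pow_le_pow_left' (HH_le hc hs hf hfs x) _).trans ((add_pow_le' _ _ _).trans (le_of_eq ?_))
          rw [mul_pow, pow_mul 2]; norm_num; rfl
      _ = 4 ^ r * (A + 80 ^ (2 * r) * ∫⁻ x, Mc g x ^ (2 * r)) := by
          rw [lintegral_const_mul _ (by fun_prop), lintegral_add_left (by fun_prop), lintegral_const_mul _ (by fun_prop)]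
      _ ≤ _ := by gcongr
  have hfH : ∫⁻ x, ‖f x * HH z b s f x‖ₑ ^ r ≤ ε * (4 ^ r * (A + 80 ^ (2 * r) * (c2 * G))) + (ε⁻¹ : ℝ≥0) * G := by
    calc _ ≤ ∫⁻ x, (ε * ‖HH z b s f x‖ₑ ^ (2 * r) + (ε⁻¹ : ℝ≥0) * g x ^ (2 * r)) := by
          refine lintegral_mono fun x => ?_
          rw [enorm_mul, mul_pow, mul_comm 2 r, pow_mul, pow_mul]
          exact young_eps hε0 _ _
      _ = ε * (∫⁻ x, ‖HH z b s f x‖ₑ ^ (2 * r)) + (ε⁻¹ : ℝ≥0) * G := by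
          rw [lintegral_add_left (by fun_prop), lintegral_const_mul _ (by fun_prop), lintegral_const_mul _ (by fun_prop)]
      _ ≤ _ := by gcongr
  have hτ : ∫⁻ x, ‖TT z b s (fun y => f y * HH z b s f y) x‖ₑ ^ r ≤ K * ∫⁻ x, ‖f x * HH z b s f x‖ₑ ^ r :=
    hK z b hc s hs _ (hf.mul cH) hfs.mul_right
  have hE : ∫⁻ x, ‖EE z b s f x‖ₑ ^ r ≤ 2 ^ r * (12800 ^ r * (c1 * (G + c2 * G)) + 6400 ^ r * (c2 * G)) := by
    have mMM := measurable_Mc (fun y => g y * Mc g y)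
    calc _ ≤ ∫⁻ x, 2 ^ r * (12800 ^ r * Mc (fun y => g y * Mc g y) x ^ r + 6400 ^ r * Mc g x ^ (2 * r)) := by
          refine lintegral_mono fun x => ?_
          refine (pow_le_pow_left' (EE_le hc hs hf x) _).trans ((add_pow_le' _ _ _).trans (le_of_eq ?_))
          rw [mul_pow, mul_pow, pow_mul]
      _ = 2 ^ r * (12800 ^ r * (∫⁻ x, Mc (fun y => g y * Mc g y) x ^ r) + 6400 ^ r * ∫⁻ x, Mc g x ^ (2 * r)) := by
          rw [lintegral_const_mul _ (by fun_prop), lintegral_add_left (by fun_prop), lintegral_const_mul _ (by fun_prop),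
            lintegral_const_mul _ (by fun_prop)]
      _ ≤ 2 ^ r * (12800 ^ r * (c1 * ∫⁻ x, (g x * Mc g x) ^ r) + 6400 ^ r * (c2 * G)) := by
          gcongr
          exact hc1 _ (mg.mul mM)
      _ ≤ 2 ^ r * (12800 ^ r * (c1 * ∫⁻ x, (g x ^ (2 * r) + Mc g x ^ (2 * r))) + 6400 ^ r * (c2 * G)) := by
          gcongr with x
          rw [mul_pow, mul_comm 2 r, pow_mul, pow_mul, add_comm]
          simpa using young_eps one_pos (g x ^ r) (Mc g x ^ r)
      _ ≤ _ := by
          rw [lintegral_add_left (by fun_prop)]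
          gcongr
  have main : A ≤ 2 ^ r * (2 ^ r * (∫⁻ x, ‖TT z b s (fun y => f y * HH z b s f y) x‖ₑ ^ r) + ∫⁻ x, ‖EE z b s f x‖ₑ ^ r) := by
    have cT2 := (contTT hc hs (hf.mul cH) hfs.mul_right).measurable.enorm
    calc A ≤ ∫⁻ x, 2 ^ r * (2 ^ r * ‖TT z b s (fun y => f y * HH z b s f y) x‖ₑ ^ r + ‖EE z b s f x‖ₑ ^ r) := by
          refine lintegral_mono fun x => ?_
          rw [pow_mul, ← enorm_pow, cotlar_id hc hs hf hfs x]
          refine (pow_le_pow_left' (enorm_add_le _ _) _).trans ((add_pow_le' _ _ _).trans (le_of_eq ?_))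
          rw [enorm_mul, mul_pow]
          congr 3
          rw [← ofReal_norm]; norm_num
      _ = _ := by
          rw [lintegral_const_mul', lintegral_add_left, lintegral_const_mul']
          · exact ENNReal.pow_ne_top (by norm_num)
          · exact (cT2.pow_const r).const_mul _
          · exact ENNReal.pow_ne_top (by norm_num)
  have e16 : (16 : ℝ≥0∞) ^ r = 4 ^ r * 4 ^ r := by rw [← mul_pow]; norm_num
  have e4 : (4 : ℝ≥0∞) ^ r = 2 ^ r * 2 ^ r := by rw [← mul_pow]; norm_num
  have hhalf : (16 : ℝ≥0∞) ^ r * K * ε ≤ 1 / 2 := by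
    have : (16 : ℝ≥0) ^ r * K * ε ≤ 1 / 2 := by
      rw [hε, ← div_eq_mul_inv, div_le_iff₀ (by positivity)]
      have : (1 : ℝ≥0) / 2 * (2 * 16 ^ r * (K + 1)) = 16 ^ r * (K + 1) := by field_simp
      rw [this]
      gcongr
      exact le_self_add
    have h2 := ENNReal.coe_le_coe.2 this
    push_cast at h2
    simpa using h2
  have fin : A ≤ A / 2 + c3 * G := by
    calc A ≤ 2 ^ r * (2 ^ r * (K * (ε * (4 ^ r * (A + 80 ^ (2 * r) * (c2 * G))) + (ε⁻¹ : ℝ≥0) * G)) +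
          2 ^ r * (12800 ^ r * (c1 * (G + c2 * G)) + 6400 ^ r * (c2 * G))) := by
            refine main.trans ?_
            gcongr
            exact hτ.trans (by gcongr)
      _ = 16 ^ r * K * ε * A + c3 * G := by
            rw [hc3, e16]
            push_cast
            rw [e4]
            ring
      _ ≤ 1 / 2 * A + c3 * G := by gcongr
      _ = _ := by rw [one_div, ENNReal.div_eq_inv_mul]
  have h3 : A / 2 + A / 2 ≤ A / 2 + c3 * G := by rwa [ENNReal.add_halves]
  have h4 : A / 2 ≤ c3 * G := (ENNReal.add_le_add_iff_left (ENNReal.div_lt_top hAf.ne (by norm_num)).ne).1 h3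
  rw [ENNReal.div_le_iff (by norm_num) (by norm_num)] at h4
  refine h4.trans (le_of_eq ?_)
  push_cast
  ring

theorem BT_all (k : ℕ) : BT (2 ^ (k + 1)) := by
  induction k with
  | zero => simpa using BT_two
  | succ k ih =>
    rw [pow_succ, mul_comm]
    refine BT_step ?_ ih
    calc 2 = 2 ^ 1 := by norm_num
      _ ≤ _ := Nat.pow_le_pow_right (by norm_num) (by omega)

end
end CC

namespace CC
noncomputable section
open MeasureTheory Filter Set Metric Topology
open scoped ENNReal BigOperators ComplexConjugate NNReal

lemma root_avg {N m : ℕ} (hm : m < N) {ζ : ℂ} (hζ : IsPrimitiveRoot ζ N) {r : ℂ} (hr : ‖r‖ ≤ 1 / 4) :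
    ∑ k ∈ Finset.range N, (ζ ^ k) ^ (N - m) * (1 / (1 - ζ ^ k * r)) = N * (r ^ m / (1 - r ^ N)) := by
  have hN : 0 < N := by omega
  have hz1 : ‖ζ‖ = 1 := hζ.norm'_eq_one hN.ne'
  have hrN : ‖r ^ N‖ < 1 := by
    rw [norm_pow]
    exact pow_lt_one₀ (norm_nonneg _) (by linarith) hN.ne'
  have hne : ∀ w : ℂ, ‖w‖ < 1 → 1 - w ≠ 0 := fun w hw h => by
    rw [sub_eq_zero] at h
    rw [← h] at hw
    simp at hw
  have h1 : ∀ k, 1 / (1 - ζ ^ k * r) = (∑ n ∈ Finset.range N, (ζ ^ k * r) ^ n) / (1 - r ^ N) := by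
    intro k
    rw [div_eq_div_iff, mul_comm _ (1 - ζ ^ k * r), mul_neg_geom_sum, mul_pow, ← pow_mul, mul_comm k, pow_mul, hζ.pow_eq_one]
    · simp
    · refine hne _ ?_
      rw [norm_mul, norm_pow, hz1]; simp; linarith
    · exact hne _ hrN
  have h2 : ∀ n ∈ Finset.range N, ∑ k ∈ Finset.range N, (ζ ^ k) ^ (N - m) * (ζ ^ k * r) ^ n = if n = m then N * r ^ m else 0 := by
    intro n hn
    rw [Finset.mem_range] at hn
    have e : ∀ k, (ζ ^ k) ^ (N - m) * (ζ ^ k * r) ^ n = (ζ ^ (N - m + n)) ^ k * r ^ n := by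
      intro k
      rw [mul_pow, ← mul_assoc]
      congr 1
      ring
    simp_rw [e]
    rw [← Finset.sum_mul]
    split_ifs with h
    · subst h
      rw [Nat.sub_add_cancel hn.le, hζ.pow_eq_one]
      simp
    · have hne1 : ζ ^ (N - m + n) ≠ 1 := by
        rw [Ne, hζ.pow_eq_one_iff_dvd]
        rintro ⟨q, hq⟩
        have : q = 1 := by
          have h3 : 0 < N * q := by omega
          have h4 : N * q < N * 2 := by omega
          have h5 := Nat.lt_of_mul_lt_mul_left h4
          have h6 := Nat.pos_of_mul_pos_left h3
          omega
        subst this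
        omega
      rw [geom_sum_eq hne1, ← pow_mul, mul_comm (N - m + n) N, pow_mul, hζ.pow_eq_one]
      simp
  calc _ = (∑ k ∈ Finset.range N, ∑ n ∈ Finset.range N, (ζ ^ k) ^ (N - m) * (ζ ^ k * r) ^ n) / (1 - r ^ N) := by
        rw [Finset.sum_div]
        refine Finset.sum_congr rfl fun k _ => ?_
        rw [h1, ← mul_div_assoc, Finset.mul_sum]
    _ = _ := by
        rw [Finset.sum_comm, Finset.sum_congr rfl h2, Finset.sum_ite_eq' , if_pos (Finset.mem_range.2 hm)]
        ring

def XI (s x y : ℝ) : ℂ := ((x - y : ℝ) : ℂ) + s * Complex.I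

lemma XI_norm_ge (s x y : ℝ) : |x - y| ≤ ‖XI s x y‖ := by
  have := Complex.abs_re_le_norm (XI s x y)
  simpa [XI] using this

lemma XI_norm_ge' {s : ℝ} (hs : 0 ≤ s) (x y : ℝ) : s ≤ ‖XI s x y‖ := by
  have := Complex.abs_im_le_norm (XI s x y)
  simpa [XI, abs_of_nonneg hs] using this

lemma XI_norm_half {s : ℝ} (hs : 0 ≤ s) (x y : ℝ) : (|x - y| + s) / 2 ≤ ‖XI s x y‖ := by
  have h1 := XI_norm_ge s x y
  have h2 := XI_norm_ge' hs x y
  linarith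

lemma XI_ne {s : ℝ} (hs : 0 < s) (x y : ℝ) : XI s x y ≠ 0 := fun h => by
  have := XI_norm_ge' hs.le x y
  rw [h, norm_zero] at this
  linarith

lemma contXI (s : ℝ) : Continuous fun q : ℝ × ℝ => XI s q.1 q.2 := by unfold XI; fun_prop

/-- smooth real function with small derivative -/
structure Sm (κ : ℝ) (B β : ℝ → ℝ) : Prop where
  deriv : ∀ x, HasDerivAt B (β x) x
  cont : Continuous β
  bd : ∀ x, |β x| ≤ κ

lemma Sm.contB {κ : ℝ} {B β : ℝ → ℝ} (h : Sm κ B β) : Continuous B :=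
  continuous_iff_continuousAt.2 fun x => (h.deriv x).continuousAt

lemma Sm.lip {κ : ℝ} {B β : ℝ → ℝ} (h : Sm κ B β) (x y : ℝ) : |B x - B y| ≤ κ * |x - y| :=
  convex_univ.norm_image_sub_le_of_norm_hasDerivWithin_le (fun t _ => (h.deriv t).hasDerivWithinAt) (fun t _ => h.bd t)
    (mem_univ y) (mem_univ x)

lemma Sm.crv {B β : ℝ → ℝ} (h : Sm (1 / 4) B β) {ω : ℂ} (hω : ‖ω‖ = 1) :
    Crv (fun x => x + ω * B x) (fun x => 1 + ω * β x) where
  deriv x := by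
    have h1 := (h.deriv x).ofReal_comp
    exact (Complex.ofRealCLM.hasDerivAt (x := x)).add (h1.const_mul ω)
  cont := by have := h.cont; fun_prop
  close x := by
    have := h.bd x
    simpa [norm_mul, hω] using this

lemma enorm_avg_pow {N n : ℕ} (hN : 0 < N) (hn : 1 ≤ n) (v : ℕ → ℂ) :
    ‖(∑ k ∈ Finset.range N, v k) / N‖ₑ ^ n ≤ (N : ℝ≥0∞)⁻¹ * ∑ k ∈ Finset.range N, ‖v k‖ₑ ^ n := by
  have hN' : (N : ℝ≥0∞) ≠ 0 := by exact_mod_cast hN.ne'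
  have h1 : ‖(∑ k ∈ Finset.range N, v k) / N‖ₑ ≤ ∑ k ∈ Finset.range N, (N : ℝ≥0∞)⁻¹ * ‖v k‖ₑ := by
    rw [← Finset.mul_sum, div_eq_inv_mul, enorm_mul, enorm_inv (by exact_mod_cast hN.ne')]
    have : ‖(N : ℂ)‖ₑ = N := by rw [← ofReal_norm, Complex.norm_natCast, ENNReal.ofReal_natCast]
    rw [this]
    gcongr
    exact enorm_sum_le _ _
  have h2 := ENNReal.rpow_arith_mean_le_arith_mean_rpow (Finset.range N) (fun _ => (N : ℝ≥0∞)⁻¹) (fun k => ‖v k‖ₑ)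
    (by rw [Finset.sum_const, Finset.card_range, nsmul_eq_mul, ENNReal.mul_inv_cancel hN' (by simp)]) (p := n) (by exact_mod_cast hn)
  simp only [ENNReal.rpow_natCast] at h2
  rw [Finset.mul_sum]
  exact (pow_le_pow_left' h1 n).trans h2

lemma extract {n : ℕ} (hn : 1 ≤ n) (hB : BT n) : ∃ K : ℝ≥0, ∀ (m : ℕ) (B β : ℝ → ℝ), Sm (1 / 4) B β → ∀ s : ℝ, 0 < s → ∀ f : ℝ → ℂ,
    Continuous f → HasCompactSupport f →
    ∫⁻ x, ‖∫ y, f y * ((B x - B y : ℝ) : ℂ) ^ m / XI s x y ^ (m + 1)‖ₑ ^ n ≤ K * ∫⁻ x, ‖f x‖ₑ ^ n := by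
  obtain ⟨K, hK⟩ := hB
  refine ⟨K * 2 ^ n, fun m B β hS s hs f hf hfs => ?_⟩
  have cB := hS.contB
  have cβ := hS.cont
  have hlip : ∀ x y, |B x - B y| ≤ ‖XI s x y‖ / 4 := fun x y => by
    have := hS.lip x y
    have := XI_norm_ge s x y
    linarith
  set r : ℝ → ℝ → ℂ := fun x y => -((B x - B y : ℝ) : ℂ) / XI s x y with hr
  have hr4 : ∀ x y, ‖r x y‖ ≤ 1 / 4 := fun x y => by
    rw [hr, norm_div, norm_neg, Complex.norm_real, div_le_iff₀ (norm_pos_iff.2 (XI_ne hs x y))]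
    have := hlip x y
    rw [Real.norm_eq_abs]
    linarith
  have cr : ∀ x, Continuous fun y => r x y := fun x => by
    refine Continuous.div (by fun_prop) ((contXI s).comp (by fun_prop : Continuous fun y : ℝ => (x, y))) fun y => XI_ne hs _ _
  have cX : ∀ x, Continuous fun y => XI s x y := fun x => ((contXI s).comp (by fun_prop : Continuous fun y : ℝ => (x, y)))
  set U : ℕ → ℝ → ℂ := fun N x => ∫ y, f y / XI s x y * (r x y ^ m / (1 - r x y ^ N)) with hU
  have hne : ∀ N, 0 < N → ∀ x y, 1 / 2 ≤ ‖1 - r x y ^ N‖ := fun N hN x y => by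
    have h1 : ‖r x y ^ N‖ ≤ 1 / 4 := by
      rw [norm_pow]
      refine (pow_le_of_le_one (norm_nonneg _) (by linarith [hr4 x y]) hN.ne').trans (hr4 x y)
    have := norm_sub_norm_le (1 : ℂ) (r x y ^ N)
    rw [norm_one] at this
    linarith
  have bound : ∀ N, m < N → Measurable (U N) ∧ ∫⁻ x, ‖U N x‖ₑ ^ n ≤ (K * 2 ^ n : ℝ≥0) * ∫⁻ x, ‖f x‖ₑ ^ n := by
    intro N hmN
    have hN : 0 < N := by omega
    set ζ := Complex.exp (2 * Real.pi * Complex.I / N)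
    have hζ : IsPrimitiveRoot ζ N := Complex.isPrimitiveRoot_exp N hN.ne'
    have hz1 : ‖ζ‖ = 1 := hζ.norm'_eq_one hN.ne'
    have hzk : ∀ k, ‖ζ ^ k‖ = 1 := fun k => by rw [norm_pow, hz1, one_pow]
    have hc := fun k => hS.crv (hzk k)
    set b : ℕ → ℝ → ℂ := fun k x => 1 + ζ ^ k * β x with hb
    set z : ℕ → ℝ → ℂ := fun k x => x + ζ ^ k * B x with hz
    have hb0 : ∀ k x, b k x ≠ 0 := fun k x h => by
      have := (hc k).le_norm x
      simp only [hb] at h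
      rw [h] at this; norm_num at this
    have cb : ∀ k, Continuous (b k) := fun k => (hc k).cont
    have cf : ∀ k, Continuous fun y => f y / b k y := fun k => hf.div (cb k) (hb0 k)
    have sf : ∀ k, HasCompactSupport fun y => f y / b k y := fun k => hfs.mono fun w hw h => hw (by simp [h])
    have eD : ∀ k x y, DD (z k) s x y = XI s x y * (1 - ζ ^ k * r x y) := by
      intro k x y
      have := XI_ne hs x y
      simp only [hr, hz, DD]
      field_simp
      simp only [XI]
      push_cast
      ring
    have hDne := fun k x y => (hc k).D_ne hs x y
    have eT : ∀ k x, TT (z k) (b k) s (fun y => f y / b k y) x = ∫ y, f y / XI s x y * (1 / (1 - ζ ^ k * r x y)) := by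
      intro k x
      unfold TT
      congr 1; ext y
      have h1 := hb0 k y
      rw [eD, div_mul_cancel₀ _ h1, div_mul_div_comm, mul_one]
    have key : ∀ x, U N x = (∑ k ∈ Finset.range N, (ζ ^ k) ^ (N - m) * TT (z k) (b k) s (fun y => f y / b k y) x) / N := by
      intro x
      simp_rw [eT, hU, ← integral_const_mul]
      rw [← integral_finsetSum, ← integral_div]
      · congr 1; ext y
        have := root_avg hmN hζ (hr4 x y)
        have hNc : (N : ℂ) ≠ 0 := by exact_mod_cast hN.ne'
        rw [eq_div_iff hNc, mul_assoc, mul_comm _ (N : ℂ), ← this, Finset.mul_sum]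
        refine Finset.sum_congr rfl fun k _ => by ring
      · intro k _
        refine Continuous.integrable_of_hasCompactSupport ?_ (hfs.mono fun w hw h => hw (by simp [h]))
        refine continuous_const.mul ((hf.div (cX x) fun y => XI_ne hs x y).mul (continuous_const.div ?_ fun y => ?_))
        · have := cr x; fun_prop
        · have := hDne k x y
          change DD (z k) s x y ≠ 0 at this
          rw [eD] at this
          exact right_ne_zero_of_mul this
    have cTk := fun k => (contTT (hc k) hs (cf k) (sf k))
    constructor
    · have : U N = fun x => (∑ k ∈ Finset.range N, (ζ ^ k) ^ (N - m) * TT (z k) (b k) s (fun y => f y / b k y) x) / N := funext key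
      rw [this]
      refine Measurable.div_const (Finset.measurable_fun_sum _ fun k _ => (cTk k).measurable.const_mul _) _
    · calc _ ≤ ∫⁻ x, (N : ℝ≥0∞)⁻¹ * ∑ k ∈ Finset.range N, ‖TT (z k) (b k) s (fun y => f y / b k y) x‖ₑ ^ n := by
            refine lintegral_mono fun x => ?_
            rw [key]
            refine (enorm_avg_pow hN hn _).trans (le_of_eq ?_)
            congr 1
            refine Finset.sum_congr rfl fun k _ => ?_
            rw [enorm_mul, ← ofReal_norm ((ζ ^ k) ^ (N - m)), norm_pow, hzk]
            simp
        _ = (N : ℝ≥0∞)⁻¹ * ∑ k ∈ Finset.range N, ∫⁻ x, ‖TT (z k) (b k) s (fun y => f y / b k y) x‖ₑ ^ n := by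
            rw [lintegral_const_mul _ (Finset.measurable_fun_sum _ fun k _ => (cTk k).measurable.enorm.pow_const n),
              lintegral_finsetSum _ fun k _ => (cTk k).measurable.enorm.pow_const n]
        _ ≤ (N : ℝ≥0∞)⁻¹ * ∑ k ∈ Finset.range N, (K * 2 ^ n : ℝ≥0) * ∫⁻ x, ‖f x‖ₑ ^ n := by
            gcongr with k hk
            refine (hK _ _ (hc k) s hs _ (cf k) (sf k)).trans ?_
            push_cast
            rw [mul_assoc]
            gcongr
            rw [← lintegral_const_mul _ (hf.measurable.enorm.pow_const n)]
            refine lintegral_mono fun x => ?_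
            simp only
            rw [← mul_pow]
            gcongr
            have e2 : (2 : ℝ≥0∞) = ENNReal.ofReal 2 := by norm_num
            rw [← ofReal_norm, ← ofReal_norm, e2, ← ENNReal.ofReal_mul (by norm_num)]
            refine ENNReal.ofReal_le_ofReal ?_
            have h3 : 3 / 4 ≤ ‖b k x‖ := (hc k).le_norm x
            rw [norm_div, div_le_iff₀ (by linarith)]
            nlinarith [norm_nonneg (f x)]
        _ = _ := by
            rw [Finset.sum_const, Finset.card_range, nsmul_eq_mul, ← mul_assoc, ENNReal.inv_mul_cancel (by exact_mod_cast hN.ne') (by simp),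
              one_mul]
  have hlim : ∀ x, Tendsto (fun N => U N x) atTop (𝓝 (∫ y, f y / XI s x y * r x y ^ m)) := by
    intro x
    refine tendsto_integral_filter_of_dominated_convergence (fun y => 2 * ‖f y / XI s x y‖) ?_ ?_ ?_ ?_
    · filter_upwards [eventually_gt_atTop 0] with N hN
      have := cr x
      refine (Continuous.mul (hf.div (cX x) fun y => XI_ne hs x y) (Continuous.div (by fun_prop) (by fun_prop) fun y h => ?_)).aestronglyMeasurable
      have := hne N hN x y
      rw [h, norm_zero] at this
      linarith
    · filter_upwards [eventually_gt_atTop 0] with N hN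
      refine Eventually.of_forall fun y => ?_
      rw [norm_mul, mul_comm]
      gcongr
      rw [norm_div, norm_pow]
      have h1 := hne N hN x y
      rw [div_le_iff₀ (by linarith)]
      have : ‖r x y‖ ^ m ≤ 1 := pow_le_one₀ (norm_nonneg _) (by linarith [hr4 x y])
      linarith
    · refine Continuous.integrable_of_hasCompactSupport ?_ (hfs.mono fun w hw h => hw (by simp [h]))
      exact continuous_const.mul (hf.div (cX x) fun y => XI_ne hs x y).norm
    · refine Eventually.of_forall fun y => ?_
      have h1 : Tendsto (fun N => r x y ^ N) atTop (𝓝 0) :=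
        tendsto_pow_atTop_nhds_zero_of_norm_lt_one (by linarith [hr4 x y])
      have h2 : Tendsto (fun N => r x y ^ m / (1 - r x y ^ N)) atTop (𝓝 (r x y ^ m / (1 - 0))) :=
        tendsto_const_nhds.div (tendsto_const_nhds.sub h1) (by norm_num)
      rw [sub_zero, div_one] at h2
      exact tendsto_const_nhds.mul h2
  have e0 : ∀ x, ‖∫ y, f y * ((B x - B y : ℝ) : ℂ) ^ m / XI s x y ^ (m + 1)‖ₑ = ‖∫ y, f y / XI s x y * r x y ^ m‖ₑ := by
    intro x
    have : ∫ y, f y / XI s x y * r x y ^ m = (-1) ^ m * ∫ y, f y * ((B x - B y : ℝ) : ℂ) ^ m / XI s x y ^ (m + 1) := by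
      rw [← integral_const_mul]
      congr 1; ext y
      simp only [hr]
      have := XI_ne hs x y
      rw [div_pow, neg_pow]
      field_simp
      ring
    rw [this, enorm_mul, ← ofReal_norm ((-1 : ℂ) ^ m)]
    simp
  simp_rw [e0]
  calc ∫⁻ x, ‖∫ y, f y / XI s x y * r x y ^ m‖ₑ ^ n = ∫⁻ x, liminf (fun N => ‖U (N + m + 1) x‖ₑ ^ n) atTop := by
        refine lintegral_congr fun x => ?_
        have h1 := ((hlim x).comp (tendsto_add_atTop_nat (m + 1))).enorm
        have h2 := ((ENNReal.continuous_pow n).tendsto _).comp h1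
        exact h2.liminf_eq.symm
    _ ≤ liminf (fun N => ∫⁻ x, ‖U (N + m + 1) x‖ₑ ^ n) atTop :=
        lintegral_liminf_le fun N => ((bound _ (by omega)).1.enorm.pow_const n)
    _ ≤ _ := by
        refine liminf_le_of_le (by isBoundedDefault) fun c hc => ?_
        obtain ⟨N, hN⟩ := hc.exists
        exact hN.trans (bound _ (by omega)).2

end
end CC

namespace CC
noncomputable section
open MeasureTheory Filter Set Metric Topology
open scoped ENNReal BigOperators ComplexConjugate NNReal

def sg (t : Fin 2) : ℂ := if t = 0 then -1 else 1
def tau (t : Fin 2) : ℝ := if t = 0 then 0 else 1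

lemma polar (m : ℕ) : ∃ M : ℕ, 0 < M ∧ ∀ c : Fin m → ℂ, (M : ℂ) * ∏ j, c j =
    ∑ e : Fin m → Fin 2, (∏ j, sg (e j)) * (∑ j, (tau (e j) : ℂ) * c j) ^ m := by
  classical
  refine ⟨(Finset.univ.filter fun φ : Fin m → Fin m => Function.Surjective φ).card,
    Finset.card_pos.2 ⟨id, by simp [Function.surjective_id]⟩, fun c => ?_⟩
  have h1 : ∀ e : Fin m → Fin 2, (∑ j, (tau (e j) : ℂ) * c j) ^ m =
      ∑ φ : Fin m → Fin m, (∏ i, c (φ i)) * ∏ i, (tau (e (φ i)) : ℂ) := by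
    intro e
    have := Finset.prod_univ_sum (fun _ : Fin m => (Finset.univ : Finset (Fin m))) (fun _ j => (tau (e j) : ℂ) * c j)
    rw [Finset.prod_const, Finset.card_univ, Fintype.card_fin, Fintype.piFinset_univ] at this
    rw [this]
    refine Finset.sum_congr rfl fun φ _ => ?_
    rw [Finset.prod_mul_distrib, mul_comm]
  have h2 : ∀ φ : Fin m → Fin m, ∑ e : Fin m → Fin 2, (∏ j, sg (e j)) * ∏ i, (tau (e (φ i)) : ℂ) =
      if Function.Surjective φ then 1 else 0 := by
    intro φ
    have e1 : ∀ e : Fin m → Fin 2, (∏ j, sg (e j)) * ∏ i, (tau (e (φ i)) : ℂ) =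
        ∏ j, (sg (e j) * (tau (e j) : ℂ) ^ (Finset.univ.filter fun i => φ i = j).card) := by
      intro e
      rw [Finset.prod_mul_distrib]
      congr 1
      rw [← Finset.prod_fiberwise' Finset.univ φ (fun j => (tau (e j) : ℂ))]
      simp_rw [Finset.prod_const]
    simp_rw [e1]
    have := Finset.prod_univ_sum (fun _ : Fin m => (Finset.univ : Finset (Fin 2)))
      (fun j t => sg t * (tau t : ℂ) ^ (Finset.univ.filter fun i => φ i = j).card)
    rw [Fintype.piFinset_univ] at this
    rw [← this]
    simp only [Fin.sum_univ_two, sg, tau]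
    by_cases h : Function.Surjective φ
    · rw [if_pos h]
      refine Finset.prod_eq_one fun j _ => ?_
      obtain ⟨i, hi⟩ := h j
      have : (Finset.univ.filter fun i => φ i = j).card ≠ 0 :=
        Finset.card_ne_zero_of_mem (Finset.mem_filter.2 ⟨Finset.mem_univ i, hi⟩)
      simp [this]
    · rw [if_neg h]
      unfold Function.Surjective at h
      push Not at h
      obtain ⟨j, hj⟩ := h
      refine Finset.prod_eq_zero (Finset.mem_univ j) ?_
      have : (Finset.univ.filter fun i => φ i = j) = ∅ := Finset.filter_eq_empty_iff.2 fun i _ => hj i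
      simp [this]
  simp_rw [h1, Finset.mul_sum]
  rw [Finset.sum_comm]
  have h3 : ∀ φ : Fin m → Fin m, ∑ e : Fin m → Fin 2, (∏ j, sg (e j)) * ((∏ i, c (φ i)) * ∏ i, (tau (e (φ i)) : ℂ)) =
      if Function.Surjective φ then ∏ j, c j else 0 := by
    intro φ
    have : ∀ e : Fin m → Fin 2, (∏ j, sg (e j)) * ((∏ i, c (φ i)) * ∏ i, (tau (e (φ i)) : ℂ)) =
      (∏ i, c (φ i)) * ((∏ j, sg (e j)) * ∏ i, (tau (e (φ i)) : ℂ)) := fun e => by ring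
    simp_rw [this]
    rw [← Finset.mul_sum, h2]
    split_ifs with h
    · rw [mul_one]
      exact Function.Bijective.prod_comp ⟨Finite.injective_iff_surjective.2 h, h⟩ c
    · rw [mul_zero]
  rw [Finset.sum_congr rfl fun φ _ => h3 φ, ← Finset.sum_filter, Finset.sum_const, nsmul_eq_mul]

/-- regularized commutator with given primitives -/
def SS {m : ℕ} (A : Fin m → ℝ → ℝ) (s : ℝ) (f : ℝ → ℂ) (x : ℝ) : ℂ :=
  ∫ y, f y * (∏ j, ((A j x - A j y : ℝ) : ℂ)) / XI s x y ^ (m + 1)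

lemma sum_pow_le' {ι : Type*} [Fintype ι] [Nonempty ι] (u : ι → ℝ≥0∞) (n : ℕ) : (∑ i, u i) ^ n ≤ (Fintype.card ι : ℝ≥0∞) ^ n * ∑ i, u i ^ n := by
  obtain ⟨i0, -, hi⟩ := Finset.exists_max_image Finset.univ u Finset.univ_nonempty
  calc (∑ i, u i) ^ n ≤ ((Fintype.card ι : ℝ≥0∞) * u i0) ^ n := by
        gcongr
        refine (Finset.sum_le_card_nsmul _ _ _ hi).trans (le_of_eq ?_)
        rw [nsmul_eq_mul, Finset.card_univ]
    _ = (Fintype.card ι : ℝ≥0∞) ^ n * u i0 ^ n := mul_pow _ _ _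
    _ ≤ _ := by
        gcongr
        exact Finset.single_le_sum (f := fun i => u i ^ n) (fun _ _ => bot_le) (Finset.mem_univ i0)


/-- uniform `L^n` bounds for regularized commutators with smooth data. -/
lemma SS_smooth {n : ℕ} (hn : 1 ≤ n) (hB : BT n) (m : ℕ) : ∃ K : ℝ≥0, ∀ (A α : Fin m → ℝ → ℝ), (∀ j, Sm 1 (A j) (α j)) →
    ∀ s : ℝ, 0 < s → ∀ f : ℝ → ℂ, Continuous f → HasCompactSupport f →
    ∫⁻ x, ‖SS A s f x‖ₑ ^ n ≤ K * ∫⁻ x, ‖f x‖ₑ ^ n := by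
  obtain ⟨K, hK⟩ := extract hn hB
  obtain ⟨M, hM, hpol⟩ := polar m
  set κ : ℝ := 4 * (m + 1) with hκ
  have hκ0 : 0 < κ := by positivity
  set L : ℝ≥0 := Real.toNNReal (κ ^ m) with hL
  refine ⟨(Fintype.card (Fin m → Fin 2)) ^ n * ((Fintype.card (Fin m → Fin 2)) * (L ^ n * K)), fun A α hA s hs f hf hfs => ?_⟩
  set B : (Fin m → Fin 2) → ℝ → ℝ := fun e x => ∑ j, (tau (e j) / κ) * A j x with hBdef
  have htau : ∀ t, |tau t| ≤ 1 := fun t => by unfold tau; split_ifs <;> simp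
  have hsg : ∀ t, ‖sg t‖ = 1 := fun t => by unfold sg; split_ifs <;> simp
  have hSm : ∀ e, Sm (1 / 4) (B e) (fun x => ∑ j, (tau (e j) / κ) * α j x) := by
    intro e
    refine ⟨fun x => HasDerivAt.fun_sum fun j _ => ((hA j).deriv x).const_mul _, ?_, fun x => ?_⟩
    · exact continuous_finset_sum _ fun j _ => continuous_const.mul (hA j).cont
    · refine (Finset.abs_sum_le_sum_abs _ _).trans ?_
      calc _ ≤ ∑ j : Fin m, 1 / κ := by
            refine Finset.sum_le_sum fun j _ => ?_
            rw [abs_mul, abs_div, abs_of_pos hκ0]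
            have h1 := htau (e j)
            have h2 := (hA j).bd x
            calc _ ≤ 1 / κ * 1 := by gcongr
              _ = _ := mul_one _
        _ = m / κ := by rw [Finset.sum_const, Finset.card_univ, Fintype.card_fin, nsmul_eq_mul]; ring
        _ ≤ 1 / 4 := by
            rw [div_le_iff₀ hκ0, hκ]; linarith
  set V : (Fin m → Fin 2) → ℝ → ℂ := fun e x => ∫ y, f y * ((B e x - B e y : ℝ) : ℂ) ^ m / XI s x y ^ (m + 1) with hV
  have cX : ∀ x, Continuous fun y => XI s x y := fun x => ((contXI s).comp (by fun_prop : Continuous fun y : ℝ => (x, y)))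
  have hMc : (M : ℂ) ≠ 0 := by exact_mod_cast hM.ne'
  have key : ∀ x, SS A s f x = ∑ e, (∏ j, sg (e j)) * (κ : ℂ) ^ m / M * V e x := by
    intro x
    simp only [hV, ← integral_const_mul]
    rw [← integral_finsetSum]
    · unfold SS
      congr 1; ext y
      have h := hpol (fun j => ((A j x - A j y : ℝ) : ℂ))
      rw [← eq_inv_mul_iff_mul_eq₀ hMc] at h
      rw [h, Finset.mul_sum, Finset.mul_sum, Finset.sum_div]
      refine Finset.sum_congr rfl fun e _ => ?_
      have : ∑ j, (tau (e j) : ℂ) * ((A j x - A j y : ℝ) : ℂ) = κ * ((B e x - B e y : ℝ) : ℂ) := by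
        simp only [hBdef]
        rw [← Finset.sum_sub_distrib, Complex.ofReal_sum, Finset.mul_sum]
        refine Finset.sum_congr rfl fun j _ => ?_
        have : (κ : ℂ) ≠ 0 := by exact_mod_cast hκ0.ne'
        push_cast
        field_simp
      rw [this, mul_pow]
      ring
    · intro e _
      refine Continuous.integrable_of_hasCompactSupport ?_ (hfs.mono fun w hw h => hw (by simp [h]))
      have := (hSm e).contB
      exact continuous_const.mul (Continuous.div (by fun_prop) ((cX x).pow _) fun y => pow_ne_zero _ (XI_ne hs x y))
  have mV : ∀ e, Measurable (V e) := by
    intro e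
    have cB := (hSm e).contB
    obtain ⟨R, hR, hM⟩ := supp_bd hfs
    have : ∀ x, V e x = ∫ y in (-R)..R, f y * ((B e x - B e y : ℝ) : ℂ) ^ m / XI s x y ^ (m + 1) := fun x =>
      int_supp hR hM fun w hw => by simp [hw]
    rw [show V e = fun x => _ from funext this]
    refine Continuous.measurable (intervalIntegral.continuous_parametric_intervalIntegral_of_continuous'
      (f := fun x y => f y * ((B e x - B e y : ℝ) : ℂ) ^ m / XI s x y ^ (m + 1)) ?_ _ _)
    exact Continuous.div (by fun_prop) ((contXI s).pow _) fun q => pow_ne_zero _ (XI_ne hs _ _)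
  have hco : ∀ e : Fin m → Fin 2, ‖(∏ j, sg (e j)) * (κ : ℂ) ^ m / M‖ₑ ≤ L := by
    intro e
    rw [← ofReal_norm, hL]
    refine ENNReal.ofReal_le_ofReal ?_
    rw [norm_div, norm_mul, norm_prod, norm_pow, Complex.norm_real, Real.norm_of_nonneg hκ0.le, Complex.norm_natCast]
    simp only [hsg, Finset.prod_const_one, one_mul]
    exact div_le_self (by positivity) (by exact_mod_cast hM)
  calc _ ≤ ∫⁻ x, (Fintype.card (Fin m → Fin 2) : ℝ≥0∞) ^ n * ∑ e, L ^ n * ‖V e x‖ₑ ^ n := by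
        refine lintegral_mono fun x => ?_
        rw [key]
        refine (pow_le_pow_left' (enorm_sum_le _ _) n).trans ((sum_pow_le' _ n).trans ?_)
        gcongr with e
        rw [enorm_mul, mul_pow]
        gcongr
        exact hco e
    _ = (Fintype.card (Fin m → Fin 2) : ℝ≥0∞) ^ n * ∑ e, L ^ n * ∫⁻ x, ‖V e x‖ₑ ^ n := by
        rw [lintegral_const_mul _ (Finset.measurable_fun_sum _ fun e _ => ((mV e).enorm.pow_const n).const_mul _),
          lintegral_finsetSum _ fun e _ => ((mV e).enorm.pow_const n).const_mul _]
        simp_rw [lintegral_const_mul _ ((mV _).enorm.pow_const n)]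
    _ ≤ (Fintype.card (Fin m → Fin 2) : ℝ≥0∞) ^ n * ∑ e : Fin m → Fin 2, L ^ n * (K * ∫⁻ x, ‖f x‖ₑ ^ n) := by
        gcongr with e
        exact hK m (B e) _ (hSm e) s hs f hf hfs
    _ = _ := by
        rw [Finset.sum_const, Finset.card_univ, nsmul_eq_mul]
        push_cast
        ring

end
end CC

namespace CC
noncomputable section
open MeasureTheory Filter Set Metric Topology
open scoped ENNReal BigOperators ComplexConjugate NNReal

/-- all the functions are 1-Lipschitz -/
def Lip1 {m : ℕ} (A : Fin m → ℝ → ℝ) : Prop := ∀ j x y, |A j x - A j y| ≤ |x - y|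

lemma Lip1.cont {m : ℕ} {A : Fin m → ℝ → ℝ} (h : Lip1 A) (j : Fin m) : Continuous (A j) := by
  have : LipschitzWith 1 (A j) := LipschitzWith.of_dist_le_mul fun x y => by
    simpa [Real.dist_eq] using h j x y
  exact this.continuous

lemma ker_bd {m : ℕ} {s : ℝ} (hs : 0 < s) (x y : ℝ) (u : Fin m → ℝ) (hu : ∀ j, |u j| ≤ |x - y|) (w : ℂ) :
    ‖w * (∏ j, (u j : ℂ)) / XI s x y ^ (m + 1)‖ ≤ ‖w‖ * (2 / (|x - y| + s)) := by
  have hX : 0 < ‖XI s x y‖ := norm_pos_iff.2 (XI_ne hs x y)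
  rw [norm_div, norm_mul, norm_prod, norm_pow, mul_div_assoc]
  refine mul_le_mul_of_nonneg_left ?_ (norm_nonneg _)
  have h1 : ∏ j, ‖(u j : ℂ)‖ ≤ ‖XI s x y‖ ^ m := by
    calc ∏ j, ‖(u j : ℂ)‖ ≤ ∏ _j : Fin m, ‖XI s x y‖ := Finset.prod_le_prod (fun _ _ => norm_nonneg _) fun j _ => by
            rw [Complex.norm_real]; exact (hu j).trans (XI_norm_ge s x y)
      _ = _ := by simp
  have h2 := XI_norm_half hs.le x y
  have h3 : 0 < |x - y| + s := by positivity
  calc _ ≤ ‖XI s x y‖ ^ m / ‖XI s x y‖ ^ (m + 1) := by gcongr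
    _ = 1 / ‖XI s x y‖ := by rw [pow_succ]; field_simp
    _ ≤ 1 / ((|x - y| + s) / 2) := one_div_le_one_div_of_le (by positivity) h2
    _ = _ := by field_simp

lemma ker_bd_s {m : ℕ} {s : ℝ} (hs : 0 < s) (x y : ℝ) (u : Fin m → ℝ) (hu : ∀ j, |u j| ≤ |x - y|) (w : ℂ) :
    ‖w * (∏ j, (u j : ℂ)) / XI s x y ^ (m + 1)‖ ≤ 2 / s * ‖w‖ := by
  refine (ker_bd hs x y u hu w).trans ?_
  rw [mul_comm]
  gcongr
  linarith [abs_nonneg (x - y)]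

/-- Steklov averages -/
def Stk (k : ℕ) (A : ℝ → ℝ) (x : ℝ) : ℝ := (k + 1 : ℝ) * ∫ t in x..(x + 1 / (k + 1 : ℝ)), A t

lemma Stk_sm {A : ℝ → ℝ} (hA : ∀ x y, |A x - A y| ≤ |x - y|) (hc : Continuous A) (k : ℕ) :
    Sm 1 (Stk k A) (fun x => (k + 1 : ℝ) * (A (x + 1 / (k + 1 : ℝ)) - A x)) where
  deriv x := by
    have hk : (0:ℝ) < k + 1 := by positivity
    have e : Stk k A = fun x => (k + 1 : ℝ) * ((∫ t in (0:ℝ)..(x + 1 / (k + 1 : ℝ)), A t) - ∫ t in (0:ℝ)..x, A t) := by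
      ext x
      rw [Stk, intervalIntegral.integral_interval_sub_left (hc.intervalIntegrable _ _) (hc.intervalIntegrable _ _)]
    rw [e]
    have d : ∀ x, HasDerivAt (fun x => ∫ t in (0:ℝ)..x, A t) (A x) x := fun x =>
      intervalIntegral.integral_hasDerivAt_right (hc.intervalIntegrable _ _)
        hc.stronglyMeasurable.stronglyMeasurableAtFilter hc.continuousAt
    have d2 : HasDerivAt (fun x => ∫ t in (0:ℝ)..(x + 1 / (k + 1 : ℝ)), A t) (A (x + 1 / (k + 1 : ℝ))) x :=
      HasDerivAt.comp_add_const x (1 / (k + 1 : ℝ)) (d _)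
    exact (d2.sub (d x)).const_mul _
  cont := by fun_prop
  bd x := by
    have hk : (0:ℝ) < k + 1 := by positivity
    rw [abs_mul, abs_of_pos hk]
    have := hA (x + 1 / (k + 1 : ℝ)) x
    rw [add_sub_cancel_left, abs_of_pos (show 0 < 1 / (k + 1 : ℝ) by positivity)] at this
    calc _ ≤ (k + 1 : ℝ) * (1 / (k + 1)) := by gcongr
      _ = 1 := by field_simp

lemma Stk_close {A : ℝ → ℝ} (hA : ∀ x y, |A x - A y| ≤ |x - y|) (hc : Continuous A) (k : ℕ) (x : ℝ) :
    |Stk k A x - A x| ≤ 1 / (k + 1 : ℝ) := by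
  have hk : (0:ℝ) < k + 1 := by positivity
  have h1 : Stk k A x - A x = (k + 1 : ℝ) * ∫ t in x..(x + 1 / (k + 1 : ℝ)), (A t - A x) := by
    rw [intervalIntegral.integral_sub (hc.intervalIntegrable _ _) (by simp), Stk]
    simp
    field_simp
  have h2 : ‖∫ t in x..(x + 1 / (k + 1 : ℝ)), (A t - A x)‖ ≤ (1 / (k + 1 : ℝ)) * |x + 1 / (k + 1 : ℝ) - x| := by
    refine intervalIntegral.norm_integral_le_of_norm_le_const fun t ht => ?_
    rw [uIoc_of_le (by simp; positivity)] at ht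
    refine (hA t x).trans ?_
    rw [abs_of_nonneg (by linarith [ht.1])]
    linarith [ht.2]
  rw [h1, abs_mul, abs_of_pos hk]
  rw [add_sub_cancel_left, abs_of_pos (show 0 < 1 / (k + 1 : ℝ) by positivity)] at h2
  calc _ ≤ (k + 1 : ℝ) * (1 / (k + 1 : ℝ) * (1 / (k + 1 : ℝ))) := by gcongr; exact h2
    _ = _ := by field_simp

lemma Stk_tendsto {A : ℝ → ℝ} (hA : ∀ x y, |A x - A y| ≤ |x - y|) (hc : Continuous A) (x : ℝ) :
    Tendsto (fun k => Stk k A x) atTop (𝓝 (A x)) := by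
  rw [tendsto_iff_norm_sub_tendsto_zero]
  exact squeeze_zero (fun _ => norm_nonneg _) (fun k => Stk_close hA hc k x) tendsto_one_div_add_atTop_nhds_zero_nat

lemma SS_meas {m : ℕ} {A : Fin m → ℝ → ℝ} (hA : ∀ j, Continuous (A j)) (s : ℝ) {f : ℝ → ℂ} (hf : Measurable f) :
    Measurable (SS A s f) := by
  have : StronglyMeasurable (fun q : ℝ × ℝ => f q.2 * (∏ j, ((A j q.1 - A j q.2 : ℝ) : ℂ)) / XI s q.1 q.2 ^ (m + 1)) := by
    refine Measurable.stronglyMeasurable ?_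
    have h1 := (contXI s).measurable
    refine Measurable.div (Measurable.mul (hf.comp measurable_snd) ?_) (h1.pow_const _)
    exact Continuous.measurable (continuous_finsetProd _ fun j _ => by have := hA j; fun_prop)
  exact (this.integral_prod_right' (ν := volume)).measurable

lemma SS_int {m : ℕ} {A : Fin m → ℝ → ℝ} (hA : ∀ j, Continuous (A j)) {s : ℝ} {f : ℝ → ℂ} (hf : Measurable f) (x : ℝ) :
    AEStronglyMeasurable (fun y => f y * (∏ j, ((A j x - A j y : ℝ) : ℂ)) / XI s x y ^ (m + 1)) volume := by
  refine Measurable.aestronglyMeasurable ?_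
  have h1 : Measurable fun y => XI s x y := ((contXI s).comp (by fun_prop : Continuous fun y : ℝ => (x, y))).measurable
  refine Measurable.div (hf.mul ?_) (h1.pow_const _)
  exact Continuous.measurable (continuous_finsetProd _ fun j _ => by have := hA j; fun_prop)

lemma fatou_pow {n : ℕ} {F : ℕ → ℝ → ℂ} {F0 : ℝ → ℂ} (hF : ∀ k, Measurable (F k)) (h : ∀ x, Tendsto (fun k => F k x) atTop (𝓝 (F0 x)))
    {c : ℝ≥0∞} (hc : ∀ k, ∫⁻ x, ‖F k x‖ₑ ^ n ≤ c) : ∫⁻ x, ‖F0 x‖ₑ ^ n ≤ c := by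
  calc ∫⁻ x, ‖F0 x‖ₑ ^ n = ∫⁻ x, liminf (fun k => ‖F k x‖ₑ ^ n) atTop := by
        refine lintegral_congr fun x => ?_
        have : Tendsto (fun k => ‖F k x‖ₑ ^ n) atTop (𝓝 (‖F0 x‖ₑ ^ n)) :=
          ((ENNReal.continuous_pow n).tendsto _).comp ((continuous_enorm.tendsto _).comp (h x))
        exact this.liminf_eq.symm
    _ ≤ liminf (fun k => ∫⁻ x, ‖F k x‖ₑ ^ n) atTop := lintegral_liminf_le fun k => ((hF k).enorm.pow_const n)
    _ ≤ c := liminf_le_of_le (by isBoundedDefault) fun b hb => by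
        obtain ⟨k, hk⟩ := hb.exists
        exact hk.trans (hc k)

lemma SS_lipCc {n : ℕ} (hn : 1 ≤ n) (hB : BT n) (m : ℕ) : ∃ K : ℝ≥0, ∀ A : Fin m → ℝ → ℝ, Lip1 A →
    ∀ s : ℝ, 0 < s → ∀ f : ℝ → ℂ, Continuous f → HasCompactSupport f →
      ∫⁻ x, ‖SS A s f x‖ₑ ^ n ≤ K * ∫⁻ x, ‖f x‖ₑ ^ n := by
  obtain ⟨K, hK⟩ := SS_smooth hn hB m
  refine ⟨K, fun A hA s hs f hf hfs => ?_⟩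
  have hsm := fun k j => Stk_sm (hA j) (hA.cont j) k
  refine fatou_pow (F := fun k => SS (fun j => Stk k (A j)) s f) (fun k => SS_meas (fun j => (hsm k j).contB) s hf.measurable) ?_
    fun k => hK _ _ (hsm k) s hs f hf hfs
  intro x
  refine tendsto_integral_of_dominated_convergence (fun y => 2 / s * ‖f y‖) (fun k => SS_int (fun j => (hsm k j).contB) hf.measurable x)
    ((hf.integrable_of_hasCompactSupport hfs).norm.const_mul _) ?_ ?_
  · intro k
    refine .of_forall fun y => ker_bd_s hs x y (fun j => Stk k (A j) x - Stk k (A j) y) (fun j => ?_) _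
    simpa using (hsm k j).lip x y
  · refine .of_forall fun y => ?_
    refine Tendsto.div_const (Tendsto.const_mul _ (tendsto_finsetProd _ fun j _ => ?_)) _
    exact (Complex.continuous_ofReal.tendsto _).comp ((Stk_tendsto (hA j) (hA.cont j) x).sub (Stk_tendsto (hA j) (hA.cont j) y))

lemma holder_ker {n : ℕ} (hn : 2 ≤ n) {s : ℝ} (hs : 0 < s) : ∃ c : ℝ≥0∞, c ≠ ∞ ∧ ∀ (x : ℝ) (g : ℝ → ℝ≥0∞), Measurable g →
    ∫⁻ y, g y * ENNReal.ofReal (2 / (|x - y| + s)) ≤ c * (∫⁻ y, g y ^ n) ^ (1 / (n:ℝ)) := by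
  have hn' : (1:ℝ) < n := by exact_mod_cast (show 1 < n by omega)
  have hpq : (n:ℝ).HolderConjugate (Real.conjExponent n) := Real.HolderConjugate.conjExponent hn'
  set q := Real.conjExponent n with hq
  have hq1 : 1 < q := hpq.symm.lt
  refine ⟨(∫⁻ y : ℝ, ENNReal.ofReal (2 / (|y| + s)) ^ q) ^ (1 / q), ?_, fun x g hg => ?_⟩
  · refine ENNReal.rpow_ne_top_of_nonneg (by positivity) ?_
    have h0 : Integrable (fun y : ℝ => (1 + ‖y‖) ^ (-q)) := integrable_one_add_norm (by simpa using hq1)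
    have h1 := (h0.const_mul ((2 / min 1 s) ^ q)).lintegral_lt_top
    refine (lt_of_le_of_lt (lintegral_mono fun y => ?_) h1).ne
    have hm : 0 < min 1 s := lt_min one_pos hs
    rw [ENNReal.ofReal_rpow_of_nonneg (by positivity) (by positivity)]
    refine ENNReal.ofReal_le_ofReal ?_
    rw [Real.rpow_neg (by positivity), ← div_eq_mul_inv, ← Real.div_rpow (by positivity) (by positivity)]
    refine Real.rpow_le_rpow (by positivity) ?_ (by positivity)
    rw [div_div]
    refine div_le_div_of_nonneg_left (by norm_num) (by positivity) ?_
    have a1 := min_le_left 1 s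
    have a2 := min_le_right 1 s
    rw [Real.norm_eq_abs]
    nlinarith [abs_nonneg y]
  · have h := ENNReal.lintegral_mul_le_Lp_mul_Lq volume hpq hg.aemeasurable
      (g := fun y => ENNReal.ofReal (2 / (|x - y| + s))) (by fun_prop)
    simp only [Pi.mul_apply, ENNReal.rpow_natCast] at h
    refine h.trans_eq ?_
    rw [mul_comm]
    congr 2
    exact lintegral_sub_left_eq_self (fun y => ENNReal.ofReal (2 / (|y| + s)) ^ q) x

lemma SS_sub_le {m : ℕ} {A : Fin m → ℝ → ℝ} (hA : Lip1 A) {s : ℝ} (hs : 0 < s) {f g : ℝ → ℂ} (x : ℝ)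
    (hf : Integrable (fun y => f y * (∏ j, ((A j x - A j y : ℝ) : ℂ)) / XI s x y ^ (m + 1)))
    (hg : Integrable (fun y => g y * (∏ j, ((A j x - A j y : ℝ) : ℂ)) / XI s x y ^ (m + 1))) :
    ‖SS A s f x - SS A s g x‖ₑ ≤ ∫⁻ y, ‖f y - g y‖ₑ * ENNReal.ofReal (2 / (|x - y| + s)) := by
  unfold SS
  rw [← integral_sub hf hg]
  refine (enorm_integral_le_lintegral_enorm _).trans (lintegral_mono fun y => ?_)
  rw [← sub_div, ← sub_mul, ← ofReal_norm, ← ofReal_norm, ← ENNReal.ofReal_mul (norm_nonneg _)]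
  exact ENNReal.ofReal_le_ofReal (ker_bd hs x y _ (fun j => hA j x y) _)

lemma SS_integrable {n : ℕ} (hn : 2 ≤ n) {m : ℕ} {A : Fin m → ℝ → ℝ} (hA : Lip1 A) {s : ℝ} (hs : 0 < s) {f : ℝ → ℂ} (hf : Measurable f)
    (hfn : ∫⁻ y, ‖f y‖ₑ ^ n ≠ ∞) (x : ℝ) :
    Integrable (fun y => f y * (∏ j, ((A j x - A j y : ℝ) : ℂ)) / XI s x y ^ (m + 1)) := by
  refine ⟨SS_int hA.cont hf x, ?_⟩
  obtain ⟨c, hc, h⟩ := holder_ker hn hs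
  refine lt_of_le_of_lt (lintegral_mono fun y => ?_) ((h x _ hf.enorm).trans_lt ?_)
  · rw [← ofReal_norm, ← ofReal_norm, ← ENNReal.ofReal_mul (norm_nonneg _)]
    exact ENNReal.ofReal_le_ofReal (ker_bd hs x y _ (fun j => hA j x y) _)
  · exact ENNReal.mul_lt_top hc.lt_top (ENNReal.rpow_lt_top_of_nonneg (by positivity) hfn)

lemma approx_Cc {n : ℕ} (hn : 2 ≤ n) {f : ℝ → ℂ} (hf : Measurable f) (hfn : ∫⁻ y, ‖f y‖ₑ ^ n ≠ ∞) (k : ℕ) :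
    ∃ g : ℝ → ℂ, Continuous g ∧ HasCompactSupport g ∧ ∫⁻ y, ‖f y - g y‖ₑ ^ n ≤ ((k + 1 : ℕ) : ℝ≥0∞)⁻¹ := by
  have h0 : (n : ℝ≥0∞) ≠ 0 := by exact_mod_cast (by omega)
  have hL : MemLp f n volume := by
    refine ⟨hf.aestronglyMeasurable, ?_⟩
    rw [eLpNorm_lt_top_iff_lintegral_rpow_enorm_lt_top h0 (by simp)]
    simpa using hfn.lt_top
  obtain ⟨g, h1, h2, h3, -⟩ := hL.exists_hasCompactSupport_eLpNorm_sub_le (by simp) (ε := ((k + 1 : ℕ) : ℝ≥0∞)⁻¹) (by simp)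
  refine ⟨g, h3, h1, ?_⟩
  rw [eLpNorm_eq_lintegral_rpow_enorm_toReal h0 (by simp)] at h2
  simp only [ENNReal.toReal_natCast, ENNReal.rpow_natCast, Pi.sub_apply] at h2
  have hn0 : (0:ℝ) < n := by exact_mod_cast (by omega)
  rw [one_div, ENNReal.rpow_inv_le_iff hn0, ENNReal.rpow_natCast] at h2
  refine h2.trans ?_
  refine pow_le_of_le_one bot_le ?_ (by omega)
  rw [ENNReal.inv_le_one]
  exact_mod_cast Nat.succ_pos k

/-- the regularised commutator is bounded on `L^n`. -/
lemma SS_Ln {n : ℕ} (hn : 2 ≤ n) (hB : BT n) (m : ℕ) : ∃ K : ℝ≥0, ∀ A : Fin m → ℝ → ℝ, Lip1 A →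
    ∀ s : ℝ, 0 < s → ∀ f : ℝ → ℂ, Measurable f →
      ∫⁻ x, ‖SS A s f x‖ₑ ^ n ≤ K * ∫⁻ x, ‖f x‖ₑ ^ n := by
  obtain ⟨K, hK⟩ := SS_lipCc (by omega) hB m
  refine ⟨K * 2 ^ n + 1, fun A hA s hs f hf => ?_⟩
  by_cases hfn : ∫⁻ y, ‖f y‖ₑ ^ n = ∞
  · rw [hfn, ENNReal.mul_top]
    · exact le_top
    · positivity
  choose g hg hgs hgf using approx_Cc hn hf hfn
  have hgm := fun k => (hg k).measurable
  have hgn : ∀ k, ∫⁻ y, ‖g k y‖ₑ ^ n ≤ 2 ^ n * ((∫⁻ y, ‖f y‖ₑ ^ n) + ((k + 1 : ℕ) : ℝ≥0∞)⁻¹) := by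
    intro k
    calc ∫⁻ y, ‖g k y‖ₑ ^ n ≤ ∫⁻ y, 2 ^ n * (‖f y‖ₑ ^ n + ‖f y - g k y‖ₑ ^ n) := by
          refine lintegral_mono fun y => (pow_le_pow_left' ?_ n).trans (add_pow_le' _ _ n)
          calc ‖g k y‖ₑ = ‖f y - (f y - g k y)‖ₑ := by simp
            _ ≤ _ := enorm_sub_le
      _ = 2 ^ n * ((∫⁻ y, ‖f y‖ₑ ^ n) + ∫⁻ y, ‖f y - g k y‖ₑ ^ n) := by
          rw [lintegral_const_mul _ (by have := hgm k; fun_prop), lintegral_add_left (by fun_prop)]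
      _ ≤ _ := by gcongr; exact hgf k
  have hgfin : ∀ k, ∫⁻ y, ‖g k y‖ₑ ^ n ≠ ∞ := fun k => ((hgn k).trans_lt
    (ENNReal.mul_lt_top (by simp) (ENNReal.add_lt_top.2 ⟨lt_top_iff_ne_top.2 hfn, by simp⟩))).ne
  have htend0 : Tendsto (fun k : ℕ => ((k + 1 : ℕ) : ℝ≥0∞)⁻¹) atTop (𝓝 0) :=
    ENNReal.tendsto_inv_nat_nhds_zero.comp (tendsto_add_atTop_nat 1)
  have hn0 : (0:ℝ) < n := by exact_mod_cast (by omega)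
  have hpt : ∀ x, Tendsto (fun k => SS A s (g k) x) atTop (𝓝 (SS A s f x)) := by
    intro x
    obtain ⟨c, hc, h⟩ := holder_ker hn hs
    rw [tendsto_iff_edist_tendsto_0]
    have hb : ∀ k, edist (SS A s (g k) x) (SS A s f x) ≤ c * (((k + 1 : ℕ) : ℝ≥0∞)⁻¹) ^ (1 / (n:ℝ)) := by
      intro k
      rw [edist_comm, edist_eq_enorm_sub]
      refine (SS_sub_le hA hs x (SS_integrable hn hA hs hf hfn x) (SS_integrable hn hA hs (hgm k) (hgfin k) x)).trans
        ((h x _ (hf.sub (hgm k)).enorm).trans ?_)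
      gcongr
      exact hgf k
    have hb2 : Tendsto (fun k : ℕ => c * (((k + 1 : ℕ) : ℝ≥0∞)⁻¹) ^ (1 / (n:ℝ))) atTop (𝓝 0) := by
      have := ENNReal.Tendsto.const_mul (a := c) ((ENNReal.continuous_rpow_const (y := 1 / (n:ℝ))).tendsto 0 |>.comp htend0) (Or.inr hc)
      simpa [ENNReal.zero_rpow_of_pos (show 0 < (n:ℝ)⁻¹ by positivity)] using this
    exact tendsto_of_tendsto_of_tendsto_of_le_of_le tendsto_const_nhds hb2 (fun _ => bot_le) hb
  have hall : ∀ j : ℕ, ∫⁻ x, ‖SS A s f x‖ₑ ^ n ≤ K * (2 ^ n * ((∫⁻ y, ‖f y‖ₑ ^ n) + ((j + 1 : ℕ) : ℝ≥0∞)⁻¹)) := by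
    intro j
    refine fatou_pow (F := fun k => SS A s (g (k + j))) (fun k => SS_meas hA.cont s (hgm _))
      (fun x => (hpt x).comp (tendsto_add_atTop_nat j)) fun k => ?_
    refine (hK A hA s hs _ (hg _) (hgs _)).trans ?_
    gcongr
    refine (hgn _).trans ?_
    gcongr
    omega
  have hlim : Tendsto (fun j : ℕ => (K:ℝ≥0∞) * (2 ^ n * ((∫⁻ y, ‖f y‖ₑ ^ n) + ((j + 1 : ℕ) : ℝ≥0∞)⁻¹))) atTop
      (𝓝 (K * (2 ^ n * ((∫⁻ y, ‖f y‖ₑ ^ n) + 0)))) :=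
    ENNReal.Tendsto.const_mul (ENNReal.Tendsto.const_mul (htend0.const_add _) (Or.inr (by simp))) (Or.inr (by simp))
  refine (ge_of_tendsto' hlim hall).trans ?_
  rw [add_zero, ← mul_assoc]
  gcongr
  push_cast
  exact le_self_add

end
end CC

namespace CC
noncomputable section
open MeasureTheory Filter Set Metric Topology
open scoped ENNReal BigOperators ComplexConjugate NNReal

lemma prod_diff {ι : Type*} (t : Finset ι) (u v : ι → ℂ) (hu : ∀ i, ‖u i‖ ≤ 1) (hv : ∀ i, ‖v i‖ ≤ 1) :
    ‖∏ i ∈ t, u i - ∏ i ∈ t, v i‖ ≤ ∑ i ∈ t, ‖u i - v i‖ := by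
  classical
  induction t using Finset.induction_on with
  | empty => simp
  | insert a t ha ih =>
    rw [Finset.prod_insert ha, Finset.prod_insert ha, Finset.sum_insert ha]
    have e : u a * ∏ i ∈ t, u i - v a * ∏ i ∈ t, v i = (u a - v a) * ∏ i ∈ t, u i + v a * (∏ i ∈ t, u i - ∏ i ∈ t, v i) := by ring
    rw [e]
    refine (norm_add_le _ _).trans (add_le_add ?_ ?_)
    · rw [norm_mul, norm_prod]
      exact mul_le_of_le_one_right (norm_nonneg _) (Finset.prod_le_one (fun _ _ => norm_nonneg _) fun i _ => hu i)
    · rw [norm_mul]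
      exact (mul_le_of_le_one_left (norm_nonneg _) (hv a)).trans ih

/-- the kernel of `SS`. -/
def KK {m : ℕ} (A : Fin m → ℝ → ℝ) (s x y : ℝ) : ℂ := (∏ j, ((A j x - A j y : ℝ) : ℂ)) / XI s x y ^ (m + 1)

lemma KK_le {m : ℕ} {A : Fin m → ℝ → ℝ} (hA : Lip1 A) {s : ℝ} (hs : 0 < s) (x y : ℝ) :
    ‖KK A s x y‖ ≤ 2 / (|x - y| + s) := by
  have := ker_bd hs x y _ (fun j => hA j x y) 1
  simpa [KK] using this

lemma KK_form {m : ℕ} (A : Fin m → ℝ → ℝ) (s x y : ℝ) :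
    KK A s x y = 1 / XI s x y * ∏ j, (((A j x - A j y : ℝ) : ℂ) / XI s x y) := by
  rw [KK, Finset.prod_div_distrib, Finset.prod_const, Finset.card_univ, Fintype.card_fin, pow_succ, div_mul_div_comm,
    one_mul, mul_comm (XI s x y ^ m)]

lemma ratio_le {m : ℕ} {A : Fin m → ℝ → ℝ} (hA : Lip1 A) {s : ℝ} (hs : 0 < s) (x y : ℝ) (j : Fin m) :
    ‖((A j x - A j y : ℝ) : ℂ) / XI s x y‖ ≤ 1 := by
  rw [norm_div, Complex.norm_real, div_le_one (norm_pos_iff.2 (XI_ne hs x y))]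
  exact (hA j x y).trans (XI_norm_ge s x y)

lemma KK_diff {m : ℕ} {A : Fin m → ℝ → ℝ} (hA : Lip1 A) {s σ : ℝ} (hσ : 0 < σ) (hs : σ < s) {x x0 y : ℝ} (hx : |x - x0| < s)
    (hy : 2 * s ≤ |x0 - y|) : ‖KK A s x0 y - KK A σ x y‖ ≤ 18 * (m + 1) * (s / (|x0 - y| + s) ^ 2) := by
  have hs0 : 0 < s := hσ.trans hs
  set X := XI s x0 y with hX
  set X' := XI σ x y with hX'
  have hXn : X ≠ 0 := XI_ne hs0 _ _
  have hXn' : X' ≠ 0 := XI_ne hσ _ _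
  have hXX : ‖X' - X‖ ≤ 2 * s := by
    have : X' - X = ((x - x0 : ℝ) : ℂ) + ((σ - s : ℝ) : ℂ) * Complex.I := by
      simp only [hX, hX', XI]; push_cast; ring
    rw [this]
    refine (norm_add_le _ _).trans ?_
    rw [norm_mul, Complex.norm_real, Complex.norm_real, Complex.norm_I, Real.norm_eq_abs, Real.norm_eq_abs,
      abs_of_neg (by linarith : σ - s < 0)]
    linarith
  have hp := norm_pos_iff.2 hXn
  have hp' := norm_pos_iff.2 hXn'
  have hinv : ‖1 / X - 1 / X'‖ ≤ 2 * s / (‖X‖ * ‖X'‖) := by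
    have : 1 / X - 1 / X' = (X' - X) / (X * X') := by field_simp
    rw [this, norm_div, norm_mul]
    gcongr
  have hr : ∀ j, ‖((A j x0 - A j y : ℝ) : ℂ) / X - ((A j x - A j y : ℝ) : ℂ) / X'‖ ≤ 3 * s / ‖X'‖ := by
    intro j
    have e : ((A j x0 - A j y : ℝ) : ℂ) / X - ((A j x - A j y : ℝ) : ℂ) / X' =
        ((A j x0 - A j x : ℝ) : ℂ) / X' + ((A j x0 - A j y : ℝ) : ℂ) / X * ((X' - X) / X') := by
      push_cast; field_simp; ring
    rw [e]
    have h1 : ‖((A j x0 - A j x : ℝ) : ℂ) / X'‖ ≤ s / ‖X'‖ := by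
      rw [norm_div, Complex.norm_real]
      gcongr
      refine (hA j x0 x).trans ?_
      rw [abs_sub_comm]; exact hx.le
    have h2 : ‖((A j x0 - A j y : ℝ) : ℂ) / X * ((X' - X) / X')‖ ≤ 1 * (2 * s / ‖X'‖) := by
      rw [norm_mul]
      refine mul_le_mul (ratio_le hA hs0 _ _ j) ?_ (norm_nonneg _) zero_le_one
      rw [norm_div]
      gcongr
    refine (norm_add_le _ _).trans ((add_le_add h1 h2).trans_eq ?_)
    ring
  have hprod := (prod_diff Finset.univ _ _ (ratio_le hA hs0 x0 y) (ratio_le hA hσ x y)).trans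
    (Finset.sum_le_sum fun j _ => hr j)
  rw [Finset.sum_const, Finset.card_univ, Fintype.card_fin, nsmul_eq_mul] at hprod
  have hP' : ‖∏ j, (((A j x - A j y : ℝ) : ℂ) / X')‖ ≤ 1 := by
    rw [norm_prod]
    exact Finset.prod_le_one (fun _ _ => norm_nonneg _) fun j _ => ratio_le hA hσ x y j
  rw [KK_form, KK_form, ← hX, ← hX']
  set P := ∏ j, (((A j x0 - A j y : ℝ) : ℂ) / X)
  set P' := ∏ j, (((A j x - A j y : ℝ) : ℂ) / X')
  have e : 1 / X * P - 1 / X' * P' = 1 / X * (P - P') + (1 / X - 1 / X') * P' := by ring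
  have hd : (|x0 - y| + s) / 2 ≤ ‖X‖ := XI_norm_half hs0.le _ _
  have hd' : (|x0 - y| + s) / 3 ≤ ‖X'‖ := by
    have h1 := XI_norm_ge σ x y
    have h2 : |x0 - y| ≤ |x - x0| + |x - y| := by
      rw [abs_sub_comm x x0]
      exact abs_sub_le _ _ _
    rw [← hX'] at h1
    linarith
  have hdp : 0 < |x0 - y| + s := by positivity
  rw [e]
  calc _ ≤ ‖1 / X * (P - P')‖ + ‖(1 / X - 1 / X') * P'‖ := norm_add_le _ _
    _ ≤ 1 / ‖X‖ * (m * (3 * s / ‖X'‖)) + 2 * s / (‖X‖ * ‖X'‖) * 1 := by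
        rw [norm_mul, norm_mul, norm_div, norm_one]
        gcongr
    _ = (3 * m + 2) * s * (1 / (‖X‖ * ‖X'‖)) := by field_simp
    _ ≤ (3 * m + 2) * s * (1 / ((|x0 - y| + s) / 2 * ((|x0 - y| + s) / 3))) := by gcongr
    _ = 6 * (3 * m + 2) * (s / (|x0 - y| + s) ^ 2) := by field_simp; ring
    _ ≤ _ := by
        gcongr ?_ * _
        linarith

lemma SS_eq_KK {m : ℕ} (A : Fin m → ℝ → ℝ) (s : ℝ) (f : ℝ → ℂ) (x : ℝ) : SS A s f x = ∫ y, f y * KK A s x y := by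
  unfold SS KK
  simp_rw [mul_div_assoc]

lemma SS_int' {n : ℕ} (hn : 2 ≤ n) {m : ℕ} {A : Fin m → ℝ → ℝ} (hA : Lip1 A) {s : ℝ} (hs : 0 < s) {f : ℝ → ℂ} (hf : Measurable f)
    (hfn : ∫⁻ y, ‖f y‖ₑ ^ n ≠ ∞) (x : ℝ) : Integrable (fun y => f y * KK A s x y) := by
  simpa only [KK, mul_div_assoc] using SS_integrable hn hA hs hf hfn x

lemma cotlar_pt {n : ℕ} (hn : 2 ≤ n) {m : ℕ} {A : Fin m → ℝ → ℝ} (hA : Lip1 A) {s σ : ℝ} (hσ : 0 < σ) (hs : σ < s) {f : ℝ → ℂ} (hf : Measurable f)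
    (hfn : ∫⁻ y, ‖f y‖ₑ ^ n ≠ ∞) {x x0 : ℝ} (hx : x ∈ ball x0 s) :
    ‖SS A s f x0‖ₑ ≤ ENNReal.ofReal (72 * (m + 1)) * Mc (fun y => ‖f y‖ₑ) x0 +
      (‖SS A σ f x‖ₑ + ‖SS A σ ((ball x0 (2 * s)).indicator f) x‖ₑ) := by
  have hs0 : 0 < s := hσ.trans hs
  rw [mem_ball, Real.dist_eq] at hx
  set f1 := (ball x0 (2 * s)).indicator f with hf1
  have mf1 : Measurable f1 := hf.indicator measurableSet_ball
  have f1le : ∀ y, ‖f1 y‖ₑ ≤ ‖f y‖ₑ := fun y => by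
    simp only [hf1, indicator]; split_ifs <;> simp
  have hf1n : ∫⁻ y, ‖f1 y‖ₑ ^ n ≠ ∞ :=
    ((lintegral_mono fun y => pow_le_pow_left' (f1le y) n).trans_lt (lt_top_iff_ne_top.2 hfn)).ne
  have i1 := SS_int' hn hA hs0 hf hfn x0
  have i2 := SS_int' hn hA hσ hf hfn x
  have i3 := SS_int' hn hA hσ mf1 hf1n x
  have e : SS A s f x0 - (SS A σ f x - SS A σ f1 x) = ∫ y, (f y * KK A s x0 y - (f y * KK A σ x y - f1 y * KK A σ x y)) := by
    have i4 : Integrable (fun y => f y * KK A σ x y - f1 y * KK A σ x y) volume := i2.sub i3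
    rw [integral_sub i1 i4, integral_sub i2 i3, SS_eq_KK, SS_eq_KK, SS_eq_KK]
  have hb : ‖SS A s f x0 - (SS A σ f x - SS A σ f1 x)‖ₑ ≤ ENNReal.ofReal (72 * (m + 1)) * Mc (fun y => ‖f y‖ₑ) x0 := by
    rw [e]
    calc _ ≤ ∫⁻ y, ENNReal.ofReal (18 * (m + 1)) * (‖f y‖ₑ * ENNReal.ofReal (s / (|x0 - y| + s) ^ 2)) := by
          refine (enorm_integral_le_lintegral_enorm _).trans (lintegral_mono fun y => ?_)
          have hd : 0 < |x0 - y| + s := by positivity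
          have key : ‖f y * KK A s x0 y - (f y * KK A σ x y - f1 y * KK A σ x y)‖ ≤
              18 * (m + 1) * (‖f y‖ * (s / (|x0 - y| + s) ^ 2)) := by
            by_cases hy : y ∈ ball x0 (2 * s)
            · have : f1 y = f y := indicator_of_mem hy f
              rw [this, sub_self, sub_zero, norm_mul]
              rw [mem_ball, Real.dist_eq, abs_sub_comm] at hy
              have h1 := KK_le hA hs0 x0 y
              have h2 : 2 / (|x0 - y| + s) ≤ 6 * (s / (|x0 - y| + s) ^ 2) := by
                rw [← mul_div_assoc, div_le_div_iff₀ hd (by positivity)]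
                nlinarith
              calc _ ≤ ‖f y‖ * (6 * (s / (|x0 - y| + s) ^ 2)) := by gcongr; exact h1.trans h2
                _ = 6 * (‖f y‖ * (s / (|x0 - y| + s) ^ 2)) := by ring
                _ ≤ _ := by
                    gcongr ?_ * _
                    have : (0:ℝ) ≤ m := by positivity
                    linarith
            · have : f1 y = 0 := indicator_of_notMem hy f
              rw [this, zero_mul, sub_zero, ← mul_sub, norm_mul]
              rw [mem_ball, Real.dist_eq, abs_sub_comm, not_lt] at hy
              calc _ ≤ ‖f y‖ * (18 * (m + 1) * (s / (|x0 - y| + s) ^ 2)) := by gcongr; exact KK_diff hA hσ hs hx hy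
                _ = _ := by ring
          rw [← ofReal_norm, ← ofReal_norm, ← ENNReal.ofReal_mul (norm_nonneg _), ← ENNReal.ofReal_mul (by positivity)]
          exact ENNReal.ofReal_le_ofReal key
      _ = ENNReal.ofReal (18 * (m + 1)) * ∫⁻ y, ‖f y‖ₑ * ENNReal.ofReal (s / (|x0 - y| + s) ^ 2) := by
          rw [lintegral_const_mul _ (by fun_prop)]
      _ ≤ ENNReal.ofReal (18 * (m + 1)) * (4 * Mc (fun y => ‖f y‖ₑ) x0) := by
          gcongr
          exact poisson_le hf.enorm x0 hs0
      _ = _ := by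
          rw [← mul_assoc]
          congr 1
          rw [show (4:ℝ≥0∞) = ENNReal.ofReal 4 by simp, ← ENNReal.ofReal_mul (by positivity)]
          congr 1; ring
  calc ‖SS A s f x0‖ₑ = ‖(SS A s f x0 - (SS A σ f x - SS A σ f1 x)) + (SS A σ f x - SS A σ f1 x)‖ₑ := by simp
    _ ≤ _ := (enorm_add_le _ _).trans (add_le_add hb enorm_sub_le)

lemma three_pow (u v w : ℝ≥0∞) (r : ℕ) : (u + (v + w)) ^ r ≤ 4 ^ r * (u ^ r + (v ^ r + w ^ r)) := by
  calc _ ≤ 2 ^ r * (u ^ r + (v + w) ^ r) := add_pow_le' _ _ _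
    _ ≤ 2 ^ r * (2 ^ r * u ^ r + 2 ^ r * (v ^ r + w ^ r)) := by
        gcongr
        · exact le_mul_of_one_le_left bot_le (one_le_pow₀ (by norm_num))
        · exact add_pow_le' _ _ _
    _ = _ := by
        rw [show (4:ℝ≥0∞) = 2 * 2 by norm_num, mul_pow]; ring

lemma cotlar_avg {r : ℕ} {m : ℕ} {K : ℝ≥0}
    (hK : ∀ A : Fin m → ℝ → ℝ, Lip1 A → ∀ s : ℝ, 0 < s → ∀ f : ℝ → ℂ, Measurable f → ∫⁻ x, ‖SS A s f x‖ₑ ^ r ≤ K * ∫⁻ x, ‖f x‖ₑ ^ r)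
    (hr : r ≠ 0) {n : ℕ} (hn : 2 ≤ n) {A : Fin m → ℝ → ℝ} (hA : Lip1 A) {s σ : ℝ} (hσ : 0 < σ) (hs : σ < s) {f : ℝ → ℂ} (hf : Measurable f)
    (hfn : ∫⁻ y, ‖f y‖ₑ ^ n ≠ ∞) (x0 : ℝ) :
    ‖SS A s f x0‖ₑ ^ r ≤ 4 ^ r * ((ENNReal.ofReal (72 * (m + 1)) * Mc (fun y => ‖f y‖ₑ) x0) ^ r +
      (Mc (fun y => ‖SS A σ f y‖ₑ ^ r) x0 + 2 * K * Mc (fun y => ‖f y‖ₑ ^ r) x0)) := by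
  have hs0 : 0 < s := hσ.trans hs
  set f1 := (ball x0 (2 * s)).indicator f with hf1
  have mf1 : Measurable f1 := hf.indicator measurableSet_ball
  set L := ENNReal.ofReal (2 * s) with hL
  have hL0 : L ≠ 0 := by rw [hL, Ne, ENNReal.ofReal_eq_zero]; linarith
  have hLt : L ≠ ∞ := ENNReal.ofReal_ne_top
  have hvol : volume (ball x0 s) = L := by rw [Real.volume_ball]
  set c := (ENNReal.ofReal (72 * (m + 1)) * Mc (fun y => ‖f y‖ₑ) x0) ^ r with hc
  have mS := SS_meas hA.cont σ hf
  have mS1 := SS_meas hA.cont σ mf1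
  have h1 : L * ‖SS A s f x0‖ₑ ^ r ≤ L * (4 ^ r * (c + (Mc (fun y => ‖SS A σ f y‖ₑ ^ r) x0 + 2 * K * Mc (fun y => ‖f y‖ₑ ^ r) x0))) := by
    calc L * ‖SS A s f x0‖ₑ ^ r = ∫⁻ _x in ball x0 s, ‖SS A s f x0‖ₑ ^ r := by
          rw [setLIntegral_const, hvol, mul_comm]
      _ ≤ ∫⁻ x in ball x0 s, 4 ^ r * (c + (‖SS A σ f x‖ₑ ^ r + ‖SS A σ f1 x‖ₑ ^ r)) := by
          refine setLIntegral_mono' measurableSet_ball fun x hx => ?_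
          exact (pow_le_pow_left' (cotlar_pt hn hA hσ hs hf hfn hx) r).trans (three_pow _ _ _ r)
      _ = 4 ^ r * (L * c + ((∫⁻ x in ball x0 s, ‖SS A σ f x‖ₑ ^ r) + ∫⁻ x in ball x0 s, ‖SS A σ f1 x‖ₑ ^ r)) := by
          rw [lintegral_const_mul _ (by fun_prop), lintegral_add_left (by fun_prop), lintegral_add_left (by fun_prop),
            setLIntegral_const, hvol, mul_comm c]
      _ ≤ 4 ^ r * (L * c + (L * Mc (fun y => ‖SS A σ f y‖ₑ ^ r) x0 + L * (2 * K * Mc (fun y => ‖f y‖ₑ ^ r) x0))) := by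
          gcongr
          · exact le_Mc _ x0 hs0
          · calc _ ≤ ∫⁻ x, ‖SS A σ f1 x‖ₑ ^ r := setLIntegral_le_lintegral _ _
              _ ≤ K * ∫⁻ x, ‖f1 x‖ₑ ^ r := hK A hA σ hσ f1 mf1
              _ = K * ∫⁻ x in ball x0 (2 * s), ‖f x‖ₑ ^ r := by
                  rw [← lintegral_indicator measurableSet_ball]
                  congr 1
                  refine lintegral_congr fun y => ?_
                  simp only [hf1, indicator]
                  split_ifs <;> simp [hr]
              _ ≤ K * (ENNReal.ofReal (2 * (2 * s)) * Mc (fun y => ‖f y‖ₑ ^ r) x0) := by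
                  gcongr
                  exact le_Mc _ x0 (by linarith)
              _ = _ := by
                  rw [ENNReal.ofReal_mul (p := 2) (by norm_num), ← hL, ENNReal.ofReal_ofNat]
                  ring
      _ = _ := by ring
  exact (ENNReal.mul_le_mul_iff_right hL0 hLt).1 h1

/-- Cotlar-type maximal bound -/
lemma cotlar_max (k m : ℕ) : ∃ K : ℝ≥0, ∀ A : Fin m → ℝ → ℝ, Lip1 A → ∀ f : ℝ → ℂ, Measurable f → ∫⁻ y, ‖f y‖ₑ ^ (2 * 2 ^ (k + 1)) ≠ ∞ →
    ∃ G : ℝ → ℝ≥0∞, Measurable G ∧ (∀ s : ℝ, 0 < s → ∀ x, ‖SS A s f x‖ₑ ^ 2 ^ (k + 1) ≤ G x) ∧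
      ∫⁻ x, G x ^ 2 ≤ K * ∫⁻ x, ‖f x‖ₑ ^ (2 * 2 ^ (k + 1)) := by
  set r := 2 ^ (k + 1) with hr
  have hr2 : 2 ≤ r := by
    calc 2 = 2 ^ 1 := by norm_num
      _ ≤ 2 ^ (k + 1) := Nat.pow_le_pow_right (by norm_num) (by omega)
  obtain ⟨K1, hK1⟩ := SS_Ln hr2 (BT_all k) m
  obtain ⟨K2, hK2⟩ := SS_Ln (n := 2 * r) (by omega) (by rw [hr, show 2 * 2 ^ (k + 1) = 2 ^ (k + 1 + 1) by ring]; exact BT_all (k + 1)) m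
  obtain ⟨c1, hc1⟩ := Mc_nat (n := 2) le_rfl
  obtain ⟨c2, hc2⟩ := Mc_nat (n := 2 * r) (by omega)
  set D := (72 * (m + 1) : ℝ).toNNReal with hD
  refine ⟨(4 ^ r) ^ 2 * (4 ^ 2 * (D ^ (2 * r) * c2 + (c1 * K2 + (2 * K1) ^ 2 * c1))), fun A hA f hf hfn => ?_⟩
  set H : ℝ → ℝ → ℝ≥0∞ := fun σ x0 => 4 ^ r * ((ENNReal.ofReal (72 * (m + 1)) * Mc (fun y => ‖f y‖ₑ) x0) ^ r +
      (Mc (fun y => ‖SS A σ f y‖ₑ ^ r) x0 + 2 * K1 * Mc (fun y => ‖f y‖ₑ ^ r) x0)) with hH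
  have mM := fun g => measurable_Mc g
  have mH : ∀ σ, Measurable (H σ) := fun σ => by
    have h1 := mM (fun y => ‖f y‖ₑ)
    have h2 := mM (fun y => ‖SS A σ f y‖ₑ ^ r)
    have h3 := mM (fun y => ‖f y‖ₑ ^ r)
    simp only [hH]
    fun_prop
  have hpos : ∀ k : ℕ, (0:ℝ) < 1 / ((k:ℝ) + 1) := fun k => by positivity
  refine ⟨fun x => liminf (fun k : ℕ => H (1 / ((k:ℝ) + 1)) x) atTop, Measurable.liminf fun k => mH _, ?_, ?_⟩
  · intro s hs x
    refine le_liminf_of_le (by isBoundedDefault) ?_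
    have := (tendsto_one_div_add_atTop_nhds_zero_nat (𝕜 := ℝ)).eventually (gt_mem_nhds hs)
    filter_upwards [this] with k hk
    exact cotlar_avg hK1 (by omega) (n := 2 * r) (by omega) hA (hpos k) hk hf hfn x
  · have hHb : ∀ σ, 0 < σ → ∫⁻ x, H σ x ^ 2 ≤ ((4 ^ r) ^ 2 * (4 ^ 2 * (D ^ (2 * r) * c2 + (c1 * K2 + (2 * K1) ^ 2 * c1))) : ℝ≥0) *
        ∫⁻ x, ‖f x‖ₑ ^ (2 * r) := by
      intro σ hσ
      have mS := SS_meas hA.cont σ hf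
      calc _ ≤ ∫⁻ x, (4 ^ r) ^ 2 * (4 ^ 2 * ((D:ℝ≥0∞) ^ (2 * r) * Mc (fun y => ‖f y‖ₑ) x ^ (2 * r) +
              (Mc (fun y => ‖SS A σ f y‖ₑ ^ r) x ^ 2 + (2 * K1) ^ 2 * Mc (fun y => ‖f y‖ₑ ^ r) x ^ 2))) := by
            refine lintegral_mono fun x => ?_
            simp only [hH]
            rw [mul_pow]
            refine mul_le_mul_right ((three_pow _ _ _ 2).trans_eq ?_) _
            rw [← pow_mul, mul_pow, mul_pow (2 * (K1:ℝ≥0∞)), mul_comm r 2]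
            rfl
        _ = (4 ^ r) ^ 2 * (4 ^ 2 * ((D:ℝ≥0∞) ^ (2 * r) * (∫⁻ x, Mc (fun y => ‖f y‖ₑ) x ^ (2 * r)) +
              ((∫⁻ x, Mc (fun y => ‖SS A σ f y‖ₑ ^ r) x ^ 2) + (2 * K1) ^ 2 * ∫⁻ x, Mc (fun y => ‖f y‖ₑ ^ r) x ^ 2))) := by
            have h1 := mM (fun y => ‖f y‖ₑ)
            have h2 := mM (fun y => ‖SS A σ f y‖ₑ ^ r)
            have h3 := mM (fun y => ‖f y‖ₑ ^ r)
            rw [lintegral_const_mul _ (by fun_prop), lintegral_const_mul _ (by fun_prop), lintegral_add_left (by fun_prop),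
              lintegral_add_left (by fun_prop), lintegral_const_mul _ (by fun_prop), lintegral_const_mul _ (by fun_prop)]
        _ ≤ (4 ^ r) ^ 2 * (4 ^ 2 * ((D:ℝ≥0∞) ^ (2 * r) * (c2 * ∫⁻ x, ‖f x‖ₑ ^ (2 * r)) +
              (c1 * (K2 * ∫⁻ x, ‖f x‖ₑ ^ (2 * r)) + (2 * K1) ^ 2 * (c1 * ∫⁻ x, ‖f x‖ₑ ^ (2 * r))))) := by
            gcongr
            · exact hc2 _ hf.enorm
            · refine (hc1 _ (mS.enorm.pow_const r)).trans ?_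
              gcongr
              simp_rw [← pow_mul, mul_comm r 2]
              exact hK2 A hA σ hσ f hf
            · refine (hc1 _ (hf.enorm.pow_const r)).trans_eq ?_
              simp_rw [← pow_mul, mul_comm r 2]
        _ = _ := by push_cast; ring
    calc _ ≤ ∫⁻ x, liminf (fun k : ℕ => H (1 / ((k:ℝ) + 1)) x ^ 2) atTop := by
          refine lintegral_mono fun x => ?_
          have hmono : Monotone fun u : ℝ≥0∞ => u ^ 2 := fun u v h => pow_le_pow_left' h 2
          exact (hmono.map_liminf_of_continuousAt _ ((ENNReal.continuous_pow 2).continuousAt)).le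
      _ ≤ liminf (fun k : ℕ => ∫⁻ x, H (1 / ((k:ℝ) + 1)) x ^ 2) atTop := lintegral_liminf_le fun k => (mH _).pow_const 2
      _ ≤ _ := liminf_le_of_le (by isBoundedDefault) fun b hb => by
          obtain ⟨k, hk⟩ := hb.exists
          exact hk.trans (hHb _ (hpos k))

end
end CC

namespace CC
noncomputable section
open MeasureTheory Filter Set Metric Topology
open scoped ENNReal BigOperators ComplexConjugate NNReal

lemma gen_diff {m : ℕ} (u v : Fin m → ℂ) {X Y : ℂ} (hX : X ≠ 0) (hY : Y ≠ 0) (hu : ∀ j, ‖u j‖ ≤ ‖X‖) (hv : ∀ j, ‖v j‖ ≤ ‖Y‖)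
    {δ1 δ2 : ℝ} (h1 : ∀ j, ‖u j - v j‖ ≤ δ1) (h2 : ‖Y - X‖ ≤ δ2) (h0 : 0 ≤ δ1) :
    ‖(∏ j, u j) / X ^ (m + 1) - (∏ j, v j) / Y ^ (m + 1)‖ ≤ (m + 1) * (δ1 + δ2) / (‖X‖ * ‖Y‖) := by
  have form : ∀ (w : Fin m → ℂ) (Z : ℂ), (∏ j, w j) / Z ^ (m + 1) = 1 / Z * ∏ j, (w j / Z) := by
    intro w Z
    rw [Finset.prod_div_distrib, Finset.prod_const, Finset.card_univ, Fintype.card_fin, pow_succ, div_mul_div_comm,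
      one_mul, mul_comm (Z ^ m)]
  have hp := norm_pos_iff.2 hX
  have hp' := norm_pos_iff.2 hY
  have h20 : 0 ≤ δ2 := (norm_nonneg _).trans h2
  have ru : ∀ j, ‖u j / X‖ ≤ 1 := fun j => by rw [norm_div, div_le_one hp]; exact hu j
  have rv : ∀ j, ‖v j / Y‖ ≤ 1 := fun j => by rw [norm_div, div_le_one hp']; exact hv j
  have hr : ∀ j, ‖u j / X - v j / Y‖ ≤ (δ1 + δ2) / ‖Y‖ := by
    intro j
    have e : u j / X - v j / Y = (u j - v j) / Y + u j / X * ((Y - X) / Y) := by field_simp; ring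
    rw [e]
    have a1 : ‖(u j - v j) / Y‖ ≤ δ1 / ‖Y‖ := by rw [norm_div]; gcongr; exact h1 j
    have a2 : ‖u j / X * ((Y - X) / Y)‖ ≤ 1 * (δ2 / ‖Y‖) := by
      rw [norm_mul]
      refine mul_le_mul (ru j) ?_ (norm_nonneg _) zero_le_one
      rw [norm_div]; gcongr
    refine (norm_add_le _ _).trans ((add_le_add a1 a2).trans_eq ?_)
    ring
  have hprod := (prod_diff Finset.univ _ _ ru rv).trans (Finset.sum_le_sum fun j _ => hr j)
  rw [Finset.sum_const, Finset.card_univ, Fintype.card_fin, nsmul_eq_mul] at hprod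
  have hP : ‖∏ j, (v j / Y)‖ ≤ 1 := by
    rw [norm_prod]
    exact Finset.prod_le_one (fun _ _ => norm_nonneg _) fun j _ => rv j
  rw [form, form]
  set P := ∏ j, (u j / X)
  set Q := ∏ j, (v j / Y)
  have e : 1 / X * P - 1 / Y * Q = 1 / X * (P - Q) + (Y - X) / (X * Y) * Q := by field_simp; ring
  rw [e]
  calc _ ≤ ‖1 / X * (P - Q)‖ + ‖(Y - X) / (X * Y) * Q‖ := norm_add_le _ _
    _ ≤ 1 / ‖X‖ * (m * ((δ1 + δ2) / ‖Y‖)) + δ2 / (‖X‖ * ‖Y‖) * 1 := by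
        rw [norm_mul, norm_mul, norm_div, norm_one, norm_div, norm_mul]
        gcongr
    _ = (m * (δ1 + δ2) + δ2) / (‖X‖ * ‖Y‖) := by field_simp
    _ ≤ _ := by
        gcongr
        linarith

/-- truncated (real) kernel -/
def KT {m : ℕ} (B : Fin m → ℝ → ℝ) (ε x y : ℝ) : ℝ :=
  if ε < |x - y| then (∏ j, (B j x - B j y)) / (x - y) ^ (m + 1) else 0

lemma KT_le {m : ℕ} {B : Fin m → ℝ → ℝ} {ε x y : ℝ} (hε : 0 < ε) (hB : ∀ j, |B j x - B j y| ≤ |x - y|) :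
    |KT B ε x y| ≤ 2 / (|x - y| + ε) := by
  unfold KT
  split_ifs with h
  · have hD : 0 < |x - y| := hε.trans h
    rw [abs_div, Finset.abs_prod, abs_pow]
    have h1 : ∏ j, |B j x - B j y| ≤ |x - y| ^ m := by
      calc ∏ j, |B j x - B j y| ≤ ∏ _j : Fin m, |x - y| := Finset.prod_le_prod (fun _ _ => abs_nonneg _) fun j _ => hB j
        _ = _ := by simp
    calc _ ≤ |x - y| ^ m / |x - y| ^ (m + 1) := by gcongr
      _ = 1 / |x - y| := by rw [pow_succ]; field_simp
      _ ≤ _ := by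
        rw [div_le_div_iff₀ hD (by positivity)]
        linarith
  · rw [abs_zero]; positivity

lemma ker_core {m : ℕ} {B A : Fin m → ℝ → ℝ} {ε x y w d : ℝ} (hε : 0 < ε) (hA : Lip1 A) (hB : ∀ j, |B j x - B j y| ≤ |x - y|)
    (hx : ∀ j, B j x = A j x) (hy : ∀ j, |B j y - A j y| ≤ 2 * d) (hd : d ≤ |x - y|) (hw : |w - y| ≤ d / 2) :
    ‖(KT B ε x y : ℂ) - KK A ε x w‖ ≤ 8 * (m + 1) * (d / |x - y| ^ 2 + ε / (|x - y| + ε) ^ 2) := by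
  have hd0 : 0 ≤ d := by linarith [abs_nonneg (w - y)]
  have hm : (0:ℝ) ≤ m := by positivity
  have hxw : |x - y| / 2 ≤ |x - w| := by
    have := abs_sub_le x w y
    linarith
  set D := |x - y| with hDdef
  have hD0 : 0 ≤ D := abs_nonneg _
  unfold KT
  split_ifs with h
  · rw [← hDdef] at h
    have hD : 0 < D := hε.trans h
    have hX : ((x - y : ℝ) : ℂ) ≠ 0 := by
      rw [Ne, Complex.ofReal_eq_zero, ← abs_eq_zero]; exact hD.ne'
    have hXn : ‖((x - y : ℝ) : ℂ)‖ = D := by rw [Complex.norm_real]; rfl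
    have key := gen_diff (m := m) (fun j => ((B j x - B j y : ℝ) : ℂ)) (fun j => ((A j x - A j w : ℝ) : ℂ)) hX (XI_ne hε x w)
      (fun j => by rw [Complex.norm_real, hXn]; exact hB j)
      (fun j => by rw [Complex.norm_real]; exact (hA j x w).trans (XI_norm_ge ε x w))
      (δ1 := 5 / 2 * d) (δ2 := d / 2 + ε)
      (fun j => by
        rw [← Complex.ofReal_sub, Complex.norm_real, Real.norm_eq_abs, hx j]
        have e : A j x - B j y - (A j x - A j w) = -(B j y - A j y) + (A j w - A j y) := by ring
        rw [e]
        refine (abs_add_le _ _).trans ?_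
        rw [abs_neg]
        have := hA j w y
        linarith [hy j])
      (by
        have e : XI ε x w - ((x - y : ℝ) : ℂ) = ((y - w : ℝ) : ℂ) + (ε : ℂ) * Complex.I := by
          simp only [XI]; push_cast; ring
        rw [e]
        refine (norm_add_le _ _).trans ?_
        rw [norm_mul, Complex.norm_real, Complex.norm_real, Complex.norm_I, Real.norm_eq_abs, Real.norm_eq_abs, abs_of_pos hε,
          abs_sub_comm]
        linarith)
      (by positivity)
    have hY : D / 2 ≤ ‖XI ε x w‖ := hxw.trans (XI_norm_ge ε x w)
    rw [hXn] at key
    have e2 : (((∏ j, (B j x - B j y)) / (x - y) ^ (m + 1) : ℝ) : ℂ) =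
        (∏ j, ((B j x - B j y : ℝ) : ℂ)) / ((x - y : ℝ) : ℂ) ^ (m + 1) := by push_cast; rfl
    rw [e2]
    refine key.trans ?_
    have h3 : ε / D ^ 2 ≤ 4 * (ε / (D + ε) ^ 2) := by
      rw [← mul_div_assoc, div_le_div_iff₀ (by positivity) (by positivity)]
      have : (D + ε) ^ 2 ≤ 4 * D ^ 2 := by nlinarith
      nlinarith
    have h4 : 0 ≤ d / D ^ 2 := by positivity
    calc _ ≤ (m + 1) * (5 / 2 * d + (d / 2 + ε)) / (D * (D / 2)) := by gcongr
      _ = 2 * (m + 1) * (3 * (d / D ^ 2) + ε / D ^ 2) := by field_simp; ring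
      _ ≤ 2 * (m + 1) * (4 * (d / D ^ 2) + 4 * (ε / (D + ε) ^ 2)) := by gcongr; linarith
      _ = _ := by ring
  · rw [← hDdef, not_lt] at h
    rw [Complex.ofReal_zero, zero_sub, norm_neg]
    have h1 := KK_le hA hε x w
    have h4 : 0 ≤ d / D ^ 2 := by positivity
    have h5 : 0 ≤ ε / (D + ε) ^ 2 := by positivity
    calc _ ≤ 2 / (|x - w| + ε) := h1
      _ ≤ 2 / ((D + ε) / 2) := by gcongr; linarith
      _ ≤ 8 * (ε / (D + ε) ^ 2) := by
          rw [div_div_eq_mul_div, ← mul_div_assoc, div_le_div_iff₀ (by positivity) (by positivity)]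
          nlinarith [mul_nonneg (show 0 ≤ ε - D by linarith) (show 0 ≤ D + ε by linarith)]
      _ ≤ _ := by nlinarith

/-- averaging density -/
def th (F : Set ℝ) (y w : ℝ) : ℝ := if |w - y| < infDist y F / 2 then 1 / infDist y F else 0

lemma th_nonneg (F : Set ℝ) (y w : ℝ) : 0 ≤ th F y w := by
  unfold th; split_ifs
  · exact div_nonneg zero_le_one infDist_nonneg
  · exact le_rfl

lemma th_meas (F : Set ℝ) : Measurable fun q : ℝ × ℝ => th F q.1 q.2 := by
  have h1 : Continuous fun q : ℝ × ℝ => infDist q.1 F := (continuous_infDist_pt F).comp continuous_fst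
  unfold th
  refine Measurable.ite (measurableSet_lt (by fun_prop) (by have := h1.measurable; fun_prop)) ?_ measurable_const
  exact measurable_const.div h1.measurable

lemma th_int (F : Set ℝ) (hF : IsClosed F) (hne : F.Nonempty) (y : ℝ) :
    ∫⁻ w, ENNReal.ofReal (th F y w) = Fᶜ.indicator (fun _ => 1) y := by
  by_cases hy : y ∈ F
  · have h0 : infDist y F = 0 := infDist_zero_of_mem hy
    have : ∀ w, th F y w = 0 := fun w => by
      unfold th; rw [h0, if_neg]; simp
    simp [this, hy]
  · have hp : 0 < infDist y F := (hF.notMem_iff_infDist_pos hne).1 hy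
    have e : ∀ w, ENNReal.ofReal (th F y w) = (ball y (infDist y F / 2)).indicator (fun _ => ENNReal.ofReal (1 / infDist y F)) w := by
      intro w
      unfold th
      by_cases h : |w - y| < infDist y F / 2
      · rw [if_pos h, indicator_of_mem]; rw [mem_ball, Real.dist_eq]; exact h
      · rw [if_neg h, indicator_of_notMem, ENNReal.ofReal_zero]; rw [mem_ball, Real.dist_eq]; exact h
    simp_rw [e]
    rw [lintegral_indicator measurableSet_ball, setLIntegral_const, Real.volume_ball, indicator_of_mem (by exact hy),
      ← ENNReal.ofReal_mul (by positivity)]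
    rw [show 1 / infDist y F * (2 * (infDist y F / 2)) = 1 by field_simp, ENNReal.ofReal_one]

lemma th_avg (F : Set ℝ) (hF : IsClosed F) (hne : F.Nonempty) {g : ℝ → ℝ≥0∞} (hM : ∀ z ∈ F, Mc g z ≤ 1) (w : ℝ) :
    ∫⁻ y, g y * ENNReal.ofReal (th F y w) ≤ Fᶜ.indicator (fun _ => 6) w := by
  have hlip : ∀ a b, infDist a F ≤ infDist b F + |a - b| := fun a b => by
    rw [← Real.dist_eq]; exact infDist_le_infDist_add_dist
  by_cases hw : w ∈ F
  · have h0 : infDist w F = 0 := infDist_zero_of_mem hw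
    have : ∀ y, th F y w = 0 := fun y => by
      unfold th; rw [if_neg]
      intro h
      have := hlip y w
      rw [h0, abs_sub_comm] at this
      linarith [abs_nonneg (w - y)]
    simp [this]
  · have hp : 0 < infDist w F := (hF.notMem_iff_infDist_pos hne).1 hw
    obtain ⟨z, hz, hzw⟩ := hF.exists_infDist_eq_dist hne w
    set d := infDist w F with hd
    rw [indicator_of_mem (by exact hw)]
    calc _ ≤ ∫⁻ y, (ball z (2 * d)).indicator (fun y => ENNReal.ofReal (3 / 2 / d) * g y) y := by
          refine lintegral_mono fun y => ?_
          unfold th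
          split_ifs with h
          · have h1 := hlip w y
            have h2 := hlip y w
            rw [abs_sub_comm] at h2
            rw [← hd] at h1 h2
            have h3 : 0 < infDist y F := by linarith [abs_nonneg (w - y)]
            rw [indicator_of_mem, mul_comm]
            · refine mul_le_mul_left (ENNReal.ofReal_le_ofReal ?_) _
              rw [div_le_div_iff₀ h3 hp]
              linarith
            · rw [mem_ball]
              have := dist_triangle y w z
              rw [← hzw, dist_comm y w, Real.dist_eq w y] at this
              linarith
          · simp
      _ = ∫⁻ y in ball z (2 * d), ENNReal.ofReal (3 / 2 / d) * g y := lintegral_indicator measurableSet_ball _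
      _ = ENNReal.ofReal (3 / 2 / d) * ∫⁻ y in ball z (2 * d), g y := lintegral_const_mul' _ _ ENNReal.ofReal_ne_top
      _ ≤ ENNReal.ofReal (3 / 2 / d) * (ENNReal.ofReal (2 * (2 * d)) * 1) := by
          gcongr
          exact (le_Mc g z (by linarith)).trans (mul_le_mul_right (hM z hz) _)
      _ = 6 := by
          rw [mul_one, ← ENNReal.ofReal_mul (by positivity), show 3 / 2 / d * (2 * (2 * d)) = 6 by field_simp; norm_num]
          simp

lemma int_Omega (F : Set ℝ) (hF : IsClosed F) (hne : F.Nonempty) {g : ℝ → ℝ≥0∞} (hg : Measurable g) (hM : ∀ z ∈ F, Mc g z ≤ 1) :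
    ∫⁻ y in Fᶜ, g y ≤ 6 * volume Fᶜ := by
  have mt := th_meas F
  calc ∫⁻ y in Fᶜ, g y = ∫⁻ y, g y * ∫⁻ w, ENNReal.ofReal (th F y w) := by
        rw [← lintegral_indicator hF.isOpen_compl.measurableSet]
        refine lintegral_congr fun y => ?_
        rw [th_int F hF hne]
        simp only [indicator]
        split_ifs <;> simp
    _ = ∫⁻ y, ∫⁻ w, g y * ENNReal.ofReal (th F y w) := by
        refine lintegral_congr fun y => ?_
        rw [lintegral_const_mul]
        exact (mt.comp (by fun_prop : Measurable fun w : ℝ => (y, w))).ennreal_ofReal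
    _ = ∫⁻ w, ∫⁻ y, g y * ENNReal.ofReal (th F y w) := by
        rw [lintegral_lintegral_swap]
        exact ((hg.comp measurable_fst).mul mt.ennreal_ofReal).aemeasurable
    _ ≤ ∫⁻ w, Fᶜ.indicator (fun _ => 6) w := lintegral_mono fun w => th_avg F hF hne hM w
    _ = _ := by rw [lintegral_indicator hF.isOpen_compl.measurableSet, setLIntegral_const]

/-- Marcinkiewicz-type integral -/
def JJ (F : Set ℝ) (g : ℝ → ℝ≥0∞) (x : ℝ) : ℝ≥0∞ := ∫⁻ y, g y * ENNReal.ofReal (infDist y F / |x - y| ^ 2)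

lemma int_far {d : ℝ} (hd : 0 < d) (y : ℝ) : ∫⁻ x in {x | d ≤ |x - y|}, ENNReal.ofReal (d / |x - y| ^ 2) ≤ 8 := by
  have h1 : ∀ x ∈ {x | d ≤ |x - y|}, ENNReal.ofReal (d / |x - y| ^ 2) ≤ 4 * ENNReal.ofReal (d / (|x - y| + d) ^ 2) := by
    intro x hx
    have hx : d ≤ |x - y| := hx
    have hp : 0 < |x - y| := hd.trans_le hx
    rw [show (4:ℝ≥0∞) = ENNReal.ofReal 4 by simp, ← ENNReal.ofReal_mul (by norm_num)]
    refine ENNReal.ofReal_le_ofReal ?_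
    rw [← mul_div_assoc, div_le_div_iff₀ (by positivity) (by positivity)]
    have : (|x - y| + d) ^ 2 ≤ 4 * |x - y| ^ 2 := by nlinarith
    nlinarith
  have mS : MeasurableSet {x : ℝ | d ≤ |x - y|} := measurableSet_le measurable_const (by fun_prop)
  have hab : ∫⁻ t : ℝ, ENNReal.ofReal (d / (|t| + d) ^ 2) ≤ 2 := by
    have hI := int_sq hd le_rfl
    have e1 : ∫⁻ t in Ioi (0:ℝ), ENNReal.ofReal (d / (|t| + d) ^ 2) = 1 := by
      rw [← show ENNReal.ofReal (d / (0 + d)) = 1 by rw [zero_add, div_self hd.ne', ENNReal.ofReal_one], ← hI]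
      refine setLIntegral_congr_fun measurableSet_Ioi fun t ht => ?_
      rw [abs_of_pos ht]
    have e2 : ∫⁻ t in Iic (0:ℝ), ENNReal.ofReal (d / (|t| + d) ^ 2) = 1 := by
      rw [← e1, ← lintegral_indicator measurableSet_Iic, ← lintegral_indicator measurableSet_Ioi,
        ← lintegral_neg_eq_self]
      refine lintegral_congr_ae ?_
      have : ∀ᵐ t : ℝ, t ≠ 0 := by simp [ae_iff]
      filter_upwards [this] with t ht
      simp only [indicator, mem_Iic, mem_Ioi, abs_neg]
      rcases lt_or_gt_of_ne ht with h | h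
      · rw [if_neg (by linarith), if_neg (by linarith)]
      · rw [if_pos (by linarith), if_pos h]
    have := lintegral_add_compl (μ := volume) (fun t : ℝ => ENNReal.ofReal (d / (|t| + d) ^ 2)) (measurableSet_Ioi (a := (0:ℝ)))
    rw [compl_Ioi, e1, e2] at this
    rw [← this]; norm_num
  calc _ ≤ ∫⁻ x in {x | d ≤ |x - y|}, 4 * ENNReal.ofReal (d / (|x - y| + d) ^ 2) := setLIntegral_mono' mS h1
    _ ≤ ∫⁻ x, 4 * ENNReal.ofReal (d / (|x - y| + d) ^ 2) := setLIntegral_le_lintegral _ _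
    _ = 4 * ∫⁻ x, ENNReal.ofReal (d / (|x - y| + d) ^ 2) := lintegral_const_mul' _ _ (by norm_num)
    _ = 4 * ∫⁻ t, ENNReal.ofReal (d / (|t| + d) ^ 2) := by
        rw [lintegral_sub_right_eq_self (fun t => ENNReal.ofReal (d / (|t| + d) ^ 2)) y]
    _ ≤ 4 * 2 := by gcongr
    _ = 8 := by norm_num

lemma int_JJ (F : Set ℝ) (hF : IsClosed F) (hne : F.Nonempty) {g : ℝ → ℝ≥0∞} (hg : Measurable g) (hM : ∀ z ∈ F, Mc g z ≤ 1) :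
    ∫⁻ x in F, JJ F g x ≤ 48 * volume Fᶜ := by
  have h1 : Continuous fun q : ℝ × ℝ => infDist q.2 F := (continuous_infDist_pt F).comp continuous_snd
  have h1m := h1.measurable
  calc ∫⁻ x in F, JJ F g x = ∫⁻ y, ∫⁻ x in F, g y * ENNReal.ofReal (infDist y F / |x - y| ^ 2) := by
        unfold JJ
        rw [lintegral_lintegral_swap]
        refine Measurable.aemeasurable ?_
        exact (hg.comp measurable_snd).mul (Measurable.ennreal_ofReal (h1m.div (by fun_prop)))
    _ ≤ ∫⁻ y, Fᶜ.indicator (fun y => 8 * g y) y := by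
        refine lintegral_mono fun y => ?_
        by_cases hy : y ∈ F
        · simp [infDist_zero_of_mem hy]
        · have hp : 0 < infDist y F := (hF.notMem_iff_infDist_pos hne).1 hy
          rw [indicator_of_mem (by exact hy), lintegral_const_mul _ (by fun_prop), mul_comm]
          refine mul_le_mul_left (le_trans (lintegral_mono_set ?_) (int_far hp y)) _
          intro x hx
          have := infDist_le_dist_of_mem (x := y) hx
          rw [dist_comm, Real.dist_eq] at this
          exact this
    _ = 8 * ∫⁻ y in Fᶜ, g y := by
        rw [lintegral_indicator hF.isOpen_compl.measurableSet, lintegral_const_mul _ hg]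
    _ ≤ 8 * (6 * volume Fᶜ) := by gcongr; exact int_Omega F hF hne hg hM
    _ = _ := by rw [← mul_assoc]; norm_num

end
end CC

namespace CC
noncomputable section
open MeasureTheory Filter Set Metric Topology
open scoped ENNReal BigOperators ComplexConjugate NNReal

lemma KK_meas {m : ℕ} {A : Fin m → ℝ → ℝ} (hA : ∀ j, Continuous (A j)) (s : ℝ) : Measurable fun q : ℝ × ℝ => KK A s q.1 q.2 := by
  have h1 := (contXI s).measurable
  unfold KK
  refine Measurable.div ?_ (h1.pow_const _)
  exact Continuous.measurable (continuous_finsetProd _ fun j _ => by have := hA j; fun_prop)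

lemma KK_meas_y {m : ℕ} {A : Fin m → ℝ → ℝ} (hA : ∀ j, Continuous (A j)) (s x : ℝ) : Measurable fun y => KK A s x y := by
  have h1 : Measurable fun y : ℝ => (x, y) := by fun_prop
  have h2 := (KK_meas hA s).comp h1
  simpa only [Function.comp_def] using h2

lemma KT_meas_y {m : ℕ} {B : Fin m → ℝ → ℝ} (hB : ∀ j, Continuous (B j)) (ε x : ℝ) : Measurable fun y => KT B ε x y := by
  unfold KT
  refine Measurable.ite (measurableSet_lt measurable_const (by fun_prop)) ?_ measurable_const
  refine Measurable.div ?_ (by fun_prop)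
  exact Continuous.measurable (continuous_finsetProd _ fun j _ => by have := hB j; fun_prop)

/-- the data of the good-set reduction -/
structure Good {m : ℕ} (F : Set ℝ) (A B : Fin m → ℝ → ℝ) (φ : ℝ → ℝ) : Prop where
  cl : IsClosed F
  ne : F.Nonempty
  fin : volume Fᶜ ≠ ∞
  lip : Lip1 A
  cont : ∀ j, Continuous (B j)
  bd : ∀ j, ∀ x ∈ F, ∀ y, |B j x - B j y| ≤ |x - y|
  agree : ∀ j, ∀ x ∈ F, B j x = A j x
  meas : Measurable φ
  mx : ∀ x ∈ F, Mc (fun y => ‖φ y‖ₑ) x ≤ 1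

namespace Good
variable {m : ℕ} {F : Set ℝ} {A B : Fin m → ℝ → ℝ} {φ : ℝ → ℝ}

lemma close (h : Good F A B φ) (j : Fin m) (y : ℝ) : |B j y - A j y| ≤ 2 * infDist y F := by
  obtain ⟨z, hz, hzw⟩ := h.cl.exists_infDist_eq_dist h.ne y
  have h1 := h.bd j z hz y
  have h2 := h.lip j z y
  rw [Real.dist_eq, abs_sub_comm] at hzw
  rw [← hzw] at h1 h2
  have e : B j y - A j y = -(B j z - B j y) + (A j z - A j y) := by rw [h.agree j z hz]; ring
  rw [e]
  refine (abs_add_le _ _).trans ?_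
  rw [abs_neg]; linarith

lemma dle (_h : Good F A B φ) {x : ℝ} (hx : x ∈ F) (y : ℝ) : infDist y F ≤ |x - y| := by
  have := infDist_le_dist_of_mem (x := y) hx
  rwa [dist_comm, Real.dist_eq] at this

lemma intO (h : Good F A B φ) : ∫⁻ y in Fᶜ, ‖φ y‖ₑ ≠ ∞ :=
  ((int_Omega F h.cl h.ne h.meas.enorm h.mx).trans_lt (ENNReal.mul_lt_top (by norm_num) h.fin.lt_top)).ne

/-- the averaged bad part -/
def ft (F : Set ℝ) (φ : ℝ → ℝ) (w : ℝ) : ℝ := ∫ y, φ y * th F y w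

lemma ft_meas (h : Good F A B φ) : Measurable (ft F φ) := by
  have : StronglyMeasurable fun q : ℝ × ℝ => φ q.2 * th F q.2 q.1 :=
    ((h.meas.comp measurable_snd).mul ((th_meas F).comp measurable_swap)).stronglyMeasurable
  exact (this.integral_prod_right' (ν := volume)).measurable

lemma ft_le (h : Good F A B φ) (w : ℝ) : ‖ft F φ w‖ₑ ≤ Fᶜ.indicator (fun _ => 6) w := by
  refine ((enorm_integral_le_lintegral_enorm _).trans_eq ?_).trans (th_avg F h.cl h.ne h.mx w)
  refine lintegral_congr fun y => ?_
  rw [enorm_mul, Real.enorm_of_nonneg (th_nonneg F y w)]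

def psi (F : Set ℝ) (φ : ℝ → ℝ) (w : ℝ) : ℂ := ((F.indicator φ w : ℝ) : ℂ) + ((ft F φ w : ℝ) : ℂ)

lemma psi_meas (h : Good F A B φ) : Measurable (psi F φ) := by
  have h1 := h.meas.indicator h.cl.measurableSet
  have h2 := h.ft_meas
  unfold psi
  fun_prop

lemma phiF_le (h : Good F A B φ) : ∀ᵐ w, ‖F.indicator φ w‖ₑ ≤ min ‖φ w‖ₑ 1 := by
  filter_upwards [le_Mc_ae h.meas.enorm (fun x => enorm_ne_top)] with w hw
  by_cases hwF : w ∈ F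
  · rw [indicator_of_mem hwF]
    exact le_min le_rfl (hw.trans (h.mx w hwF))
  · simp [indicator_of_notMem hwF]

lemma phiF_int (h : Good F A B φ) (n : ℕ) : ∫⁻ w, ‖((F.indicator φ w : ℝ) : ℂ)‖ₑ ^ n ≤ ∫⁻ w, (min ‖φ w‖ₑ 1) ^ n := by
  refine lintegral_mono_ae ?_
  filter_upwards [h.phiF_le] with w hw
  rw [show ‖((F.indicator φ w : ℝ) : ℂ)‖ₑ = ‖F.indicator φ w‖ₑ by rw [← ofReal_norm, Complex.norm_real, ofReal_norm]]
  exact pow_le_pow_left' hw n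

lemma ft_int (h : Good F A B φ) {n : ℕ} (hn : n ≠ 0) : ∫⁻ w, ‖((ft F φ w : ℝ) : ℂ)‖ₑ ^ n ≤ 6 ^ n * volume Fᶜ := by
  calc _ ≤ ∫⁻ w, Fᶜ.indicator (fun _ => 6 ^ n) w := by
        refine lintegral_mono fun w => ?_
        rw [show ‖((ft F φ w : ℝ) : ℂ)‖ₑ = ‖ft F φ w‖ₑ by rw [← ofReal_norm, Complex.norm_real, ofReal_norm]]
        refine (pow_le_pow_left' (h.ft_le w) n).trans_eq ?_
        simp only [indicator]; split_ifs <;> simp [hn]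
    _ = _ := by rw [lintegral_indicator h.cl.isOpen_compl.measurableSet, setLIntegral_const]

lemma psi_int (h : Good F A B φ) {n : ℕ} (hn : n ≠ 0) :
    ∫⁻ w, ‖psi F φ w‖ₑ ^ n ≤ 2 ^ n * ((∫⁻ w, (min ‖φ w‖ₑ 1) ^ n) + 6 ^ n * volume Fᶜ) := by
  have h1 := h.meas.indicator h.cl.measurableSet
  have h2 := h.ft_meas
  calc _ ≤ ∫⁻ w, 2 ^ n * (‖((F.indicator φ w : ℝ) : ℂ)‖ₑ ^ n + ‖((ft F φ w : ℝ) : ℂ)‖ₑ ^ n) :=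
        lintegral_mono fun w => (pow_le_pow_left' (enorm_add_le _ _) n).trans (add_pow_le' _ _ n)
    _ = 2 ^ n * ((∫⁻ w, ‖((F.indicator φ w : ℝ) : ℂ)‖ₑ ^ n) + ∫⁻ w, ‖((ft F φ w : ℝ) : ℂ)‖ₑ ^ n) := by
        rw [lintegral_const_mul _ (by fun_prop), lintegral_add_left (by fun_prop)]
    _ ≤ _ := by
        exact mul_le_mul_right (add_le_add (h.phiF_int n) (h.ft_int hn)) _

lemma int_k (h : Good F A B φ) {n : ℕ} (hn : 2 ≤ n) (hfin : ∫⁻ w, (min ‖φ w‖ₑ 1) ^ n ≠ ∞) (x : ℝ) {ε : ℝ} (hε : 0 < ε)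
    {k : ℝ → ℂ} (hk : Measurable k) (hkb : ∀ y, ‖k y‖ ≤ 2 / (|x - y| + ε)) :
    Integrable fun y => (φ y : ℂ) * k y := by
  have hφ := h.meas
  refine ⟨by fun_prop, ?_⟩
  obtain ⟨c, hc, hH⟩ := holder_ker hn hε
  have mF := h.meas.indicator h.cl.measurableSet
  have b : ∀ y, ‖(φ y : ℂ) * k y‖ₑ ≤ ‖((F.indicator φ y : ℝ) : ℂ)‖ₑ * ENNReal.ofReal (2 / (|x - y| + ε)) +
      Fᶜ.indicator (fun y => ‖φ y‖ₑ * ENNReal.ofReal (2 / ε)) y := by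
    intro y
    rw [enorm_mul]
    have h1 : ‖k y‖ₑ ≤ ENNReal.ofReal (2 / (|x - y| + ε)) := by rw [← ofReal_norm]; exact ENNReal.ofReal_le_ofReal (hkb y)
    by_cases hy : y ∈ F
    · rw [indicator_of_mem hy]
      exact le_add_right (mul_le_mul_right h1 _)
    · rw [indicator_of_notMem hy, indicator_of_mem (by exact hy)]
      refine le_add_left ?_
      rw [show ‖(φ y : ℂ)‖ₑ = ‖φ y‖ₑ by rw [← ofReal_norm, Complex.norm_real, ofReal_norm]]
      refine mul_le_mul_right (h1.trans (ENNReal.ofReal_le_ofReal ?_)) _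
      gcongr
      linarith [abs_nonneg (x - y)]
  refine (lintegral_mono b).trans_lt ?_
  rw [lintegral_add_left (by fun_prop), lintegral_indicator h.cl.isOpen_compl.measurableSet,
    lintegral_mul_const _ (by fun_prop)]
  refine ENNReal.add_lt_top.2 ⟨(hH x _ (by fun_prop)).trans_lt ?_, ENNReal.mul_lt_top h.intO.lt_top ENNReal.ofReal_lt_top⟩
  exact ENNReal.mul_lt_top hc.lt_top (ENNReal.rpow_lt_top_of_nonneg (by positivity) ((h.phiF_int n).trans_lt hfin.lt_top).ne)

lemma SS_psi (h : Good F A B φ) {n : ℕ} (hn : 2 ≤ n) (hfin : ∫⁻ w, (min ‖φ w‖ₑ 1) ^ n ≠ ∞) (x : ℝ) {ε : ℝ} (hε : 0 < ε) :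
    Integrable (fun y => (φ y : ℂ) * ∫ w, (th F y w : ℂ) * KK A ε x w) ∧
    SS A ε (psi F φ) x = (∫ y, ((F.indicator φ y : ℝ) : ℂ) * KK A ε x y) + ∫ y, (φ y : ℂ) * ∫ w, (th F y w : ℂ) * KK A ε x w := by
  have mF := h.meas.indicator h.cl.measurableSet
  have mft := h.ft_meas
  have mφ := h.meas
  have mK := KK_meas_y h.lip.cont ε x
  have i1 := SS_int' hn h.lip hε (f := fun w => ((F.indicator φ w : ℝ) : ℂ)) (by fun_prop) ((h.phiF_int n).trans_lt hfin.lt_top).ne x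
  have i2 := SS_int' hn h.lip hε (f := fun w => ((ft F φ w : ℝ) : ℂ)) (by fun_prop)
    ((h.ft_int (n := n) (by omega)).trans_lt (ENNReal.mul_lt_top (by simp) h.fin.lt_top)).ne x
  have mt := th_meas F
  have hsw : Integrable (Function.uncurry fun y w => (φ y : ℂ) * ((th F y w : ℂ) * KK A ε x w)) (volume.prod volume) := by
    have hmeas : Measurable (Function.uncurry fun y w => (φ y : ℂ) * ((th F y w : ℂ) * KK A ε x w)) := by
      simp only [Function.uncurry_def]
      exact (Complex.measurable_ofReal.comp (mφ.comp measurable_fst)).mul ((Complex.measurable_ofReal.comp mt).mul (mK.comp measurable_snd))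
    refine ⟨hmeas.aestronglyMeasurable, ?_⟩
    unfold HasFiniteIntegral
    rw [lintegral_prod _ hmeas.enorm.aemeasurable]
    calc _ ≤ ∫⁻ y, ∫⁻ w, ENNReal.ofReal (2 / ε) * (‖φ y‖ₑ * ENNReal.ofReal (th F y w)) := by
          refine lintegral_mono fun y => lintegral_mono fun w => ?_
          simp only [Function.uncurry_apply_pair]
          rw [← ofReal_norm, ← ofReal_norm, ← ENNReal.ofReal_mul (norm_nonneg _), ← ENNReal.ofReal_mul (by positivity)]
          refine ENNReal.ofReal_le_ofReal ?_
          rw [norm_mul, norm_mul, Complex.norm_real, Complex.norm_real, Real.norm_of_nonneg (th_nonneg F y w)]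
          have h1 : ‖KK A ε x w‖ ≤ 2 / ε := (KK_le h.lip hε x w).trans (by gcongr; linarith [abs_nonneg (x - w)])
          have h2 : 0 ≤ ‖φ y‖ * th F y w := mul_nonneg (norm_nonneg _) (th_nonneg F y w)
          calc _ = ‖KK A ε x w‖ * (‖φ y‖ * th F y w) := by ring
            _ ≤ _ := by gcongr
      _ = ENNReal.ofReal (2 / ε) * ∫⁻ y in Fᶜ, ‖φ y‖ₑ := by
          rw [← lintegral_indicator h.cl.isOpen_compl.measurableSet, ← lintegral_const_mul' _ _ ENNReal.ofReal_ne_top]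
          refine lintegral_congr fun y => ?_
          rw [lintegral_const_mul' _ _ ENNReal.ofReal_ne_top, lintegral_const_mul' _ _ enorm_ne_top, th_int F h.cl h.ne]
          simp only [indicator]; split_ifs <;> simp
      _ < ∞ := ENNReal.mul_lt_top ENNReal.ofReal_lt_top h.intO.lt_top
  refine ⟨by simpa only [Function.uncurry_apply_pair, integral_const_mul] using hsw.integral_prod_left, ?_⟩
  rw [SS_eq_KK]
  simp only [psi, add_mul]
  rw [integral_add i1 i2]
  congr 1
  calc ∫ w, ((ft F φ w : ℝ) : ℂ) * KK A ε x w = ∫ w, ∫ y, (φ y : ℂ) * ((th F y w : ℂ) * KK A ε x w) := by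
        congr 1; ext w
        have : ∫ y, ((φ y * th F y w : ℝ) : ℂ) = ((∫ y, φ y * th F y w : ℝ) : ℂ) := integral_ofReal
        rw [ft, ← this, ← integral_mul_const]
        congr 1; ext y
        simp [mul_assoc]
    _ = ∫ y, ∫ w, (φ y : ℂ) * ((th F y w : ℂ) * KK A ε x w) := (integral_integral_swap hsw).symm
    _ = _ := by
        congr 1; ext y
        rw [integral_const_mul]

lemma diff_pt (h : Good F A B φ) {x : ℝ} (hx : x ∈ F) {ε : ℝ} (hε : 0 < ε) (y : ℝ) :
    ‖(φ y : ℂ) * (KT B ε x y : ℂ) - ((F.indicator φ y : ℝ) : ℂ) * KK A ε x y - (φ y : ℂ) * ∫ w, (th F y w : ℂ) * KK A ε x w‖ ≤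
      ‖φ y‖ * (8 * (m + 1) * (infDist y F / |x - y| ^ 2 + ε / (|x - y| + ε) ^ 2)) := by
  have mt := th_meas F
  have kc := fun w => ker_core (w := w) hε h.lip (fun j => h.bd j x hx y) (fun j => h.agree j x hx) (fun j => h.close j y) (h.dle hx y)
  by_cases hy : y ∈ F
  · have h0 : infDist y F = 0 := infDist_zero_of_mem hy
    have ht : ∀ w, th F y w = 0 := fun w => by
      unfold th; rw [h0, if_neg]; simp
    simp only [ht, indicator_of_mem hy, Complex.ofReal_zero, zero_mul, integral_zero, mul_zero, sub_zero]
    rw [← mul_sub, norm_mul, Complex.norm_real]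
    gcongr
    exact kc y (by simp [h0])
  · have hp : 0 < infDist y F := (h.cl.notMem_iff_infDist_pos h.ne).1 hy
    rw [indicator_of_notMem hy, Complex.ofReal_zero, zero_mul, sub_zero, ← mul_sub, norm_mul, Complex.norm_real]
    gcongr
    have mty : Measurable fun w => th F y w := mt.comp (by fun_prop : Measurable fun w : ℝ => (y, w))
    have hth1 := th_int F h.cl h.ne y
    rw [indicator_of_mem (by exact hy)] at hth1
    have ith : Integrable fun w => th F y w := by
      refine ⟨mty.aestronglyMeasurable, ?_⟩
      unfold HasFiniteIntegral
      simp_rw [Real.enorm_of_nonneg (th_nonneg F y _)]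
      rw [hth1]; simp
    have hth : ∫ w, th F y w = 1 := by
      rw [integral_eq_lintegral_of_nonneg_ae (.of_forall fun w => th_nonneg F y w) mty.aestronglyMeasurable, hth1]; simp
    have mK := KK_meas_y h.lip.cont ε x
    have itK : Integrable fun w => (th F y w : ℂ) * KK A ε x w := by
      refine ith.ofReal.mul_bdd (c := 2 / ε) mK.aestronglyMeasurable (.of_forall fun w => ?_)
      exact (KK_le h.lip hε x w).trans (by gcongr; linarith [abs_nonneg (x - w)])
    have e : (KT B ε x y : ℂ) - ∫ w, (th F y w : ℂ) * KK A ε x w = ∫ w, (th F y w : ℂ) * ((KT B ε x y : ℂ) - KK A ε x w) := by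
      simp_rw [mul_sub]
      have i5 : Integrable fun w => (th F y w : ℂ) * (KT B ε x y : ℂ) := ith.ofReal.mul_const _
      rw [integral_sub i5 itK, integral_mul_const]
      have : ∫ w, ((th F y w : ℝ) : ℂ) = ((∫ w, th F y w : ℝ) : ℂ) := integral_ofReal
      rw [this, hth]; simp
    rw [e]
    set bd := 8 * (m + 1) * (infDist y F / |x - y| ^ 2 + ε / (|x - y| + ε) ^ 2) with hbd
    calc _ ≤ ∫ w, th F y w * bd := by
          refine norm_integral_le_of_norm_le (ith.mul_const _) (.of_forall fun w => ?_)
          rw [norm_mul, Complex.norm_real, Real.norm_of_nonneg (th_nonneg F y w)]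
          by_cases hw : |w - y| < infDist y F / 2
          · exact mul_le_mul_of_nonneg_left (kc w hw.le) (th_nonneg F y w)
          · have : th F y w = 0 := by unfold th; rw [if_neg hw]
            simp [this]
      _ = bd := by rw [integral_mul_const, hth, one_mul]

lemma diff_int (h : Good F A B φ) {n : ℕ} (hn : 2 ≤ n) (hfin : ∫⁻ w, (min ‖φ w‖ₑ 1) ^ n ≠ ∞) {x : ℝ} (hx : x ∈ F) {ε : ℝ} (hε : 0 < ε) :
    ‖((∫ y, KT B ε x y * φ y : ℝ) : ℂ) - SS A ε (psi F φ) x‖ₑ ≤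
      ENNReal.ofReal (8 * (m + 1)) * (JJ F (fun y => ‖φ y‖ₑ) x + 4) := by
  have mφ := h.meas
  have mF := h.meas.indicator h.cl.measurableSet
  have mK := KK_meas_y h.lip.cont ε x
  have mT := KT_meas_y h.cont ε x
  have mt := th_meas F
  have mA : Measurable fun y => ∫ w, (th F y w : ℂ) * KK A ε x w := by
    have : StronglyMeasurable fun q : ℝ × ℝ => (th F q.1 q.2 : ℂ) * KK A ε x q.2 :=
      ((Complex.measurable_ofReal.comp mt).mul (mK.comp measurable_snd)).stronglyMeasurable
    exact (this.integral_prod_right' (ν := volume)).measurable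
  have j1 : Integrable fun y => (φ y : ℂ) * (KT B ε x y : ℂ) :=
    h.int_k hn hfin x hε (by fun_prop) fun y => by
      rw [Complex.norm_real]; exact KT_le hε fun j => h.bd j x hx y
  have j2 := SS_int' hn h.lip hε (f := fun w => ((F.indicator φ w : ℝ) : ℂ)) (by fun_prop) ((h.phiF_int n).trans_lt hfin.lt_top).ne x
  have hd2 : Measurable fun y => infDist y F := (continuous_infDist_pt F).measurable
  have hbound : ∫⁻ y, ‖φ y‖ₑ * ENNReal.ofReal (8 * (m + 1) * (infDist y F / |x - y| ^ 2 + ε / (|x - y| + ε) ^ 2)) ≤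
      ENNReal.ofReal (8 * (m + 1)) * (JJ F (fun y => ‖φ y‖ₑ) x + 4) := by
    calc _ = ∫⁻ y, ENNReal.ofReal (8 * (m + 1)) * (‖φ y‖ₑ * ENNReal.ofReal (infDist y F / |x - y| ^ 2) +
            ‖φ y‖ₑ * ENNReal.ofReal (ε / (|x - y| + ε) ^ 2)) := by
          refine lintegral_congr fun y => ?_
          have : 0 ≤ infDist y F := infDist_nonneg
          rw [ENNReal.ofReal_mul (by positivity), ENNReal.ofReal_add (by positivity) (by positivity)]
          ring
      _ = ENNReal.ofReal (8 * (m + 1)) * (JJ F (fun y => ‖φ y‖ₑ) x + ∫⁻ y, ‖φ y‖ₑ * ENNReal.ofReal (ε / (|x - y| + ε) ^ 2)) := by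
          rw [lintegral_const_mul' _ _ ENNReal.ofReal_ne_top, lintegral_add_right _ (by fun_prop), JJ]
      _ ≤ _ := by
          gcongr
          refine (poisson_le mφ.enorm x hε).trans ?_
          calc _ ≤ 4 * (1:ℝ≥0∞) := by gcongr; exact h.mx x hx
            _ = 4 := mul_one _
  obtain ⟨j3, hS⟩ := h.SS_psi hn hfin x hε
  have j12 : Integrable fun y => (φ y : ℂ) * (KT B ε x y : ℂ) - ((F.indicator φ y : ℝ) : ℂ) * KK A ε x y := j1.sub j2
  have hT : ((∫ y, KT B ε x y * φ y : ℝ) : ℂ) = ∫ y, (φ y : ℂ) * (KT B ε x y : ℂ) := by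
    have : ∫ y, ((KT B ε x y * φ y : ℝ) : ℂ) = ((∫ y, KT B ε x y * φ y : ℝ) : ℂ) := integral_ofReal
    rw [← this]
    congr 1; ext y; push_cast; ring
  rw [hS, hT, ← sub_sub, ← integral_sub j1 j2, ← integral_sub j12 j3]
  refine ((enorm_integral_le_lintegral_enorm _).trans (lintegral_mono fun y => ?_)).trans hbound
  rw [← ofReal_norm, ← ofReal_norm, ← ENNReal.ofReal_mul (norm_nonneg _)]
  exact ENNReal.ofReal_le_ofReal (h.diff_pt hx hε y)

lemma JJ_meas (F : Set ℝ) {g : ℝ → ℝ≥0∞} (hg : Measurable g) : Measurable (JJ F g) := by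
  have h1 : Continuous fun q : ℝ × ℝ => infDist q.2 F := (continuous_infDist_pt F).comp continuous_snd
  have h1m := h1.measurable
  have : Measurable fun q : ℝ × ℝ => g q.2 * ENNReal.ofReal (infDist q.2 F / |q.1 - q.2| ^ 2) :=
    (hg.comp measurable_snd).mul (Measurable.ennreal_ofReal (h1m.div (by fun_prop)))
  exact this.lintegral_prod_right'

end Good

/-- The core estimate, normalised. -/
lemma core0 (k m : ℕ) : ∃ C0 : ℝ≥0, 1 ≤ C0 ∧ ∀ (F : Set ℝ) (A B : Fin m → ℝ → ℝ) (φ : ℝ → ℝ), Good F A B φ →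
    volume {x | ∃ ε : ℝ, 0 < ε ∧ (C0 : ℝ) < |∫ y, KT B ε x y * φ y|} ≤
      C0 * (volume Fᶜ + ∫⁻ y, (min ‖φ y‖ₑ 1) ^ (2 * 2 ^ (k + 1))) := by
  obtain ⟨K, hK⟩ := cotlar_max k m
  set r := 2 ^ (k + 1) with hr
  have hr0 : 0 < r := by positivity
  set E : ℝ≥0 := (8 * (m + 1) : ℝ).toNNReal with hE
  set C1 : ℝ≥0 := 5 * E + 1 with hC1
  set C2 : ℝ≥0 := 49 + K * 2 ^ (2 * r) * (1 + 6 ^ (2 * r)) with hC2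
  refine ⟨C1 + C2, ?_, fun F A B φ h => ?_⟩
  · rw [hC1, hC2]
    calc (1:ℝ≥0) ≤ 5 * E + 1 := le_add_self
      _ ≤ _ := le_self_add
  by_cases hfin : ∫⁻ y, (min ‖φ y‖ₑ 1) ^ (2 * r) = ∞
  · rw [hfin, add_top, ENNReal.mul_top]
    · exact le_top
    · rw [hC1]; positivity
  have hψ := h.psi_int (n := 2 * r) (by omega)
  obtain ⟨G, mG, hG1, hG2⟩ := hK A h.lip _ h.psi_meas ((hψ.trans_lt (ENNReal.mul_lt_top (by simp)
    (ENNReal.add_lt_top.2 ⟨lt_top_iff_ne_top.2 hfin, ENNReal.mul_lt_top (by simp) h.fin.lt_top⟩))).ne)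
  set g : ℝ → ℝ≥0∞ := fun y => ‖φ y‖ₑ with hg
  set I := ∫⁻ y, (min ‖φ y‖ₑ 1) ^ (2 * r) with hI
  have mJ := Good.JJ_meas F (h.meas.enorm)
  have hsub : {x | ∃ ε : ℝ, 0 < ε ∧ ((C1 + C2 : ℝ≥0) : ℝ) < |∫ y, KT B ε x y * φ y|} ⊆
      Fᶜ ∪ ({x | 1 ≤ JJ F g x} ∩ F) ∪ {x | 1 ≤ G x ^ 2} := by
    rintro x ⟨ε, hε, hx⟩
    by_contra hcon
    simp only [mem_union, mem_inter_iff, mem_compl_iff, not_or, not_not, not_and, mem_ofPred_eq, not_le] at hcon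
    obtain ⟨⟨hxF, hJ⟩, hGx⟩ := hcon
    have hJ : JJ F g x < 1 := by
      by_contra hc
      exact hJ (not_lt.1 hc) hxF
    have hG' : G x < 1 := by
      by_contra hc
      exact absurd hGx (not_lt.2 (one_le_pow₀ (not_lt.1 hc)))
    have hS : ‖SS A ε (Good.psi F φ) x‖ₑ ≤ 1 := by
      by_contra hc
      exact absurd ((hG1 ε hε x).trans_lt hG') (not_lt.2 (one_le_pow₀ (not_le.1 hc).le))
    have hd := h.diff_int (n := 2 * r) (by omega) hfin hxF hε
    have : ‖((∫ y, KT B ε x y * φ y : ℝ) : ℂ)‖ₑ ≤ C1 := by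
      calc _ = ‖(((∫ y, KT B ε x y * φ y : ℝ) : ℂ) - SS A ε (Good.psi F φ) x) + SS A ε (Good.psi F φ) x‖ₑ := by simp
        _ ≤ ENNReal.ofReal (8 * (m + 1)) * (JJ F g x + 4) + 1 := (enorm_add_le _ _).trans (add_le_add hd hS)
        _ ≤ ENNReal.ofReal (8 * (m + 1)) * (1 + 4) + 1 := by gcongr
        _ = C1 := by
            have e : ENNReal.ofReal (8 * (m + 1)) = (E : ℝ≥0∞) := rfl
            rw [e, show (1:ℝ≥0∞) + 4 = 5 by norm_num, hC1]
            push_cast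
            ring_nf
    rw [← ofReal_norm, Complex.norm_real, Real.norm_eq_abs, ENNReal.ofReal_le_iff_le_toReal (by simp)] at this
    simp only [ENNReal.coe_toReal] at this
    push_cast at hx
    linarith [C2.coe_nonneg]
  calc _ ≤ volume Fᶜ + volume ({x | 1 ≤ JJ F g x} ∩ F) + volume {x | 1 ≤ G x ^ 2} :=
        (measure_mono hsub).trans ((measure_union_le _ _).trans (add_le_add_left (measure_union_le _ _) _))
    _ ≤ volume Fᶜ + 48 * volume Fᶜ + K * (2 ^ (2 * r) * (I + 6 ^ (2 * r) * volume Fᶜ)) := by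
        refine add_le_add (add_le_add le_rfl ?_) ?_
        · rw [← Measure.restrict_apply' h.cl.measurableSet]
          have := mul_meas_ge_le_lintegral (μ := volume.restrict F) mJ 1
          rw [one_mul] at this
          exact this.trans (int_JJ F h.cl h.ne h.meas.enorm h.mx)
        · have := mul_meas_ge_le_lintegral (μ := volume) (mG.pow_const 2) 1
          rw [one_mul] at this
          exact this.trans (hG2.trans (mul_le_mul_right hψ _))
    _ = 49 * volume Fᶜ + K * 2 ^ (2 * r) * (I + 6 ^ (2 * r) * volume Fᶜ) := by ring
    _ ≤ 49 * (volume Fᶜ + I) + K * 2 ^ (2 * r) * ((1 + 6 ^ (2 * r)) * (volume Fᶜ + I)) := by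
        gcongr
        · exact le_self_add
        · calc I + 6 ^ (2 * r) * volume Fᶜ ≤ (volume Fᶜ + I) + 6 ^ (2 * r) * (volume Fᶜ + I) := by
                gcongr
                · exact le_add_self
                · exact le_self_add
            _ = _ := by ring
    _ = C2 * (volume Fᶜ + I) := by rw [hC2]; push_cast; ring
    _ ≤ _ := by
        gcongr
        exact le_add_self

end
end CC

namespace CC
noncomputable section
open MeasureTheory Filter Set Metric Topology
open scoped ENNReal BigOperators ComplexConjugate NNReal

/-- the truncated commutator -/
def TC {m : ℕ} (a : Fin m → ℝ → ℝ) (f : ℝ → ℝ) (ε x : ℝ) : ℝ :=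
  ∫ y in {y : ℝ | ε < |x - y|}, (∏ j, Adiff (a j) x y) / (x - y) ^ (m + 1) * f y

lemma meas_far (ε x : ℝ) : MeasurableSet {y : ℝ | ε < |x - y|} :=
  measurableSet_lt measurable_const (by fun_prop)

lemma TC_eq_KT {m : ℕ} (α : Fin m → ℝ → ℝ) (B : Fin m → ℝ → ℝ) (φ : ℝ → ℝ)
    (h : ∀ j x y, Adiff (α j) x y = 2 * (B j x - B j y)) (ε x : ℝ) :
    TC α φ ε x = 2 ^ m * ∫ y, KT B ε x y * φ y := by
  unfold TC
  rw [← integral_indicator (meas_far ε x), ← integral_const_mul]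
  congr 1
  ext y
  unfold KT
  by_cases hy : ε < |x - y|
  · rw [indicator_of_mem (by exact hy), if_pos hy]
    simp only [h, Finset.prod_mul_distrib, Finset.prod_const, Finset.card_univ, Fintype.card_fin]
    ring
  · rw [indicator_of_notMem (by exact hy), if_neg hy]; simp

lemma Adiff_le_Mc {g : ℝ → ℝ} {x : ℝ} {c : ℝ} (hc : 0 ≤ c)
    (hx : Mc (fun y => ‖g y‖ₑ) x ≤ ENNReal.ofReal c) (y : ℝ) :
    |Adiff g x y| ≤ 2 * c * |x - y| := by
  have key : ∀ r, |x - y| < r → |Adiff g x y| ≤ 2 * c * r := by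
    intro r hr
    have hr0 : 0 < r := (abs_nonneg _).trans_lt hr
    have h1 : ‖Adiff g x y‖ₑ ≤ ∫⁻ t in ball x r, ‖g t‖ₑ := by
      unfold Adiff
      rw [← ofReal_norm, intervalIntegral.norm_intervalIntegral_eq, ofReal_norm]
      refine (enorm_integral_le_lintegral_enorm _).trans (lintegral_mono_set ?_)
      intro t ht
      rw [mem_ball, Real.dist_eq]
      have := abs_sub_right_of_mem_uIcc (uIoc_subset_uIcc ht)
      rw [abs_sub_comm] at this
      exact this.trans_lt hr
    have h2 := h1.trans ((le_Mc _ x hr0).trans (mul_le_mul_right hx _))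
    rw [← ofReal_norm, Real.norm_eq_abs, ← ENNReal.ofReal_mul (by positivity)] at h2
    have := (ENNReal.ofReal_le_ofReal_iff (by positivity)).1 h2
    linarith
  refine le_of_forall_pos_lt_add fun δ hδ => ?_
  have h := key (|x - y| + δ / (2 * (2 * c + 1))) (by have : 0 < δ / (2 * (2 * c + 1)) := by positivity
                                                      linarith)
  have : 2 * c * (δ / (2 * (2 * c + 1))) < δ := by
    rw [mul_div_assoc', div_lt_iff₀ (by positivity)]
    nlinarith
  linarith

lemma intervalIntegrable_of_Mc {g : ℝ → ℝ} (hg : AEMeasurable g) {x : ℝ}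
    (hx : Mc (fun y => ‖g y‖ₑ) x ≠ ∞) (u v : ℝ) : IntervalIntegrable g volume u v := by
  set r := |x - u| + |x - v| + 1
  have hr : 0 < r := by positivity
  have h1 : ∫⁻ t in ball x r, ‖g t‖ₑ < ∞ :=
    (le_Mc _ x hr).trans_lt (ENNReal.mul_lt_top ENNReal.ofReal_lt_top (lt_top_iff_ne_top.2 hx))
  have h2 : IntegrableOn g (ball x r) := ⟨hg.aestronglyMeasurable.restrict, h1⟩
  rw [intervalIntegrable_iff]
  refine h2.mono_set ?_
  intro t ht
  rw [mem_ball, Real.dist_eq]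
  have h3 := abs_sub_left_of_mem_uIcc (uIoc_subset_uIcc ht)
  have h4 := abs_sub_right_of_mem_uIcc (uIoc_subset_uIcc ht)
  have e1 : |t - x| ≤ |t - u| + |u - x| := abs_sub_le _ _ _
  have e2 : |t - x| ≤ |t - v| + |v - x| := abs_sub_le _ _ _
  have e3 : |v - u| ≤ |v - x| + |x - u| := abs_sub_le _ _ _
  rw [abs_sub_comm v x] at *
  rw [abs_sub_comm u x] at *
  rcases le_total u v with huv | huv
  · rw [uIoc_of_le huv] at ht
    rw [abs_lt]
    constructor <;> linarith [ht.1, ht.2, le_abs_self (x - u), le_abs_self (x - v), neg_abs_le (x - v),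
      neg_abs_le (x - u), abs_nonneg (x-u), abs_nonneg (x-v)]
  · rw [uIoc_of_ge huv] at ht
    rw [abs_lt]
    constructor <;> linarith [ht.1, ht.2, le_abs_self (x - u), le_abs_self (x - v), neg_abs_le (x - v),
      neg_abs_le (x - u), abs_nonneg (x-u), abs_nonneg (x-v)]

lemma core1 (k m : ℕ) : ∃ C0 : ℝ≥0, 1 ≤ C0 ∧ ∀ (α : Fin m → ℝ → ℝ) (φ : ℝ → ℝ),
    (∀ j, Measurable (α j)) → Measurable φ →
    volume {x | ∃ ε, 0 < ε ∧ (C0 : ℝ) < |TC α φ ε x|} ≤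
      C0 * ((∑ j, volume {x | 1 < Mc (fun y => ‖α j y‖ₑ) x}) + volume {x | 1 < Mc (fun y => ‖φ y‖ₑ) x}
        + ∫⁻ y, (min ‖φ y‖ₑ 1) ^ (2 * 2 ^ (k + 1))) := by
  obtain ⟨C, hC1, hC⟩ := core0 k m
  refine ⟨2 ^ m * C, one_le_mul (one_le_pow₀ (by norm_num)) hC1, fun α φ hα hφ => ?_⟩
  set Ω : Set ℝ := (⋃ j, {x | 1 < Mc (fun y => ‖α j y‖ₑ) x}) ∪ {x | 1 < Mc (fun y => ‖φ y‖ₑ) x} with hΩ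
  set S : ℝ≥0∞ := (∑ j, volume {x | 1 < Mc (fun y => ‖α j y‖ₑ) x}) + volume {x | 1 < Mc (fun y => ‖φ y‖ₑ) x}
    with hS
  have hΩS : volume Ω ≤ S :=
    (measure_union_le _ _).trans (add_le_add_left (measure_iUnion_fintype_le _ _) _)
  have hCC : (C : ℝ≥0∞) ≤ ((2 ^ m * C : ℝ≥0) : ℝ≥0∞) := by
    rw [ENNReal.coe_le_coe]
    exact le_mul_of_one_le_left bot_le (one_le_pow₀ (by norm_num))
  by_cases hfin : volume Ω = ∞
  · have : S = ∞ := top_le_iff.1 (hfin ▸ hΩS)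
    rw [this, top_add, ENNReal.mul_top]
    · exact le_top
    · have : (0 : ℝ≥0) < 2 ^ m * C := by positivity
      exact_mod_cast this.ne'
  have hopen : IsOpen Ω := (isOpen_iUnion fun j => isOpen_lt_Mc _ _).union (isOpen_lt_Mc _ _)
  have hFα : ∀ x ∈ Ωᶜ, ∀ j, Mc (fun y => ‖α j y‖ₑ) x ≤ 1 := by
    intro x hx j
    by_contra hc
    exact hx (Or.inl (mem_iUnion.2 ⟨j, not_le.1 hc⟩))
  have hFφ : ∀ x ∈ Ωᶜ, Mc (fun y => ‖φ y‖ₑ) x ≤ 1 := by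
    intro x hx
    by_contra hc
    exact hx (Or.inr (not_le.1 hc))
  have hne : (Ωᶜ).Nonempty := by
    by_contra hc
    rw [not_nonempty_iff_eq_empty, compl_empty_iff] at hc
    rw [hc] at hfin
    simp at hfin
  obtain ⟨x0, hx0⟩ := hne
  have hii : ∀ j u v, IntervalIntegrable (α j) volume u v := fun j u v =>
    intervalIntegrable_of_Mc (hα j).aemeasurable (ne_top_of_le_ne_top ENNReal.one_ne_top (hFα x0 hx0 j)) u v
  set B : Fin m → ℝ → ℝ := fun j x => (∫ t in (0:ℝ)..x, α j t) / 2 with hB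
  have hBd : ∀ j x y, Adiff (α j) x y = 2 * (B j x - B j y) := by
    intro j x y
    unfold Adiff
    rw [← intervalIntegral.integral_interval_sub_left (hii j 0 x) (hii j 0 y)]
    simp only [hB]; ring
  have hbd : ∀ j, ∀ x ∈ Ωᶜ, ∀ y, |B j x - B j y| ≤ |x - y| := by
    intro j x hx y
    have h := Adiff_le_Mc (c := 1) zero_le_one (by simpa using hFα x hx j) y
    rw [hBd, abs_mul, abs_two] at h
    linarith
  have hext : ∀ j, ∃ A : ℝ → ℝ, LipschitzWith 1 A ∧ EqOn (B j) A Ωᶜ := by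
    intro j
    refine LipschitzOnWith.extend_real (LipschitzOnWith.of_dist_le_mul fun x hx y hy => ?_)
    simpa [Real.dist_eq] using hbd j x hx y
  choose A hA1 hA2 using hext
  have hgood : Good Ωᶜ A B φ := by
    refine ⟨hopen.isClosed_compl, ⟨x0, hx0⟩, by rwa [compl_compl], ?_, ?_, hbd, ?_, hφ, hFφ⟩
    · intro j x y
      simpa [Real.dist_eq] using (hA1 j).dist_le_mul x y
    · intro j
      exact (intervalIntegral.continuous_primitive (hii j) 0).div_const 2
    · exact fun j x hx => hA2 j hx
  have h := hC _ _ _ _ hgood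
  rw [compl_compl] at h
  have hset : {x | ∃ ε, 0 < ε ∧ ((2 ^ m * C : ℝ≥0) : ℝ) < |TC α φ ε x|} ⊆
      {x | ∃ ε, 0 < ε ∧ (C : ℝ) < |∫ y, KT B ε x y * φ y|} := by
    rintro x ⟨ε, hε, hx⟩
    refine ⟨ε, hε, ?_⟩
    rw [TC_eq_KT α B φ hBd, abs_mul] at hx
    push_cast at hx
    rw [abs_of_pos (by positivity : (0:ℝ) < 2 ^ m)] at hx
    exact lt_of_mul_lt_mul_left hx (by positivity)
  refine (measure_mono hset).trans (h.trans ?_)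
  exact mul_le_mul' hCC (add_le_add hΩS le_rfl)

end
end CC

namespace CC
noncomputable section
open MeasureTheory Filter Set Metric Topology
open scoped ENNReal BigOperators ComplexConjugate NNReal

lemma TC_scale {m : ℕ} (a : Fin m → ℝ → ℝ) (f : ℝ → ℝ) (l : Fin m → ℝ) (c ε x : ℝ) :
    TC (fun j y => l j * a j y) (fun y => c * f y) ε x = ((∏ j, l j) * c) * TC a f ε x := by
  unfold TC
  rw [← integral_const_mul]
  congr 1
  ext y
  have : ∀ j, Adiff (fun y => l j * a j y) x y = l j * Adiff (a j) x y := fun j => by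
    unfold Adiff; rw [intervalIntegral.integral_const_mul]
  simp only [this, Finset.prod_mul_distrib]
  ring

lemma Mc_const_mul {c : ℝ≥0∞} (hc : c ≠ ∞) (g : ℝ → ℝ≥0∞) (x : ℝ) :
    Mc (fun y => c * g y) x = c * Mc g x := by
  unfold Mc
  simp only [ENNReal.mul_iSup, lintegral_const_mul' _ _ hc, div_eq_mul_inv, mul_assoc]

lemma Mc_scale_set {l : ℝ} (hl : 0 < l) (g : ℝ → ℝ) :
    {x | 1 < Mc (fun y => ‖l⁻¹ * g y‖ₑ) x} = {x | ENNReal.ofReal l < Mc (fun y => ‖g y‖ₑ) x} := by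
  ext x
  have h1 : (fun y => ‖l⁻¹ * g y‖ₑ) = fun y => (ENNReal.ofReal l)⁻¹ * ‖g y‖ₑ := by
    ext y
    rw [enorm_mul, ← ENNReal.ofReal_inv_of_pos hl, Real.enorm_of_nonneg (by positivity)]
  have hl0 : ENNReal.ofReal l ≠ 0 := by simpa using hl
  rw [mem_ofPred_eq, mem_ofPred_eq, h1, Mc_const_mul (by simpa using hl), mul_comm, ← div_eq_mul_inv,
    ENNReal.lt_div_iff_mul_lt (Or.inl hl0) (Or.inl ENNReal.ofReal_ne_top), one_mul]

lemma core2 (k m : ℕ) : ∃ C0 : ℝ≥0, 1 ≤ C0 ∧ ∀ (α : Fin m → ℝ → ℝ) (φ : ℝ → ℝ),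
    (∀ j, Measurable (α j)) → Measurable φ → ∀ (l : Fin m → ℝ) (c : ℝ), (∀ j, 0 < l j) → 0 < c →
    volume {x | ∃ ε, 0 < ε ∧ (C0 : ℝ) * ((∏ j, l j) * c) < |TC α φ ε x|} ≤
      C0 * ((∑ j, volume {x | ENNReal.ofReal (l j) < Mc (fun y => ‖α j y‖ₑ) x})
        + volume {x | ENNReal.ofReal c < Mc (fun y => ‖φ y‖ₑ) x}
        + ∫⁻ y, (min (‖φ y‖ₑ / ENNReal.ofReal c) 1) ^ (2 * 2 ^ (k + 1))) := by
  obtain ⟨C, hC1, hC⟩ := core1 k m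
  refine ⟨C, hC1, fun α φ hα hφ l c hl hc => ?_⟩
  have h := hC (fun j y => (l j)⁻¹ * α j y) (fun y => c⁻¹ * φ y) (fun j => (hα j).const_mul _) (hφ.const_mul _)
  simp only [Mc_scale_set hc, fun j => Mc_scale_set (hl j) (α j)] at h
  have e1 : ∀ y, ‖c⁻¹ * φ y‖ₑ = ‖φ y‖ₑ / ENNReal.ofReal c := by
    intro y
    rw [enorm_mul, div_eq_mul_inv, mul_comm, ← ENNReal.ofReal_inv_of_pos hc, Real.enorm_of_nonneg (inv_nonneg.2 hc.le)]
  simp only [e1] at h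
  refine le_trans (measure_mono ?_) h
  rintro x ⟨ε, hε, hx⟩
  refine ⟨ε, hε, ?_⟩
  rw [TC_scale, abs_mul]
  have hP : 0 < (∏ j, l j) * c := mul_pos (Finset.prod_pos fun j _ => hl j) hc
  have : (∏ j, (l j)⁻¹) * c⁻¹ = ((∏ j, l j) * c)⁻¹ := by
    rw [Finset.prod_inv_distrib, mul_inv]
  rw [this, abs_of_pos (by positivity), ← div_eq_inv_mul, lt_div_iff₀ hP]
  exact hx

lemma exists_k (q : ℝ) : ∃ k : ℕ, q < ((2 * 2 ^ (k + 1) : ℕ) : ℝ) := by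
  obtain ⟨k, hk⟩ := pow_unbounded_of_one_lt q (one_lt_two)
  refine ⟨k, hk.trans_le ?_⟩
  push_cast
  rw [pow_succ]
  nlinarith [pow_pos (zero_lt_two (α := ℝ)) k]

lemma min_pow_le {q : ℝ} (hq : 0 ≤ q) {R : ℕ} (hR : q ≤ R) (u : ℝ≥0∞) : (min u 1) ^ R ≤ u ^ q := by
  rw [← ENNReal.rpow_natCast]
  exact (ENNReal.rpow_le_rpow_of_exponent_ge (min_le_right _ _) hR).trans
    (ENNReal.rpow_le_rpow (min_le_left _ _) hq)

lemma weakT {m : ℕ} {p : Fin m → ℝ} (hp : ∀ j, 1 ≤ p j) {q : ℝ} (hq : 1 ≤ q) :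
    ∃ C : ℝ≥0, 1 ≤ C ∧ ∀ (α : Fin m → ℝ → ℝ) (φ : ℝ → ℝ),
    (∀ j, Measurable (α j)) → Measurable φ →
    volume {x | ∃ ε, 0 < ε ∧ (C : ℝ) < |TC α φ ε x|} ≤
      C * ((∑ j, ∫⁻ y, ‖α j y‖ₑ ^ p j) + ∫⁻ y, ‖φ y‖ₑ ^ q) := by
  obtain ⟨k, hk⟩ := exists_k q
  obtain ⟨C, hC1, hC⟩ := core1 k m
  set E : ℝ≥0 := (∑ j, Real.toNNReal (5 * 2 ^ p j / 1 ^ p j)) + Real.toNNReal (5 * 2 ^ q / 1 ^ q) + 1 with hE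
  have hE1 : 1 ≤ E := by rw [hE]; exact le_add_self
  have hEj : ∀ j, ENNReal.ofReal (5 * 2 ^ p j / 1 ^ p j) ≤ E := by
    intro j
    unfold ENNReal.ofReal
    rw [ENNReal.coe_le_coe, hE]
    exact ((Finset.single_le_sum (f := fun j => Real.toNNReal (5 * 2 ^ p j / 1 ^ p j)) (fun _ _ => bot_le)
      (Finset.mem_univ j)).trans le_self_add).trans le_self_add
  have hEq : ENNReal.ofReal (5 * 2 ^ q / 1 ^ q) + 1 ≤ E := by
    unfold ENNReal.ofReal
    rw [hE, ← ENNReal.coe_one, ← ENNReal.coe_add, ENNReal.coe_le_coe, add_assoc]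
    exact le_add_self
  refine ⟨C * E, one_le_mul hC1 hE1, fun α φ hα hφ => ?_⟩
  have hsub : {x | ∃ ε, 0 < ε ∧ ((C * E : ℝ≥0) : ℝ) < |TC α φ ε x|} ⊆
      {x | ∃ ε, 0 < ε ∧ (C : ℝ) < |TC α φ ε x|} := by
    rintro x ⟨ε, hε, hx⟩
    refine ⟨ε, hε, lt_of_le_of_lt ?_ hx⟩
    exact_mod_cast le_mul_of_one_le_right bot_le hE1
  refine (measure_mono hsub).trans ((hC α φ hα hφ).trans ?_)
  rw [ENNReal.coe_mul, mul_assoc]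
  refine mul_le_mul_right ?_ _
  rw [mul_add, Finset.mul_sum, add_assoc]
  refine add_le_add (Finset.sum_le_sum fun j _ => ?_) ?_
  · have := Mc_weak_p (hp j) (fun y => ‖α j y‖ₑ) (hα j).enorm 1 one_pos
    rw [ENNReal.ofReal_one] at this
    exact this.trans (mul_le_mul_left (hEj j) _)
  · have := Mc_weak_p hq (fun y => ‖φ y‖ₑ) hφ.enorm 1 one_pos
    rw [ENNReal.ofReal_one] at this
    refine le_trans ?_ (mul_le_mul_left hEq _)
    rw [add_mul, one_mul]
    refine add_le_add this (lintegral_mono fun y => min_pow_le (by linarith) hk.le _)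

/-- scaled version -/
lemma weakT' {m : ℕ} {p : Fin m → ℝ} (hp : ∀ j, 1 ≤ p j) {q : ℝ} (hq : 1 ≤ q) :
    ∃ C : ℝ≥0, 1 ≤ C ∧ ∀ (α : Fin m → ℝ → ℝ) (φ : ℝ → ℝ),
    (∀ j, Measurable (α j)) → Measurable φ → ∀ (l : Fin m → ℝ) (c : ℝ), (∀ j, 0 < l j) → 0 < c →
    volume {x | ∃ ε, 0 < ε ∧ (C : ℝ) * ((∏ j, l j) * c) < |TC α φ ε x|} ≤
      C * ((∑ j, ENNReal.ofReal (l j) ^ (- p j) * ∫⁻ y, ‖α j y‖ₑ ^ p j) +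
        ENNReal.ofReal c ^ (-q) * ∫⁻ y, ‖φ y‖ₑ ^ q) := by
  obtain ⟨C, hC1, hC⟩ := weakT hp hq
  refine ⟨C, hC1, fun α φ hα hφ l c hl hc => ?_⟩
  have h := hC (fun j y => (l j)⁻¹ * α j y) (fun y => c⁻¹ * φ y) (fun j => (hα j).const_mul _) (hφ.const_mul _)
  have e1 : ∀ (c : ℝ) (_ : 0 < c) (r : ℝ) (_ : 1 ≤ r) (g : ℝ → ℝ), ∫⁻ y, ‖c⁻¹ * g y‖ₑ ^ r =
      ENNReal.ofReal c ^ (-r) * ∫⁻ y, ‖g y‖ₑ ^ r := by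
    intro c hc r hr g
    have hc0 : ENNReal.ofReal c ≠ 0 := by simpa using hc
    rw [← lintegral_const_mul' _ _ (ENNReal.rpow_ne_top_of_ne_zero hc0 ENNReal.ofReal_ne_top)]
    refine lintegral_congr fun y => ?_
    rw [enorm_mul, ENNReal.mul_rpow_of_nonneg _ _ (by linarith), ENNReal.rpow_neg, ← ENNReal.inv_rpow,
      ← ENNReal.ofReal_inv_of_pos hc, Real.enorm_of_nonneg (by positivity)]
  simp only [e1 c hc q hq, fun j => e1 (l j) (hl j) (p j) (hp j) (α j)] at h
  refine le_trans (measure_mono ?_) h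
  rintro x ⟨ε, hε, hx⟩
  refine ⟨ε, hε, ?_⟩
  rw [TC_scale, abs_mul]
  have hP : 0 < (∏ j, l j) * c := mul_pos (Finset.prod_pos fun j _ => hl j) hc
  have : (∏ j, (l j)⁻¹) * c⁻¹ = ((∏ j, l j) * c)⁻¹ := by
    rw [Finset.prod_inv_distrib, mul_inv]
  rw [this, abs_of_pos (by positivity), ← div_eq_inv_mul, lt_div_iff₀ hP]
  exact hx

end
end CC

namespace CC
noncomputable section
open MeasureTheory Filter Set Metric Topology
open scoped ENNReal BigOperators ComplexConjugate NNReal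

lemma min_int {P q : ℝ} (hP : 0 < P) (hq : 0 < q) {R : ℕ} (hR : q < R) (v : ℝ) (hv : 0 ≤ v) :
    ∫⁻ t in Ioi (0:ℝ), ENNReal.ofReal (P * t ^ (P - 1)) *
      (min (ENNReal.ofReal v / ENNReal.ofReal (t ^ (P / q))) 1) ^ R ≤
      ENNReal.ofReal (1 + q / (R - q)) * ENNReal.ofReal v ^ q := by
  have hR0 : R ≠ 0 := by rintro rfl; simp at hR; linarith
  rcases hv.eq_or_lt with rfl | hv
  · simp [hR0]
  set w : ℝ := v ^ (q / P) with hw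
  have hw0 : 0 < w := by positivity
  set s : ℝ := P - 1 - P / q * R with hs
  have hPq : P / q * q = P := by field_simp
  have hs1 : s < -1 := by
    rw [hs]
    have : P / q * q < P / q * R := mul_lt_mul_of_pos_left hR (by positivity)
    linarith
  have hpt : ∀ t ∈ Ioi (0:ℝ), ENNReal.ofReal (P * t ^ (P - 1)) *
      (min (ENNReal.ofReal v / ENNReal.ofReal (t ^ (P / q))) 1) ^ R ≤
      ENNReal.ofReal (P * t ^ (P - 1)) * (if ENNReal.ofReal t < ENNReal.ofReal w then 1 else 0) +
      (Ici w).indicator (fun t => ENNReal.ofReal (P * v ^ R * t ^ s)) t := by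
    intro t ht
    have ht : 0 < t := ht
    by_cases htw : t < w
    · rw [if_pos ((ENNReal.ofReal_lt_ofReal_iff hw0).2 htw), mul_one]
      refine le_trans ?_ le_self_add
      exact mul_le_of_le_one_right bot_le (pow_le_one₀ bot_le (min_le_right _ _))
    · rw [indicator_of_mem (by exact not_lt.1 htw)]
      refine le_trans ?_ le_add_self
      refine (mul_le_mul_right (pow_le_pow_left₀ bot_le (min_le_left _ _) R) _).trans ?_
      rw [← ENNReal.ofReal_div_of_pos (by positivity), ← ENNReal.ofReal_pow (by positivity),
        ← ENNReal.ofReal_mul (by positivity)]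
      refine ENNReal.ofReal_le_ofReal (le_of_eq ?_)
      rw [hs, Real.rpow_sub ht (P - 1) (P / q * R), div_pow, ← Real.rpow_mul_natCast ht.le]
      ring
  have hm : Measurable (fun t : ℝ => ENNReal.ofReal (P * t ^ (P - 1)) * (if ENNReal.ofReal t < ENNReal.ofReal w then (1:ℝ≥0∞) else 0)) := by
    refine Measurable.mul (by fun_prop) (Measurable.ite ?_ measurable_const measurable_const)
    exact measurableSet_lt (by fun_prop) measurable_const
  refine (setLIntegral_mono' measurableSet_Ioi hpt).trans ?_
  rw [lintegral_add_left hm, layer_pt hP]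
  have h2 : ∫⁻ t in Ioi (0:ℝ), (Ici w).indicator (fun t => ENNReal.ofReal (P * v ^ R * t ^ s)) t ≤
      ENNReal.ofReal (q / (R - q) * v ^ q) := by
    refine (setLIntegral_le_lintegral _ _).trans ?_
    rw [lintegral_indicator measurableSet_Ici, setLIntegral_congr Ioi_ae_eq_Ici.symm,
      ← ofReal_integral_eq_lintegral_ofReal]
    · refine ENNReal.ofReal_le_ofReal (le_of_eq ?_)
      rw [integral_const_mul, integral_Ioi_rpow_of_lt hs1 hw0, hw, ← Real.rpow_mul hv.le, hs]
      have e1 : q / P * (P - 1 - P / q * R + 1) = q - R := by field_simp; ring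
      rw [e1, Real.rpow_sub hv, Real.rpow_natCast]
      have e2 : P - 1 - P / q * R + 1 = - (P * (R - q) / q) := by field_simp; ring
      rw [e2]
      have : (R:ℝ) - q ≠ 0 := by linarith
      field_simp
    · exact (integrableOn_Ioi_rpow_of_lt hs1 hw0).const_mul _
    · filter_upwards [ae_restrict_mem measurableSet_Ioi] with t ht
      have : 0 < t := hw0.trans ht
      simp only [Pi.zero_apply]
      positivity
  have h1 : ENNReal.ofReal w ^ P = ENNReal.ofReal (v ^ q) := by
    rw [ENNReal.ofReal_rpow_of_pos hw0, hw, ← Real.rpow_mul hv.le]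
    congr 2; field_simp
  have hRq : 0 < (R:ℝ) - q := by linarith
  rw [h1, ENNReal.ofReal_rpow_of_pos hv, ← ENNReal.ofReal_mul (by positivity), add_mul, one_mul,
    ENNReal.ofReal_add (by positivity) (by positivity)]
  exact add_le_add_right h2 _

lemma Mc_layer {P p : ℝ} (hP : 0 < P) (hp : 1 < p) (g : ℝ → ℝ≥0∞) (hg : Measurable g) :
    ∫⁻ t in Ioi (0:ℝ), ENNReal.ofReal (P * t ^ (P - 1)) * volume {x | ENNReal.ofReal (t ^ (P / p)) < Mc g x}
      ≤ ENNReal.ofReal (10 * p / (p - 1) * 2 ^ (p - 1)) * ∫⁻ x, g x ^ p := by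
  refine le_trans (le_of_eq ?_) (Mc_strong hp g hg)
  have h := layer_cake (μ := volume) hP ((measurable_Mc g).pow_const (P / p)⁻¹)
  have e : ∀ x, (Mc g x ^ (P / p)⁻¹) ^ P = Mc g x ^ p := by
    intro x
    rw [← ENNReal.rpow_mul]; congr 1; field_simp
  simp only [e] at h
  rw [h]
  refine setLIntegral_congr_fun measurableSet_Ioi fun t ht => ?_
  have ht : 0 < t := ht
  congr 2
  ext x
  rw [mem_ofPred_eq, mem_ofPred_eq, ENNReal.lt_rpow_inv_iff (by positivity), ENNReal.ofReal_rpow_of_pos ht]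

lemma strongT {m : ℕ} {p : Fin m → ℝ} (hp : ∀ j, 1 < p j) {q P : ℝ} (hq : 1 < q) (hP : 0 < P)
    (hpq : 1 / P = ∑ j, 1 / p j + 1 / q) :
    ∃ C : ℝ≥0, 1 ≤ C ∧ ∀ (α : Fin m → ℝ → ℝ) (φ : ℝ → ℝ),
    (∀ j, Measurable (α j)) → Measurable φ →
    ∫⁻ t in Ioi (0:ℝ), ENNReal.ofReal (P * t ^ (P - 1)) *
      volume {x | ∃ ε, 0 < ε ∧ (C : ℝ) * t < |TC α φ ε x|} ≤
      C * ((∑ j, ∫⁻ y, ‖α j y‖ₑ ^ p j) + ∫⁻ y, ‖φ y‖ₑ ^ q) := by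
  obtain ⟨k, hk⟩ := exists_k q
  obtain ⟨C, hC1, hC⟩ := core2 k m
  set R : ℕ := 2 * 2 ^ (k + 1) with hR
  set c1 : ℝ → ℝ := fun p => 10 * p / (p - 1) * 2 ^ (p - 1) with hc1
  set E : ℝ≥0 := (∑ j, Real.toNNReal (c1 (p j))) + (Real.toNNReal (c1 q) + Real.toNNReal (1 + q / (R - q))) + 1 with hE
  have hE1 : 1 ≤ E := by rw [hE]; exact le_add_self
  have hEj : ∀ j, ENNReal.ofReal (c1 (p j)) ≤ E := by
    intro j
    unfold ENNReal.ofReal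
    rw [ENNReal.coe_le_coe, hE]
    exact ((Finset.single_le_sum (f := fun j => Real.toNNReal (c1 (p j))) (fun _ _ => bot_le)
      (Finset.mem_univ j)).trans le_self_add).trans le_self_add
  have hEq : ENNReal.ofReal (c1 q) + ENNReal.ofReal (1 + q / (R - q)) ≤ E := by
    unfold ENNReal.ofReal
    rw [hE, ← ENNReal.coe_add, ENNReal.coe_le_coe]
    exact le_add_self.trans le_self_add
  refine ⟨C * E, one_le_mul hC1 hE1, fun α φ hα hφ => ?_⟩
  have hstep : ∀ t ∈ Ioi (0:ℝ), ENNReal.ofReal (P * t ^ (P - 1)) *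
      volume {x | ∃ ε, 0 < ε ∧ ((C * E : ℝ≥0) : ℝ) * t < |TC α φ ε x|} ≤
      C * ((∑ j, ENNReal.ofReal (P * t ^ (P - 1)) * volume {x | ENNReal.ofReal (t ^ (P / p j)) < Mc (fun y => ‖α j y‖ₑ) x})
        + ENNReal.ofReal (P * t ^ (P - 1)) * volume {x | ENNReal.ofReal (t ^ (P / q)) < Mc (fun y => ‖φ y‖ₑ) x}
        + ∫⁻ y, ENNReal.ofReal (P * t ^ (P - 1)) * (min (‖φ y‖ₑ / ENNReal.ofReal (t ^ (P / q))) 1) ^ R) := by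
    intro t ht
    have ht : 0 < t := ht
    have h := hC α φ hα hφ (fun j => t ^ (P / p j)) (t ^ (P / q)) (fun j => by positivity) (by positivity)
    have e : (∏ j, t ^ (P / p j)) * t ^ (P / q) = t := by
      rw [← Real.rpow_sum_of_pos ht, ← Real.rpow_add ht]
      have : ∑ j, P / p j + P / q = 1 := by
        have h2 : ∑ j, P / p j + P / q = P * (∑ j, 1 / p j + 1 / q) := by
          rw [mul_add, Finset.mul_sum]; simp [div_eq_mul_inv]
        rw [h2, ← hpq]; field_simp
      rw [this, Real.rpow_one]
    rw [e] at h
    have hsub : {x | ∃ ε, 0 < ε ∧ ((C * E : ℝ≥0) : ℝ) * t < |TC α φ ε x|} ⊆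
        {x | ∃ ε, 0 < ε ∧ (C : ℝ) * t < |TC α φ ε x|} := by
      rintro x ⟨ε, hε, hx⟩
      refine ⟨ε, hε, lt_of_le_of_lt (mul_le_mul_of_nonneg_right ?_ ht.le) hx⟩
      exact_mod_cast le_mul_of_one_le_right bot_le hE1
    refine (mul_le_mul_right ((measure_mono hsub).trans h) _).trans (le_of_eq ?_)
    rw [lintegral_const_mul' _ _ ENNReal.ofReal_ne_top, ← Finset.mul_sum]
    ring
  have hanti : ∀ (s : ℝ) (_ : 0 ≤ s) (g : ℝ → ℝ≥0∞), AEMeasurable (fun t : ℝ => ENNReal.ofReal (P * t ^ (P - 1)) *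
      volume {x | ENNReal.ofReal (t ^ s) < g x}) (volume.restrict (Ioi 0)) := by
    intro s hs g
    refine AEMeasurable.mul (by fun_prop) ?_
    refine aemeasurable_restrict_of_antitoneOn measurableSet_Ioi ?_
    intro t ht t' ht' htt
    refine measure_mono fun x hx => ?_
    rw [mem_ofPred_eq] at hx ⊢
    refine lt_of_le_of_lt (ENNReal.ofReal_le_ofReal (Real.rpow_le_rpow (le_of_lt ht) htt hs)) hx
  have hpj : ∀ j, 0 ≤ P / p j := fun j => by have := hp j; positivity
  refine (setLIntegral_mono' measurableSet_Ioi hstep).trans ?_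
  rw [lintegral_const_mul' _ _ ENNReal.coe_ne_top, ENNReal.coe_mul, mul_assoc]
  refine mul_le_mul_right ?_ _
  rw [lintegral_add_left', lintegral_add_left', lintegral_finsetSum', mul_add, Finset.mul_sum, add_assoc]
  · refine add_le_add (Finset.sum_le_sum fun j _ => ?_) ?_
    · exact (Mc_layer hP (hp j) _ (hα j).enorm).trans (mul_le_mul_left (hEj j) _)
    · refine le_trans ?_ (mul_le_mul_left hEq _)
      rw [add_mul]
      refine add_le_add (Mc_layer hP hq _ hφ.enorm) ?_
      rw [lintegral_lintegral_swap]
      · rw [← lintegral_const_mul' _ _ ENNReal.ofReal_ne_top]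
        refine lintegral_mono fun y => ?_
        have := min_int hP (by linarith) hk |φ y| (abs_nonneg _)
        rw [← Real.enorm_eq_ofReal_abs] at this
        exact this
      · refine Measurable.aemeasurable ?_
        unfold Function.uncurry
        refine Measurable.mul (by fun_prop) (Measurable.pow_const ?_ _)
        exact Measurable.min (Measurable.div (by fun_prop) (by fun_prop)) measurable_const
  · exact fun j _ => hanti _ (hpj j) _
  · exact Finset.aemeasurable_fun_sum _ fun j _ => hanti _ (hpj j) _
  · exact (Finset.aemeasurable_fun_sum _ fun j _ => hanti _ (hpj j) _).add (hanti _ (by positivity) _)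

end
end CC

namespace CC
noncomputable section
open MeasureTheory Filter Set Metric Topology
open scoped ENNReal BigOperators ComplexConjugate NNReal

lemma pv_of_approx (u : ℝ → ℝ → ℝ)
    (h : ∀ δ : ℝ, 0 < δ → ∀ η : ℝ, 0 < η → ∃ v w : ℝ → ℝ → ℝ,
      (∀ᵐ x, ∀ ε : ℝ, 0 < ε → u ε x = v ε x + w ε x) ∧
      (∀ᵐ x, ∃ l, Tendsto (fun ε => v ε x) (𝓝[>] 0) (𝓝 l)) ∧
      volume {x | ∃ ε : ℝ, 0 < ε ∧ δ < |w ε x|} ≤ ENNReal.ofReal η) :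
    ∀ᵐ x, ∃ l, Tendsto (fun ε => u ε x) (𝓝[>] 0) (𝓝 l) := by
  have key : ∀ n : ℕ, ∀ᵐ x, ∃ t ∈ 𝓝[>] (0:ℝ), ∀ ε ∈ t, ∀ ε' ∈ t, |u ε x - u ε' x| < 1 / ((n:ℝ) + 1) := by
    intro n
    rw [ae_iff]
    refine le_antisymm (ENNReal.le_of_forall_pos_le_add fun η hη _ => ?_) bot_le
    have hη' : (0:ℝ) < η := hη
    set δ : ℝ := 1 / (4 * ((n:ℝ) + 1)) with hδ
    have hδ0 : 0 < δ := by positivity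
    obtain ⟨v, w, h1, h2, h3⟩ := h δ hδ0 η hη'
    rw [zero_add]
    have h3' : volume {x | ∃ ε : ℝ, 0 < ε ∧ δ < |w ε x|} ≤ (η : ℝ≥0∞) := by simpa using h3
    refine le_trans (measure_mono_ae ?_) h3'
    filter_upwards [h1, h2] with x hx1 hx2
    intro hx
    by_contra hc
    apply hx
    have hw : ∀ ε : ℝ, 0 < ε → |w ε x| ≤ δ := by
      intro ε hε
      by_contra hcc
      exact hc ⟨ε, hε, not_le.1 hcc⟩
    obtain ⟨l, hl⟩ := hx2
    rw [Metric.tendsto_nhds] at hl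
    have h4 := hl (δ / 2) (by positivity)
    refine ⟨{ε | dist (v ε x) l < δ / 2} ∩ Ioi 0, inter_mem h4 self_mem_nhdsWithin, ?_⟩
    rintro ε ⟨he, he0⟩ ε' ⟨he', he0'⟩
    rw [mem_ofPred_eq, Real.dist_eq, abs_lt] at he he'
    rw [hx1 ε he0, hx1 ε' he0']
    have a1 := abs_le.1 (hw ε he0)
    have a2 := abs_le.1 (hw ε' he0')
    have : 1 / ((n:ℝ) + 1) = 4 * δ := by rw [hδ]; field_simp
    rw [this, abs_lt]
    constructor <;> linarith
  rw [← ae_all_iff] at key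
  filter_upwards [key] with x hx
  rw [← cauchy_map_iff_exists_tendsto, Metric.cauchy_iff]
  refine ⟨inferInstance, fun e he => ?_⟩
  obtain ⟨n, hn⟩ := exists_nat_one_div_lt he
  obtain ⟨t, ht, h5⟩ := hx n
  refine ⟨(fun ε => u ε x) '' t, image_mem_map ht, ?_⟩
  rintro _ ⟨ε, h6, rfl⟩ _ ⟨ε', h7, rfl⟩
  exact (h5 ε h6 ε' h7).trans hn

lemma Mc_fin_ae {p : ℝ} (hp : 1 ≤ p) (g : ℝ → ℝ≥0∞) (hg : Measurable g) (h : ∫⁻ y, g y ^ p ≠ ∞) :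
    ∀ᵐ x, Mc g x ≠ ∞ := by
  rw [ae_iff]
  simp only [not_not, ne_eq]
  set N := ∫⁻ y, g y ^ p with hN
  have hb : ∀ n : ℕ, volume {x | Mc g x = ∞} ≤ ENNReal.ofReal (5 * 2 ^ p / ((n:ℝ) + 1) ^ p) * N := by
    intro n
    refine (measure_mono fun x hx => ?_).trans (Mc_weak_p hp g hg ((n:ℝ) + 1) (by positivity))
    rw [mem_ofPred_eq] at hx ⊢
    rw [hx]; exact ENNReal.ofReal_lt_top
  have ht : Tendsto (fun n : ℕ => ENNReal.ofReal (5 * 2 ^ p / ((n:ℝ) + 1) ^ p) * N) atTop (𝓝 (ENNReal.ofReal 0 * N)) := by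
    refine ENNReal.Tendsto.mul_const (ENNReal.tendsto_ofReal ?_) (Or.inr h)
    refine Tendsto.const_div_atTop ?_ _
    exact (tendsto_rpow_atTop (by linarith)).comp (tendsto_atTop_add_const_right _ _ tendsto_natCast_atTop_atTop)
  have := ge_of_tendsto' ht hb
  simpa using this

lemma TC_meas_y {m : ℕ} {a : Fin m → ℝ → ℝ} (ha : ∀ j u v, IntervalIntegrable (a j) volume u v) (x : ℝ) :
    Measurable (fun y => (∏ j, Adiff (a j) x y) / (x - y) ^ (m + 1)) := by
  refine Measurable.div (Finset.measurable_fun_prod _ fun j _ => Continuous.measurable ?_) (by fun_prop)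
  have : Adiff (a j) x = fun y => - ∫ t in x..y, a j t := by
    ext y; unfold Adiff; rw [intervalIntegral.integral_symm]
  rw [this]
  exact (intervalIntegral.continuous_primitive (ha j) x).neg

lemma TC_integrable {m : ℕ} {a : Fin m → ℝ → ℝ} {f : ℝ → ℝ} (ha : ∀ j, Measurable (a j)) (hf : Measurable f)
    {q : ℝ} (hq : 1 ≤ q) (hfq : ∫⁻ y, ‖f y‖ₑ ^ q ≠ ∞) {x : ℝ} (hx : ∀ j, Mc (fun y => ‖a j y‖ₑ) x ≠ ∞)
    {ε : ℝ} (hε : 0 < ε) :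
    IntegrableOn (fun y => (∏ j, Adiff (a j) x y) / (x - y) ^ (m + 1) * f y) {y | ε < |x - y|} := by
  have hii : ∀ j u v, IntervalIntegrable (a j) volume u v := fun j u v =>
    intervalIntegrable_of_Mc (ha j).aemeasurable (hx j) u v
  refine ⟨((TC_meas_y hii x).mul hf).aestronglyMeasurable, ?_⟩
  set c : Fin m → ℝ := fun j => (Mc (fun y => ‖a j y‖ₑ) x).toReal with hc
  have hA : ∀ j y, |Adiff (a j) x y| ≤ 2 * c j * |x - y| := fun j y =>
    Adiff_le_Mc ENNReal.toReal_nonneg (by rw [ENNReal.ofReal_toReal (hx j)]) y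
  set K : ℝ := ∏ j, (2 * c j) with hK
  have hK0 : 0 ≤ K := Finset.prod_nonneg fun j _ => mul_nonneg zero_le_two ENNReal.toReal_nonneg
  obtain ⟨n, hn⟩ := exists_nat_ge (max q 2)
  have hn2 : 2 ≤ n := by exact_mod_cast (le_max_right q 2).trans hn
  have hnq : q ≤ n := (le_max_left q 2).trans hn
  obtain ⟨C, hC, hH⟩ := holder_ker hn2 hε
  have hpt : ∀ y ∈ {y | ε < |x - y|}, ‖(∏ j, Adiff (a j) x y) / (x - y) ^ (m + 1) * f y‖ₑ ≤
      ENNReal.ofReal K * (ENNReal.ofReal (1 / ε) * ‖f y‖ₑ ^ q +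
        (min ‖f y‖ₑ 1) * ENNReal.ofReal (2 / (|x - y| + ε))) := by
    intro y hy
    have hy : ε < |x - y| := hy
    have hxy : 0 < |x - y| := hε.trans hy
    have h1 : ‖(∏ j, Adiff (a j) x y) / (x - y) ^ (m + 1) * f y‖ₑ ≤ ENNReal.ofReal K * (ENNReal.ofReal (1 / |x - y|) * ‖f y‖ₑ) := by
      rw [enorm_mul, ← mul_assoc]
      refine mul_le_mul_left ?_ _
      rw [← ofReal_norm, ← ENNReal.ofReal_mul hK0]
      refine ENNReal.ofReal_le_ofReal ?_
      rw [Real.norm_eq_abs, abs_div, Finset.abs_prod, abs_pow, div_le_iff₀ (by positivity)]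
      calc _ ≤ ∏ j : Fin m, (2 * c j * |x - y|) := Finset.prod_le_prod (fun _ _ => abs_nonneg _) fun j _ => hA j y
        _ = _ := by
          rw [Finset.prod_mul_distrib, Finset.prod_const, Finset.card_univ, Fintype.card_fin, ← hK, pow_succ]
          field_simp
    refine h1.trans (mul_le_mul_right ?_ _)
    rcases le_total ‖f y‖ₑ 1 with h2 | h2
    · refine le_trans ?_ le_add_self
      rw [min_eq_left h2, mul_comm]
      refine mul_le_mul_right (ENNReal.ofReal_le_ofReal ?_) _
      rw [div_le_div_iff₀ hxy (by positivity)]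
      linarith
    · refine le_trans ?_ le_self_add
      refine mul_le_mul' (ENNReal.ofReal_le_ofReal (one_div_le_one_div_of_le hε hy.le)) ?_
      conv_lhs => rw [← ENNReal.rpow_one ‖f y‖ₑ]
      exact ENNReal.rpow_le_rpow_of_exponent_le h2 hq
  have h3 := hH x (fun y => min ‖f y‖ₑ 1) (hf.enorm.min measurable_const)
  have h4 : ∫⁻ y, (min ‖f y‖ₑ 1) ^ n ≤ ∫⁻ y, ‖f y‖ₑ ^ q := lintegral_mono fun y => min_pow_le (by linarith) hnq _
  unfold HasFiniteIntegral
  refine (setLIntegral_mono' (meas_far ε x) hpt).trans_lt ?_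
  refine (setLIntegral_le_lintegral _ _).trans_lt ?_
  rw [lintegral_const_mul' _ _ ENNReal.ofReal_ne_top, lintegral_add_left (by fun_prop),
    lintegral_const_mul' _ _ ENNReal.ofReal_ne_top]
  refine ENNReal.mul_lt_top ENNReal.ofReal_lt_top (ENNReal.add_lt_top.2 ⟨ENNReal.mul_lt_top ENNReal.ofReal_lt_top (lt_top_iff_ne_top.2 hfq), ?_⟩)
  refine h3.trans_lt (ENNReal.mul_lt_top (lt_top_iff_ne_top.2 hC) ?_)
  exact ENNReal.rpow_lt_top_of_nonneg (by positivity) (ne_top_of_le_ne_top hfq h4)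

end
end CC

namespace CC
noncomputable section
open MeasureTheory Filter Set Metric Topology
open scoped ENNReal BigOperators ComplexConjugate NNReal

lemma prod_lip {ι : Type*} (t : Finset ι) (u v : ι → ℝ) {M : ℝ} (hM : 1 ≤ M) (hu : ∀ i, |u i| ≤ M)
    (hv : ∀ i, |v i| ≤ M) :
    |∏ i ∈ t, u i - ∏ i ∈ t, v i| ≤ M ^ t.card * ∑ i ∈ t, |u i - v i| := by
  classical
  induction t using Finset.induction_on with
  | empty => simp
  | insert i t hi ih =>
    rw [Finset.prod_insert hi, Finset.prod_insert hi, Finset.sum_insert hi, Finset.card_insert_of_notMem hi]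
    have e : u i * ∏ j ∈ t, u j - v i * ∏ j ∈ t, v j =
      u i * (∏ j ∈ t, u j - ∏ j ∈ t, v j) + (u i - v i) * ∏ j ∈ t, v j := by ring
    have hV : |∏ j ∈ t, v j| ≤ M ^ t.card := by
      rw [Finset.abs_prod]
      exact (Finset.prod_le_prod (fun _ _ => abs_nonneg _) fun j _ => hv j).trans (by rw [Finset.prod_const])
    have hM0 : 0 ≤ M := by linarith
    calc _ ≤ |u i| * |∏ j ∈ t, u j - ∏ j ∈ t, v j| + |u i - v i| * |∏ j ∈ t, v j| := by
          rw [e, ← abs_mul, ← abs_mul]; exact abs_add_le _ _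
      _ ≤ M * (M ^ t.card * ∑ i ∈ t, |u i - v i|) + |u i - v i| * M ^ t.card :=
          add_le_add (mul_le_mul (hu i) ih (abs_nonneg _) hM0) (mul_le_mul_of_nonneg_left hV (abs_nonneg _))
      _ ≤ M * (M ^ t.card * ∑ i ∈ t, |u i - v i|) + |u i - v i| * M ^ (t.card + 1) := by
          refine add_le_add le_rfl (mul_le_mul_of_nonneg_left ?_ (abs_nonneg _))
          exact pow_le_pow_right₀ hM (Nat.le_succ _)
      _ = _ := by ring

lemma odd_int (x ε ρ : ℝ) : ∫ y, (if ε < |x - y| ∧ |x - y| < ρ then (x - y)⁻¹ else 0) = 0 := by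
  have h1 := integral_sub_left_eq_self (fun z : ℝ => if ε < |z| ∧ |z| < ρ then z⁻¹ else 0) volume x
  rw [h1]
  have h2 := integral_neg_eq_self (fun z : ℝ => if ε < |z| ∧ |z| < ρ then z⁻¹ else 0) volume
  have h3 : (fun z : ℝ => if ε < |-z| ∧ |-z| < ρ then (-z)⁻¹ else 0) =
      fun z => - (if ε < |z| ∧ |z| < ρ then z⁻¹ else 0) := by
    ext z
    rw [abs_neg, inv_neg]
    split_ifs <;> simp
  rw [h3, integral_neg] at h2
  linarith

lemma Adiff_quot {g : ℝ → ℝ} {M : ℝ} (hc : Continuous g) (hM : 0 ≤ M) (hl : ∀ x y, |g x - g y| ≤ M * |x - y|) {x y : ℝ}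
    (hxy : x ≠ y) : |Adiff g x y / (x - y) - g x| ≤ M * |x - y| := by
  have h0 : x - y ≠ 0 := sub_ne_zero.2 hxy
  have e : Adiff g x y / (x - y) - g x = (∫ t in y..x, (g t - g x)) / (x - y) := by
    rw [intervalIntegral.integral_sub (hc.intervalIntegrable _ _) intervalIntegrable_const]
    unfold Adiff
    rw [intervalIntegral.integral_const, smul_eq_mul]
    field_simp
  rw [e, abs_div, div_le_iff₀ (abs_pos.2 h0)]
  rw [← Real.norm_eq_abs (∫ t in y..x, (g t - g x))]
  refine intervalIntegral.norm_integral_le_of_norm_le_const (C := M * |x - y|) (f := fun t => g t - g x) fun t ht => ?_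
  rw [Real.norm_eq_abs]
  refine (hl t x).trans (mul_le_mul_of_nonneg_left ?_ hM)
  have := abs_sub_right_of_mem_uIcc (uIoc_subset_uIcc ht)
  rwa [abs_sub_comm t x]

lemma pv_nice {m : ℕ} {a : Fin m → ℝ → ℝ} {f : ℝ → ℝ} {M : ℝ} (hM : 1 ≤ M)
    (hac : ∀ j, Continuous (a j)) (hfc : Continuous f)
    (hab : ∀ j x, |a j x| ≤ M) (hal : ∀ j x y, |a j x - a j y| ≤ M * |x - y|)
    (hfb : ∀ x, |f x| ≤ M) (hfl : ∀ x y, |f x - f y| ≤ M * |x - y|) (hfs : HasCompactSupport f) (x : ℝ) :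
    ∃ l, Tendsto (fun ε => TC a f ε x) (𝓝[>] 0) (𝓝 l) := by
  have hM0 : 0 ≤ M := by linarith
  obtain ⟨ρ, hρ0, hρ⟩ : ∃ ρ : ℝ, 0 < ρ ∧ ∀ y, ρ ≤ |x - y| → f y = 0 := by
    obtain ⟨R, hR⟩ := hfs.isCompact.isBounded.subset_ball x
    refine ⟨max R 1, by positivity, fun y hy => ?_⟩
    by_contra hc
    have h1 := hR (subset_tsupport f hc)
    rw [mem_ball, Real.dist_eq, abs_sub_comm] at h1
    exact absurd (h1.trans_le ((le_max_left _ _).trans hy)) (lt_irrefl _)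
  set D : Fin m → ℝ → ℝ := fun j y => Adiff (a j) x y / (x - y) with hD
  set κ : ℝ → ℝ := fun y => (∏ j, D j y) * f y with hκ
  set k0 : ℝ := (∏ j, a j x) * f x with hk0
  have hker : ∀ y, (∏ j, Adiff (a j) x y) / (x - y) ^ (m + 1) * f y = κ y / (x - y) := by
    intro y
    simp only [hκ, hD, Finset.prod_div_distrib, Finset.prod_const, Finset.card_univ, Fintype.card_fin, pow_succ]
    rw [div_mul_eq_div_div]; ring
  have hDb : ∀ j y, |D j y| ≤ M := by
    intro j y
    simp only [hD]
    rw [abs_div]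
    refine div_le_of_le_mul₀ (abs_nonneg _) hM0 ?_
    have := intervalIntegral.norm_integral_le_of_norm_le_const (f := a j) (a := y) (b := x) (C := M) fun t _ => hab j t
    exact this
  set L : ℝ := M ^ m * (∑ _j : Fin m, M) * M + M ^ m * M with hL
  have hL0 : 0 ≤ L := by positivity
  have hκl : ∀ y, x ≠ y → |κ y - k0| ≤ L * |x - y| := by
    intro y hy
    have h1 := prod_lip Finset.univ (fun j => D j y) (fun j => a j x) hM (fun j => hDb j y) (fun j => hab j x)
    rw [Finset.card_univ, Fintype.card_fin] at h1
    have h2 : ∑ j, |D j y - a j x| ≤ (∑ _j : Fin m, M) * |x - y| := by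
      rw [Finset.sum_mul]
      exact Finset.sum_le_sum fun j _ => Adiff_quot (hac j) hM0 (hal j) hy
    have h3 : |∏ j, a j x| ≤ M ^ m := by
      rw [Finset.abs_prod]
      exact (Finset.prod_le_prod (fun _ _ => abs_nonneg _) fun j _ => hab j x).trans (by simp)
    have e : κ y - k0 = (∏ j, D j y - ∏ j, a j x) * f y + (∏ j, a j x) * (f y - f x) := by
      simp only [hκ, hk0]; ring
    rw [e]
    calc _ ≤ |∏ j, D j y - ∏ j, a j x| * |f y| + |∏ j, a j x| * |f y - f x| := by
          rw [← abs_mul, ← abs_mul]; exact abs_add_le _ _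
      _ ≤ (M ^ m * ((∑ _j : Fin m, M) * |x - y|)) * M + M ^ m * (M * |x - y|) := by
          refine add_le_add (mul_le_mul (h1.trans (mul_le_mul_of_nonneg_left h2 (by positivity))) (hfb y) (abs_nonneg _) (by positivity)) ?_
          refine mul_le_mul h3 ?_ (abs_nonneg _) (by positivity)
          rw [abs_sub_comm x y]; exact hfl y x
      _ = _ := by rw [hL]; ring
  set H : ℝ → ℝ → ℝ := fun ε y => if ε < |x - y| ∧ |x - y| < ρ then (κ y - k0) / (x - y) else 0 with hH
  have hHm0 : ∀ ε, Measurable fun y => if ε < |x - y| ∧ |x - y| < ρ then κ y / (x - y) else 0 := by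
    intro ε
    refine Measurable.ite ?_ ?_ measurable_const
    · exact (meas_far ε x).inter (measurableSet_lt (f := fun y => |x - y|) (by fun_prop) measurable_const)
    · have := (TC_meas_y (a := a) (fun j u v => (hac j).intervalIntegrable u v) x).mul hfc.measurable
      have e : (fun y => κ y / (x - y)) = (fun y => (∏ j, Adiff (a j) x y) / (x - y) ^ (m + 1)) * f := by
        ext y; exact (hker y).symm
      rw [e]; exact this
  have hm1 : ∀ ε, Measurable fun y => if ε < |x - y| ∧ |x - y| < ρ then (x - y)⁻¹ else 0 := by
    intro ε
    refine Measurable.ite ?_ (by fun_prop) measurable_const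
    exact (meas_far ε x).inter (measurableSet_lt (f := fun y => |x - y|) (by fun_prop) measurable_const)
  have hHe : ∀ ε y, H ε y = (if ε < |x - y| ∧ |x - y| < ρ then κ y / (x - y) else 0) -
      k0 * (if ε < |x - y| ∧ |x - y| < ρ then (x - y)⁻¹ else 0) := by
    intro ε y
    simp only [hH]
    split_ifs <;> ring
  have hHm : ∀ ε, Measurable (H ε) := by
    intro ε
    have : H ε = fun y => (if ε < |x - y| ∧ |x - y| < ρ then κ y / (x - y) else 0) -
      k0 * (if ε < |x - y| ∧ |x - y| < ρ then (x - y)⁻¹ else 0) := by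
      ext y; exact hHe ε y
    rw [this]
    exact (hHm0 ε).sub ((hm1 ε).const_mul _)
  have hball : ∀ c : ℝ, Integrable ((ball x ρ).indicator fun _ => c) := fun c =>
    (integrable_indicator_iff measurableSet_ball).2 (integrableOn_const (by rw [Real.volume_ball]; exact ENNReal.ofReal_ne_top))
  have hTC : ∀ ε, 0 < ε → TC a f ε x = ∫ y, H ε y := by
    intro ε hε
    have i1 : Integrable fun y => if ε < |x - y| ∧ |x - y| < ρ then (x - y)⁻¹ else 0 := by
      refine (hball (1 / ε)).mono' (hm1 ε).aestronglyMeasurable (Eventually.of_forall fun y => ?_)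
      split_ifs with h
      · rw [indicator_of_mem (by rw [mem_ball, Real.dist_eq, abs_sub_comm]; exact h.2), norm_inv, Real.norm_eq_abs,
          ← one_div]
        exact one_div_le_one_div_of_le hε h.1.le
      · rw [norm_zero]; exact indicator_nonneg (fun _ _ => by positivity) _
    have i2 : Integrable (H ε) := by
      refine (hball L).mono' (hHm ε).aestronglyMeasurable (Eventually.of_forall fun y => ?_)
      simp only [hH]
      split_ifs with h
      · rw [indicator_of_mem (by rw [mem_ball, Real.dist_eq, abs_sub_comm]; exact h.2), Real.norm_eq_abs, abs_div,
          div_le_iff₀ (hε.trans h.1)]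
        refine hκl y ?_
        rintro rfl; simp at h; linarith
      · rw [norm_zero]; exact indicator_nonneg (fun _ _ => hL0) _
    have e1 : TC a f ε x = ∫ y, (H ε y + k0 * (if ε < |x - y| ∧ |x - y| < ρ then (x - y)⁻¹ else 0)) := by
      unfold TC
      rw [← integral_indicator (meas_far ε x)]
      congr 1
      ext y
      rw [hHe, sub_add_cancel]
      by_cases h1 : ε < |x - y|
      · rw [indicator_of_mem (by exact h1), hker]
        by_cases h2 : |x - y| < ρ
        · rw [if_pos ⟨h1, h2⟩]
        · rw [if_neg (fun h => h2 h.2)]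
          simp [hκ, hρ y (not_lt.1 h2)]
      · rw [indicator_of_notMem (by exact h1), if_neg (fun h => h1 h.1)]
    rw [e1, integral_add i2 (i1.const_mul _), integral_const_mul, odd_int]
    simp
  refine ⟨∫ y, H 0 y, ?_⟩
  have hlim : Tendsto (fun ε => ∫ y, H ε y) (𝓝[>] 0) (𝓝 (∫ y, H 0 y)) := by
    refine tendsto_integral_filter_of_dominated_convergence ((ball x ρ).indicator fun _ => L)
      (Eventually.of_forall fun ε => (hHm ε).aestronglyMeasurable) ?_ (hball L) ?_
    · filter_upwards [self_mem_nhdsWithin] with ε hε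
      have hε : 0 < ε := hε
      refine Eventually.of_forall fun y => ?_
      simp only [hH]
      split_ifs with h
      · rw [indicator_of_mem (by rw [mem_ball, Real.dist_eq, abs_sub_comm]; exact h.2), Real.norm_eq_abs, abs_div,
          div_le_iff₀ (hε.trans h.1)]
        refine hκl y ?_
        rintro rfl; simp at h; linarith
      · rw [norm_zero]; exact indicator_nonneg (fun _ _ => hL0) _
    · have hne : ∀ᵐ y : ℝ, y ≠ x := by simp [ae_iff]
      filter_upwards [hne] with y hy
      refine tendsto_const_nhds.congr' ?_
      have hpos : 0 < |x - y| := abs_pos.2 (sub_ne_zero.2 (Ne.symm hy))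
      have : ∀ᶠ ε in 𝓝[>] (0:ℝ), ε < |x - y| := nhdsWithin_le_nhds (Iio_mem_nhds hpos)
      filter_upwards [this] with ε hε
      simp only [hH, hpos, hε]
  refine hlim.congr' ?_
  filter_upwards [self_mem_nhdsWithin] with ε hε
  exact (hTC ε hε).symm

end
end CC

namespace CC
noncomputable section
open MeasureTheory Filter Set Metric Topology
open scoped ENNReal BigOperators ComplexConjugate NNReal

/-- unified slots -/
def TU {m : ℕ} (b : Fin (m + 1) → ℝ → ℝ) (ε x : ℝ) : ℝ :=
  TC (fun j : Fin m => b j.castSucc) (b (Fin.last m)) ε x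

/-- slot value -/
def WW {m : ℕ} (g : ℝ → ℝ) (i : Fin (m + 1)) (x y : ℝ) : ℝ := if i = Fin.last m then g y else Adiff g x y

lemma integrand_eq {m : ℕ} (b : Fin (m + 1) → ℝ → ℝ) (x y : ℝ) :
    (∏ j : Fin m, Adiff (b j.castSucc) x y) / (x - y) ^ (m + 1) * b (Fin.last m) y =
      (∏ i, WW (b i) i x y) / (x - y) ^ (m + 1) := by
  rw [Fin.prod_univ_castSucc]
  have : ∀ j : Fin m, WW (b j.castSucc) j.castSucc x y = Adiff (b j.castSucc) x y := by
    intro j; unfold WW; rw [if_neg (Fin.castSucc_lt_last j).ne]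
  simp only [this]
  unfold WW
  rw [if_pos rfl]; ring

lemma prod_update {m : ℕ} (b : Fin (m + 1) → ℝ → ℝ) (i : Fin (m + 1)) (g : ℝ → ℝ) (x y : ℝ) :
    ∏ k, WW (Function.update b i g k) k x y = WW g i x y * ∏ k ∈ Finset.univ.erase i, WW (b k) k x y := by
  rw [← Finset.mul_prod_erase Finset.univ _ (Finset.mem_univ i), Function.update_self]
  congr 1
  refine Finset.prod_congr rfl fun k hk => ?_
  rw [Function.update_of_ne (Finset.ne_of_mem_erase hk)]

/-- data with finite norms -/
structure Fnt {m : ℕ} (r : Fin (m + 1) → ℝ) (b : Fin (m + 1) → ℝ → ℝ) : Prop where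
  meas : ∀ i, Measurable (b i)
  fin : ∀ i, ∫⁻ y, ‖b i y‖ₑ ^ r i ≠ ∞

lemma Fnt.update {m : ℕ} {r : Fin (m + 1) → ℝ} {b : Fin (m + 1) → ℝ → ℝ} (h : Fnt r b) {i : Fin (m + 1)} {g : ℝ → ℝ}
    (hg : Measurable g) (hfin : ∫⁻ y, ‖g y‖ₑ ^ r i ≠ ∞) : Fnt r (Function.update b i g) := by
  constructor
  · intro k
    by_cases hk : k = i
    · subst hk; rwa [Function.update_self]
    · rw [Function.update_of_ne hk]; exact h.meas k
  · intro k
    by_cases hk : k = i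
    · subst hk; rwa [Function.update_self]
    · rw [Function.update_of_ne hk]; exact h.fin k

lemma Fnt.Mc_fin {m : ℕ} {r : Fin (m + 1) → ℝ} (hr : ∀ i, 1 ≤ r i) {b : Fin (m + 1) → ℝ → ℝ} (h : Fnt r b) :
    ∀ᵐ x, ∀ i, Mc (fun y => ‖b i y‖ₑ) x ≠ ∞ :=
  ae_all_iff.2 fun i => Mc_fin_ae (hr i) _ (h.meas i).enorm (h.fin i)

lemma Fnt.integrable {m : ℕ} {r : Fin (m + 1) → ℝ} (hr : ∀ i, 1 ≤ r i) {b : Fin (m + 1) → ℝ → ℝ} (h : Fnt r b)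
    {x : ℝ} (hx : ∀ i, Mc (fun y => ‖b i y‖ₑ) x ≠ ∞) {ε : ℝ} (hε : 0 < ε) :
    IntegrableOn (fun y => (∏ i, WW (b i) i x y) / (x - y) ^ (m + 1)) {y | ε < |x - y|} := by
  have := TC_integrable (a := fun j : Fin m => b j.castSucc) (fun j => h.meas _) (h.meas (Fin.last m)) (hr _) (h.fin _)
    (fun j => hx j.castSucc) hε
  refine this.congr_fun (fun y _ => ?_) (meas_far ε x)
  exact integrand_eq b x y

lemma TU_eq {m : ℕ} (b : Fin (m + 1) → ℝ → ℝ) (ε x : ℝ) :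
    TU b ε x = ∫ y in {y | ε < |x - y|}, (∏ i, WW (b i) i x y) / (x - y) ^ (m + 1) := by
  unfold TU TC
  exact integral_congr_ae (Eventually.of_forall fun y => integrand_eq b x y)

lemma TU_add {m : ℕ} {r : Fin (m + 1) → ℝ} (hr : ∀ i, 1 ≤ r i) {b : Fin (m + 1) → ℝ → ℝ} (i : Fin (m + 1)) {g h : ℝ → ℝ}
    (hb : b i = fun y => g y + h y) (hg : Fnt r (Function.update b i g)) (hh : Fnt r (Function.update b i h)) :
    ∀ᵐ x, ∀ ε : ℝ, 0 < ε → TU b ε x = TU (Function.update b i g) ε x + TU (Function.update b i h) ε x := by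
  filter_upwards [hg.Mc_fin hr, hh.Mc_fin hr] with x h1 h2 ε hε
  rw [TU_eq, TU_eq, TU_eq, ← integral_add (hg.integrable hr h1 hε) (hh.integrable hr h2 hε)]
  refine integral_congr_ae (Eventually.of_forall fun y => ?_)
  have e0 : ∏ k, WW (b k) k x y = WW (b i) i x y * ∏ k ∈ Finset.univ.erase i, WW (b k) k x y :=
    (Finset.mul_prod_erase Finset.univ _ (Finset.mem_univ i)).symm
  have e1 : WW (b i) i x y = WW g i x y + WW h i x y := by
    unfold WW
    rw [hb]
    split_ifs
    · rfl
    · have g1 := h1 i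
      have g2 := h2 i
      have m1 := hg.meas i
      have m2 := hh.meas i
      rw [Function.update_self] at g1 g2 m1 m2
      exact intervalIntegral.integral_add (intervalIntegrable_of_Mc m1.aemeasurable g1 _ _)
        (intervalIntegrable_of_Mc m2.aemeasurable g2 _ _)
  simp only [e0, e1, prod_update]
  ring

lemma weakU {m : ℕ} {r : Fin (m + 1) → ℝ} (hr : ∀ i, 1 ≤ r i) :
    ∃ C : ℝ≥0, 1 ≤ C ∧ ∀ (b : Fin (m + 1) → ℝ → ℝ),
    (∀ i, Measurable (b i)) → ∀ (l : Fin (m + 1) → ℝ), (∀ i, 0 < l i) →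
    volume {x | ∃ ε, 0 < ε ∧ (C : ℝ) * ∏ i, l i < |TU b ε x|} ≤
      C * ∑ i, ENNReal.ofReal (l i) ^ (- r i) * ∫⁻ y, ‖b i y‖ₑ ^ r i := by
  obtain ⟨C, hC1, hC⟩ := weakT' (fun j : Fin m => hr j.castSucc) (hr (Fin.last m))
  refine ⟨C, hC1, fun b hb l hl => ?_⟩
  rw [Fin.prod_univ_castSucc, Fin.sum_univ_castSucc]
  exact hC (fun j => b j.castSucc) (b (Fin.last m)) (fun j => hb _) (hb _) (fun j => l j.castSucc) _ (fun j => hl _) (hl _)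

/-- nice functions -/
def Nice (g : ℝ → ℝ) : Prop := HasCompactSupport g ∧ ContDiff ℝ 1 g

lemma Nice.bd {g : ℝ → ℝ} (h : Nice g) : ∃ M : ℝ, 0 ≤ M ∧ (∀ x, |g x| ≤ M) ∧ ∀ x y, |g x - g y| ≤ M * |x - y| := by
  obtain ⟨C, hC⟩ := ContDiff.lipschitzWith_of_hasCompactSupport h.1 h.2 (by norm_num)
  obtain ⟨D, hD⟩ := h.1.exists_bound_of_continuous h.2.continuous
  refine ⟨C + |D|, by positivity, fun x => ?_, fun x y => ?_⟩
  · exact (hD x).trans ((le_abs_self D).trans (by simp))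
  · have := hC.dist_le_mul x y
    rw [Real.dist_eq, Real.dist_eq] at this
    exact this.trans (mul_le_mul_of_nonneg_right (by simp) (abs_nonneg _))

lemma exists_nice {r : ℝ} (hr : 1 ≤ r) {g : ℝ → ℝ} (hg : Measurable g) (hfin : ∫⁻ y, ‖g y‖ₑ ^ r ≠ ∞) {η : ℝ} (hη : 0 < η) :
    ∃ h : ℝ → ℝ, Nice h ∧ Measurable h ∧ ∫⁻ y, ‖h y‖ₑ ^ r ≠ ∞ ∧ ∫⁻ y, ‖g y - h y‖ₑ ^ r ≤ ENNReal.ofReal η := by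
  have hr0 : 0 < r := by linarith
  have hp0 : ENNReal.ofReal r ≠ 0 := by simpa using hr0
  have hlt : ∀ u : ℝ → ℝ, eLpNorm u (ENNReal.ofReal r) volume = (∫⁻ y, ‖u y‖ₑ ^ r) ^ (1 / r) := by
    intro u
    rw [eLpNorm_eq_lintegral_rpow_enorm_toReal hp0 ENNReal.ofReal_ne_top, ENNReal.toReal_ofReal hr0.le]
  have hml : MemLp g (ENNReal.ofReal r) volume := by
    refine ⟨hg.aestronglyMeasurable, ?_⟩
    rw [hlt]
    exact ENNReal.rpow_lt_top_of_nonneg (by positivity) hfin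
  obtain ⟨h, h1, h2, h3⟩ := hml.exist_eLpNorm_sub_le ENNReal.ofReal_ne_top (by simpa using hr)
    (ε := η ^ (1 / r)) (by positivity)
  have hc : Continuous h := h2.continuous
  refine ⟨h, ⟨h1, h2.of_le (by exact_mod_cast le_top)⟩, hc.measurable, ?_, ?_⟩
  · have := (hc.memLp_of_hasCompactSupport h1 (μ := volume) (p := ENNReal.ofReal r)).2
    rw [hlt] at this
    intro hcc
    rw [hcc, ENNReal.top_rpow_of_pos (by positivity)] at this
    exact lt_irrefl _ this
  · rw [hlt, ← ENNReal.ofReal_rpow_of_pos hη, ENNReal.rpow_le_rpow_iff (by positivity)] at h3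
    exact h3

lemma choose_l {m : ℕ} {r : Fin (m + 1) → ℝ} (hr : ∀ i, 1 ≤ r i) (C : ℝ≥0) (hC : 1 ≤ C) {N : Fin (m + 1) → ℝ≥0∞}
    (hN : ∀ i, N i ≠ ∞) (i : Fin (m + 1)) {δ η : ℝ} (hδ : 0 < δ) (hη : 0 < η) :
    ∃ l : Fin (m + 1) → ℝ, (∀ k, 0 < l k) ∧ (C : ℝ) * ∏ k, l k ≤ δ ∧ ∃ η' : ℝ, 0 < η' ∧
      C * ((ENNReal.ofReal (l i) ^ (- r i) * ENNReal.ofReal η') +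
        ∑ k ∈ Finset.univ.erase i, ENNReal.ofReal (l k) ^ (- r k) * N k) ≤ ENNReal.ofReal η := by
  set S : ℝ := (C * ∑ k ∈ Finset.univ.erase i, N k).toReal with hS
  have hSt : (C * ∑ k ∈ Finset.univ.erase i, N k) ≠ ∞ :=
    ENNReal.mul_ne_top ENNReal.coe_ne_top (ENNReal.sum_ne_top.2 fun k _ => hN k)
  have hS0 : 0 ≤ S := ENNReal.toReal_nonneg
  set Λ : ℝ := 1 + 2 * S / η with hΛ
  have hΛ1 : 1 ≤ Λ := by rw [hΛ]; have : 0 ≤ 2 * S / η := by positivity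
                         linarith
  have hC0 : (0:ℝ) < C := by exact_mod_cast zero_lt_one.trans_le hC
  have hΛ0 : 0 < Λ := by linarith
  set li : ℝ := δ / (C * Λ ^ m) with hli
  have hli0 : 0 < li := by positivity
  set l : Fin (m + 1) → ℝ := Function.update (fun _ => Λ) i li with hl
  have hl_i : l i = li := by simp [hl]
  have hl_k : ∀ k ∈ Finset.univ.erase i, l k = Λ := by
    intro k hk; simp [hl, Function.update_of_ne (Finset.ne_of_mem_erase hk)]
  refine ⟨l, ?_, ?_, η / 2 / (C * li ^ (- r i)), by positivity, ?_⟩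
  · intro k
    by_cases hk : k = i
    · rw [hk, hl_i]; exact hli0
    · rw [hl_k k (Finset.mem_erase.2 ⟨hk, Finset.mem_univ _⟩)]; exact hΛ0
  · rw [← Finset.mul_prod_erase Finset.univ _ (Finset.mem_univ i), Finset.prod_congr rfl hl_k, hl_i]
    rw [Finset.prod_const, Finset.card_erase_of_mem (Finset.mem_univ _), Finset.card_univ, Fintype.card_fin]
    simp only [Nat.add_sub_cancel]
    refine le_of_eq ?_
    rw [hli]; field_simp
  · rw [mul_add]
    have e : ENNReal.ofReal η = ENNReal.ofReal (η / 2) + ENNReal.ofReal (η / 2) := by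
      rw [← ENNReal.ofReal_add (by positivity) (by positivity)]; congr 1; ring
    rw [e]
    refine add_le_add ?_ ?_
    · rw [hl_i, ENNReal.ofReal_rpow_of_pos hli0, ← ENNReal.ofReal_coe_nnreal, ← ENNReal.ofReal_mul (by positivity),
        ← ENNReal.ofReal_mul (by positivity)]
      refine ENNReal.ofReal_le_ofReal (le_of_eq ?_)
      have : li ^ (- r i) ≠ 0 := by positivity
      field_simp
    · have h1 : ∑ k ∈ Finset.univ.erase i, ENNReal.ofReal (l k) ^ (- r k) * N k ≤
          ENNReal.ofReal Λ⁻¹ * ∑ k ∈ Finset.univ.erase i, N k := by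
        rw [Finset.mul_sum]
        refine Finset.sum_le_sum fun k hk => mul_le_mul_left ?_ _
        rw [hl_k k hk, ENNReal.ofReal_rpow_of_pos hΛ0]
        refine ENNReal.ofReal_le_ofReal ?_
        rw [← Real.rpow_neg_one]
        exact Real.rpow_le_rpow_of_exponent_le hΛ1 (by linarith [hr k])
      refine (mul_le_mul_right h1 _).trans ?_
      rw [mul_left_comm, ← ENNReal.ofReal_toReal hSt, ← hS, ← ENNReal.ofReal_mul (by positivity)]
      refine ENNReal.ofReal_le_ofReal ?_
      rw [inv_mul_le_iff₀ hΛ0, hΛ]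
      have : (1 + 2 * S / η) * (η / 2) = η / 2 + S := by field_simp
      rw [this]; linarith

theorem pv_ae {m : ℕ} {r : Fin (m + 1) → ℝ} (hr : ∀ i, 1 ≤ r i) (b : Fin (m + 1) → ℝ → ℝ) (hb : Fnt r b) :
    ∀ᵐ x, ∃ l, Tendsto (fun ε => TU b ε x) (𝓝[>] 0) (𝓝 l) := by
  obtain ⟨C, hC1, hC⟩ := weakU hr
  have main : ∀ (S : Finset (Fin (m + 1))) (b : Fin (m + 1) → ℝ → ℝ), Fnt r b → (∀ i ∉ S, Nice (b i)) →
      ∀ᵐ x, ∃ l, Tendsto (fun ε => TU b ε x) (𝓝[>] 0) (𝓝 l) := by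
    intro S
    induction S using Finset.induction_on with
    | empty =>
      intro b hb hn
      have hn : ∀ i, Nice (b i) := fun i => hn i (by simp)
      choose M hM0 hM1 hM2 using fun i => (hn i).bd
      set K : ℝ := 1 + ∑ i, M i with hK
      have hMK : ∀ i, M i ≤ K := by
        intro i
        have := Finset.single_le_sum (f := M) (fun i _ => hM0 i) (Finset.mem_univ i)
        linarith
      have hK1 : 1 ≤ K := by
        have : 0 ≤ ∑ i, M i := Finset.sum_nonneg fun i _ => hM0 i
        linarith
      refine Eventually.of_forall fun x => ?_
      exact pv_nice hK1 (fun j => (hn _).2.continuous) (hn _).2.continuous (fun j x => (hM1 _ x).trans (hMK _))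
        (fun j x y => (hM2 _ x y).trans (mul_le_mul_of_nonneg_right (hMK _) (abs_nonneg _)))
        (fun x => (hM1 _ x).trans (hMK _))
        (fun x y => (hM2 _ x y).trans (mul_le_mul_of_nonneg_right (hMK _) (abs_nonneg _))) (hn _).1 x
    | insert i S hi ih =>
      intro b hb hn
      refine pv_of_approx _ fun δ hδ η hη => ?_
      obtain ⟨l, hl0, hlδ, η', hη', hle⟩ := choose_l hr C hC1 hb.fin i hδ hη
      obtain ⟨g, hgn, hgm, hgf, hgd⟩ := exists_nice (hr i) (hb.meas i) (hb.fin i) hη'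
      have f1 : Fnt r (Function.update b i g) := hb.update hgm hgf
      have hm2 : Measurable fun y => b i y - g y := (hb.meas i).sub hgm
      have f2 : Fnt r (Function.update b i (fun y => b i y - g y)) :=
        hb.update hm2 (ne_top_of_le_ne_top ENNReal.ofReal_ne_top hgd)
      refine ⟨TU (Function.update b i g), TU (Function.update b i (fun y => b i y - g y)),
        TU_add hr i (by ext y; ring) f1 f2, ih _ f1 ?_, ?_⟩
      · intro k hk
        by_cases hki : k = i
        · subst hki; rwa [Function.update_self]
        · rw [Function.update_of_ne hki]; exact hn k (by simp [hki, hk])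
      · have h := hC _ f2.meas l hl0
        rw [← Finset.add_sum_erase Finset.univ _ (Finset.mem_univ i), Function.update_self] at h
        refine le_trans (measure_mono ?_) (h.trans (le_trans (mul_le_mul_right ?_ _) hle))
        · rintro x ⟨ε, hε, hx⟩
          exact ⟨ε, hε, lt_of_le_of_lt hlδ hx⟩
        · refine add_le_add (mul_le_mul_right hgd _) (le_of_eq (Finset.sum_congr rfl fun k hk => ?_))
          rw [Function.update_of_ne (Finset.ne_of_mem_erase hk)]
  exact main Finset.univ b hb fun i hi => absurd (Finset.mem_univ i) hi

end
end CC

namespace CC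
noncomputable section
open MeasureTheory Filter Set Metric Topology
open scoped ENNReal BigOperators ComplexConjugate NNReal

/-- a largest measurable set on which a given function is a.e. measurable -/
lemma exists_max_set (f : ℝ → ℝ) : ∃ U : Set ℝ, MeasurableSet U ∧ AEMeasurable f (volume.restrict U) ∧
    ∀ V : Set ℝ, MeasurableSet V → AEMeasurable f (volume.restrict V) → volume (V \ U) = 0 := by
  set μ : Measure ℝ := (volume : Measure ℝ).toFinite with hμ
  set G : Set ℝ≥0∞ := {c | ∃ V : Set ℝ, MeasurableSet V ∧ AEMeasurable f (volume.restrict V) ∧ c = μ V} with hG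
  have hne : G.Nonempty := ⟨μ ∅, ∅, MeasurableSet.empty, by simp, rfl⟩
  obtain ⟨u, -, hu, huG⟩ := exists_seq_tendsto_sSup hne (OrderTop.bddAbove G)
  choose V hV1 hV2 hV3 using huG
  refine ⟨⋃ n, V n, MeasurableSet.iUnion hV1, aemeasurable_iUnion_iff.2 hV2, fun W hW1 hW2 => ?_⟩
  have h1 : sSup G ≤ μ (⋃ n, V n) := by
    refine le_of_tendsto' hu fun n => ?_
    rw [hV3]; exact measure_mono (subset_iUnion V n)
  have h2 : μ ((⋃ n, V n) ∪ W) ≤ sSup G :=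
    le_sSup ⟨_, (MeasurableSet.iUnion hV1).union hW1,
      aemeasurable_union_iff.2 ⟨aemeasurable_iUnion_iff.2 hV2, hW2⟩, rfl⟩
  have h3 : μ (W \ ⋃ n, V n) = 0 := by
    have h4 : μ (⋃ n, V n) + μ (W \ ⋃ n, V n) ≤ μ (⋃ n, V n) + 0 := by
      rw [← measure_union disjoint_sdiff_right (hW1.diff (MeasurableSet.iUnion hV1)), union_sdiff_self, add_zero]
      exact h2.trans h1
    exact le_antisymm ((ENNReal.add_le_add_iff_left (measure_ne_top _ _)).1 h4) bot_le
  exact absolutelyContinuous_toFinite volume h3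

/-- the class of `x` -/
def QCl {m : ℕ} (a : Fin m → ℝ → ℝ) (x : ℝ) : Set ℝ := {y | ∀ j, IntervalIntegrable (a j) volume x y}

lemma mem_QCl {m : ℕ} {a : Fin m → ℝ → ℝ} {x y : ℝ} :
    y ∈ QCl a x ↔ ∀ j, IntervalIntegrable (a j) volume x y := Iff.rfl

lemma QCl_self {m : ℕ} (a : Fin m → ℝ → ℝ) (x : ℝ) : x ∈ QCl a x := fun j => IntervalIntegrable.refl

lemma QCl_eq {m : ℕ} {a : Fin m → ℝ → ℝ} {x y : ℝ} (h : y ∈ QCl a x) : QCl a y = QCl a x := by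
  ext z
  exact ⟨fun hz j => (h j).trans (hz j), fun hz j => (h j).symm.trans (hz j)⟩

lemma QCl_ord {m : ℕ} (a : Fin m → ℝ → ℝ) (x : ℝ) : (QCl a x).OrdConnected := by
  refine ⟨fun y hy z hz w hw j => ?_⟩
  have h1 : IntervalIntegrable (a j) volume y z := (hy j).symm.trans (hz j)
  refine (hy j).trans (h1.mono_set ?_)
  rw [uIcc_of_le hw.1, uIcc_of_le (hw.1.trans hw.2)]
  exact Icc_subset_Icc_right hw.2

lemma QCl_meas {m : ℕ} (a : Fin m → ℝ → ℝ) (x : ℝ) : MeasurableSet (QCl a x) := (QCl_ord a x).measurableSet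

lemma prod_zero_of_notMem {m : ℕ} {a : Fin m → ℝ → ℝ} {x y : ℝ} (h : y ∉ QCl a x) : ∏ j, Adiff (a j) x y = 0 := by
  rw [mem_QCl] at h
  push Not at h
  obtain ⟨j, hj⟩ := h
  refine Finset.prod_eq_zero (Finset.mem_univ j) ?_
  exact intervalIntegral.integral_undef fun h => hj h.symm

lemma QCl_aemeas {m : ℕ} (a : Fin m → ℝ → ℝ) (x : ℝ) (j : Fin m) : AEMeasurable (a j) (volume.restrict (QCl a x)) := by
  have h0 : (volume : Measure ℝ).restrict (interior (QCl a x)) = volume.restrict (QCl a x) :=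
    Measure.restrict_congr_set (interior_ae_eq_of_null_frontier ((QCl_ord a x).convex.addHaar_frontier volume))
  rw [← h0]
  have : LocallyIntegrableOn (a j) (interior (QCl a x)) volume := by
    intro y hy
    have hy' : QCl a x ∈ 𝓝 y := mem_interior_iff_mem_nhds.1 hy
    obtain ⟨δ, hδ, hs⟩ := Metric.nhds_basis_closedBall.mem_iff.1 hy'
    refine ⟨Ioc (y - δ) (y + δ), mem_nhdsWithin_of_mem_nhds (Ioc_mem_nhds (by linarith) (by linarith)), ?_⟩
    rw [Real.closedBall_eq_Icc] at hs
    have h1 : IntervalIntegrable (a j) volume (y - δ) (y + δ) :=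
      (hs ⟨le_refl _, by linarith⟩ j).symm.trans (hs ⟨by linarith, le_refl _⟩ j)
    exact (intervalIntegrable_iff_integrableOn_Ioc_of_le (by linarith)).1 h1
  exact this.aestronglyMeasurable.aemeasurable

lemma Adiff_meas {g : ℝ → ℝ} (hg : Measurable g) (x : ℝ) : Measurable fun y => Adiff g x y := by
  unfold Adiff
  simp only [intervalIntegral]
  have h1 : ∀ y, ∫ t in Ioc y x, g t = ∫ t, (if y < t ∧ t ≤ x then g t else 0) := by
    intro y
    rw [← integral_indicator measurableSet_Ioc]
    refine integral_congr_ae (Eventually.of_forall fun t => ?_)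
    simp only [indicator_apply, mem_Ioc]
  have h2 : ∀ y, ∫ t in Ioc x y, g t = ∫ t, (if x < t ∧ t ≤ y then g t else 0) := by
    intro y
    rw [← integral_indicator measurableSet_Ioc]
    refine integral_congr_ae (Eventually.of_forall fun t => ?_)
    simp only [indicator_apply, mem_Ioc]
  simp only [h1, h2]
  refine Measurable.sub ?_ ?_
  · refine (StronglyMeasurable.integral_prod_right (Measurable.stronglyMeasurable ?_)).measurable
    refine Measurable.ite ?_ (hg.comp measurable_snd) measurable_const
    exact (measurableSet_lt measurable_fst measurable_snd).inter (measurableSet_le measurable_snd measurable_const)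
  · refine (StronglyMeasurable.integral_prod_right (Measurable.stronglyMeasurable ?_)).measurable
    refine Measurable.ite ?_ (hg.comp measurable_snd) measurable_const
    exact (measurableSet_lt measurable_const measurable_snd).inter (measurableSet_le measurable_snd measurable_fst)

lemma ker_meas {m : ℕ} {a : Fin m → ℝ → ℝ} (ha : ∀ j, Measurable (a j)) (x : ℝ) :
    Measurable fun y => (∏ j, Adiff (a j) x y) / (x - y) ^ (m + 1) := by
  refine Measurable.div ?_ (by fun_prop)
  exact Finset.measurable_fun_prod _ fun j _ => Adiff_meas (ha j) x

/-- reduction to measurable data on one class -/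
lemma class_red {m : ℕ} (a : Fin m → ℝ → ℝ) (f : ℝ → ℝ) {U : Set ℝ} (hU : MeasurableSet U)
    (hUm : ∀ V : Set ℝ, MeasurableSet V → AEMeasurable f (volume.restrict V) → volume (V \ U) = 0)
    (x : ℝ) (a' : Fin m → ℝ → ℝ) (f' : ℝ → ℝ) (ha' : ∀ j, Measurable (a' j)) 
    (haa : ∀ j, (QCl a x).indicator (a j) =ᵐ[volume] a' j) (hff : (U ∩ QCl a x).indicator f =ᵐ[volume] f') :
    (∃ ε₀ > 0, ∀ ε ≤ ε₀, TC a f ε x = 0) ∨ ∀ ε > 0, TC a f ε x = TC a' f' ε x := by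
  set Q := QCl a x with hQ
  have hA : ∀ y ∈ Q, ∀ j, Adiff (a j) x y = Adiff (a' j) x y := by
    intro y hy j
    have h1 : Adiff (a j) x y = Adiff (Q.indicator (a j)) x y := by
      unfold Adiff
      refine intervalIntegral.integral_congr fun t ht => ?_
      have : t ∈ Q := (QCl_ord a x).uIcc_subset hy (QCl_self a x) ht
      simp only [indicator_of_mem this]
    rw [h1]
    unfold Adiff
    refine intervalIntegral.integral_congr_ae ?_
    filter_upwards [haa j] with t ht _ using ht
  set k : ℝ → ℝ := Q.indicator fun y => (∏ j, Adiff (a' j) x y) / (x - y) ^ (m + 1) with hk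
  have hkm : Measurable k := (ker_meas ha' x).indicator (QCl_meas a x)
  have hF : ∀ y, (∏ j, Adiff (a j) x y) / (x - y) ^ (m + 1) * f y = k y * f y := by
    intro y
    by_cases hy : y ∈ Q
    · rw [hk, indicator_of_mem hy, Finset.prod_congr rfl fun j _ => hA y hy j]
    · rw [hk, indicator_of_notMem hy, prod_zero_of_notMem hy, zero_div]
  have hT : ∀ ε, TC a f ε x = ∫ y in {y : ℝ | ε < |x - y|}, k y * f y := by
    intro ε; unfold TC; simp only [hF]
  by_cases hc : ∀ ε > 0, AEMeasurable (fun y => k y * f y) (volume.restrict {y : ℝ | ε < |x - y|})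
  · right
    intro ε hε
    set V := {y : ℝ | ε < |x - y|} ∩ {y | k y ≠ 0} with hV
    have hVm : MeasurableSet V := (meas_far ε x).inter (hkm (measurableSet_singleton 0).compl)
    have h1 : AEMeasurable f (volume.restrict V) := by
      have h2 : AEMeasurable (fun y => k y * f y) (volume.restrict V) := (hc ε hε).mono_set inter_subset_left
      have h3 := h2.div hkm.aemeasurable
      refine h3.congr ?_
      filter_upwards [ae_restrict_mem hVm] with y hy
      have : k y ≠ 0 := hy.2
      simp only [Pi.div_apply]
      field_simp
    have h4 := hUm V hVm h1
    rw [hT]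
    unfold TC
    refine integral_congr_ae ?_
    have h5 : ∀ᵐ y, y ∉ V \ U := measure_eq_zero_iff_ae_notMem.1 h4
    filter_upwards [ae_restrict_of_ae h5, ae_restrict_of_ae hff, ae_restrict_mem (meas_far ε x)] with y hy1 hy2 hy3
    rw [← hy2]
    by_cases hyQ : y ∈ Q
    · by_cases hyU : y ∈ U
      · rw [indicator_of_mem (show y ∈ U ∩ Q from ⟨hyU, hyQ⟩), hk, indicator_of_mem hyQ]
      · rw [indicator_of_notMem (fun h => hyU h.1), mul_zero]
        have : k y = 0 := by
          by_contra h
          exact hy1 ⟨⟨hy3, h⟩, hyU⟩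
        rw [this, zero_mul]
    · rw [indicator_of_notMem (fun h => hyQ h.2), mul_zero, hk, indicator_of_notMem hyQ, zero_mul]
  · left
    push Not at hc
    obtain ⟨ε₀, hε₀, hn⟩ := hc
    refine ⟨ε₀, hε₀, fun ε hε => ?_⟩
    rw [hT]
    refine integral_non_aestronglyMeasurable fun h => hn ?_
    exact h.aemeasurable.mono_set fun y hy => lt_of_le_of_lt hε hy

lemma Ccomm_eq {m : ℕ} (a : Fin m → ℝ → ℝ) (f : ℝ → ℝ) (x : ℝ) :
    Ccomm m a f x = limUnder (𝓝[>] 0) fun ε => TC a f ε x := rfl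

lemma Ccomm_zero {m : ℕ} {a : Fin m → ℝ → ℝ} {f : ℝ → ℝ} {x : ℝ}
    (h : ∃ ε₀ > 0, ∀ ε ≤ ε₀, TC a f ε x = 0) : Ccomm m a f x = 0 := by
  obtain ⟨ε₀, hε₀, h⟩ := h
  rw [Ccomm_eq]
  refine Tendsto.limUnder_eq (tendsto_const_nhds.congr' ?_)
  filter_upwards [mem_nhdsWithin_of_mem_nhds (Iic_mem_nhds hε₀)] with ε hε
  exact (h ε hε).symm

lemma TC_singleton {m : ℕ} {a : Fin m → ℝ → ℝ} {f : ℝ → ℝ} {x : ℝ} (h : QCl a x ⊆ {x}) (ε : ℝ) :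
    TC a f ε x = 0 := by
  unfold TC
  refine integral_eq_zero_of_ae ?_
  refine ae_restrict_of_ae ?_
  have : ∀ᵐ y : ℝ, y ≠ x := by
    simp [ae_iff]
  filter_upwards [this] with y hy
  rw [prod_zero_of_notMem fun h' => hy (h h')]
  simp

lemma exists_rat {m : ℕ} {a : Fin m → ℝ → ℝ} {x : ℝ} (h : ¬ QCl a x ⊆ {x}) : ∃ q : ℚ, x ∈ QCl a q := by
  rw [not_subset] at h
  obtain ⟨y, hy, hyx⟩ := h
  have hyx : y ≠ x := hyx
  have key : ∃ q : ℚ, (q : ℝ) ∈ QCl a x := by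
    rcases lt_or_gt_of_ne hyx with h | h
    · obtain ⟨q, h1, h2⟩ := exists_rat_btwn h
      exact ⟨q, (QCl_ord a x).out hy (QCl_self a x) ⟨h1.le, h2.le⟩⟩
    · obtain ⟨q, h1, h2⟩ := exists_rat_btwn h
      exact ⟨q, (QCl_ord a x).out (QCl_self a x) hy ⟨h1.le, h2.le⟩⟩
  obtain ⟨q, hq⟩ := key
  exact ⟨q, by rw [QCl_eq hq]; exact QCl_self a x⟩

/-- the reduction to countably many measurable pieces -/
lemma NM {m : ℕ} (B : Fin (m + 1) → ℝ → ℝ) :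
    ∃ (ι : Type) (_ : Countable ι) (b : ι → Fin (m + 1) → ℝ → ℝ), (∀ i k, Measurable (b i k)) ∧
      (∀ (k : Fin (m + 1)) (r : ℝ), 0 < r → ∑' i, ∫⁻ y, ‖b i k y‖ₑ ^ r ≤ ∫⁻ y, ‖B k y‖ₑ ^ r) ∧
      ∀ x, Ccomm m (fun j => B j.castSucc) (B (Fin.last m)) x ≠ 0 → ∃ i, ∀ ε > 0, TU B ε x = TU (b i) ε x := by
  set a : Fin m → ℝ → ℝ := fun j => B j.castSucc with ha
  set f := B (Fin.last m) with hf
  obtain ⟨U, hU, hUf, hUm⟩ := exists_max_set f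
  set R : Set (Set ℝ) := Set.range fun q : ℚ => QCl a q with hR
  have hRc : Countable R := (countable_range _).to_subtype
  have hRm : ∀ i : R, MeasurableSet (i : Set ℝ) := by
    rintro ⟨_, q, rfl⟩; exact QCl_meas a _
  have hRd : Pairwise (Function.onFun Disjoint fun i : R => (i : Set ℝ)) := by
    rintro ⟨_, q, rfl⟩ ⟨_, q', rfl⟩ hne
    simp only [Function.onFun]
    rw [Set.disjoint_left]
    intro z hz hz'
    refine hne ?_
    ext1
    simp only
    rw [← QCl_eq hz, QCl_eq hz']
  have hRae : ∀ (i : R) j, AEMeasurable ((i : Set ℝ).indicator (a j)) volume := by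
    rintro ⟨_, q, rfl⟩ j
    exact (aemeasurable_indicator_iff (QCl_meas a _)).2 (QCl_aemeas a _ j)
  have hRf : ∀ i : R, AEMeasurable ((U ∩ (i : Set ℝ)).indicator f) volume := by
    intro i
    exact (aemeasurable_indicator_iff (hU.inter (hRm i))).2 (hUf.mono_set inter_subset_left)
  set b : R → Fin (m + 1) → ℝ → ℝ := fun i =>
    Fin.snoc (α := fun _ => ℝ → ℝ) (fun j => (hRae i j).mk _) ((hRf i).mk _) with hb
  have hb1 : ∀ i j, b i (Fin.castSucc j) = (hRae i j).mk _ := by intro i j; simp [hb]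
  have hb2 : ∀ i, b i (Fin.last m) = (hRf i).mk _ := by intro i; simp [hb]
  refine ⟨R, hRc, b, ?_, ?_, ?_⟩
  · intro i k
    induction k using Fin.lastCases with
    | last => rw [hb2]; exact (hRf i).measurable_mk
    | cast j => rw [hb1]; exact (hRae i j).measurable_mk
  · intro k r hr
    have h1 : ∀ i, ∫⁻ y, ‖b i k y‖ₑ ^ r ≤ ∫⁻ y in (i : Set ℝ), ‖B k y‖ₑ ^ r := by
      intro i
      rw [← lintegral_indicator (hRm i)]
      induction k using Fin.lastCases with
      | last =>
        refine lintegral_mono_ae ?_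
        rw [hb2]
        filter_upwards [(hRf i).ae_eq_mk] with y hy
        rw [← hy]
        by_cases h : y ∈ U ∩ (i : Set ℝ)
        · rw [indicator_of_mem h, indicator_of_mem h.2]
        · rw [indicator_of_notMem h]; simp [hr]
      | cast j =>
        refine lintegral_mono_ae ?_
        rw [hb1]
        filter_upwards [(hRae i j).ae_eq_mk] with y hy
        rw [← hy]
        by_cases h : y ∈ (i : Set ℝ)
        · rw [indicator_of_mem h, indicator_of_mem h]
        · rw [indicator_of_notMem h]; simp [hr]
    refine (ENNReal.tsum_le_tsum h1).trans ?_
    rw [← lintegral_iUnion hRm hRd]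
    exact setLIntegral_le_lintegral _ _
  · intro x hx
    by_cases hs : QCl a x ⊆ {x}
    · exact absurd (Ccomm_zero ⟨1, one_pos, fun ε _ => TC_singleton hs ε⟩) hx
    obtain ⟨q, hq⟩ := exists_rat hs
    refine ⟨⟨QCl a q, q, rfl⟩, ?_⟩
    set i : R := ⟨QCl a q, q, rfl⟩ with hi
    have hix : QCl a x = (i : Set ℝ) := QCl_eq hq
    rcases class_red a f hU hUm x (fun j => b i j.castSucc) (b i (Fin.last m))
      (fun j => by rw [hb1]; exact (hRae i j).measurable_mk)
      (fun j => by rw [hb1, hix]; exact (hRae i j).ae_eq_mk)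
      (by rw [hb2, hix]; exact (hRf i).ae_eq_mk) with h | h
    · exact absurd (Ccomm_zero h) hx
    · exact h

end
end CC

namespace CC
noncomputable section
open MeasureTheory Filter Set Metric Topology
open scoped ENNReal BigOperators ComplexConjugate NNReal

/-- the commutator in unified slots -/
def CU {m : ℕ} (B : Fin (m + 1) → ℝ → ℝ) (x : ℝ) : ℝ := Ccomm m (fun j => B j.castSucc) (B (Fin.last m)) x

lemma CU_eq {m : ℕ} (B : Fin (m + 1) → ℝ → ℝ) (x : ℝ) :
    CU B x = limUnder (𝓝[>] 0) fun ε => TU B ε x := rfl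

lemma CU_of_tendsto {m : ℕ} {B b : Fin (m + 1) → ℝ → ℝ} {x l : ℝ} (h : ∀ ε > 0, TU B ε x = TU b ε x)
    (hl : Tendsto (fun ε => TU b ε x) (𝓝[>] 0) (𝓝 l)) : CU B x = l := by
  rw [CU_eq]
  refine Tendsto.limUnder_eq (hl.congr' ?_)
  filter_upwards [self_mem_nhdsWithin] with ε hε using (h ε hε).symm

lemma TU_zero {m : ℕ} {b : Fin (m + 1) → ℝ → ℝ} {k : Fin (m + 1)} (h : b k =ᵐ[volume] 0) (ε x : ℝ) : TU b ε x = 0 := by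
  unfold TU TC
  induction k using Fin.lastCases with
  | last =>
    refine integral_eq_zero_of_ae (ae_restrict_of_ae ?_)
    filter_upwards [h] with y hy
    rw [hy]; simp
  | cast j =>
    refine integral_eq_zero_of_ae (Eventually.of_forall fun y => ?_)
    have : Adiff (b j.castSucc) x y = 0 := by
      unfold Adiff
      refine intervalIntegral.integral_zero_ae ?_
      filter_upwards [h] with t ht _ using ht
    have h2 : ∏ j : Fin m, Adiff (b j.castSucc) x y = 0 := Finset.prod_eq_zero (Finset.mem_univ j) this
    simp only [h2]
    simp

lemma CU_zero {m : ℕ} {B : Fin (m + 1) → ℝ → ℝ} {k : Fin (m + 1)} {r : ℝ} (hr : 0 < r)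
    (h : ∫⁻ y, ‖B k y‖ₑ ^ r = 0) (x : ℝ) : CU B x = 0 := by
  obtain ⟨ι, _, b, hbm, hbs, hbx⟩ := NM B
  by_contra hx
  obtain ⟨i, hi⟩ := hbx x hx
  have h1 : ∫⁻ y, ‖b i k y‖ₑ ^ r = 0 :=
    le_antisymm ((ENNReal.le_tsum i).trans ((hbs k r hr).trans h.le)) bot_le
  rw [lintegral_eq_zero_iff ((hbm i k).enorm.pow_const r)] at h1
  have h2 : b i k =ᵐ[volume] 0 := by
    filter_upwards [h1] with y hy
    simpa [hr, hr.not_gt] using hy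
  refine hx (CU_of_tendsto hi ?_)
  simp only [TU_zero h2]
  exact tendsto_const_nhds

/-- distribution function of the truncated operators -/
def DU {m : ℕ} (b : Fin (m + 1) → ℝ → ℝ) (t : ℝ) : ℝ≥0∞ := volume {x | ∃ ε, 0 < ε ∧ t < |TU b ε x|}

lemma DU_anti {m : ℕ} (b : Fin (m + 1) → ℝ → ℝ) : Antitone (DU b) := by
  intro s t hst
  refine measure_mono ?_
  rintro x ⟨ε, hε, hx⟩
  exact ⟨ε, hε, lt_of_le_of_lt hst hx⟩

lemma TU_scale {m : ℕ} (b : Fin (m + 1) → ℝ → ℝ) (l : Fin (m + 1) → ℝ) (ε x : ℝ) :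
    TU (fun k y => l k * b k y) ε x = (∏ k, l k) * TU b ε x := by
  unfold TU
  rw [Fin.prod_univ_castSucc]
  exact TC_scale (fun j => b j.castSucc) (b (Fin.last m)) (fun j => l j.castSucc) (l (Fin.last m)) ε x

lemma NM2 {m : ℕ} {r : Fin (m + 1) → ℝ} (hr : ∀ i, 1 ≤ r i) (B : Fin (m + 1) → ℝ → ℝ)
    (hB : ∀ k, ∫⁻ y, ‖B k y‖ₑ ^ r k ≠ ∞) :
    ∃ (ι : Type) (_ : Countable ι) (b : ι → Fin (m + 1) → ℝ → ℝ), (∀ i k, Measurable (b i k)) ∧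
      (∀ k, ∑' i, ∫⁻ y, ‖b i k y‖ₑ ^ r k ≤ ∫⁻ y, ‖B k y‖ₑ ^ r k) ∧
      ∀ t, 0 ≤ t → volume {x | t < |CU B x|} ≤ ∑' i, DU (b i) t := by
  obtain ⟨ι, hι, b, hbm, hbs, hbx⟩ := NM B
  have hs := fun k => hbs k (r k) (by linarith [hr k])
  refine ⟨ι, hι, b, hbm, hs, fun t ht => ?_⟩
  have hpv : ∀ᵐ x, ∀ i, ∃ l, Tendsto (fun ε => TU (b i) ε x) (𝓝[>] 0) (𝓝 l) := by
    rw [ae_all_iff]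
    intro i
    refine pv_ae hr (b i) ⟨hbm i, fun k => ne_top_of_le_ne_top (hB k) ((ENNReal.le_tsum i).trans (hs k))⟩
  refine le_trans (measure_mono_ae ?_) (measure_iUnion_le _)
  filter_upwards [hpv] with x hx hxt
  have hxt : t < |CU B x| := hxt
  have h0 : CU B x ≠ 0 := by
    intro h; rw [h, abs_zero] at hxt; linarith
  obtain ⟨i, hi⟩ := hbx x h0
  obtain ⟨l, hl⟩ := hx i
  rw [CU_of_tendsto hi hl] at hxt
  have h1 : ∀ᶠ ε in 𝓝[>] (0:ℝ), t < |TU (b i) ε x| := hl.abs.eventually (lt_mem_nhds hxt)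
  obtain ⟨ε, h2, h3⟩ := (h1.and self_mem_nhdsWithin).exists
  exact mem_iUnion.2 ⟨i, ε, h3, h2⟩

lemma LpNorm_eq {r : ℝ} (hr : 0 < r) (g : ℝ → ℝ) : LpNorm r g = (∫⁻ y, ‖g y‖ₑ ^ r) ^ (1 / r) := by
  unfold LpNorm
  congr 1
  refine lintegral_congr fun y => ?_
  rw [Real.enorm_eq_ofReal_abs, ENNReal.ofReal_rpow_of_nonneg (abs_nonneg _) hr.le]

/-- trichotomy of the right-hand side -/
lemma rhs_cases {m : ℕ} {r : Fin (m + 1) → ℝ} (hr : ∀ i, 1 ≤ r i) (B : Fin (m + 1) → ℝ → ℝ) {C : ℝ} (hC : 0 < C) :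
    (∀ x, CU B x = 0) ∨ (ENNReal.ofReal C * ∏ k, LpNorm (r k) (B k) = ∞) ∨
    ∃ N : Fin (m + 1) → ℝ, (∀ k, 0 < N k) ∧ (∀ k, LpNorm (r k) (B k) = ENNReal.ofReal (N k)) ∧
      ∀ k, ∫⁻ y, ‖B k y‖ₑ ^ r k = ENNReal.ofReal (N k ^ r k) := by
  have hr0 : ∀ k, 0 < r k := fun k => by linarith [hr k]
  by_cases h0 : ∃ k, ∫⁻ y, ‖B k y‖ₑ ^ r k = 0
  · obtain ⟨k, hk⟩ := h0
    exact Or.inl (CU_zero (hr0 k) hk)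
  push Not at h0
  right
  have hne : ∀ k, LpNorm (r k) (B k) ≠ 0 := by
    intro k hk
    rw [LpNorm_eq (hr0 k), ENNReal.rpow_eq_zero_iff_of_pos (by have := hr0 k; positivity)] at hk
    exact h0 k hk
  by_cases h1 : ∃ k, LpNorm (r k) (B k) = ∞
  · left
    obtain ⟨k, hk⟩ := h1
    rw [← Finset.mul_prod_erase Finset.univ _ (Finset.mem_univ k), hk,
      ENNReal.top_mul (Finset.prod_ne_zero_iff.2 fun i _ => hne i), ENNReal.mul_top (by simpa using hC)]
  · right
    push Not at h1
    refine ⟨fun k => (LpNorm (r k) (B k)).toReal, fun k => ENNReal.toReal_pos (hne k) (h1 k),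
      fun k => (ENNReal.ofReal_toReal (h1 k)).symm, fun k => ?_⟩
    rw [← ENNReal.ofReal_rpow_of_nonneg ENNReal.toReal_nonneg (hr0 k).le, ENNReal.ofReal_toReal (h1 k),
      LpNorm_eq (hr0 k), ← ENNReal.rpow_mul, one_div, inv_mul_cancel₀ (hr0 k).ne', ENNReal.rpow_one]

theorem weakF {m : ℕ} {r : Fin (m + 1) → ℝ} (hr : ∀ i, 1 ≤ r i) {P : ℝ} (hP : 0 < P) (hPr : 1 / P = ∑ i, 1 / r i) :
    ∃ C : ℝ, 0 < C ∧ ∀ B : Fin (m + 1) → ℝ → ℝ, wkNorm P (CU B) ≤ ENNReal.ofReal C * ∏ k, LpNorm (r k) (B k) := by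
  obtain ⟨C0, hC1, hC0⟩ := weakU hr
  have hr0 : ∀ k, 0 < r k := fun k => by linarith [hr k]
  have hC00 : (0:ℝ) < C0 := lt_of_lt_of_le one_pos (by exact_mod_cast hC1)
  set A : ℝ := (C0 * (m + 1)) ^ (1 / P) with hA
  have hA0 : 0 < A := by positivity
  refine ⟨A * C0, by positivity, fun B => ?_⟩
  rcases rhs_cases hr B (C := A * C0) (by positivity) with h | h | ⟨N, hN0, hN1, hN2⟩
  · have : wkNorm P (CU B) = 0 := by
      unfold wkNorm
      simp only [h, abs_zero]
      refine le_antisymm (iSup₂_le fun t ht => ?_) bot_le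
      have : {x : ℝ | t < 0} = ∅ := by ext; simp [le_of_lt ht]
      rw [this, measure_empty, ENNReal.zero_rpow_of_pos (by positivity), mul_zero]
    rw [this]; exact bot_le
  · rw [h]; exact le_top
  obtain ⟨ι, hι, b, hbm, hbs, hbD⟩ := NM2 hr B (fun k => by rw [hN2]; exact ENNReal.ofReal_ne_top)
  simp only [hN1]
  rw [← ENNReal.ofReal_prod_of_nonneg (fun k _ => (hN0 k).le), ← ENNReal.ofReal_mul (by positivity)]
  set M : ℝ := ∏ k, N k with hM
  have hM0 : 0 < M := Finset.prod_pos fun k _ => hN0 k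
  unfold wkNorm
  refine iSup₂_le fun t ht => ?_
  set s : ℝ := t / (C0 * M) with hs
  have hs0 : 0 < s := by positivity
  set l : Fin (m + 1) → ℝ := fun k => N k * s ^ (P / r k) with hl
  have hl0 : ∀ k, 0 < l k := fun k => mul_pos (hN0 k) (Real.rpow_pos_of_pos hs0 _)
  have hprod : (C0 : ℝ) * ∏ k, l k = t := by
    rw [hl, Finset.prod_mul_distrib, ← Real.rpow_sum_of_pos hs0]
    have : ∑ k, P / r k = 1 := by
      have : ∑ k, P / r k = P * ∑ k, 1 / r k := by rw [Finset.mul_sum]; simp only [mul_one_div]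
      rw [this, ← hPr]; field_simp
    rw [this, Real.rpow_one, hs, ← hM]; field_simp
  have hterm : ∀ k, ENNReal.ofReal (l k) ^ (-r k) * ∫⁻ y, ‖B k y‖ₑ ^ r k = ENNReal.ofReal (s ^ (-P)) := by
    intro k
    rw [hN2, ENNReal.ofReal_rpow_of_pos (hl0 k), ← ENNReal.ofReal_mul (Real.rpow_nonneg (hl0 k).le _)]
    congr 1
    rw [hl]
    simp only
    rw [Real.mul_rpow (hN0 k).le (Real.rpow_nonneg hs0.le _), ← Real.rpow_mul hs0.le,
      mul_right_comm, ← Real.rpow_add (hN0 k)]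
    have h1 : P / r k * (-r k) = -P := by have := hr0 k; field_simp
    rw [h1, neg_add_cancel, Real.rpow_zero, one_mul]
  have hvol : volume {x | t < |CU B x|} ≤ ENNReal.ofReal (C0 * (m + 1) * s ^ (-P)) := by
    refine (hbD t ht.le).trans ?_
    have h1 : ∀ i, DU (b i) t ≤ C0 * ∑ k, ENNReal.ofReal (l k) ^ (-r k) * ∫⁻ y, ‖b i k y‖ₑ ^ r k := by
      intro i
      have := hC0 (b i) (hbm i) l hl0
      rw [hprod] at this
      exact this
    refine (ENNReal.tsum_le_tsum h1).trans ?_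
    rw [ENNReal.tsum_mul_left, Summable.tsum_finsetSum (fun _ _ => ENNReal.summable)]
    simp only [ENNReal.tsum_mul_left]
    refine (mul_le_mul_right (Finset.sum_le_sum fun k _ => mul_le_mul_right (hbs k) _) _).trans ?_
    simp only [hterm]
    rw [Finset.sum_const, Finset.card_univ, Fintype.card_fin, nsmul_eq_mul, mul_assoc,
      ENNReal.ofReal_mul hC00.le, ENNReal.ofReal_mul (by positivity), ENNReal.ofReal_coe_nnreal]
    have : ENNReal.ofReal ((m : ℝ) + 1) = ((m + 1 : ℕ) : ℝ≥0∞) := by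
      rw [← ENNReal.ofReal_natCast]; push_cast; rfl
    rw [this]
  calc ENNReal.ofReal t * volume {x | t < |CU B x|} ^ (1 / P)
      ≤ ENNReal.ofReal t * ENNReal.ofReal (C0 * (m + 1) * s ^ (-P)) ^ (1 / P) :=
        mul_le_mul_right (ENNReal.rpow_le_rpow hvol (by positivity)) _
    _ = ENNReal.ofReal (A * C0 * M) := by
        rw [ENNReal.ofReal_rpow_of_nonneg (by positivity) (by positivity), ← ENNReal.ofReal_mul ht.le]
        congr 1
        rw [Real.mul_rpow (by positivity) (by positivity), ← Real.rpow_mul hs0.le, ← hA]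
        have : -P * (1 / P) = -1 := by field_simp
        rw [this, Real.rpow_neg_one, hs]
        have := ht.ne'
        field_simp

theorem strongF {m : ℕ} {r : Fin (m + 1) → ℝ} (hr : ∀ i, 1 < r i) {P : ℝ} (hP : 0 < P) (hPr : 1 / P = ∑ i, 1 / r i) :
    ∃ C : ℝ, 0 < C ∧ ∀ B : Fin (m + 1) → ℝ → ℝ, LpNorm P (CU B) ≤ ENNReal.ofReal C * ∏ k, LpNorm (r k) (B k) := by
  have hr1 : ∀ k, 1 ≤ r k := fun k => (hr k).le
  have hr0 : ∀ k, 0 < r k := fun k => by linarith [hr k]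
  obtain ⟨C0, hC1, hC0⟩ := strongT (p := fun j : Fin m => r j.castSucc) (fun j => hr _) (hr (Fin.last m)) hP
    (by rw [hPr, Fin.sum_univ_castSucc])
  have hC00 : (0:ℝ) < C0 := lt_of_lt_of_le one_pos (by exact_mod_cast hC1)
  set A : ℝ := (C0 * (m + 1)) ^ (1 / P) with hA
  have hA0 : 0 < A := by positivity
  refine ⟨A * C0, by positivity, fun B => ?_⟩
  rcases rhs_cases hr1 B (C := A * C0) (by positivity) with h | h | ⟨N, hN0, hN1, hN2⟩
  · have : LpNorm P (CU B) = 0 := by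
      unfold LpNorm
      simp only [h, abs_zero]
      rw [Real.zero_rpow hP.ne']
      simp [hP]
    rw [this]; exact bot_le
  · rw [h]; exact le_top
  obtain ⟨ι, hι, b, hbm, hbs, hbD⟩ := NM2 hr1 B (fun k => by rw [hN2]; exact ENNReal.ofReal_ne_top)
  simp only [hN1]
  rw [← ENNReal.ofReal_prod_of_nonneg (fun k _ => (hN0 k).le), ← ENNReal.ofReal_mul (by positivity)]
  set M : ℝ := ∏ k, N k with hM
  have hM0 : 0 < M := Finset.prod_pos fun k _ => hN0 k
  have hscale : ∀ i t, DU (fun k y => (N k)⁻¹ * b i k y) (C0 * t) = DU (b i) (C0 * M * t) := by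
    intro i t
    unfold DU
    congr 1
    ext x
    refine exists_congr fun ε => and_congr_right fun _ => ?_
    rw [TU_scale, Finset.prod_inv_distrib, ← hM, abs_mul, abs_of_pos (inv_pos.2 hM0), lt_inv_mul_iff₀ hM0]
    rw [show M * (C0 * t) = C0 * M * t by ring]
  have hpiece : ∀ i, ∫⁻ t in Ioi (0:ℝ), ENNReal.ofReal (P * t ^ (P - 1)) * DU (b i) (C0 * M * t) ≤
      C0 * ∑ k, ENNReal.ofReal (N k ^ (-r k)) * ∫⁻ y, ‖b i k y‖ₑ ^ r k := by
    intro i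
    have h := hC0 (fun j y => (N j.castSucc)⁻¹ * b i j.castSucc y) (fun y => (N (Fin.last m))⁻¹ * b i (Fin.last m) y)
      (fun j => (hbm i _).const_mul _) ((hbm i _).const_mul _)
    have h2 : ∀ k, ∫⁻ y, ‖(N k)⁻¹ * b i k y‖ₑ ^ r k = ENNReal.ofReal (N k ^ (-r k)) * ∫⁻ y, ‖b i k y‖ₑ ^ r k := by
      intro k
      rw [← lintegral_const_mul' _ _ ENNReal.ofReal_ne_top]
      refine lintegral_congr fun y => ?_
      rw [enorm_mul, ENNReal.mul_rpow_of_nonneg _ _ (hr0 k).le, Real.enorm_of_nonneg (inv_pos.2 (hN0 k)).le,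
        ENNReal.ofReal_rpow_of_pos (inv_pos.2 (hN0 k)), Real.inv_rpow (hN0 k).le, Real.rpow_neg (hN0 k).le]
    rw [Fin.sum_univ_castSucc]
    simp only [← h2]
    refine le_trans (le_of_eq ?_) h
    refine lintegral_congr fun t => ?_
    rw [← hscale]
    rfl
  set g : ℝ → ℝ≥0∞ := fun x => ‖CU B x‖ₑ * ENNReal.ofReal ((C0 * M)⁻¹) with hg
  have hCM : (0:ℝ) < C0 * M := by positivity
  have hmain : ∫⁻ x, g x ^ P ≤ ENNReal.ofReal (C0 * (m + 1)) := by
    obtain ⟨h, hhm, hhle, hheq⟩ := exists_measurable_le_lintegral_eq volume fun x => g x ^ P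
    rw [hheq]
    have h1 : ∫⁻ x, h x = ∫⁻ x, (h x ^ (1 / P)) ^ P := by
      refine lintegral_congr fun x => ?_
      rw [← ENNReal.rpow_mul, one_div, inv_mul_cancel₀ hP.ne', ENNReal.rpow_one]
    rw [h1, layer_cake hP (hhm.pow_const _)]
    have h2 : ∀ t ∈ Ioi (0:ℝ), ENNReal.ofReal (P * t ^ (P - 1)) * volume {x | ENNReal.ofReal t < h x ^ (1 / P)} ≤
        ∑' i, ENNReal.ofReal (P * t ^ (P - 1)) * DU (b i) (C0 * M * t) := by
      intro t ht
      have ht : 0 < t := ht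
      rw [ENNReal.tsum_mul_left]
      refine mul_le_mul_right ((measure_mono ?_).trans (hbD (C0 * M * t) (by positivity))) _
      intro x hx
      have hx : ENNReal.ofReal t < h x ^ (1 / P) := hx
      have h3 : h x ^ (1 / P) ≤ g x := by
        refine (ENNReal.rpow_le_rpow (hhle x) (by positivity)).trans (le_of_eq ?_)
        rw [← ENNReal.rpow_mul, mul_one_div, div_self hP.ne', ENNReal.rpow_one]
      have h4 := hx.trans_le h3
      rw [hg] at h4
      simp only at h4
      rw [Real.enorm_eq_ofReal_abs, ← ENNReal.ofReal_mul (abs_nonneg _),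
        ENNReal.ofReal_lt_ofReal_iff_of_nonneg ht.le, ← div_eq_mul_inv, lt_div_iff₀ hCM] at h4
      show C0 * M * t < |CU B x|
      linarith
    refine (setLIntegral_mono' measurableSet_Ioi h2).trans ?_
    rw [lintegral_tsum]
    · refine (ENNReal.tsum_le_tsum hpiece).trans ?_
      rw [ENNReal.tsum_mul_left, Summable.tsum_finsetSum (fun _ _ => ENNReal.summable)]
      simp only [ENNReal.tsum_mul_left]
      refine (mul_le_mul_right (Finset.sum_le_sum fun k _ => mul_le_mul_right (hbs k) _) _).trans ?_
      have hterm : ∀ k, ENNReal.ofReal (N k ^ (-r k)) * ∫⁻ y, ‖B k y‖ₑ ^ r k = 1 := by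
        intro k
        rw [hN2, ← ENNReal.ofReal_mul (Real.rpow_nonneg (hN0 k).le _), ← Real.rpow_add (hN0 k), neg_add_cancel,
          Real.rpow_zero, ENNReal.ofReal_one]
      simp only [hterm]
      rw [Finset.sum_const, Finset.card_univ, Fintype.card_fin, nsmul_eq_mul, mul_one,
        ENNReal.ofReal_mul hC00.le, ENNReal.ofReal_coe_nnreal]
      have : ENNReal.ofReal ((m : ℝ) + 1) = ((m + 1 : ℕ) : ℝ≥0∞) := by
        rw [← ENNReal.ofReal_natCast]; push_cast; rfl
      rw [this]
    · intro i
      refine Measurable.aemeasurable (Measurable.mul (by fun_prop) ?_)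
      refine Antitone.measurable fun s t hst => DU_anti _ ?_
      exact mul_le_mul_of_nonneg_left hst hCM.le
  have hfin : ∫⁻ x, ‖CU B x‖ₑ ^ P = ENNReal.ofReal ((C0 * M) ^ P) * ∫⁻ x, g x ^ P := by
    rw [← lintegral_const_mul' _ _ ENNReal.ofReal_ne_top]
    refine lintegral_congr fun x => ?_
    rw [hg]
    simp only
    rw [ENNReal.mul_rpow_of_nonneg _ _ hP.le, ENNReal.ofReal_rpow_of_pos (inv_pos.2 hCM), mul_left_comm,
      ← ENNReal.ofReal_mul (by positivity), Real.inv_rpow hCM.le, mul_inv_cancel₀ (by positivity), ENNReal.ofReal_one,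
      mul_one]
  rw [LpNorm_eq hP, hfin]
  refine (ENNReal.rpow_le_rpow (mul_le_mul_right hmain _) (by positivity)).trans (le_of_eq ?_)
  rw [← ENNReal.ofReal_mul (by positivity), ENNReal.ofReal_rpow_of_nonneg (by positivity) (by positivity)]
  congr 1
  rw [Real.mul_rpow (by positivity) (by positivity), ← Real.rpow_mul hCM.le, mul_one_div, div_self hP.ne',
    Real.rpow_one, ← hA]
  ring

end
end CC

/-- Theorem 1.1: weak and strong type bounds for the `(m+1)`-th order
Calderón commutator `𝒞_{m+1}`. -/
theorem bounds_Ccomm (m : ℕ) (p : Fin (m + 1) → ℝ) (hp : ∀ i, 1 ≤ p i)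
    (ptot : ℝ) (hpt : 1 / ptot = ∑ i, 1 / p i) (hptl : 1 / ((m : ℝ) + 1) < ptot) :
    ∃ C : ℝ, 0 < C ∧
      (∀ (a : Fin m → ℝ → ℝ) (f : ℝ → ℝ),
        wkNorm ptot (Ccomm m a f) ≤
          ENNReal.ofReal C *
            ((∏ j : Fin m, LpNorm (p j.castSucc) (a j)) * LpNorm (p (Fin.last m)) f)) ∧
      ((∀ i, 1 < p i) →
        ∀ (a : Fin m → ℝ → ℝ) (f : ℝ → ℝ),
          LpNorm ptot (Ccomm m a f) ≤
            ENNReal.ofReal C *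
              ((∏ j : Fin m, LpNorm (p j.castSucc) (a j)) * LpNorm (p (Fin.last m)) f)) := by
  have hP : 0 < ptot := lt_trans (by positivity) hptl
  have key : ∀ (a : Fin m → ℝ → ℝ) (f : ℝ → ℝ), ∃ B : Fin (m + 1) → ℝ → ℝ, Ccomm m a f = CC.CU B ∧
      (∏ j : Fin m, LpNorm (p j.castSucc) (a j)) * LpNorm (p (Fin.last m)) f = ∏ k, LpNorm (p k) (B k) := by
    intro a f
    refine ⟨Fin.snoc (α := fun _ => ℝ → ℝ) a f, ?_, ?_⟩
    · funext x
      unfold CC.CU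
      simp
    · rw [Fin.prod_univ_castSucc]
      simp
  obtain ⟨C1, hC1, h1⟩ := CC.weakF hp hP hpt
  by_cases hs : ∀ i, 1 < p i
  · obtain ⟨C2, hC2, h2⟩ := CC.strongF hs hP hpt
    refine ⟨max C1 C2, lt_max_of_lt_left hC1, fun a f => ?_, fun _ a f => ?_⟩
    · obtain ⟨B, hB1, hB2⟩ := key a f
      rw [hB1, hB2]
      exact (h1 B).trans (mul_le_mul_left (ENNReal.ofReal_le_ofReal (le_max_left _ _)) _)
    · obtain ⟨B, hB1, hB2⟩ := key a f
      rw [hB1, hB2]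
      exact (h2 B).trans (mul_le_mul_left (ENNReal.ofReal_le_ofReal (le_max_right _ _)) _)
  · refine ⟨C1, hC1, fun a f => ?_, fun h => absurd h hs⟩
    obtain ⟨B, hB1, hB2⟩ := key a f
    rw [hB1, hB2]
    exact h1 B
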